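/- A closed Jordan curve Γ in the complex plane C is a quasicircle if and only if there exists a constant C ≥ 1 such that diam(arc(z_1,z_2)) ≤ C|z_1 − z_2| for any z_1, z_2 ∈ Γ, where arc(z_1,z_2) denotes the smaller of the two subarcs of Γ between z_1 and z_2. -/

import Mathlib

/-!
Common definitions used to formalize the statements of
"Transmission of harmonic functions through quasicircles on compact Riemann surfaces".

We model the extended plane by working with planar representations of sphere
self-homeomorphisms (recording the preimage/image of `∞` as `Option ℂ` data,
`none` standing for `∞` itself).
-/

open Complex MeasureTheory Metric Set Filter Topology Bornology
open scoped Real ENNReal ComplexConjugate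

noncomputable section

namespace WPPaper

/-! ### Basic sets and curves -/

def unitCircleSet : Set ℂ := Metric.sphere (0 : ℂ) 1

def unitDiskSet : Set ℂ := Metric.ball (0 : ℂ) 1

def extDiskSet : Set ℂ := {z : ℂ | 1 < ‖z‖}

/-- Arc-length (angle) parametrization of the unit circle. -/
def circlePt (θ : ℝ) : ℂ := Complex.exp (θ * Complex.I)

/-- A closed Jordan curve in `ℂ`: a homeomorphic image of the unit circle. -/
def IsJordanCurve (Γ : Set ℂ) : Prop :=
  ∃ f : ℂ → ℂ, ContinuousOn f unitCircleSet ∧ InjOn f unitCircleSet ∧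
    f '' unitCircleSet = Γ

/-- `A` and `B` are the two complementary subarcs of the Jordan curve `Γ`
between the points `z₁, z₂ ∈ Γ`. -/
def IsArcPair (Γ : Set ℂ) (z₁ z₂ : ℂ) (A B : Set ℂ) : Prop :=
  A ∪ B = Γ ∧ A ∩ B = {z₁, z₂} ∧ IsClosed A ∧ IsClosed B ∧
    IsConnected A ∧ IsConnected B

/-- `Ω` is one of the two complementary (Jordan) domains of the Jordan curve `Γ`
(as a planar set; the unbounded component represents the component of
`Ĉ ∖ Γ` containing `∞` with the point `∞` removed). -/
def IsJordanComplComponent (Ω Γ : Set ℂ) : Prop :=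
  IsJordanCurve Γ ∧ IsOpen Ω ∧ IsPreconnected Ω ∧ Ω ∩ Γ = ∅ ∧ frontier Ω = Γ

/-! ### Hyperbolic densities -/

/-- Hyperbolic density of the unit disk (normalized to curvature `-4`). -/
def rhoD (z : ℂ) : ℝ := (1 - ‖z‖ ^ 2)⁻¹

/-- Hyperbolic density of the exterior disk `𝔻* = {|z| > 1} ∪ {∞}`. -/
def rhoDStar (z : ℂ) : ℝ := (‖z‖ ^ 2 - 1)⁻¹

/-- Hyperbolic (Poincaré) density of a hyperbolic planar domain `Ω`, normalized so that
`hypDensity unitDiskSet = rhoD`; defined via the extremal (covering) map from the disk. -/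
def hypDensity (Ω : Set ℂ) (z : ℂ) : ℝ :=
  (sSup {r : ℝ | ∃ f : ℂ → ℂ, DifferentiableOn ℂ f unitDiskSet ∧
    MapsTo f unitDiskSet Ω ∧ f 0 = z ∧ r = ‖deriv f 0‖})⁻¹

/-- The constant weight `1`; for `p = 2` the hyperbolic weights in the Dirichlet
integral cancel, so the `2`-Dirichlet integral is the unweighted one. -/
def constOne : ℂ → ℝ := fun _ => 1

/-! ### Harmonic functions and Dirichlet integrals -/

/-- `|∇f(z)|`. -/
def gradNorm (f : ℂ → ℂ) (z : ℂ) : ℝ :=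
  Real.sqrt (‖fderiv ℝ f z 1‖ ^ 2 + ‖fderiv ℝ f z Complex.I‖ ^ 2)

/-- `|∇f(z)|` computed from a given (weak) derivative. -/
def gradNormL (L : ℂ →L[ℝ] ℂ) : ℝ := Real.sqrt (‖L 1‖ ^ 2 + ‖L Complex.I‖ ^ 2)

/-- `f` is (complex-valued) harmonic on `Ω`: it is `C²` there and its Laplacian vanishes. -/
def IsHarmonicOn (f : ℂ → ℂ) (Ω : Set ℂ) : Prop :=
  ContDiffOn ℝ 2 f Ω ∧ ∀ z ∈ Ω,
    fderiv ℝ (fun w => fderiv ℝ f w 1) z 1 +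
      fderiv ℝ (fun w => fderiv ℝ f w Complex.I) z Complex.I = 0

/-- The `p`-Dirichlet energy `∫_Ω (|∇f| ρ⁻¹)^p ρ² dxdy` with weight `ρ`. -/
def dirichletEnergy (p : ℝ) (ρ : ℂ → ℝ) (f : ℂ → ℂ) (Ω : Set ℂ) : ℝ≥0∞ :=
  ∫⁻ z in Ω, ENNReal.ofReal ((gradNorm f z * (ρ z)⁻¹) ^ p * (ρ z) ^ 2)

/-- The `p`-Dirichlet norm `‖f‖_{D_p}` with weight `ρ`. -/
def dirichletNorm (p : ℝ) (ρ : ℂ → ℝ) (f : ℂ → ℂ) (Ω : Set ℂ) : ℝ≥0∞ :=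
  dirichletEnergy p ρ f Ω ^ (1 / p)

/-- `f ∈ HD_p(Ω)`: a `p`-Dirichlet finite harmonic function on `Ω` (weight `ρ`). -/
def MemHD (p : ℝ) (ρ : ℂ → ℝ) (f : ℂ → ℂ) (Ω : Set ℂ) : Prop :=
  IsHarmonicOn f Ω ∧ dirichletEnergy p ρ f Ω < ⊤

/-! ### Weak derivatives, Sobolev energies -/

/-- `f'` is a weak (distributional) derivative of `f` on `Ω`. -/
def HasWeakFDerivOn (f : ℂ → ℂ) (f' : ℂ → ℂ →L[ℝ] ℂ) (Ω : Set ℂ) : Prop :=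
  LocallyIntegrableOn f Ω volume ∧
  (∀ v : ℂ, LocallyIntegrableOn (fun z => f' z v) Ω volume) ∧
  ∀ ψ : ℂ → ℝ, ContDiff ℝ (⊤ : ℕ∞) ψ → HasCompactSupport ψ → tsupport ψ ⊆ Ω →
    ∀ v : ℂ, ∫ z in Ω, ψ z • f' z v = -∫ z in Ω, fderiv ℝ ψ z v • f z

/-- The derivative `f'` is locally square integrable on `Ω` (`W^{1,2}_loc`). -/
def W12locOn (f' : ℂ → ℂ →L[ℝ] ℂ) (Ω : Set ℂ) : Prop :=
  ∀ K : Set ℂ, K ⊆ Ω → IsCompact K → (∫⁻ z in K, (‖f' z‖₊ : ℝ≥0∞) ^ 2) < ⊤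

/-- The weighted `p`-Sobolev (Dirichlet) energy computed from a weak derivative. -/
def sobolevEnergyW (p : ℝ) (ρ : ℂ → ℝ) (f' : ℂ → ℂ →L[ℝ] ℂ) (Ω : Set ℂ) : ℝ≥0∞ :=
  ∫⁻ z in Ω, ENNReal.ofReal ((gradNormL (f' z) * (ρ z)⁻¹) ^ p * (ρ z) ^ 2)

/-- The function with weak derivative `g'` can be approximated, in the weighted
`p`-Dirichlet seminorm, by smooth compactly supported functions on `Ω`;
i.e. it lies in the closure of `C₀^∞(Ω)`. -/
def ApproxByTest (p : ℝ) (ρ : ℂ → ℝ) (g' : ℂ → ℂ →L[ℝ] ℂ) (Ω : Set ℂ) : Prop :=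
  ∀ ε : ℝ, 0 < ε → ∃ ψ : ℂ → ℂ, ContDiff ℝ (⊤ : ℕ∞) ψ ∧ HasCompactSupport ψ ∧ tsupport ψ ⊆ Ω ∧
    sobolevEnergyW p ρ (fun z => g' z - fderiv ℝ ψ z) Ω < ENNReal.ofReal ε

/-! ### Wirtinger derivatives and quasiconformal maps -/

def wirtingerD (L : ℂ →L[ℝ] ℂ) : ℂ := (L 1 - Complex.I * L Complex.I) / 2

def wirtingerDBar (L : ℂ →L[ℝ] ℂ) : ℂ := (L 1 + Complex.I * L Complex.I) / 2

/-- `f` is a `K`-quasiconformal homeomorphism of `Ω` onto `Ω'`: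
an orientation-preserving homeomorphism in `W^{1,2}_loc` whose Beltrami coefficient
satisfies `|μ| ≤ (K-1)/(K+1)` a.e. -/
def IsQCOn (f : ℂ → ℂ) (Ω Ω' : Set ℂ) (K : ℝ) : Prop :=
  1 ≤ K ∧ ContinuousOn f Ω ∧ BijOn f Ω Ω' ∧
  (∃ g : ℂ → ℂ, ContinuousOn g Ω' ∧ InvOn g f Ω Ω') ∧
  ∃ f' : ℂ → ℂ →L[ℝ] ℂ, HasWeakFDerivOn f f' Ω ∧ W12locOn f' Ω ∧
    ∀ᵐ z ∂volume.restrict Ω,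
      ‖wirtingerDBar (f' z)‖ ≤ (K - 1) / (K + 1) * ‖wirtingerD (f' z)‖

/-- `f` is a quasiconformal homeomorphism of `Ω` onto `Ω'` with complex dilatation
(Beltrami coefficient) `μ`. -/
def IsQCWithBeltrami (f : ℂ → ℂ) (Ω Ω' : Set ℂ) (μ : ℂ → ℂ) : Prop :=
  ContinuousOn f Ω ∧ BijOn f Ω Ω' ∧
  (∃ g : ℂ → ℂ, ContinuousOn g Ω' ∧ InvOn g f Ω Ω') ∧
  ∃ f' : ℂ → ℂ →L[ℝ] ℂ, HasWeakFDerivOn f f' Ω ∧ W12locOn f' Ω ∧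
    ∀ᵐ z ∂volume.restrict Ω, wirtingerDBar (f' z) = μ z * wirtingerD (f' z)

/-- `Γ` is a `K`-quasicircle: the image of the unit circle under a `K`-quasiconformal
self-homeomorphism of `ℂ`. -/
def IsKQuasicircle (Γ : Set ℂ) (K : ℝ) : Prop :=
  ∃ f : ℂ → ℂ, IsQCOn f univ univ K ∧ f '' unitCircleSet = Γ

def IsQuasicircle (Γ : Set ℂ) : Prop := ∃ K : ℝ, IsKQuasicircle Γ K

/-- `Γ` is a chord-arc curve: the image of the unit circle under a bi-Lipschitz
self-homeomorphism of `ℂ`. -/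
def IsChordArcCurve (Γ : Set ℂ) : Prop :=
  ∃ f : ℂ → ℂ, Function.Bijective f ∧
    (∃ L : ℝ, 1 ≤ L ∧ (∀ z w : ℂ, ‖f z - f w‖ ≤ L * ‖z - w‖) ∧
      (∀ z w : ℂ, ‖z - w‖ ≤ L * ‖f z - f w‖)) ∧
    f '' unitCircleSet = Γ

/-! ### Circle homeomorphisms and quasisymmetry -/

/-- `h` is an orientation-preserving homeomorphism of the unit circle onto itself
(encoded by a continuous strictly increasing degree-one lift). -/
def IsCircleHomeo (h : ℂ → ℂ) : Prop :=
  ∃ H : ℝ → ℝ, Continuous H ∧ StrictMono H ∧ (∀ θ, H (θ + 2 * π) = H θ + 2 * π) ∧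
    ∀ θ, h (circlePt θ) = circlePt (H θ)

/-- `h` is a quasisymmetric homeomorphism of the unit circle: an orientation-preserving
circle homeomorphism extending to a quasiconformal self-homeomorphism of the disk. -/
def IsQuasisymmetric (h : ℂ → ℂ) : Prop :=
  IsCircleHomeo h ∧
  ∃ (Hext : ℂ → ℂ) (K : ℝ), IsQCOn Hext unitDiskSet unitDiskSet K ∧
    ContinuousOn Hext (closure unitDiskSet) ∧ ∀ ζ ∈ unitCircleSet, Hext ζ = h ζ

/-- Normalization: fixing the three boundary points `1`, `i`, `-i`. -/
def FixesNormalization (f : ℂ → ℂ) : Prop :=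
  f 1 = 1 ∧ f Complex.I = Complex.I ∧ f (-Complex.I) = -Complex.I

/-! ### Besov spaces on the circle and on rectifiable curves -/

def besovEnergy (p : ℝ) (φ : ℂ → ℂ) : ℝ≥0∞ :=
  ∫⁻ x in Ioc (0 : ℝ) (2 * π), ∫⁻ y in Ioc (0 : ℝ) (2 * π),
    ENNReal.ofReal (‖φ (circlePt x) - φ (circlePt y)‖ ^ p
      / ‖circlePt x - circlePt y‖ ^ (2 : ℕ))

def besovNorm (p : ℝ) (φ : ℂ → ℂ) : ℝ≥0∞ := besovEnergy p φ ^ (1 / p)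

/-- `φ ∈ B_p(𝕊)`: the homogeneous `p`-Besov space on the unit circle. -/
def MemBesov (p : ℝ) (φ : ℂ → ℂ) : Prop :=
  IntegrableOn (fun θ : ℝ => φ (circlePt θ)) (Ioc 0 (2 * π)) volume ∧
  besovEnergy p φ < ⊤

/-- Besov energy on a rectifiable curve `Γ`, with respect to arc length
(one-dimensional Hausdorff measure). -/
def besovEnergyCurve (p : ℝ) (Γ : Set ℂ) (φ : ℂ → ℂ) : ℝ≥0∞ :=
  ∫⁻ x in Γ, ∫⁻ y in Γ,
    ENNReal.ofReal (‖φ x - φ y‖ ^ p / ‖x - y‖ ^ (2 : ℕ)) ∂μH[1] ∂μH[1]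

def besovNormCurve (p : ℝ) (Γ : Set ℂ) (φ : ℂ → ℂ) : ℝ≥0∞ :=
  besovEnergyCurve p Γ φ ^ (1 / p)

/-- `φ ∈ B_p(Γ)`: `φ ∈ L_p(Γ)` with finite Besov energy on `Γ`. -/
def MemBesovCurve (p : ℝ) (Γ : Set ℂ) (φ : ℂ → ℂ) : Prop :=
  (∫⁻ x in Γ, ENNReal.ofReal (‖φ x‖ ^ p) ∂μH[1]) < ⊤ ∧ besovEnergyCurve p Γ φ < ⊤

/-! ### Nontangential limits and Poisson integrals -/

/-- Nontangential approach region in `Ω` at the boundary point `ζ` with aperture `M`. -/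
def ntRegion (Ω : Set ℂ) (ζ : ℂ) (M : ℝ) : Set ℂ :=
  {z ∈ Ω | ‖z - ζ‖ < M * Metric.infDist z (frontier Ω)}

/-- `f` has nontangential limit `L` at the boundary point `ζ` of `Ω`. -/
def HasNTLimAt (f : ℂ → ℂ) (Ω : Set ℂ) (L : ℂ) (ζ : ℂ) : Prop :=
  ∀ M : ℝ, 1 < M → Tendsto f (𝓝[ntRegion Ω ζ M] ζ) (𝓝 L)

/-- `φ` is the nontangential boundary-value function on `Γ` of `f : Ω → ℂ`
(a.e. with respect to arc length on `Γ`). -/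
def IsNTBoundaryFun (f : ℂ → ℂ) (Ω Γ : Set ℂ) (φ : ℂ → ℂ) : Prop :=
  ∀ᵐ ζ ∂(μH[1] : Measure ℂ).restrict Γ, HasNTLimAt f Ω (φ ζ) ζ

/-- The Poisson integral on the unit disk:
`P(φ)(z) = (1/2π) ∫_𝕊 (1-|z|²)/|ζ-z|² φ(ζ) |dζ|`. -/
def poissonDisk (φ : ℂ → ℂ) (z : ℂ) : ℂ :=
  (2 * π)⁻¹ • ∫ θ in Ioc (0 : ℝ) (2 * π),
    ((1 - ‖z‖ ^ 2) / ‖circlePt θ - z‖ ^ 2) • φ (circlePt θ)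

/-- The Poisson integral on the exterior disk. -/
def poissonExt (φ : ℂ → ℂ) (z : ℂ) : ℂ :=
  (2 * π)⁻¹ • ∫ θ in Ioc (0 : ℝ) (2 * π),
    ((‖z‖ ^ 2 - 1) / ‖circlePt θ - z‖ ^ 2) • φ (circlePt θ)

/-! ### Integrable Beltrami coefficients -/

/-- `μ ∈ M_p(Ω)`: a Beltrami coefficient on `Ω` (`‖μ‖_∞ < 1`) that is `p`-integrable
with respect to the hyperbolic metric with density `ρ`. -/
def MemMp (p : ℝ) (μ : ℂ → ℂ) (Ω : Set ℂ) (ρ : ℂ → ℝ) : Prop :=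
  AEStronglyMeasurable μ (volume.restrict Ω) ∧
  (∃ k : ℝ, k < 1 ∧ ∀ᵐ z ∂volume.restrict Ω, ‖μ z‖ ≤ k) ∧
  (∫⁻ z in Ω, ENNReal.ofReal (‖μ z‖ ^ p * (ρ z) ^ 2)) < ⊤

/-! ### Self-maps of the Riemann sphere, in planar representation -/

/-- The filter of neighborhoods of `∞` in `Ĉ`, restricted to `ℂ`. -/
def cobdd : Filter ℂ := Bornology.cobounded ℂ

/-- The planar set attached to an `Option ℂ` datum (`none` stands for `∞`). -/
def optSet (o : Option ℂ) : Set ℂ := o.elim ∅ (fun a => {a})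

/-- `f : ℂ → ℂ` is the planar representation of a self-homeomorphism of the Riemann
sphere `Ĉ`, where `zP` is the preimage of `∞` and `wP` the image of `∞`
(`none` standing for `∞`). The value of `f` on its pole is irrelevant. -/
def IsSphereHomeo (f : ℂ → ℂ) (zP wP : Option ℂ) : Prop :=
  match zP, wP with
  | none, none =>
      Continuous f ∧ Function.Bijective f ∧
      (∃ g : ℂ → ℂ, Continuous g ∧ Function.LeftInverse g f ∧ Function.RightInverse g f) ∧
      Tendsto f cobdd cobdd
  | some a, some b =>
      ContinuousOn f {a}ᶜ ∧ BijOn f {a}ᶜ {b}ᶜ ∧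
      (∃ g : ℂ → ℂ, ContinuousOn g {b}ᶜ ∧ InvOn g f {a}ᶜ {b}ᶜ) ∧
      Tendsto f (𝓝[≠] a) cobdd ∧ Tendsto f cobdd (𝓝 b)
  | _, _ => False

/-- The (planar representation of the) sphere homeomorphism `f` has complex
dilatation `μ` a.e. on the planar set `A` (away from its pole `zP`). -/
def SphereBeltramiOn (f : ℂ → ℂ) (zP : Option ℂ) (μ : ℂ → ℂ) (A : Set ℂ) : Prop :=
  ∃ f' : ℂ → ℂ →L[ℝ] ℂ, HasWeakFDerivOn f f' (A \ optSet zP) ∧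
    W12locOn f' (A \ optSet zP) ∧
    ∀ᵐ z ∂volume.restrict (A \ optSet zP),
      wirtingerDBar (f' z) = μ z * wirtingerD (f' z)

/-- The sphere homeomorphism `f` is `K`-quasiconformal on the planar set `A`. -/
def SphereQCBddOn (f : ℂ → ℂ) (zP : Option ℂ) (K : ℝ) (A : Set ℂ) : Prop :=
  ∃ f' : ℂ → ℂ →L[ℝ] ℂ, HasWeakFDerivOn f f' (A \ optSet zP) ∧
    W12locOn f' (A \ optSet zP) ∧
    ∀ᵐ z ∂volume.restrict (A \ optSet zP),
      ‖wirtingerDBar (f' z)‖ ≤ (K - 1) / (K + 1) * ‖wirtingerD (f' z)‖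

/-- Planar representation of a quasiconformal self-homeomorphism of `Ĉ` fixing
`1, i, -i`, with complex dilatation `μ₁` on the unit disk and `μ₂` on the exterior disk. -/
def IsGMap (f : ℂ → ℂ) (zP wP : Option ℂ) (μ₁ μ₂ : ℂ → ℂ) : Prop :=
  IsSphereHomeo f zP wP ∧
  SphereBeltramiOn f zP μ₁ unitDiskSet ∧
  SphereBeltramiOn f zP μ₂ extDiskSet ∧
  FixesNormalization f

/-- `Γ ⊂ ℂ` is a `p`-Weil–Petersson curve: the image of the unit circle under the
normalized quasiconformal self-map `F_μ` of `Ĉ` with dilatation `μ ∈ M_p(𝔻*)` on `𝔻*`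
and `0` on `𝔻`. -/
def IsWPCurve (p : ℝ) (Γ : Set ℂ) : Prop :=
  ∃ μ : ℂ → ℂ, MemMp p μ extDiskSet rhoDStar ∧
  ∃ (f : ℂ → ℂ) (zP wP : Option ℂ), IsGMap f zP wP (fun _ => 0) μ ∧
    optSet zP ∩ unitCircleSet = ∅ ∧ f '' unitCircleSet = Γ

/-- The reflection of a Beltrami coefficient on `𝔻*` to one on `𝔻`
under `z ↦ 1/z̄`. -/
def reflectBeltrami (ν : ℂ → ℂ) : ℂ → ℂ :=
  fun z => conj (ν ((conj z)⁻¹)) * z ^ 2 / (conj z) ^ 2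

/-- `H = H^ν`: the quasiconformal self-homeomorphism of the unit disk with complex
dilatation `ν`, extended homeomorphically to the closed disk, fixing `1, i, -i`. -/
def IsNormalizedQCDisk (H : ℂ → ℂ) (ν : ℂ → ℂ) : Prop :=
  IsQCWithBeltrami H unitDiskSet unitDiskSet ν ∧
  ContinuousOn H (closure unitDiskSet) ∧
  BijOn H (closure unitDiskSet) (closure unitDiskSet) ∧
  (∃ g : ℂ → ℂ, ContinuousOn g (closure unitDiskSet) ∧
    InvOn g H (closure unitDiskSet) (closure unitDiskSet)) ∧
  FixesNormalization H

/-! ### Riemann mappings of the complementary domains of a Jordan curve -/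

/-- Normalized Riemann mapping from the unit disk onto the complementary domain `Ω`
(planar part) of the Jordan curve `Γ`, extended by Carathéodory to the boundary and
fixing `1, i, -i`; `zP` records a possible pole (when `∞ ∈ Ω` as a `Ĉ`-domain). -/
def IsDiskRiemannTo (F : ℂ → ℂ) (zP : Option ℂ) (Ω Γ : Set ℂ) : Prop :=
  DifferentiableOn ℂ F (unitDiskSet \ optSet zP) ∧
  optSet zP ⊆ unitDiskSet ∧
  ContinuousOn F (closure unitDiskSet \ optSet zP) ∧
  InjOn F (closure unitDiskSet \ optSet zP) ∧
  F '' unitCircleSet = Γ ∧ FixesNormalization F ∧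
  (match zP with
   | none => BijOn F unitDiskSet Ω
   | some a => BijOn F (unitDiskSet \ {a}) Ω ∧ Tendsto F (𝓝[≠] a) cobdd)

/-- Normalized Riemann mapping from the exterior disk `𝔻* = {|z|>1} ∪ {∞}` onto the
complementary domain `Ω` (planar part) of the Jordan curve `Γ`; `zP` records a possible
pole in `{|z|>1}` and `wP` the (finite) image of `∞`, `none` standing for `∞`. -/
def IsExtRiemannTo (F : ℂ → ℂ) (zP wP : Option ℂ) (Ω Γ : Set ℂ) : Prop :=
  DifferentiableOn ℂ F (extDiskSet \ optSet zP) ∧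
  optSet zP ⊆ extDiskSet ∧
  ContinuousOn F ((unitCircleSet ∪ extDiskSet) \ optSet zP) ∧
  InjOn F ((unitCircleSet ∪ extDiskSet) \ optSet zP) ∧
  F '' unitCircleSet = Γ ∧ FixesNormalization F ∧
  (match zP, wP with
   | none, none => BijOn F extDiskSet Ω ∧ Tendsto F cobdd cobdd
   | none, some b => b ∈ Ω ∧ BijOn F extDiskSet (Ω \ {b}) ∧ Tendsto F cobdd (𝓝 b)
   | some a, some b => b ∈ Ω ∧ BijOn F (extDiskSet \ {a}) (Ω \ {b}) ∧
       Tendsto F (𝓝[≠] a) cobdd ∧ Tendsto F cobdd (𝓝 b)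
   | some _, none => False)

/-- The transmission relation across `Γ`: `Φ₂` is obtained from `Φ₁` by the composition
`(F₂)_* ∘ P₂ ∘ C_{h_Γ} ∘ E₁ ∘ (F₁)^*`, i.e. `Φ₂ ∘ F₂ = P₂(E₁(Φ₁ ∘ F₁) ∘ h_Γ)` on the
exterior disk (away from the pole of `F₂`). -/
def TransRel (F₁ F₂ h : ℂ → ℂ) (zP : Option ℂ) (Φ₁ Φ₂ : ℂ → ℂ) : Prop :=
  ∃ φ : ℂ → ℂ,
    IsNTBoundaryFun (fun z => Φ₁ (F₁ z)) unitDiskSet unitCircleSet φ ∧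
    ∀ z ∈ extDiskSet \ optSet zP, Φ₂ (F₂ z) = poissonExt (fun ζ => φ (h ζ)) z

/-! ### Hilbert transform, Szegő projection, analytic Besov space -/

/-- Truncated Hilbert transform on the circle (for the principal value). -/
def hilbertTrunc (φ : ℂ → ℂ) (θ ε : ℝ) : ℂ :=
  (π * Complex.I)⁻¹ * ∫ t in Ioc (θ - π) (θ + π) \ Ioo (θ - ε) (θ + ε),
    φ (circlePt t) / (circlePt t - circlePt θ) * (Complex.I * circlePt t)

/-- `ψ = 𝓗(φ)` a.e. on the circle: `ψ` is the principal-value Hilbert transform of `φ`. -/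
def IsHilbertTransformOf (ψ φ : ℂ → ℂ) : Prop :=
  ∀ᵐ θ ∂volume.restrict (Ioc (0 : ℝ) (2 * π)),
    Tendsto (fun ε : ℝ => hilbertTrunc φ θ ε) (𝓝[>] (0 : ℝ)) (𝓝 (ψ (circlePt θ)))

/-- The Szegő projection (Cauchy integral) `𝓢(φ)(z) = (1/2πi) ∫_𝕊 φ(ζ)/(ζ-z) dζ`. -/
def szego (φ : ℂ → ℂ) (z : ℂ) : ℂ :=
  (2 * π * Complex.I)⁻¹ * ∫ t in Ioc (0 : ℝ) (2 * π),
    φ (circlePt t) / (circlePt t - z) * (Complex.I * circlePt t)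

/-- Energy of the `p`-analytic Besov space `𝓑_p(𝔻)`. -/
def analyticBesovEnergy (p : ℝ) (f : ℂ → ℂ) : ℝ≥0∞ :=
  ∫⁻ z in unitDiskSet, ENNReal.ofReal ((‖deriv f z‖ * (rhoD z)⁻¹) ^ p * (rhoD z) ^ 2)

def analyticBesovNorm (p : ℝ) (f : ℂ → ℂ) : ℝ≥0∞ := analyticBesovEnergy p f ^ (1 / p)

/-- `f ∈ 𝓑_p(𝔻)`: holomorphic on the unit disk with finite `p`-Besov energy. -/
def MemAnalyticBesov (p : ℝ) (f : ℂ → ℂ) : Prop :=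
  DifferentiableOn ℂ f unitDiskSet ∧ analyticBesovEnergy p f < ⊤

/-! ### The p-integrable Teichmüller space -/

/-- Distance `‖μ - ν‖_p + ‖μ - ν‖_∞` on Beltrami coefficients of the disk. -/
def mpDist (p : ℝ) (μ ν : ℂ → ℂ) : ℝ :=
  ((∫⁻ z in unitDiskSet, ENNReal.ofReal (‖μ z - ν z‖ ^ p * (rhoD z) ^ 2)) ^ (1 / p)).toReal +
  (essSup (fun z => (‖μ z - ν z‖₊ : ℝ≥0∞)) (volume.restrict unitDiskSet)).toReal

/-- The space `M_p(𝔻)` of `p`-integrable Beltrami coefficients on the disk. -/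
def MpD (p : ℝ) : Type := {μ : ℂ → ℂ // MemMp p μ unitDiskSet rhoD}

/-- The topology induced by the norm `‖·‖_p + ‖·‖_∞` on `M_p(𝔻)`. -/
instance (p : ℝ) : TopologicalSpace (MpD p) :=
  TopologicalSpace.generateFrom
    {U | ∃ (μ₀ : MpD p) (ε : ℝ), U = {μ : MpD p | mpDist p μ.1 μ₀.1 < ε}}

/-- Teichmüller equivalence: the normalized quasiconformal extensions have the same
boundary values on the circle. -/
def teichRel (p : ℝ) (μ ν : MpD p) : Prop :=
  ∃ H₁ H₂ : ℂ → ℂ, IsNormalizedQCDisk H₁ μ.1 ∧ IsNormalizedQCDisk H₂ ν.1 ∧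
    EqOn H₁ H₂ unitCircleSet

/-- The `p`-integrable Teichmüller space `T_p` with the quotient topology. -/
def TeichSpace (p : ℝ) : Type := Quot (teichRel p)

def TeichSpace.mk (p : ℝ) (μ : MpD p) : TeichSpace p := Quot.mk (teichRel p) μ

instance (p : ℝ) : TopologicalSpace (TeichSpace p) :=
  TopologicalSpace.coinduced (TeichSpace.mk p) inferInstance

/-! ### Arc-length parametrizations and inscribed polygons -/

/-- `γ` is an (L-periodic) arc-length parametrization of the rectifiable Jordan
curve `Γ` of length `L`. -/
def IsArcLengthParam (γ : ℝ → ℂ) (Γ : Set ℂ) (L : ℝ) : Prop :=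
  0 < L ∧ ENNReal.ofReal L = μH[1] Γ ∧ Continuous γ ∧ (∀ s, γ (s + L) = γ s) ∧
  γ '' Ico 0 L = Γ ∧ InjOn γ (Ico 0 L) ∧
  ∀ s t : ℝ, s ≤ t → t ≤ s + L → μH[1] (γ '' Icc s t) = ENNReal.ofReal (t - s)

/-- The length of the inscribed polygon with `2ⁿ` vertices evenly distributed with
respect to arc length, starting at `γ s₀`. -/
def inscribedPolygonLength (γ : ℝ → ℂ) (L s₀ : ℝ) (n : ℕ) : ℝ :=
  ∑ k ∈ Finset.range (2 ^ n),
    ‖γ (s₀ + (k + 1) * (L / 2 ^ n)) - γ (s₀ + k * (L / 2 ^ n))‖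

/-! ### Continuous logarithms -/

/-- `φ` has a continuous logarithm on `K`. -/
def HasLogOn {X : Type*} [TopologicalSpace X] (φ : X → ℂ) (K : Set X) : Prop :=
  ∃ L : X → ℂ, ContinuousOn L K ∧ ∀ z ∈ K, Complex.exp (L z) = φ z

section HasLogOn

variable {X Y : Type*} [TopologicalSpace X] [TopologicalSpace Y]

theorem HasLogOn.mono {φ : X → ℂ} {K K' : Set X} (h : HasLogOn φ K) (hK : K' ⊆ K) :
    HasLogOn φ K' := by
  obtain ⟨L, hL, e⟩ := h
  exact ⟨L, hL.mono hK, fun z hz => e z (hK hz)⟩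

theorem HasLogOn.congr {φ ψ : X → ℂ} {K : Set X} (h : HasLogOn φ K)
    (he : ∀ z ∈ K, ψ z = φ z) : HasLogOn ψ K := by
  obtain ⟨L, hL, e⟩ := h
  exact ⟨L, hL, fun z hz => (e z hz).trans (he z hz).symm⟩

theorem HasLogOn.mul {φ ψ : X → ℂ} {K : Set X} (h : HasLogOn φ K) (h' : HasLogOn ψ K) :
    HasLogOn (fun z => φ z * ψ z) K := by
  obtain ⟨L, hL, e⟩ := h
  obtain ⟨L', hL', e'⟩ := h'
  exact ⟨fun z => L z + L' z, hL.add hL', fun z hz => by rw [Complex.exp_add, e z hz, e' z hz]⟩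

theorem HasLogOn.inv {φ : X → ℂ} {K : Set X} (h : HasLogOn φ K) :
    HasLogOn (fun z => (φ z)⁻¹) K := by
  obtain ⟨L, hL, e⟩ := h
  exact ⟨fun z => - L z, hL.neg, fun z hz => by rw [Complex.exp_neg, e z hz]⟩

theorem HasLogOn.div {φ ψ : X → ℂ} {K : Set X} (h : HasLogOn φ K) (h' : HasLogOn ψ K) :
    HasLogOn (fun z => φ z / ψ z) K := by
  simpa only [div_eq_mul_inv] using h.mul h'.inv

theorem HasLogOn.conj {φ : X → ℂ} {K : Set X} (h : HasLogOn φ K) :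
    HasLogOn (fun z => conj (φ z)) K := by
  obtain ⟨L, hL, e⟩ := h
  refine ⟨fun z => conj (L z), Complex.continuous_conj.comp_continuousOn hL, fun z hz => ?_⟩
  rw [Complex.exp_conj, e z hz]

theorem hasLogOn_const {c : ℂ} (hc : c ≠ 0) (K : Set X) : HasLogOn (fun _ : X => c) K :=
  ⟨fun _ => Complex.log c, continuousOn_const, fun _ _ => Complex.exp_log hc⟩

theorem HasLogOn.ne_zero {φ : X → ℂ} {K : Set X} (h : HasLogOn φ K) {z : X} (hz : z ∈ K) :
    φ z ≠ 0 := by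
  obtain ⟨L, -, e⟩ := h
  rw [← e z hz]; exact Complex.exp_ne_zero _

theorem HasLogOn.continuousOn {φ : X → ℂ} {K : Set X} (h : HasLogOn φ K) :
    ContinuousOn φ K := by
  obtain ⟨L, hL, e⟩ := h
  exact (Complex.continuous_exp.comp_continuousOn hL).congr fun z hz => (e z hz).symm

theorem HasLogOn.comp {φ : X → ℂ} {K : Set X} (h : HasLogOn φ K) {g : Y → X} {K' : Set Y}
    (hg : ContinuousOn g K') (hm : MapsTo g K' K) : HasLogOn (fun y => φ (g y)) K' := by
  obtain ⟨L, hL, e⟩ := h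
  exact ⟨fun y => L (g y), hL.comp hg hm, fun y hy => e _ (hm hy)⟩

theorem hasLogOn_of_slitPlane {φ : X → ℂ} {K : Set X} (h : ContinuousOn φ K)
    (hs : ∀ z ∈ K, φ z ∈ Complex.slitPlane) : HasLogOn φ K :=
  ⟨fun z => Complex.log (φ z), h.clog hs,
    fun z hz => Complex.exp_log (Complex.slitPlane_ne_zero (hs z hz))⟩

/-- A continuous function close to a function with a logarithm has a logarithm. -/
theorem HasLogOn.of_close {φ ψ : X → ℂ} {K : Set X} (h : HasLogOn φ K)
    (hψ : ContinuousOn ψ K) (hc : ∀ z ∈ K, ‖ψ z - φ z‖ < ‖φ z‖) : HasLogOn ψ K := by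
  have h1 : HasLogOn (fun z => ψ z / φ z) K := by
    refine hasLogOn_of_slitPlane (hψ.div h.continuousOn fun z hz => h.ne_zero hz) ?_
    intro z hz
    apply Complex.mem_slitPlane_of_norm_lt_one (z := ψ z / φ z - 1) ?_ |> fun h => by simpa using h
    have h0 := h.ne_zero hz
    have : ψ z / φ z - 1 = (ψ z - φ z) / φ z := by field_simp
    rw [this, norm_div, div_lt_one (norm_pos_iff.2 h0)]
    exact hc z hz
  refine (h1.mul h).congr fun z hz => ?_
  have h0 := h.ne_zero hz
  field_simp

/-- A continuous function on a preconnected set whose exponential is constant is constant. -/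
theorem eq_of_exp_eq_const {D : X → ℂ} {S : Set X} (hS : IsPreconnected S)
    (hD : ContinuousOn D S) {c : ℂ} (hc : ∀ z ∈ S, Complex.exp (D z) = c) {z w : X}
    (hz : z ∈ S) (hw : w ∈ S) : D z = D w := by
  refine hS.induction₂ (fun x y => D x = D y) ?_ (fun _ _ _ _ _ _ => Eq.trans) (fun _ _ _ _ => Eq.symm) hz hw
  intro x hx
  have h1 : ∀ᶠ y in 𝓝[S] x, dist (D y) (D x) < 1 :=
    (hD x hx).eventually (Metric.ball_mem_nhds _ one_pos)
  filter_upwards [h1, self_mem_nhdsWithin] with y hy hyS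
  have h2 : Complex.exp (D x) = Complex.exp (D y) := by rw [hc x hx, hc y hyS]
  obtain ⟨n, hn⟩ := Complex.exp_eq_exp_iff_exists_int.1 h2
  rw [hn, dist_eq_norm] at hy
  have : n = 0 := by
    by_contra hn0
    have h3 : (1 : ℝ) ≤ |(n : ℝ)| := by
      have := Int.one_le_abs hn0
      exact_mod_cast this
    have h4 : ‖D y - (D y + n * (2 * π * I))‖ = |(n : ℝ)| * (2 * π) := by
      rw [show D y - (D y + n * (2 * π * I)) = - (n * (2 * π * I)) by ring, norm_neg]
      simp [abs_of_pos Real.pi_pos]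
    rw [h4] at hy
    nlinarith [Real.pi_gt_three]
  rw [hn, this]; simp

theorem HasLogOn.union {φ : X → ℂ} {A B : Set X} (hA : IsClosed A) (hB : IsClosed B)
    (hAB : IsPreconnected (A ∩ B)) (h : HasLogOn φ A) (h' : HasLogOn φ B) :
    HasLogOn φ (A ∪ B) := by
  classical
  obtain ⟨L, hL, e⟩ := h
  obtain ⟨L', hL', e'⟩ := h'
  obtain ⟨k, hk, hk'⟩ : ∃ k : ℂ, Complex.exp k = 1 ∧ ∀ z ∈ A ∩ B, L z = L' z + k := by
    rcases (A ∩ B).eq_empty_or_nonempty with h0 | ⟨x, hx⟩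
    · exact ⟨0, by simp, by simp [h0]⟩
    · have h1 : ∀ z ∈ A ∩ B, Complex.exp (L z - L' z) = 1 := by
        intro z hz
        rw [Complex.exp_sub, e z hz.1, e' z hz.2, div_self]
        rw [← e z hz.1]; exact Complex.exp_ne_zero _
      refine ⟨L x - L' x, h1 x hx, fun z hz => ?_⟩
      have := eq_of_exp_eq_const hAB ((hL.mono inter_subset_left).sub
        (hL'.mono inter_subset_right)) h1 hz hx
      simp only [Pi.sub_apply] at this
      linear_combination this
  refine ⟨fun z => if z ∈ A then L z else L' z + k, ?_, ?_⟩
  · apply ContinuousOn.union_of_isClosed _ _ hA hB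
    · exact hL.congr fun z hz => by simp [hz]
    · refine (hL'.add continuousOn_const).congr (f := fun z => L' z + k) fun z hz => ?_
      by_cases hzA : z ∈ A
      · simp [hzA, hk' z ⟨hzA, hz⟩]
      · simp [hzA]
  · intro z hz
    by_cases hzA : z ∈ A
    · simp [hzA, e z hzA]
    · have hzB : z ∈ B := hz.resolve_left hzA
      simp [hzA, Complex.exp_add, hk, e' z hzB]

end HasLogOn

theorem hasLogOn_univ_of_contractible {X : Type*} [TopologicalSpace X] [LocallyPathConnectedSpace X]
    [SimplyConnectedSpace X] {φ : X → ℂ} (h : Continuous φ) (h0 : ∀ z, φ z ≠ 0) :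
    HasLogOn φ univ := by
  obtain ⟨f, hf, he⟩ := Complex.exists_continuousOn_eqOn_exp_comp (U := (univ : Set X)) (g := φ)
    ((Homeomorph.Set.univ X).toHomotopyEquiv.simplyConnectedSpace_iff.2 inferInstance) isOpen_univ h.continuousOn (by simpa using h0)
  exact ⟨f, hf, fun z hz => he hz⟩

/-- The radial retraction onto the closed unit ball. -/
def ballRetract (z : ℂ) : ℂ := ((max 1 ‖z‖ : ℝ) : ℂ)⁻¹ * z

theorem continuous_ballRetract : Continuous ballRetract := by
  unfold ballRetract
  refine Continuous.mul (Continuous.inv₀ (by fun_prop) ?_) continuous_id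
  intro z
  have : (0:ℝ) < max 1 ‖z‖ := by positivity
  exact_mod_cast this.ne'

theorem norm_ballRetract_le (z : ℂ) : ‖ballRetract z‖ ≤ 1 := by
  unfold ballRetract
  have : (0:ℝ) < max 1 ‖z‖ := by positivity
  rw [norm_mul, norm_inv, Complex.norm_real, Real.norm_of_nonneg this.le, inv_mul_le_iff₀ this]
  simp

theorem ballRetract_of_norm_le {z : ℂ} (h : ‖z‖ ≤ 1) : ballRetract z = z := by
  simp [ballRetract, max_eq_left h]

theorem hasLogOn_closedBall {φ : ℂ → ℂ} (h : ContinuousOn φ (closedBall 0 1))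
    (h0 : ∀ z ∈ closedBall (0:ℂ) 1, φ z ≠ 0) : HasLogOn φ (closedBall 0 1) := by
  have hm : ∀ z, ballRetract z ∈ closedBall (0:ℂ) 1 := fun z => by
    simpa using norm_ballRetract_le z
  have h1 : HasLogOn (fun z => φ (ballRetract z)) univ :=
    hasLogOn_univ_of_contractible (h.comp_continuous continuous_ballRetract hm) fun z => h0 _ (hm z)
  refine (h1.mono (subset_univ _)).congr fun z hz => ?_
  rw [ballRetract_of_norm_le (by simpa using hz)]

theorem not_hasLogOn_sphere (p : ℂ) {R : ℝ} (hR : 0 < R) :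
    ¬ HasLogOn (fun z => z - p) (sphere p R) := by
  intro h
  have h1 := h.comp (g := fun θ : ℝ => p + R * Complex.exp (θ * I)) (K' := univ)
    (by fun_prop) (fun θ _ => by simp [abs_of_pos hR])
  obtain ⟨L, hL, e⟩ := h
  have hc : Continuous (fun θ : ℝ => p + R * Complex.exp (θ * I)) := by fun_prop
  have hm : ∀ θ : ℝ, p + R * Complex.exp (θ * I) ∈ sphere p R := fun θ => by
    simp [abs_of_pos hR]
  have hD : Continuous (fun θ : ℝ => L (p + R * Complex.exp (θ * I)) - θ * I) :=
    (hL.comp_continuous hc hm).sub (by fun_prop)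
  have h2 := eq_of_exp_eq_const (isPreconnected_univ (α := ℝ)) hD.continuousOn (c := R)
    (fun θ _ => by
      rw [Complex.exp_sub, e _ (hm θ)]
      have := Complex.exp_ne_zero (θ * I)
      field_simp
      ring) (mem_univ 0) (mem_univ (2 * π))
  simp only [ofReal_zero, zero_mul, Complex.exp_zero, ofReal_mul, ofReal_ofNat,
    Complex.exp_two_pi_mul_I] at h2
  have : (2 * π * I : ℂ) = 0 := by linear_combination h2
  simp [Real.pi_ne_zero] at this

theorem hasLogOn_sub_div_sub_of_preconnected {K C : Set ℂ} (hK : IsCompact K)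
    (hC : IsPreconnected C) (hCK : Disjoint C K) {p q : ℂ} (hp : p ∈ C) (hq : q ∈ C) :
    HasLogOn (fun z => (z - p) / (z - q)) K := by
  have hne : ∀ p ∈ C, ∀ z ∈ K, z - p ≠ 0 := fun p hp z hz h =>
    hCK.le_bot ⟨hp, by rwa [← sub_eq_zero.1 h]⟩
  suffices h : p ∈ C ∧ q ∈ C ∧ HasLogOn (fun z => (z - p) / (z - q)) K from h.2.2
  refine hC.induction₂ (fun p q => p ∈ C ∧ q ∈ C ∧ HasLogOn (fun z => (z - p) / (z - q)) K) ?_ ?_ ?_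
    hp hq
  · intro x hx
    have h1 : x ∉ K := fun h => hCK.le_bot ⟨hx, h⟩
    obtain ⟨r, hr, hrK⟩ := Metric.isOpen_iff.1 hK.isClosed.isOpen_compl x h1
    filter_upwards [self_mem_nhdsWithin, nhdsWithin_le_nhds (Metric.ball_mem_nhds x hr)] with y hy hyr
    refine ⟨hx, hy, ?_⟩
    have h2 : HasLogOn (fun z => (z - y) / (z - x)) K := by
      refine (hasLogOn_const one_ne_zero K).of_close ?_ ?_
      · exact ContinuousOn.div (by fun_prop) (by fun_prop) (hne x hx)
      · intro z hz
        have h3 : r ≤ ‖z - x‖ := by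
          by_contra h
          exact hrK (by rwa [mem_ball, dist_eq_norm, ← not_le]) hz
        have h4 : (z - y) / (z - x) - 1 = (x - y) / (z - x) := by
          have := hne x hx z hz
          field_simp; ring
        rw [h4, norm_div, norm_one, div_lt_one (by linarith)]
        rw [mem_ball, dist_eq_norm, norm_sub_rev] at hyr
        linarith
    exact h2.inv.congr fun z hz => by rw [inv_div]
  · rintro x y z - - - ⟨hx, hy, h⟩ ⟨_, hz, h'⟩
    refine ⟨hx, hz, (h.mul h').congr fun w hw => ?_⟩
    have := hne y hy w hw
    have := hne z hz w hw
    field_simp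
  · rintro x y - - ⟨hx, hy, h⟩
    exact ⟨hy, hx, h.inv.congr fun z _ => by rw [inv_div]⟩

theorem hasLogOn_sub_of_unbounded {K C : Set ℂ} (hK : IsCompact K)
    (hC : IsPreconnected C) (hCK : Disjoint C K) (hCb : ¬ IsBounded C) {p : ℂ} (hp : p ∈ C) :
    HasLogOn (fun z => z - p) K := by
  obtain ⟨R, hR⟩ := hK.isBounded.exists_norm_le
  obtain ⟨q, hq, hqR⟩ : ∃ q ∈ C, R < ‖q‖ := by
    by_contra! h
    exact hCb (isBounded_iff_forall_norm_le.2 ⟨R, h⟩)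
  have h1 : HasLogOn (fun z => z - q) K := by
    rcases K.eq_empty_or_nonempty with rfl | ⟨x, hx⟩
    · exact ⟨0, by simp, by simp⟩
    have hR0 : 0 ≤ R := (norm_nonneg _).trans (hR x hx)
    refine (hasLogOn_const (c := -q) ?_ K).of_close (by fun_prop) ?_
    · rw [neg_ne_zero, ← norm_pos_iff]; linarith
    · intro z hz
      rw [sub_neg_eq_add, sub_add_cancel, norm_neg]
      exact (hR z hz).trans_lt hqR
  refine ((hasLogOn_sub_div_sub_of_preconnected hK hC hCK hp hq).mul h1).congr fun z hz => ?_
  have := h1.ne_zero hz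
  field_simp

/-- Tietze extension of complex functions on closed subsets of the plane. -/
theorem exists_continuous_extension {L : ℂ → ℂ} {K : Set ℂ} (hK : IsClosed K)
    (hL : ContinuousOn L K) : ∃ L' : ℂ → ℂ, Continuous L' ∧ EqOn L' L K := by
  obtain ⟨g, hg⟩ := ContinuousMap.exists_restrict_eq (Y := ℂ) hK ⟨K.domRestrict L, hL.domRestrict⟩
  refine ⟨g, g.continuous, fun z hz => ?_⟩
  exact congrArg (fun f => f ⟨z, hz⟩) hg

/-- If `U` is bounded open and `u ∈ U`, `v ∉ U`, then `(z - u) / (z - v)` has no logarithm on a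
closed set containing the boundary of `U`. -/
theorem not_hasLogOn_of_frontier {U K : Set ℂ} (hUb : IsBounded U)
    (hUK : frontier U ⊆ K) {u : ℂ} (hu : u ∈ U) {g : ℂ → ℂ} (hg : ContinuousOn g (closure U))
    (hg0 : ∀ z ∈ closure U, g z ≠ 0) : ¬ HasLogOn (fun z => (z - u) / g z) K := by
  classical
  intro h
  obtain ⟨L, hL, e⟩ := h.mono hUK
  obtain ⟨L', hL', e'⟩ := exists_continuous_extension isClosed_frontier hL
  set r : ℂ → ℂ := fun z => if z ∈ U then g z * Complex.exp (L' z) else z - u with hr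
  have hfr : ∀ z ∈ frontier U, g z * Complex.exp (L' z) = z - u := by
    intro z hz
    rw [e' hz, e z hz, mul_div_cancel₀ _ (hg0 z (frontier_subset_closure hz))]
  have hrc : Continuous r := by
    refine continuous_if (p := fun z => z ∈ U) (fun z hz => hfr z hz) ?_ (by fun_prop)
    exact hg.mul (by fun_prop)
  have hr0 : ∀ z, r z ≠ 0 := by
    intro z
    by_cases hz : z ∈ U
    · simp only [hr, hz, if_true]
      exact mul_ne_zero (hg0 z (subset_closure hz)) (Complex.exp_ne_zero _)
    · simp only [hr, hz, if_false]
      intro h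
      exact hz (by rwa [sub_eq_zero.1 h])
  obtain ⟨R, hR⟩ := hUb.subset_ball_lt 0 u
  refine not_hasLogOn_sphere u hR.1 (((hasLogOn_univ_of_contractible hrc hr0).mono
    (subset_univ _)).congr fun z hz => ?_)
  have : z ∉ U := fun h => by
    have := hR.2 h
    rw [mem_ball] at this; rw [mem_sphere] at hz; linarith
  simp [hr, this]

theorem not_hasLogOn_sub_of_frontier {U K : Set ℂ} (hUb : IsBounded U)
    (hUK : frontier U ⊆ K) {u : ℂ} (hu : u ∈ U) : ¬ HasLogOn (fun z => z - u) K := by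
  simpa using not_hasLogOn_of_frontier hUb hUK hu (g := fun _ => 1) continuousOn_const (by simp)

theorem not_hasLogOn_sub_div_sub_of_frontier {U K : Set ℂ} (hUb : IsBounded U)
    (hUK : frontier U ⊆ K) {u v : ℂ} (hu : u ∈ U) (hv : v ∉ closure U) :
    ¬ HasLogOn (fun z => (z - u) / (z - v)) K :=
  not_hasLogOn_of_frontier hUb hUK hu (by fun_prop) fun z hz h =>
    hv (by rwa [← sub_eq_zero.1 h])

/-! ### Logarithms on compact sets with connected complement -/

theorem apply_eq_wirtinger (L : ℂ →L[ℝ] ℂ) (h : ℂ) :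
    L h = wirtingerD L * h + wirtingerDBar L * conj h := by
  have h1 : L h = h.re * L 1 + h.im * L I := by
    conv_lhs => rw [show h = (h.re : ℝ) • (1:ℂ) + (h.im : ℝ) • I by
      simp [Complex.re_add_im]]
    rw [map_add, map_smul, map_smul, Complex.real_smul, Complex.real_smul]
  rw [h1, wirtingerD, wirtingerDBar]
  have h2 : h = h.re + h.im * I := (Complex.re_add_im h).symm
  have h3 : conj h = h.re - h.im * I := by
    apply Complex.ext <;> simp
  rw [h3]
  conv_rhs => rw [h2]
  simp only [add_re, ofReal_re, mul_re, I_re, mul_zero, ofReal_im, I_im, mul_one, sub_self,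
    add_zero, add_im, mul_im, zero_add]
  linear_combination ((h.im : ℂ) * L I) * Complex.I_sq

theorem det_eq_re_im (L : ℂ →L[ℝ] ℂ) :
    L.det = (L 1).re * (L I).im - (L I).re * (L 1).im := by
  rw [ContinuousLinearMap.det, ← LinearMap.det_toMatrix Complex.basisOneI, Matrix.det_fin_two]
  simp [LinearMap.toMatrix_apply]

theorem det_eq_wirtinger (L : ℂ →L[ℝ] ℂ) :
    L.det = ‖wirtingerD L‖ ^ 2 - ‖wirtingerDBar L‖ ^ 2 := by
  rw [det_eq_re_im, wirtingerD, wirtingerDBar, ← Complex.normSq_eq_norm_sq,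
    ← Complex.normSq_eq_norm_sq, Complex.normSq_div, Complex.normSq_div]
  simp [Complex.normSq_apply]
  ring

/-- A simple zero, orientation preserving or reversing, in a topological sense. -/
def IsSimpleZero (g : ℂ → ℂ) (w : ℂ) : Prop :=
  ∃ e : ℂ → ℂ, (e = (fun z => z - w) ∨ e = fun z => conj (z - w)) ∧
    ∃ r > 0, ∀ s ∈ Ioo 0 r, HasLogOn (fun z => g z / e z) (sphere w s)

theorem isSimpleZero_of_hasFDerivAt {g : ℂ → ℂ} (hgc : Continuous g) {w : ℂ} {L : ℂ →L[ℝ] ℂ}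
    (hg : HasFDerivAt g L w) (hw : g w = 0) (hL : L.det ≠ 0) : IsSimpleZero g w := by
  rw [det_eq_wirtinger] at hL
  set a := wirtingerD L
  set b := wirtingerDBar L
  have key : ∀ ε > 0, ∃ r > 0, ∀ s ∈ Ioo 0 r, ∀ z ∈ sphere w s,
      ‖g z - (a * (z - w) + b * conj (z - w))‖ ≤ ε * ‖z - w‖ := by
    intro ε hε
    have := hg.isLittleO.def hε
    obtain ⟨r, hr, h⟩ := Metric.eventually_nhds_iff_ball.1 this
    refine ⟨r, hr, fun s hs z hz => ?_⟩
    have := h z (by rw [mem_sphere] at hz; rw [mem_ball, hz]; exact hs.2)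
    rwa [hw, sub_zero, apply_eq_wirtinger] at this
  rcases lt_trichotomy ‖b‖ ‖a‖ with h | h | h
  · refine ⟨_, Or.inl rfl, ?_⟩
    obtain ⟨r, hr, hk⟩ := key ((‖a‖ - ‖b‖) / 2) (by linarith)
    refine ⟨r, hr, fun s hs => ?_⟩
    have hne : ∀ z ∈ sphere w s, z - w ≠ 0 := fun z hz h0 => by
      rw [mem_sphere, dist_eq_norm, h0, norm_zero] at hz; linarith [hs.1]
    have ha : a ≠ 0 := norm_pos_iff.1 ((norm_nonneg b).trans_lt h)
    refine (hasLogOn_const ha _).of_close (hgc.continuousOn.div (by fun_prop) hne) ?_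
    intro z hz
    have h0 := hne z hz
    have h1 : g z / (z - w) - a = (g z - (a * (z - w) + b * conj (z - w)) + b * conj (z - w)) / (z - w) := by
      field_simp; ring
    rw [h1, norm_div, div_lt_iff₀ (norm_pos_iff.2 h0)]
    refine (norm_add_le _ _).trans_lt ?_
    rw [norm_mul, Complex.norm_conj]
    have := hk s hs z hz
    have := norm_pos_iff.2 h0
    nlinarith
  · exact absurd (by rw [h]; ring) hL
  · refine ⟨_, Or.inr rfl, ?_⟩
    obtain ⟨r, hr, hk⟩ := key ((‖b‖ - ‖a‖) / 2) (by linarith)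
    refine ⟨r, hr, fun s hs => ?_⟩
    have hne : ∀ z ∈ sphere w s, conj (z - w) ≠ 0 := fun z hz h0 => by
      rw [map_eq_zero] at h0
      rw [mem_sphere, dist_eq_norm, h0, norm_zero] at hz; linarith [hs.1]
    have hb : b ≠ 0 := norm_pos_iff.1 ((norm_nonneg a).trans_lt h)
    refine (hasLogOn_const hb _).of_close (hgc.continuousOn.div
      (Complex.continuous_conj.comp_continuousOn (by fun_prop)) hne) ?_
    intro z hz
    have h0 := hne z hz
    have h1 : g z / conj (z - w) - b =
        (g z - (a * (z - w) + b * conj (z - w)) + a * (z - w)) / conj (z - w) := by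
      field_simp; ring
    rw [h1, norm_div, div_lt_iff₀ (norm_pos_iff.2 h0)]
    refine (norm_add_le _ _).trans_lt ?_
    rw [norm_mul, Complex.norm_conj]
    have := hk s hs z hz
    have := norm_pos_iff.2 h0
    rw [Complex.norm_conj] at this
    nlinarith

theorem hasLogOn_sub_of_subset_ball {w z₀ : ℂ} {S : Set ℂ} (h : S ⊆ ball w (dist z₀ w)) :
    HasLogOn (fun z => z - z₀) S := by
  rcases S.eq_empty_or_nonempty with rfl | ⟨x, hx⟩
  · exact ⟨0, by simp, by simp⟩
  refine (hasLogOn_const (c := w - z₀) ?_ S).of_close (by fun_prop) ?_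
  · rw [sub_ne_zero]; rintro rfl
    simpa using h hx
  · intro z hz
    have := h hz
    rw [mem_ball, dist_eq_norm, dist_eq_norm] at this
    rw [norm_sub_rev w z₀]
    simpa using this

theorem hasLogOn_of_simpleZeros {K : Set ℂ} (hK : IsCompact K) (hKc : IsPreconnected Kᶜ)
    (Z : Finset ℂ) : ∀ g : ℂ → ℂ, Continuous g → (∀ z, g z = 0 → z ∈ Z) →
      (∀ w ∈ Z, w ∉ K ∧ IsSimpleZero g w) → HasLogOn g K := by
  classical
  induction Z using Finset.induction_on with
  | empty =>
    intro g hg h0 _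
    exact (hasLogOn_univ_of_contractible hg fun z h => by simpa using h0 z h).mono (subset_univ _)
  | insert z₀ Z hz₀ ih =>
    intro g hg h0 hZ
    obtain ⟨hz₀K, e, he, r, hr, hlog⟩ := hZ z₀ (Finset.mem_insert_self _ _)
    have hcl : IsClosed (K ∪ (Z : Set ℂ)) := hK.isClosed.union Z.finite_toSet.isClosed
    have hmem : z₀ ∈ (K ∪ (Z : Set ℂ))ᶜ := by simp [hz₀K, hz₀]
    obtain ⟨ρ, hρ, hρs⟩ := Metric.isOpen_iff.1 hcl.isOpen_compl z₀ hmem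
    obtain ⟨s, hs, hsm⟩ := exists_between (lt_min hr hρ)
    have hsr := hsm.trans_le (min_le_left _ _)
    have hsρ := hsm.trans_le (min_le_right _ _)
    have hec : Continuous e := by
      rcases he with rfl | rfl
      · fun_prop
      · exact Complex.continuous_conj.comp (by fun_prop)
    have he0 : ∀ z, e z = 0 → z = z₀ := by
      rcases he with rfl | rfl
      · intro z hz; exact sub_eq_zero.1 hz
      · intro z hz; exact sub_eq_zero.1 ((map_eq_zero _).1 hz)
    have helog : ∀ S : Set ℂ, HasLogOn (fun z => z - z₀) S → HasLogOn e S := by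
      rcases he with rfl | rfl
      · exact fun S h => h
      · exact fun S h => h.conj
    obtain ⟨L, hL, hLe⟩ := hlog s ⟨hs, hsr⟩
    obtain ⟨L', hL', hLL'⟩ := exists_continuous_extension isClosed_sphere hL
    set g₂ : ℂ → ℂ := fun z => if z ∈ ball z₀ s then Complex.exp (L' z) else g z / e z with hg₂
    have hg₂c : Continuous g₂ := by
      refine continuous_if (p := fun z => z ∈ ball z₀ s) (fun z hz => ?_) (by fun_prop) ?_
      · have hz' : z ∈ sphere z₀ s := by rwa [← frontier_ball z₀ hs.ne']
        rw [hLL' hz', hLe z hz']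
      · refine hg.continuousOn.div hec.continuousOn ?_
        intro z hz h
        rw [he0 z h] at hz
        have h1 : IsClosed (ball z₀ s)ᶜ := isOpen_ball.isClosed_compl
        have h2 : z₀ ∈ (ball z₀ s)ᶜ := by
          rw [← h1.closure_eq]; exact hz
        exact h2 (mem_ball_self hs)
    have hoff : ∀ z ∈ K ∪ (Z : Set ℂ), ρ ≤ dist z z₀ := fun z hz => by
      by_contra h
      exact hρs (by rw [mem_ball]; linarith) hz
    have hgout : ∀ z ∉ ball z₀ s, g₂ z = g z / e z := fun z hz => if_neg hz
    have h2 : HasLogOn g₂ K := by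
      refine ih g₂ hg₂c ?_ ?_
      · intro z hz
        by_cases hzb : z ∈ ball z₀ s
        · rw [show g₂ z = Complex.exp (L' z) from if_pos hzb] at hz
          exact absurd hz (Complex.exp_ne_zero _)
        · rw [hgout z hzb, div_eq_zero_iff] at hz
          have hne : z ≠ z₀ := by rintro rfl; exact hzb (mem_ball_self hs)
          rcases hz with hz | hz
          · exact (Finset.mem_insert.1 (h0 z hz)).resolve_left hne
          · exact absurd (he0 z hz) hne
      · intro w hw
        obtain ⟨hwK, e', he', r', hr', hlog'⟩ := hZ w (Finset.mem_insert_of_mem hw)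
        refine ⟨hwK, e', he', min r' (ρ - s), lt_min hr' (by linarith), fun t ht => ?_⟩
        have hw0 := hoff w (Or.inr hw)
        have hin : ∀ z ∈ sphere w t, z ∉ ball z₀ s := by
          intro z hz hzb
          rw [mem_sphere] at hz
          rw [mem_ball] at hzb
          have := dist_triangle_left w z₀ z
          have := ht.2.trans_le (min_le_right _ _)
          linarith
        have hle : HasLogOn e (sphere w t) := by
          refine helog _ (hasLogOn_sub_of_subset_ball (w := w) ?_)
          intro z hz
          rw [mem_sphere] at hz
          rw [mem_ball, hz, dist_comm]
          have := ht.2.trans_le (min_le_right _ _)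
          linarith
        refine ((hlog' t ⟨ht.1, ht.2.trans_le (min_le_left _ _)⟩).div hle).congr fun z hz => ?_
        rw [hgout z (hin z hz), div_right_comm]
    have hle : HasLogOn e K := by
      refine helog _ (hasLogOn_sub_of_unbounded hK hKc disjoint_compl_left ?_ hz₀K)
      intro hb
      exact NormedSpace.unbounded_univ ℝ ℂ (by
        rw [← union_compl_self K]; exact hK.isBounded.union hb)
    refine (h2.mul hle).congr fun z hz => ?_
    have hz' := hoff z (Or.inl hz)
    rw [hgout z (by rw [mem_ball]; linarith), div_mul_cancel₀]
    exact hle.ne_zero hz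

/-- Borsuk: a nonvanishing continuous function on a compact set with connected complement has a
continuous logarithm. -/
theorem hasLogOn_of_isPreconnected_compl {K : Set ℂ} (hK : IsCompact K)
    (hKc : IsPreconnected Kᶜ) {φ : ℂ → ℂ} (hφ : ContinuousOn φ K) (h0 : ∀ z ∈ K, φ z ≠ 0) :
    HasLogOn φ K := by
  classical
  obtain ⟨m, hm, hmK⟩ : ∃ m > 0, ∀ z ∈ K, m ≤ ‖φ z‖ := by
    rcases K.eq_empty_or_nonempty with rfl | hne
    · exact ⟨1, one_pos, by simp⟩
    · obtain ⟨x, hx, hmin⟩ := hK.exists_isMinOn hne hφ.norm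
      exact ⟨‖φ x‖, norm_pos_iff.2 (h0 x hx), fun z hz => hmin hz⟩
  obtain ⟨R, hR, hKR⟩ := hK.isBounded.subset_ball_lt 0 0
  obtain ⟨φ', hφ', he⟩ := exists_continuous_extension (L := fun z => if z ∈ ball (0:ℂ) R then φ z else m)
    (K := K ∪ (ball 0 R)ᶜ) (hK.isClosed.union isOpen_ball.isClosed_compl) (by
      apply ContinuousOn.union_of_isClosed _ _ hK.isClosed isOpen_ball.isClosed_compl
      · exact hφ.congr fun z hz => by simp only [hKR hz, if_true]
      · exact (continuousOn_const (c := (m:ℂ))).congr fun z hz => if_neg hz)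
  obtain ⟨ψ, hψ, hψφ, -⟩ := hφ'.exists_contDiff_approx (⊤ : ℕ∞) (ε := fun _ => m / 4)
    continuous_const (fun _ => by positivity)
  have hdiff : Differentiable ℝ ψ := hψ.differentiable (by simp)
  have hSard := addHaar_image_eq_zero_of_det_fderivWithin_eq_zero (f := ψ) (f' := fderiv ℝ ψ)
    (s := {z | (fderiv ℝ ψ z).det = 0}) volume
    (fun x _ => (hdiff x).hasFDerivAt.hasFDerivWithinAt) (fun x hx => hx)
  obtain ⟨c, hc, hcS⟩ : ∃ c ∈ ball (0:ℂ) (m/4), c ∉ ψ '' {z | (fderiv ℝ ψ z).det = 0} := by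
    by_contra! h
    have := measure_mono_null (μ := volume) h hSard
    exact (measure_ball_pos volume (0:ℂ) (by positivity : 0 < m / 4)).ne' this
  set g : ℂ → ℂ := fun z => ψ z - c with hg
  have hgc : Continuous g := hψ.continuous.sub continuous_const
  have hgφ : ∀ z, ‖g z - φ' z‖ < m / 2 := by
    intro z
    have h1 := hψφ z
    rw [dist_eq_norm] at h1
    rw [mem_ball, dist_zero_right] at hc
    calc ‖g z - φ' z‖ = ‖(ψ z - φ' z) - c‖ := by rw [hg]; congr 1; ring
      _ ≤ ‖ψ z - φ' z‖ + ‖c‖ := norm_sub_le _ _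
      _ < m / 2 := by linarith
  have hg0 : ∀ z ∈ K ∪ (ball 0 R)ᶜ, g z ≠ 0 := by
    intro z hz h
    have h1 := hgφ z
    rw [h, zero_sub, norm_neg, he hz] at h1
    by_cases hzb : z ∈ ball (0:ℂ) R
    · simp only [hzb, if_true] at h1
      have := hmK z (hz.resolve_right fun h => h hzb)
      linarith
    · simp only [hzb, if_false, Complex.norm_real, Real.norm_of_nonneg hm.le] at h1
      linarith
  have hsz : ∀ z, g z = 0 → IsSimpleZero g z ∧ ∀ᶠ w in 𝓝[≠] z, g w ≠ 0 := by
    intro z hz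
    have hd : HasFDerivAt g (fderiv ℝ ψ z) z := (hdiff z).hasFDerivAt.sub_const c
    have hdet : (fderiv ℝ ψ z).det ≠ 0 := fun h => hcS ⟨z, h, sub_eq_zero.1 hz⟩
    refine ⟨isSimpleZero_of_hasFDerivAt hgc hd hz hdet, ?_⟩
    have hinj : LinearMap.ker (fderiv ℝ ψ z : ℂ →ₗ[ℝ] ℂ) = ⊥ := by
      by_contra h
      exact hdet (LinearMap.det_eq_zero_iff_ker_ne_bot.2 h)
    obtain ⟨C, hC, hCa⟩ := LinearMap.exists_antilipschitzWith (fderiv ℝ ψ z : ℂ →ₗ[ℝ] ℂ) hinj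
    have := hd.eventually_ne (c := 0) ⟨C, hCa⟩
    simpa [hz] using this
  have hZfin : {z | g z = 0}.Finite := by
    have hcl : IsClosed {z | g z = 0} := isClosed_eq hgc continuous_const
    have hcomp : IsCompact {z | g z = 0} :=
      (isCompact_closedBall (0:ℂ) R).of_isClosed_subset hcl fun z hz => by
        by_contra h
        exact hg0 z (Or.inr fun h2 => h (ball_subset_closedBall h2)) hz
    by_contra hinf
    obtain ⟨x, hx, hacc⟩ := Set.Infinite.exists_accPt_of_subset_isCompact hinf hcomp subset_rfl
    rw [accPt_iff_frequently_nhdsNE] at hacc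
    exact hacc ((hsz x hx).2.mono fun w h => h)
  have hglog : HasLogOn g K := hasLogOn_of_simpleZeros hK hKc hZfin.toFinset g hgc
    (fun z hz => by simpa using hz) (fun w hw => by
      have hw' : g w = 0 := by simpa using hw
      exact ⟨fun h => hg0 w (Or.inl h) hw', (hsz w hw').1⟩)
  refine hglog.of_close hφ fun z hz => ?_
  have h1 := hgφ z
  rw [he (Or.inl hz)] at h1
  simp only [hKR hz, if_true] at h1
  have h2 := hmK z hz
  have h3 := norm_sub_norm_le (φ z) (g z)
  rw [norm_sub_rev (φ z)] at *
  linarith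

/-! ### Topology of Jordan curves -/

theorem isPreconnected_setOf_dist_mem (p : ℂ) {J : Set ℝ} (hJ : IsPreconnected J)
    (h0 : ∀ r ∈ J, 0 ≤ r) : IsPreconnected {z : ℂ | dist z p ∈ J} := by
  have h1 : {z : ℂ | dist z p ∈ J} =
      (fun x : ℝ × ℝ => p + x.1 * Complex.exp (x.2 * I)) '' (J ×ˢ univ) := by
    ext z
    constructor
    · intro hz
      refine ⟨(dist z p, Complex.arg (z - p)), ⟨hz, mem_univ _⟩, ?_⟩
      simp only [dist_eq_norm, Complex.norm_mul_exp_arg_mul_I]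
      ring
    · rintro ⟨⟨r, θ⟩, ⟨hr, -⟩, rfl⟩
      simp only [mem_ofPred_eq, dist_eq_norm, add_sub_cancel_left, norm_mul, Complex.norm_real,
        Complex.norm_exp_ofReal_mul_I, mul_one, Real.norm_eq_abs]
      rwa [abs_of_nonneg (h0 r hr)]
  rw [h1]
  exact (hJ.prod isPreconnected_univ).image _ (by fun_prop)

theorem isPreconnected_compl_ball (p : ℂ) {r : ℝ} (hr : 0 ≤ r) : IsPreconnected (ball p r)ᶜ := by
  convert isPreconnected_setOf_dist_mem p (isPreconnected_Ici (a := r)) fun x hx => hr.trans hx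
  ext z; simp

theorem isPreconnected_compl_closedBall (p : ℂ) {r : ℝ} (hr : 0 ≤ r) :
    IsPreconnected (closedBall p r)ᶜ := by
  convert isPreconnected_setOf_dist_mem p (isPreconnected_Ioi (a := r)) fun x hx =>
    hr.trans (le_of_lt hx)
  ext z; simp

theorem frontier_connectedComponentIn_subset {O : Set ℂ} (hO : IsOpen O) (x : ℂ) :
    frontier (connectedComponentIn O x) ⊆ Oᶜ := by
  intro z hz hzO
  have hop : IsOpen (connectedComponentIn O x) := hO.connectedComponentIn
  rw [hop.frontier_eq] at hz
  apply hz.2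
  have h1 : (connectedComponentIn O z ∩ connectedComponentIn O x).Nonempty :=
    mem_closure_iff.1 hz.1 _ hO.connectedComponentIn (mem_connectedComponentIn hzO)
  obtain ⟨w, hw, hw'⟩ := h1
  rw [connectedComponentIn_eq hw', ← connectedComponentIn_eq hw]
  exact mem_connectedComponentIn hzO

/-- The inverse of a continuous injection on a compact set is continuous. -/
theorem exists_continuousOn_inverse {f : ℂ → ℂ} {K : Set ℂ} (hK : IsCompact K)
    (hf : ContinuousOn f K) (hi : InjOn f K) :
    ∃ g : ℂ → ℂ, ContinuousOn g (f '' K) ∧ (∀ z ∈ K, g (f z) = z) ∧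
      ∀ w ∈ f '' K, g w ∈ K ∧ f (g w) = w := by
  have hg : ∀ z ∈ K, Function.invFunOn f K (f z) = z := fun z hz => hi.leftInvOn_invFunOn hz
  refine ⟨Function.invFunOn f K, ?_, hg, fun w hw => ⟨Function.invFunOn_mem hw,
    Function.invFunOn_eq hw⟩⟩
  rw [continuousOn_iff_isClosed]
  intro t ht
  refine ⟨f '' (K ∩ t), ((hK.inter_right ht).image_of_continuousOn
    (hf.mono inter_subset_left)).isClosed, ?_⟩
  ext w
  constructor
  · rintro ⟨h1, z, hz, rfl⟩
    rw [mem_preimage, hg z hz] at h1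
    exact ⟨⟨z, ⟨hz, h1⟩, rfl⟩, z, hz, rfl⟩
  · rintro ⟨⟨z, ⟨hz, h1⟩, rfl⟩, h2⟩
    exact ⟨by rwa [mem_preimage, hg z hz], h2⟩

theorem isCompact_unitCircleSet : IsCompact unitCircleSet := isCompact_sphere _ _

theorem isPreconnected_unitCircleSet : IsPreconnected unitCircleSet := by
  convert isPreconnected_setOf_dist_mem 0 (isPreconnected_singleton (x := (1:ℝ))) (by simp)
  ext z; simp [unitCircleSet]

theorem IsJordanCurve.isCompact {Γ : Set ℂ} (h : IsJordanCurve Γ) : IsCompact Γ := by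
  obtain ⟨f, hf, -, rfl⟩ := h
  exact isCompact_unitCircleSet.image_of_continuousOn hf

theorem IsJordanCurve.isPreconnected {Γ : Set ℂ} (h : IsJordanCurve Γ) : IsPreconnected Γ := by
  obtain ⟨f, hf, -, rfl⟩ := h
  exact isPreconnected_unitCircleSet.image _ hf

theorem IsJordanCurve.nonempty {Γ : Set ℂ} (h : IsJordanCurve Γ) : Γ.Nonempty := by
  obtain ⟨f, hf, -, rfl⟩ := h
  exact ⟨f 1, 1, by simp [unitCircleSet], rfl⟩

theorem hasLogOn_circle_diff {φ : ℂ → ℂ} {ζ : ℂ} (hζ : ζ ∈ unitCircleSet)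
    (hφ : ContinuousOn φ (unitCircleSet \ {ζ})) (h0 : ∀ z ∈ unitCircleSet \ {ζ}, φ z ≠ 0) :
    HasLogOn φ (unitCircleSet \ {ζ}) := by
  have hζ1 : ‖ζ‖ = 1 := by simpa [unitCircleSet] using hζ
  have hζ0 : ζ ≠ 0 := by rintro rfl; simp at hζ1
  have hm : MapsTo (fun θ : ℝ => -ζ * Complex.exp (θ * I)) (Ioo (-π) π) (unitCircleSet \ {ζ}) := by
    intro θ hθ
    refine ⟨by simp [unitCircleSet, hζ1], fun h => ?_⟩
    have h1 : Complex.exp (θ * I) = -1 := by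
      have h2 : -ζ * Complex.exp (θ * I) = ζ := h
      have h3 : ζ * (Complex.exp (θ * I) + 1) = 0 := by linear_combination -h2
      exact eq_neg_of_add_eq_zero_left ((mul_eq_zero.1 h3).resolve_left hζ0)
    have h2 := Complex.arg_exp_mul_I θ
    rw [h1, Complex.arg_neg_one, eq_comm, toIocMod_eq_self _ |>.2 ⟨hθ.1, by linarith [hθ.2]⟩] at h2
    exact hθ.2.ne h2
  have hsc : IsSimplyConnected (Ioo (-π) π) := by
    have : ContractibleSpace (Ioo (-π) π) :=
      (convex_Ioo (-π) π).contractibleSpace ⟨0, by constructor <;> linarith [Real.pi_pos]⟩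
    exact (inferInstance : SimplyConnectedSpace (Ioo (-π) π))
  obtain ⟨L, hL, he⟩ := Complex.exists_continuousOn_eqOn_exp_comp hsc isOpen_Ioo
    (hφ.comp (g := φ) (by fun_prop) hm) (by
      rintro ⟨θ, hθ, h⟩
      exact h0 _ (hm hθ) h)
  have hsl : ∀ z ∈ unitCircleSet \ {ζ}, -z / ζ ∈ Complex.slitPlane ∧
      Complex.arg (-z / ζ) ∈ Ioo (-π) π ∧ -ζ * Complex.exp (Complex.arg (-z / ζ) * I) = z := by
    rintro z ⟨hz, hzζ⟩
    have hz1 : ‖z‖ = 1 := by simpa [unitCircleSet] using hz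
    have hn : ‖-z / ζ‖ = 1 := by simp [hz1, hζ1]
    have he := Complex.norm_mul_exp_arg_mul_I (-z / ζ)
    rw [hn, ofReal_one, one_mul] at he
    have h1 : Complex.arg (-z / ζ) ≠ π := by
      intro h
      rw [h, Complex.exp_pi_mul_I] at he
      apply hzζ
      field_simp at he
      rw [mem_singleton_iff]; linear_combination he
    refine ⟨Complex.mem_slitPlane_iff_arg.2 ⟨h1, ?_⟩, ⟨Complex.neg_pi_lt_arg _,
      lt_of_le_of_ne (Complex.arg_le_pi _) h1⟩, ?_⟩
    · rw [← norm_pos_iff, hn]; exact one_pos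
    · rw [he]; field_simp
  refine ⟨fun z => L (Complex.arg (-z / ζ)), hL.comp ?_ fun z hz => (hsl z hz).2.1, fun z hz => ?_⟩
  · intro z hz
    exact ((Complex.continuousAt_arg (hsl z hz).1).comp (f := fun z => -z / ζ)
      (by fun_prop)).continuousWithinAt
  · have := he (hsl z hz).2.1
    simp only [Function.comp] at this
    rw [this, (hsl z hz).2.2]

theorem IsJordanCurve.hasLogOn_diff {Γ : Set ℂ} (h : IsJordanCurve Γ) {x : ℂ} (hx : x ∈ Γ)
    {φ : ℂ → ℂ} (hφ : ContinuousOn φ Γ) (h0 : ∀ z ∈ Γ, φ z ≠ 0) : HasLogOn φ (Γ \ {x}) := by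
  obtain ⟨f, hf, hi, rfl⟩ := h
  obtain ⟨ζ, hζ, rfl⟩ := hx
  obtain ⟨g, hg, hgf, hfg⟩ := exists_continuousOn_inverse isCompact_unitCircleSet hf hi
  have h1 : HasLogOn (fun z => φ (f z)) (unitCircleSet \ {ζ}) :=
    hasLogOn_circle_diff hζ ((hφ.comp hf (mapsTo_image _ _)).mono sdiff_subset)
      fun z hz => h0 _ (mem_image_of_mem _ hz.1)
  refine (h1.comp (g := g) (hg.mono sdiff_subset) ?_).congr fun w hw => by rw [(hfg w hw.1).2]
  rintro w ⟨hw, hw'⟩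
  refine ⟨(hfg w hw).1, fun h => hw' ?_⟩
  rw [mem_singleton_iff] at h ⊢
  rw [← (hfg w hw).2, h]

theorem IsJordanCurve.not_isPreconnected_compl {Γ : Set ℂ} (h : IsJordanCurve Γ) :
    ¬ IsPreconnected Γᶜ := by
  intro hc
  have hK := h.isCompact
  obtain ⟨f, hf, hi, rfl⟩ := h
  obtain ⟨g, hg, hgf, hfg⟩ := exists_continuousOn_inverse isCompact_unitCircleSet hf hi
  have h1 : HasLogOn g (f '' unitCircleSet) := by
    refine hasLogOn_of_isPreconnected_compl hK hc hg fun w hw h => ?_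
    have := (hfg w hw).1
    rw [h] at this; simp [unitCircleSet] at this
  have h2 := h1.comp hf (mapsTo_image _ _)
  refine not_hasLogOn_sphere 0 one_pos (h2.congr fun z hz => ?_)
  rw [hgf z hz, sub_zero]

/-- `Ω` is a bounded complementary component of `Γ`, with the separation properties provided by
the Jordan curve theorem. -/
structure IsJordanInterior (Γ Ω : Set ℂ) : Prop where
  isOpen : IsOpen Ω
  isConnected : IsConnected Ω
  isBounded : IsBounded Ω
  disjoint : Disjoint Ω Γ
  frontier_eq : frontier Ω = Γ
  isPreconnected_compl : IsPreconnected Ωᶜ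

theorem IsJordanCurve.isJordanInterior {Γ : Set ℂ} (h : IsJordanCurve Γ) {x : ℂ} (hx : x ∉ Γ)
    (hb : IsBounded (connectedComponentIn Γᶜ x)) :
    IsJordanInterior Γ (connectedComponentIn Γᶜ x) := by
  have hO : IsOpen Γᶜ := h.isCompact.isClosed.isOpen_compl
  set Ω := connectedComponentIn Γᶜ x with hΩ
  have hop : IsOpen Ω := hO.connectedComponentIn
  have hxΩ : x ∈ Ω := mem_connectedComponentIn hx
  have hsub : Ω ⊆ Γᶜ := connectedComponentIn_subset _ _
  have hfr : frontier Ω ⊆ Γ := by simpa using frontier_connectedComponentIn_subset hO x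
  refine ⟨hop, ⟨⟨x, hxΩ⟩, isPreconnected_connectedComponentIn⟩, hb,
    disjoint_left.2 fun z hz => hsub hz, hfr.antisymm fun y hy => ?_, ?_⟩
  · by_contra hyf
    refine not_hasLogOn_sub_of_frontier hb (K := Γ \ {y}) (fun z hz => ⟨hfr hz, ?_⟩) hxΩ ?_
    · rintro rfl; exact hyf hz
    · refine h.hasLogOn_diff hy (by fun_prop) fun z hz h0 => hx ?_
      rwa [← sub_eq_zero.1 h0]
  · obtain ⟨x₀, hx₀⟩ := h.nonempty
    refine isPreconnected_of_forall x₀ fun y hy => ?_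
    by_cases hyΓ : y ∈ Γ
    · exact ⟨Γ, fun z hz hz' => hsub hz' hz, hx₀, hyΓ, h.isPreconnected⟩
    · set W := connectedComponentIn Γᶜ y with hW
      have hyW : y ∈ W := mem_connectedComponentIn hyΓ
      have hdisj : Disjoint W Ω := by
        rw [disjoint_left]
        intro z hz hz'
        apply hy
        rw [hΩ, connectedComponentIn_eq hz', ← connectedComponentIn_eq hz]
        exact hyW
      have hfW : frontier W ⊆ Γ := by simpa using frontier_connectedComponentIn_subset hO y
      have hne : (frontier W).Nonempty := by
        by_contra hemp
        rw [not_nonempty_iff_eq_empty, frontier_eq_empty_iff] at hemp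
        rcases hemp with h1 | h1
        · exact (h1 ▸ hyW : y ∈ (∅ : Set ℂ))
        · exact connectedComponentIn_subset Γᶜ y (by rw [← hW, h1]; exact mem_univ x₀) hx₀
      obtain ⟨b, hb⟩ := hne
      refine ⟨Γ ∪ closure W, ?_, Or.inl hx₀, Or.inr (subset_closure hyW),
        h.isPreconnected.union b (hfW hb) (frontier_subset_closure hb)
          isPreconnected_connectedComponentIn.closure⟩
      rintro z (hz | hz) hz'
      · exact hsub hz' hz
      · exact (hdisj.symm.closure_right hop).le_bot ⟨hz', hz⟩

theorem IsJordanCurve.exists_isJordanInterior {Γ : Set ℂ} (h : IsJordanCurve Γ) :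
    ∃ Ω, IsJordanInterior Γ Ω := by
  suffices ∃ x ∉ Γ, IsBounded (connectedComponentIn Γᶜ x) by
    obtain ⟨x, hx, hb⟩ := this
    exact ⟨_, h.isJordanInterior hx hb⟩
  by_contra! hcon
  obtain ⟨R, hR, hΓR⟩ := h.isCompact.isBounded.subset_closedBall_lt 0 0
  have hE : IsPreconnected (closedBall (0:ℂ) R)ᶜ := isPreconnected_compl_closedBall 0 hR.le
  have hEΓ : (closedBall (0:ℂ) R)ᶜ ⊆ Γᶜ := compl_subset_compl.2 hΓR
  have key : ∀ x ∉ Γ, (closedBall (0:ℂ) R)ᶜ ⊆ connectedComponentIn Γᶜ x := by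
    intro x hx
    have h1 : ¬ connectedComponentIn Γᶜ x ⊆ closedBall 0 R := fun h =>
      hcon x hx (isBounded_closedBall.subset h)
    obtain ⟨y, hy, hyR⟩ := not_subset.1 h1
    rw [connectedComponentIn_eq hy]
    exact hE.subset_connectedComponentIn hyR hEΓ
  apply h.not_isPreconnected_compl
  have hp : ((R + 1 : ℝ) : ℂ) ∈ (closedBall (0:ℂ) R)ᶜ := by
    simp only [mem_compl_iff, mem_closedBall, dist_zero_right, Complex.norm_real]
    rw [Real.norm_of_nonneg (by linarith)]; linarith
  exact isPreconnected_of_forall ((R + 1 : ℝ) : ℂ) fun y hy =>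
    ⟨connectedComponentIn Γᶜ y, connectedComponentIn_subset _ _, key y hy hp,
      mem_connectedComponentIn hy, isPreconnected_connectedComponentIn⟩

/-- On a bounded domain with connected complement nonvanishing functions have logarithms. -/
theorem hasLogOn_of_isPreconnected_compl_of_isOpen {Ω : Set ℂ} (hΩ : IsOpen Ω)
    (hc : IsConnected Ω) (hb : IsBounded Ω) (hcc : IsPreconnected Ωᶜ) {φ : ℂ → ℂ}
    (hφ : ContinuousOn φ Ω) (h0 : ∀ z ∈ Ω, φ z ≠ 0) : HasLogOn φ Ω := by
  classical
  obtain ⟨p, hp⟩ := hc.nonempty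
  have hne : (Ωᶜ).Nonempty := by
    rw [nonempty_compl]; rintro rfl
    exact NormedSpace.unbounded_univ ℝ ℂ hb
  set K : ℕ → Set ℂ := fun n => {z | 1 / ((n:ℝ) + 1) ≤ infDist z Ωᶜ} with hKdef
  have hKΩ : ∀ n, K n ⊆ Ω := by
    intro n z hz
    by_contra h
    have : infDist z Ωᶜ = 0 := infDist_zero_of_mem h
    have h1 : (0:ℝ) < 1 / ((n:ℝ) + 1) := by positivity
    simp only [hKdef, mem_ofPred_eq] at hz
    linarith
  have hKm : Monotone K := by
    intro m n hmn z hz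
    simp only [hKdef, mem_ofPred_eq] at hz ⊢
    refine le_trans ?_ hz
    gcongr
  have hKcl : ∀ n, IsClosed (K n) := fun n => isClosed_le continuous_const (continuous_infDist_pt _)
  have hKc : ∀ n, IsCompact (K n) := fun n =>
    isCompact_of_isClosed_isBounded (hKcl n) (hb.subset (hKΩ n))
  have hlog : ∀ n, HasLogOn φ (K n) := by
    intro n
    refine hasLogOn_of_isPreconnected_compl (hKc n) ?_ (hφ.mono (hKΩ n)) fun z hz => h0 z (hKΩ n hz)
    obtain ⟨x₀, hx₀⟩ := hne
    have hpos : (0:ℝ) < 1 / ((n:ℝ) + 1) := by positivity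
    have hsub : Ωᶜ ⊆ (K n)ᶜ := compl_subset_compl.2 (hKΩ n)
    refine isPreconnected_of_forall x₀ fun y hy => ?_
    have hy' : infDist y Ωᶜ < 1 / ((n:ℝ) + 1) := by simpa [hKdef] using hy
    obtain ⟨w, hw, hyw⟩ := (infDist_lt_iff ⟨x₀, hx₀⟩).1 hy'
    refine ⟨Ωᶜ ∪ ball w (1 / ((n:ℝ) + 1)), union_subset hsub fun z hz => ?_, Or.inl hx₀,
      Or.inr (by rwa [mem_ball]), hcc.union w hw (mem_ball_self hpos)
        (convex_ball _ _).isPreconnected⟩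
    intro hzK
    have := infDist_le_dist_of_mem (x := z) hw
    rw [mem_ball] at hz
    simp only [hKdef, mem_ofPred_eq] at hzK
    linarith
  have hcpt : ∀ C ⊆ Ω, IsCompact C → ∃ n, C ⊆ K n := by
    intro C hC hCc
    rcases C.eq_empty_or_nonempty with rfl | hCne
    · exact ⟨0, empty_subset _⟩
    obtain ⟨x, hx, hmin⟩ := hCc.exists_isMinOn hCne (continuous_infDist_pt Ωᶜ).continuousOn
    have hpos : 0 < infDist x Ωᶜ := (hΩ.isClosed_compl.notMem_iff_infDist_pos hne).1 (by
      simpa using hC hx)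
    obtain ⟨n, hn⟩ := exists_nat_one_div_lt hpos
    exact ⟨n, fun z hz => hn.le.trans (hmin hz)⟩
  have hcov : ∀ z ∈ Ω, ∃ n, p ∈ K n ∧ ∃ r > 0, ball z r ⊆ connectedComponentIn (K n) p := by
    intro z hz
    have hpc := hΩ.isConnected_iff_isPathConnected.1 hc
    obtain ⟨γ, hγ⟩ := hpc.joinedIn p hp z hz
    obtain ⟨r, hr, hrΩ⟩ := Metric.nhds_basis_closedBall.mem_iff.1 (hΩ.mem_nhds hz)
    have hpre : IsPreconnected (range γ ∪ closedBall z r) :=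
      (isPreconnected_range γ.continuous).union z ⟨1, γ.target⟩ (mem_closedBall_self hr.le)
        (convex_closedBall z r).isPreconnected
    obtain ⟨n, hn⟩ := hcpt (range γ ∪ closedBall z r) (union_subset (by
      rintro _ ⟨t, rfl⟩; exact hγ t) hrΩ)
      ((isCompact_range γ.continuous).union (isCompact_closedBall z r))
    have hpm : p ∈ range γ ∪ closedBall z r := Or.inl ⟨0, γ.source⟩
    refine ⟨n, hn hpm, r, hr, ?_⟩
    exact (ball_subset_closedBall.trans subset_union_right).trans
      (hpre.subset_connectedComponentIn hpm hn)
  choose L hL hLe using hlog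
  set M : ℕ → ℂ → ℂ := fun n z => L n z - L n p + Complex.log (φ p) with hM
  have hMc : ∀ n, ContinuousOn (M n) (K n) := fun n => ((hL n).sub continuousOn_const).add
    continuousOn_const
  have hMe : ∀ n, p ∈ K n → ∀ z ∈ K n, Complex.exp (M n z) = φ z := by
    intro n hpn z hz
    rw [hM]
    simp only
    rw [Complex.exp_add, Complex.exp_sub, hLe n z hz, hLe n p hpn, Complex.exp_log (h0 p hp)]
    have := h0 p hp
    field_simp
  have hMp : ∀ n, M n p = Complex.log (φ p) := fun n => by simp [hM]
  have hcompat : ∀ m n, p ∈ K m → m ≤ n → ∀ z ∈ connectedComponentIn (K m) p, M m z = M n z := by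
    intro m n hpm hmn z hz
    have hs := connectedComponentIn_subset (K m) p
    have h1 := eq_of_exp_eq_const (D := M m - M n) (S := connectedComponentIn (K m) p) (c := 1)
      isPreconnected_connectedComponentIn (((hMc m).mono hs).sub
        (((hMc n).mono (hKm hmn)).mono hs)) (fun w hw => by
          rw [Pi.sub_apply, Complex.exp_sub, hMe m hpm w (hs hw), hMe n (hKm hmn hpm) w
            (hKm hmn (hs hw)), div_self (h0 w (hKΩ m (hs hw)))]) hz
            (mem_connectedComponentIn hpm)
    simp only [Pi.sub_apply, hMp, sub_self] at h1
    exact sub_eq_zero.1 h1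
  choose! N hN1 hN2 using hcov
  have hself : ∀ z ∈ Ω, z ∈ connectedComponentIn (K (N z)) p := fun z hz => by
    obtain ⟨r, hr, h⟩ := hN2 z hz
    exact h (mem_ball_self hr)
  have hagree : ∀ z ∈ Ω, ∀ n, p ∈ K n → z ∈ connectedComponentIn (K n) p → M (N z) z = M n z := by
    intro z hz n hpn hzn
    rcases le_total (N z) n with h | h
    · exact hcompat _ _ (hN1 z hz) h z (hself z hz)
    · exact (hcompat _ _ hpn h z hzn).symm
  refine ⟨fun z => M (N z) z, fun z hz => ?_, fun z hz => ?_⟩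
  · obtain ⟨r, hr, h⟩ := hN2 z hz
    have h1 : ContinuousAt (M (N z)) z := (hMc (N z)).continuousAt
      (mem_of_superset (ball_mem_nhds z hr) (h.trans (connectedComponentIn_subset _ _)))
    refine (h1.congr ?_).continuousWithinAt
    filter_upwards [ball_mem_nhds z hr, hΩ.mem_nhds hz] with w hw hwΩ
    exact (hagree w hwΩ (N z) (hN1 z hz) (h hw)).symm
  · exact hMe _ (hN1 z hz) z (connectedComponentIn_subset _ _ (hself z hz))

/-- A pointwise limit of uniformly bounded holomorphic functions is locally uniform. -/
lemma tendstoLocallyUniformlyOn_of_bounded {ι : Type*} {l : Filter ι} {Ω : Set ℂ} (hΩ : IsOpen Ω)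
    {f : ι → ℂ → ℂ} {g : ℂ → ℂ} [l.NeBot] (hd : ∀ i, DifferentiableOn ℂ (f i) Ω)
    (hb : ∀ i, ∀ z ∈ Ω, ‖f i z‖ ≤ 1) (hg : ∀ z ∈ Ω, Tendsto (fun i => f i z) l (𝓝 (g z))) :
    TendstoLocallyUniformlyOn f g l Ω := by
  rw [Metric.tendstoLocallyUniformlyOn_iff]
  intro ε hε x hx
  obtain ⟨r, hr, hrΩ⟩ := Metric.isOpen_iff.1 hΩ x hx
  have lip : ∀ i, ∀ z ∈ ball x r, dist (f i z) (f i x) ≤ 2 / r * dist z x := by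
    intro i z hz
    refine Complex.dist_le_div_mul_dist_of_mapsTo_ball ((hd i).mono hrΩ) ?_ hz
    intro y hy
    rw [mem_closedBall, dist_eq_norm]
    calc ‖f i y - f i x‖ ≤ ‖f i y‖ + ‖f i x‖ := norm_sub_le _ _
      _ ≤ 2 := by linarith [hb i y (hrΩ hy), hb i x hx]
  have lipg : ∀ z ∈ ball x r, dist (g z) (g x) ≤ 2 / r * dist z x := fun z hz =>
    le_of_tendsto ((hg z (hrΩ hz)).dist (hg x hx)) (Eventually.of_forall fun i => lip i z hz)
  set δ := min r (r * ε / 8) with hδ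
  have hδ0 : 0 < δ := lt_min hr (by positivity)
  refine ⟨ball x δ, mem_nhdsWithin_of_mem_nhds (ball_mem_nhds x hδ0), ?_⟩
  have h1 := (Metric.tendsto_nhds.1 (hg x hx)) (ε / 2) (by positivity)
  filter_upwards [h1] with i hi z hz
  have hzr : z ∈ ball x r := ball_subset_ball (min_le_left _ _) hz
  have hk : 2 / r * dist z x ≤ ε / 4 := by
    have : dist z x ≤ r * ε / 8 := (mem_ball.1 hz).le.trans (min_le_right _ _)
    calc 2 / r * dist z x ≤ 2 / r * (r * ε / 8) := by gcongr
      _ = ε / 4 := by field_simp; norm_num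
  calc dist (g z) (f i z) ≤ dist (g z) (g x) + dist (g x) (f i x) + dist (f i x) (f i z) :=
        dist_triangle4 _ _ _ _
    _ < ε := by
      have := lipg z hzr
      have := lip i z hzr
      rw [dist_comm (g x), dist_comm (f i x) (f i z)]
      linarith

/-- Montel's theorem, along an ultrafilter. -/
lemma exists_tendstoLocallyUniformlyOn {ι : Type*} (l : Ultrafilter ι) {Ω : Set ℂ} (hΩ : IsOpen Ω)
    {f : ι → ℂ → ℂ} (hd : ∀ i, DifferentiableOn ℂ (f i) Ω)
    (hb : ∀ i, ∀ z ∈ Ω, ‖f i z‖ ≤ 1) :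
    ∃ g : ℂ → ℂ, TendstoLocallyUniformlyOn f g l Ω := by
  have : ∀ z, ∃ w, z ∈ Ω → Tendsto (fun i => f i z) l (𝓝 w) := by
    intro z
    by_cases hz : z ∈ Ω
    · obtain ⟨w, -, hw⟩ := (isCompact_closedBall (0 : ℂ) 1).ultrafilter_le_nhds
        (l.map (fun i => f i z)) (by
          rw [le_principal_iff]
          exact Ultrafilter.mem_map.2 (univ_mem' fun i => by simpa using hb i z hz))
      exact ⟨w, fun _ => hw⟩
    · exact ⟨0, fun h => absurd h hz⟩
  choose g hg using this
  exact ⟨g, tendstoLocallyUniformlyOn_of_bounded hΩ hd hb hg⟩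

/-- Hurwitz: a nonconstant locally uniform limit of injective holomorphic functions is
injective. -/
lemma injOn_of_tendstoLocallyUniformlyOn {ι : Type*} {l : Filter ι} [l.NeBot] {Ω : Set ℂ}
    (hΩ : IsOpen Ω) (hc : IsPreconnected Ω) {f : ι → ℂ → ℂ} {g : ℂ → ℂ}
    (hd : ∀ i, DifferentiableOn ℂ (f i) Ω) (hi : ∀ i, InjOn (f i) Ω)
    (h : TendstoLocallyUniformlyOn f g l Ω) (hg : ∃ a ∈ Ω, ∃ b ∈ Ω, g a ≠ g b) : InjOn g Ω := by
  intro z₁ h₁ z₂ h₂ h12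
  by_contra hne
  have hgd : DifferentiableOn ℂ g Ω := h.differentiableOn (Eventually.of_forall hd) hΩ
  have hga : AnalyticOnNhd ℂ g Ω := hgd.analyticOnNhd hΩ
  have hiso : ∀ᶠ z in 𝓝[≠] z₂, g z ≠ g z₁ := by
    rcases (hga z₂ h₂).eventually_eq_or_eventually_ne
      (analyticAt_const (v := g z₁)) with h' | h'
    · exfalso
      have := hga.eqOn_of_preconnected_of_eventuallyEq (g := fun _ => g z₁)
        (analyticOnNhd_const) hc h₂ h'
      obtain ⟨a, ha, b, hb, hab⟩ := hg
      exact hab ((this ha).trans (this hb).symm)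
    · exact h'
  have hO : Ω \ {z₁} ∈ 𝓝 z₂ :=
    (hΩ.sdiff isClosed_singleton).mem_nhds ⟨h₂, fun h => hne (by simpa using h.symm)⟩
  rw [eventually_nhdsWithin_iff] at hiso
  obtain ⟨r, hr, hrs⟩ := Metric.nhds_basis_closedBall.mem_iff.1 (inter_mem hO hiso)
  have hcΩ : closedBall z₂ r ⊆ Ω := fun z hz => (hrs hz).1.1
  have hsph : IsCompact (sphere z₂ r) := isCompact_sphere _ _
  have hsne : (sphere z₂ r).Nonempty := NormedSpace.sphere_nonempty.2 hr.le
  obtain ⟨ξ, hξ, hmin⟩ := hsph.exists_isMinOn hsne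
    ((((hgd.continuousOn.mono hcΩ).mono sphere_subset_closedBall).sub
      (continuousOn_const (c := g z₁))).norm)
  set c := ‖g ξ - g z₁‖ with hcdef
  have hc0 : 0 < c := by
    rw [hcdef, norm_pos_iff, sub_ne_zero]
    refine (hrs (sphere_subset_closedBall hξ)).2 ?_
    rintro rfl
    simp [hr.ne] at hξ
  have hU := (tendstoLocallyUniformlyOn_iff_forall_isCompact hΩ).1 h _ hcΩ
    (isCompact_closedBall _ _)
  rw [Metric.tendstoUniformlyOn_iff] at hU
  have hz1 : ∀ᶠ i in l, dist (f i z₁) (g z₁) < c / 8 :=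
    Metric.tendsto_nhds.1 (h.tendsto_at h₁) _ (by positivity)
  obtain ⟨i, hi1, hi2⟩ := ((hU (c / 8) (by positivity)).and hz1).exists
  have hz2 := hi1 z₂ (mem_closedBall_self hr.le)
  have hnz : ∀ z ∈ closedBall z₂ r, f i z - f i z₁ ≠ 0 := by
    intro z hz h0
    have := hi i (hcΩ hz) h₁ (sub_eq_zero.1 h0)
    exact (hrs hz).1.2 this
  have hmax : ‖(f i z₂ - f i z₁)⁻¹‖ ≤ 4 / (3 * c) := by
    refine Complex.norm_le_of_forall_mem_frontier_norm_le (U := ball z₂ r)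
      (f := fun z => (f i z - f i z₁)⁻¹) isBounded_ball ?_ ?_
      (subset_closure (mem_ball_self hr))
    · apply DifferentiableOn.diffContOnCl
      rw [closure_ball _ hr.ne']
      exact (((hd i).mono hcΩ).sub_const _).inv hnz
    · rw [frontier_ball _ hr.ne']
      intro z hz
      have hzc := sphere_subset_closedBall hz
      have h1 := hi1 z hzc
      have h2 : c ≤ ‖g z - g z₁‖ := hmin hz
      have h3 : 3 * c / 4 ≤ ‖f i z - f i z₁‖ := by
        rw [dist_eq_norm] at h1 hi2
        have : ‖g z - g z₁‖ ≤ ‖g z - f i z‖ + ‖f i z - f i z₁‖ + ‖f i z₁ - g z₁‖ := by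
          calc ‖g z - g z₁‖ = ‖(g z - f i z) + (f i z - f i z₁) + (f i z₁ - g z₁)‖ := by
                congr 1; ring
            _ ≤ _ := norm_add₃_le
        linarith
      rw [norm_inv]
      calc ‖f i z - f i z₁‖⁻¹ ≤ (3 * c / 4)⁻¹ := by gcongr
        _ = 4 / (3 * c) := by rw [inv_div]
  have hsmall : ‖f i z₂ - f i z₁‖ < c / 4 := by
    rw [dist_eq_norm] at hz2 hi2
    calc ‖f i z₂ - f i z₁‖ = ‖-(g z₂ - f i z₂) + (g z₁ - f i z₁)‖ := by
          rw [h12]; congr 1; ring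
      _ ≤ ‖g z₂ - f i z₂‖ + ‖f i z₁ - g z₁‖ := by
          rw [← norm_neg (g z₂ - f i z₂), ← norm_neg (f i z₁ - g z₁), neg_sub (f i z₁)]
          exact norm_add_le _ _
      _ < c / 4 := by linarith
  have hpos : 0 < ‖f i z₂ - f i z₁‖ := norm_pos_iff.2 (hnz _ (mem_closedBall_self hr.le))
  rw [norm_inv, inv_le_comm₀ hpos (by positivity), inv_div] at hmax
  linarith

/-- The inverse of an injective holomorphic function on an open connected set is holomorphic. -/
lemma exists_differentiableOn_inverse {Ω : Set ℂ} (hΩ : IsOpen Ω) (hc : IsPreconnected Ω)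
    {f : ℂ → ℂ} (hf : DifferentiableOn ℂ f Ω) (hi : InjOn f Ω) {a b : ℂ} (ha : a ∈ Ω) (hb : b ∈ Ω)
    (hab : a ≠ b) :
    IsOpen (f '' Ω) ∧ ∃ F : ℂ → ℂ, DifferentiableOn ℂ F (f '' Ω) ∧ InvOn F f Ω (f '' Ω) := by
  have hA : AnalyticOnNhd ℂ f Ω := hf.analyticOnNhd hΩ
  have hopen : ∀ s ⊆ Ω, IsOpen s → IsOpen (f '' s) := by
    rcases hA.is_constant_or_isOpen hc with ⟨w, hw⟩ | h
    · exact absurd (hi ha hb ((hw a ha).trans (hw b hb).symm)) hab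
    · exact h
  refine ⟨hopen Ω Subset.rfl hΩ, Function.invFunOn f Ω, ?_, ?_⟩
  swap
  · exact ⟨hi.leftInvOn_invFunOn, fun w hw => Function.invFunOn_eq hw⟩
  have hL : LeftInvOn (Function.invFunOn f Ω) f Ω := hi.leftInvOn_invFunOn
  set F := Function.invFunOn f Ω with hF
  have hcont : ContinuousOn F (f '' Ω) := by
    intro w hw
    obtain ⟨z, hz, rfl⟩ := hw
    apply ContinuousAt.continuousWithinAt
    rw [ContinuousAt, hL hz]
    intro N hN
    obtain ⟨s, hsN, hso, hzs⟩ := _root_.mem_nhds_iff.1 (inter_mem hN (hΩ.mem_nhds hz))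
    rw [Filter.mem_map]
    refine mem_of_superset ((hopen s (fun x hx => (hsN hx).2) hso).mem_nhds ⟨z, hzs, rfl⟩) ?_
    rintro _ ⟨x, hx, rfl⟩
    rw [mem_preimage, hL (hsN hx).2]
    exact (hsN hx).1
  have hdiff : ∀ z ∈ Ω, deriv f z ≠ 0 → DifferentiableAt ℂ F (f z) := by
    intro z hz h0
    have hd : HasDerivAt f (deriv f z) z := (hf.differentiableAt (hΩ.mem_nhds hz)).hasDerivAt
    refine (HasDerivAt.of_local_left_inverse (f := f) (f' := deriv f z) (g := F) (a := f z) ?_ ?_ h0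
      ?_).differentiableAt
    · exact hcont.continuousAt ((hopen Ω Subset.rfl hΩ).mem_nhds ⟨z, hz, rfl⟩)
    · rwa [hL hz]
    · filter_upwards [(hopen Ω Subset.rfl hΩ).mem_nhds ⟨z, hz, rfl⟩] with w hw
      exact Function.invFunOn_eq hw
  rintro _ ⟨z, hz, rfl⟩
  apply DifferentiableAt.differentiableWithinAt
  have hne : ∀ᶠ x in 𝓝[≠] z, deriv f x ≠ 0 := by
    rcases (hA.deriv z hz).eventually_eq_or_eventually_ne (analyticAt_const (v := (0 : ℂ)))
      with h' | h'
    · exfalso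
      have h0 := hA.deriv.eqOn_of_preconnected_of_eventuallyEq (g := fun _ => (0 : ℂ))
        (analyticOnNhd_const) hc hz h'
      have := hΩ.eqOn_of_deriv_eq (g := fun _ => f a) hc hf (differentiableOn_const _)
        (fun x hx => by simp [h0 hx]) ha rfl
      exact hab (hi ha hb (this hb).symm)
    · exact h'
  rw [eventually_nhdsWithin_iff] at hne
  obtain ⟨s, hsN, hso, hzs⟩ := _root_.mem_nhds_iff.1 (inter_mem hne (hΩ.mem_nhds hz))
  refine (Complex.analyticAt_of_differentiable_on_punctured_nhds_of_continuousAt ?_ ?_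
    ).differentiableAt
  · rw [eventually_nhdsWithin_iff]
    filter_upwards [(hopen s (fun x hx => (hsN hx).2) hso).mem_nhds ⟨z, hzs, rfl⟩]
    rintro _ ⟨x, hx, rfl⟩ hxz
    exact hdiff x (hsN hx).2 ((hsN hx).1 (fun h => hxz (by rw [mem_singleton_iff.1 h]; rfl)))
  · exact hcont.continuousAt ((hopen Ω Subset.rfl hΩ).mem_nhds ⟨z, hz, rfl⟩)

/-- The disc automorphism exchanging `a` and `0`, up to sign. -/
def discAut (a z : ℂ) : ℂ := (z - a) / (1 - conj a * z)

lemma one_sub_conj_mul_ne_zero {a z : ℂ} (ha : ‖a‖ < 1) (hz : ‖z‖ < 1) : 1 - conj a * z ≠ 0 := by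
  intro h
  have : ‖conj a * z‖ = 1 := by rw [← sub_eq_zero.1 h]; simp
  rw [norm_mul, RCLike.norm_conj] at this
  nlinarith [norm_nonneg a, norm_nonneg z]

lemma norm_discAut_lt {a z : ℂ} (ha : ‖a‖ < 1) (hz : ‖z‖ < 1) : ‖discAut a z‖ < 1 := by
  have h0 := one_sub_conj_mul_ne_zero ha hz
  rw [discAut, norm_div, div_lt_one (norm_pos_iff.2 h0), ← sq_lt_sq₀ (norm_nonneg _) (norm_nonneg _),
    ← Complex.normSq_eq_norm_sq, ← Complex.normSq_eq_norm_sq]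
  have h1 : ‖a‖ ^ 2 < 1 := by nlinarith [norm_nonneg a]
  have h2 : ‖z‖ ^ 2 < 1 := by nlinarith [norm_nonneg z]
  rw [← Complex.normSq_eq_norm_sq] at h1 h2
  simp only [Complex.normSq_apply, sub_re, sub_im, mul_re, mul_im, conj_re, conj_im, one_re,
    one_im] at *
  nlinarith

lemma injOn_discAut {a : ℂ} (ha : ‖a‖ < 1) : InjOn (discAut a) (ball 0 1) := by
  intro z hz w hw h
  rw [mem_ball_zero_iff] at hz hw
  have h1 := one_sub_conj_mul_ne_zero ha hz
  have h2 := one_sub_conj_mul_ne_zero ha hw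
  simp only [discAut] at h
  rw [div_eq_div_iff h1 h2] at h
  have h3 : (z - w) * (1 - conj a * a) = 0 := by linear_combination h
  have h4 := one_sub_conj_mul_ne_zero ha ha
  exact sub_eq_zero.1 ((mul_eq_zero.1 h3).resolve_right h4)

lemma hasDerivAt_discAut {a z : ℂ} (ha : ‖a‖ < 1) (hz : ‖z‖ < 1) :
    HasDerivAt (discAut a) ((1 - conj a * a) / (1 - conj a * z) ^ 2) z := by
  have h0 := one_sub_conj_mul_ne_zero ha hz
  have := ((hasDerivAt_id z).sub_const a).div
    (((hasDerivAt_id z).const_mul (conj a)).const_sub 1) (by simpa using h0)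
  refine HasDerivAt.congr_deriv (f := discAut a) this ?_
  simp only [id]
  ring

lemma discAut_ne_zero {a z : ℂ} (ha : ‖a‖ < 1) (hz : ‖z‖ < 1) (h : z ≠ a) : discAut a z ≠ 0 :=
  div_ne_zero (sub_ne_zero.2 h) (one_sub_conj_mul_ne_zero ha hz)

/-- Koebe's square root trick. -/
lemma exists_larger_deriv {Ω : Set ℂ} (hΩ : IsOpen Ω)
    (hlog : ∀ φ : ℂ → ℂ, ContinuousOn φ Ω → (∀ z ∈ Ω, φ z ≠ 0) → HasLogOn φ Ω) {p : ℂ}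
    (hp : p ∈ Ω) {f : ℂ → ℂ} (hf : DifferentiableOn ℂ f Ω) (hi : InjOn f Ω)
    (hm : MapsTo f Ω (ball 0 1)) (h0 : f p = 0) (hd : deriv f p ≠ 0) {w : ℂ} (hw : w ∈ ball 0 1)
    (hwf : w ∉ f '' Ω) :
    ∃ h : ℂ → ℂ, DifferentiableOn ℂ h Ω ∧ InjOn h Ω ∧ MapsTo h Ω (ball 0 1) ∧ h p = 0 ∧
      ‖deriv f p‖ < ‖deriv h p‖ := by
  rw [mem_ball_zero_iff] at hw
  have hmf : ∀ z ∈ Ω, ‖f z‖ < 1 := fun z hz => mem_ball_zero_iff.1 (hm hz)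
  set k : ℂ → ℂ := fun z => discAut w (f z) with hk
  have hkd : DifferentiableOn ℂ k Ω := fun z hz =>
    (((hasDerivAt_discAut hw (hmf z hz)).differentiableAt.comp z
      (hf.differentiableAt (hΩ.mem_nhds hz)))).differentiableWithinAt
  have hk0 : ∀ z ∈ Ω, k z ≠ 0 := fun z hz =>
    discAut_ne_zero hw (hmf z hz) (fun h => hwf ⟨z, hz, h⟩)
  have hk1 : ∀ z ∈ Ω, ‖k z‖ < 1 := fun z hz => norm_discAut_lt hw (hmf z hz)
  have hki : InjOn k Ω := fun x hx y hy hxy => hi hx hy (injOn_discAut hw (hm hx) (hm hy) hxy)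
  obtain ⟨L, hLc, hL⟩ := hlog k hkd.continuousOn hk0
  set g : ℂ → ℂ := fun z => Complex.exp (L z / 2) with hg
  have hg2 : ∀ z ∈ Ω, g z ^ 2 = k z := by
    intro z hz
    rw [hg, ← hL z hz, ← Complex.exp_nat_mul]
    congr 1
    push_cast; ring
  have hg0 : ∀ z, g z ≠ 0 := fun z => Complex.exp_ne_zero _
  have hgc : ContinuousOn g Ω := Complex.continuous_exp.comp_continuousOn (hLc.div_const 2)
  have hgn : ∀ z ∈ Ω, ‖g z‖ < 1 := by
    intro z hz
    have h1 : ‖g z‖ ^ 2 < 1 := by rw [← norm_pow, hg2 z hz]; exact hk1 z hz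
    nlinarith [norm_nonneg (g z)]
  have hgd : ∀ z ∈ Ω, HasDerivAt g (deriv k z / (2 * g z)) z := by
    intro z hz
    have hkz : HasDerivAt k (deriv k z) z :=
      (hkd.differentiableAt (hΩ.mem_nhds hz)).hasDerivAt
    rw [hasDerivAt_iff_tendsto_slope] at hkz ⊢
    have hgz : ContinuousAt g z := hgc.continuousAt (hΩ.mem_nhds hz)
    have hlim : Tendsto (fun x => slope k z x / (g x + g z)) (𝓝[≠] z)
        (𝓝 (deriv k z / (g z + g z))) :=
      hkz.div ((hgz.tendsto.mono_left nhdsWithin_le_nhds).add_const _)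
        (by rw [← two_mul]; exact mul_ne_zero two_ne_zero (hg0 z))
    rw [two_mul]
    refine hlim.congr' ?_
    have hne : ∀ᶠ x in 𝓝[≠] z, g x + g z ≠ 0 :=
      ((hgz.tendsto.mono_left nhdsWithin_le_nhds).add_const _).eventually_ne
        (by rw [← two_mul]; exact mul_ne_zero two_ne_zero (hg0 z))
    filter_upwards [hne, nhdsWithin_le_nhds (hΩ.mem_nhds hz), self_mem_nhdsWithin] with x hx hxΩ hxz
    have hxz' : x - z ≠ 0 := sub_ne_zero.2 hxz
    rw [slope_def_field, slope_def_field, ← hg2 x hxΩ, ← hg2 z hz]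
    field_simp
    ring
  have hgi : InjOn g Ω := fun x hx y hy hxy => hki hx hy (by
    rw [← hg2 x hx, ← hg2 y hy, hxy])
  set c := g p with hc
  have hcn : ‖c‖ < 1 := hgn p hp
  refine ⟨fun z => discAut c (g z), ?_, ?_, ?_, ?_, ?_⟩
  · exact fun z hz => ((hasDerivAt_discAut hcn (hgn z hz)).comp z
      (hgd z hz)).differentiableAt.differentiableWithinAt
  · intro x hx y hy hxy
    exact hgi hx hy (injOn_discAut hcn (mem_ball_zero_iff.2 (hgn x hx))
      (mem_ball_zero_iff.2 (hgn y hy)) hxy)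
  · exact fun z hz => mem_ball_zero_iff.2 (norm_discAut_lt hcn (hgn z hz))
  · simp [discAut, hc]
  · have hD := (hasDerivAt_discAut hcn (hgn p hp)).comp p (hgd p hp)
    have hkp : deriv k p = (1 - conj w * w) * deriv f p := by
      have := (hasDerivAt_discAut hw (hmf p hp)).comp p
        (hf.differentiableAt (hΩ.mem_nhds hp)).hasDerivAt
      rw [h0] at this
      have hk' : k = discAut w ∘ f := rfl
      rw [hk']
      simpa using this.deriv
    have hDe : deriv (fun z => discAut c (g z)) p =
      (1 - conj c * c) / (1 - conj c * g p) ^ 2 * (deriv k p / (2 * g p)) := hD.deriv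
    rw [hDe, hkp, ← hc]
    have hcw : ‖c‖ ^ 2 = ‖w‖ := by
      rw [← norm_pow, hg2 p hp]
      simp [hk, h0, discAut]
    have hc0 : 0 < ‖c‖ := norm_pos_iff.2 (hg0 p)
    have e1 : ∀ u : ℂ, 1 - conj u * u = ((1 - ‖u‖ ^ 2 : ℝ) : ℂ) := by
      intro u
      rw [mul_comm, Complex.mul_conj, Complex.normSq_eq_norm_sq]
      push_cast; ring
    rw [e1, e1, norm_mul, norm_div, norm_div, norm_mul, norm_mul, norm_pow, Complex.norm_real,
      Complex.norm_real, Complex.norm_ofNat, ← hcw]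
    have h1 : 0 < 1 - ‖c‖ ^ 2 := by nlinarith
    have h2 : 0 < 1 - (‖c‖ ^ 2) ^ 2 := by nlinarith [sq_nonneg ‖c‖]
    rw [Real.norm_of_nonneg h1.le, Real.norm_of_nonneg h2.le]
    have e2 : (1 - ‖c‖ ^ 2) / (1 - ‖c‖ ^ 2) ^ 2 * ((1 - (‖c‖ ^ 2) ^ 2) * ‖deriv f p‖ / (2 * ‖c‖)) =
        ‖deriv f p‖ * ((1 + ‖c‖ ^ 2) / (2 * ‖c‖)) := by
      field_simp
      ring
    rw [e2]
    have h3 : 1 < (1 + ‖c‖ ^ 2) / (2 * ‖c‖) := by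
      rw [one_lt_div (by positivity)]
      nlinarith [sq_pos_of_pos (sub_pos.2 hcn)]
    exact lt_mul_of_one_lt_right (norm_pos_iff.2 hd) h3

/-- Riemann mapping theorem for bounded domains with continuous logarithms. -/
lemma exists_riemann_map {Ω : Set ℂ} (hΩ : IsOpen Ω) (hc : IsPreconnected Ω)
    (hb : IsBounded Ω)
    (hlog : ∀ φ : ℂ → ℂ, ContinuousOn φ Ω → (∀ z ∈ Ω, φ z ≠ 0) → HasLogOn φ Ω) {p : ℂ}
    (hp : p ∈ Ω) :
    ∃ F : ℂ → ℂ, DifferentiableOn ℂ F (ball 0 1) ∧ BijOn F (ball 0 1) Ω ∧ F 0 = p := by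
  set 𝓕 : Set (ℂ → ℂ) := {f | DifferentiableOn ℂ f Ω ∧ InjOn f Ω ∧ MapsTo f Ω (ball 0 1) ∧ f p = 0}
    with h𝓕
  obtain ⟨r, hr, hrΩ⟩ := Metric.isOpen_iff.1 hΩ p hp
  obtain ⟨R, hR, hRΩ⟩ : ∃ R, 0 < R ∧ Ω ⊆ ball p R := by
    obtain ⟨R, hR⟩ := hb.subset_ball p
    exact ⟨max R 1, by positivity, hR.trans (ball_subset_ball (le_max_left _ _))⟩
  have hne : (fun z => (z - p) / (R : ℂ)) ∈ 𝓕 := by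
    have hRc : (R : ℂ) ≠ 0 := by exact_mod_cast hR.ne'
    refine ⟨by fun_prop, ?_, ?_, by simp⟩
    · intro x _ y _ hxy
      simpa [div_left_inj' hRc] using hxy
    · intro z hz
      have := mem_ball.1 (hRΩ hz)
      rw [dist_eq_norm] at this
      rw [mem_ball_zero_iff, norm_div, Complex.norm_real, Real.norm_of_nonneg hR.le,
        div_lt_one hR]
      exact this
  set S : Set ℝ := (fun f : ℂ → ℂ => ‖deriv f p‖) '' 𝓕 with hS
  have hbd : BddAbove S := by
    refine ⟨1 / r, ?_⟩
    rintro _ ⟨f, hf, rfl⟩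
    refine Complex.norm_deriv_le_div_of_mapsTo_ball (hf.1.mono hrΩ) ?_ hr
    intro z hz
    rw [hf.2.2.2]
    exact ball_subset_closedBall (hf.2.2.1 (hrΩ hz))
  have hSne : S.Nonempty := ⟨_, _, hne, rfl⟩
  set m := sSup S with hm
  have hm0 : 0 < m := by
    refine lt_of_lt_of_le ?_ (le_csSup hbd ⟨_, hne, rfl⟩)
    have : deriv (fun z => (z - p) / (R : ℂ)) p = 1 / R := by
      simp
    simp only [this]
    rw [norm_pos_iff]
    exact one_div_ne_zero (by exact_mod_cast hR.ne')
  obtain ⟨u, -, hu, huS⟩ := exists_seq_tendsto_sSup hSne hbd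
  choose f hf hfu using huS
  obtain ⟨g, hg⟩ := exists_tendstoLocallyUniformlyOn (hyperfilter ℕ) hΩ (f := f)
    (fun i => (hf i).1) (fun i z hz => (mem_ball_zero_iff.1 ((hf i).2.2.1 hz)).le)
  have hgd : DifferentiableOn ℂ g Ω :=
    hg.differentiableOn (Eventually.of_forall fun i => (hf i).1) hΩ
  have hderiv : ‖deriv g p‖ = m := by
    have h1 := ((hg.deriv (Eventually.of_forall fun i => (hf i).1) hΩ).tendsto_at hp).norm
    have h2 : Tendsto (fun i => ‖(deriv ∘ f) i p‖) (hyperfilter ℕ : Filter ℕ) (𝓝 m) := by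
      have := hu.mono_left (Nat.hyperfilter_le_atTop)
      refine this.congr fun i => ?_
      exact (hfu i).symm
    exact tendsto_nhds_unique h1 h2
  have hd0 : deriv g p ≠ 0 := by rw [← norm_pos_iff, hderiv]; exact hm0
  have hg0 : g p = 0 := by
    refine tendsto_nhds_unique (hg.tendsto_at hp) ?_
    simp only [fun i => (hf i).2.2.2]
    exact tendsto_const_nhds
  have hnc : ∃ a ∈ Ω, ∃ b ∈ Ω, g a ≠ g b := by
    by_contra! hcon
    apply hd0
    have : g =ᶠ[𝓝 p] fun _ => g p := by
      filter_upwards [hΩ.mem_nhds hp] with z hz using hcon z hz p hp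
    rw [this.deriv_eq, deriv_const]
  have hgi : InjOn g Ω := injOn_of_tendstoLocallyUniformlyOn hΩ hc (fun i => (hf i).1)
    (fun i => (hf i).2.1) hg hnc
  obtain ⟨a, ha, b, hb', hab⟩ := hnc
  obtain ⟨hopen, F, hFd, hFi⟩ := exists_differentiableOn_inverse hΩ hc hgd hgi ha hb'
    (fun h => hab (by rw [h]))
  have hgm : MapsTo g Ω (ball 0 1) := by
    have h1 : g '' Ω ⊆ closedBall 0 1 := by
      rintro _ ⟨z, hz, rfl⟩
      rw [mem_closedBall_zero_iff]
      exact le_of_tendsto (hg.tendsto_at hz).norm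
        (Eventually.of_forall fun i => (mem_ball_zero_iff.1 ((hf i).2.2.1 hz)).le)
    have h2 := interior_maximal h1 hopen
    rw [interior_closedBall _ one_ne_zero] at h2
    exact fun z hz => h2 ⟨z, hz, rfl⟩
  have himg : g '' Ω = ball 0 1 := by
    refine Subset.antisymm (image_subset_iff.2 hgm) fun w hw => ?_
    by_contra hwf
    obtain ⟨h, h1, h2, h3, h4, h5⟩ := exists_larger_deriv hΩ hlog hp hgd hgi hgm hg0 hd0 hw hwf
    have : ‖deriv h p‖ ≤ m := le_csSup hbd ⟨h, ⟨h1, h2, h3, h4⟩, rfl⟩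
    linarith
  rw [himg] at hFd hFi
  refine ⟨F, hFd, hFi.symm.bijOn ?_ hgm, ?_⟩
  · intro w hw
    rw [← himg] at hw
    obtain ⟨z, hz, rfl⟩ := hw
    rw [hFi.1 hz]
    exact hz
  · rw [← hg0]; exact hFi.1 hp

lemma sq_lintegral_le {α : Type*} [MeasurableSpace α] (μ : Measure α) {g : α → ℝ≥0∞}
    (hg : AEMeasurable g μ) : (∫⁻ x, g x ∂μ) ^ 2 ≤ μ univ * ∫⁻ x, g x ^ 2 ∂μ := by
  have h := ENNReal.lintegral_mul_le_Lp_mul_Lq μ (p := 2) (q := 2)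
    (by rw [Real.holderConjugate_iff]; norm_num) (f := fun _ => 1) (g := g)
    aemeasurable_const hg
  simp only [Pi.mul_apply, one_mul, ENNReal.one_rpow, lintegral_one] at h
  calc (∫⁻ x, g x ∂μ) ^ 2
      ≤ (μ univ ^ (1 / 2 : ℝ) * (∫⁻ x, g x ^ (2 : ℝ) ∂μ) ^ (1 / 2 : ℝ)) ^ 2 := by gcongr
    _ = μ univ * ∫⁻ x, g x ^ 2 ∂μ := by
      rw [mul_pow, ← ENNReal.rpow_natCast, ← ENNReal.rpow_natCast, ← ENNReal.rpow_mul,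
        ← ENNReal.rpow_mul]
      norm_num

/-- The point with polar coordinates `(ρ, θ)` with respect to the centre `a` and the unit direction
`u`. -/
def polarPt (a u : ℂ) (ρ θ : ℝ) : ℂ := a + u * (ρ * Complex.exp (θ * I))

lemma dist_polarPt {a u : ℂ} (hu : ‖u‖ = 1) {ρ : ℝ} (hρ : 0 ≤ ρ) (θ : ℝ) :
    dist (polarPt a u ρ θ) a = ρ := by
  simp [polarPt, dist_eq_norm, hu, Complex.norm_exp_ofReal_mul_I, abs_of_nonneg hρ]

@[fun_prop]
lemma continuous_polarPt (a u : ℂ) (ρ : ℝ) : Continuous (polarPt a u ρ) := by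
  unfold polarPt; fun_prop

lemma hasDerivAt_polarPt (a u : ℂ) (ρ θ : ℝ) :
    HasDerivAt (polarPt a u ρ) (u * (ρ * (Complex.exp (θ * I) * I))) θ := by
  have h1 : HasDerivAt (fun θ : ℝ => (θ : ℂ) * I) I θ := by
    simpa using (Complex.ofRealCLM.hasDerivAt (x := θ)).mul_const I
  exact ((h1.cexp.const_mul (ρ : ℂ)).const_mul u).const_add a

lemma norm_deriv_polarPt {a u : ℂ} (hu : ‖u‖ = 1) {ρ : ℝ} (hρ : 0 ≤ ρ) (θ : ℝ) :
    ‖deriv (polarPt a u ρ) θ‖ = ρ := by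
  rw [(hasDerivAt_polarPt a u ρ θ).deriv]
  simp [hu, Complex.norm_exp_ofReal_mul_I, abs_of_nonneg hρ]

lemma lintegral_polarPt {W : ℂ → ℝ≥0∞} (hW : Measurable W) {a u : ℂ} (hu : ‖u‖ = 1) :
    ∫⁻ ρ in Ioi (0 : ℝ), ∫⁻ θ in Ioo (-π) π, ENNReal.ofReal ρ * W (polarPt a u ρ θ) =
      ∫⁻ z, W z := by
  have hmp : MeasurePreserving (fun z : ℂ => a + u * z) := by
    have h1 := (rotation ⟨u, by simp [Submonoid.unitSphere, hu]⟩).measurePreserving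
    have h2 := measurePreserving_add_left (volume : Measure ℂ) a
    exact h2.comp h1
  rw [← hmp.lintegral_comp hW, ← Complex.lintegral_comp_polarCoord_symm, polarCoord_target,
    Measure.volume_eq_prod, ← Measure.prod_restrict, lintegral_prod]
  · refine lintegral_congr fun ρ => lintegral_congr fun θ => ?_
    rw [Complex.polarCoord_symm_apply, smul_eq_mul, polarPt, Complex.exp_mul_I]
    simp
  · apply Measurable.aemeasurable
    apply Measurable.mul
    · fun_prop
    · refine hW.comp (Measurable.add measurable_const (Measurable.mul measurable_const ?_))
      have : (Complex.polarCoord.symm : ℝ × ℝ → ℂ) =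
          fun p => (p.1 : ℂ) * (Real.cos p.2 + Real.sin p.2 * Complex.I) := by
        ext p; exact Complex.polarCoord_symm_apply p
      rw [this]
      fun_prop

/-- The length–area inequality on circular arcs. -/
lemma length_area {W : ℂ → ℝ≥0∞} (hW : Measurable W) {a u : ℂ} (hu : ‖u‖ = 1) {r₁ r₂ l : ℝ}
    (h₁ : 0 < r₁) (h₁₂ : r₁ < r₂) (hl : 0 ≤ l)
    (h : ∀ ρ ∈ Ioo r₁ r₂, ENNReal.ofReal l ≤
      ∫⁻ θ in Ioo (-π) π, ENNReal.ofReal ρ * W (polarPt a u ρ θ)) :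
    ENNReal.ofReal (l ^ 2 * Real.log (r₂ / r₁)) ≤ ENNReal.ofReal (2 * π) * ∫⁻ z, W z ^ 2 := by
  have hm : Measurable fun p : ℝ × ℝ => W (polarPt a u p.1 p.2) := by
    refine hW.comp ?_
    unfold polarPt
    fun_prop
  have key : ∀ ρ ∈ Ioo r₁ r₂, ENNReal.ofReal (l ^ 2 * ρ⁻¹) ≤ ENNReal.ofReal (2 * π) *
      ∫⁻ θ in Ioo (-π) π, ENNReal.ofReal ρ * W (polarPt a u ρ θ) ^ 2 := by
    intro ρ hρ
    have hρ0 : 0 < ρ := h₁.trans hρ.1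
    have hmρ : Measurable fun θ => W (polarPt a u ρ θ) :=
      hW.comp (continuous_polarPt a u ρ).measurable
    have h1 := sq_lintegral_le (volume.restrict (Ioo (-π) π))
      (g := fun θ => ENNReal.ofReal ρ * W (polarPt a u ρ θ)) (hmρ.const_mul _).aemeasurable
    have h2 : ENNReal.ofReal l ^ 2 ≤ _ := (pow_le_pow_left' (h ρ hρ) 2).trans h1
    have e1 : (volume.restrict (Ioo (-π) π)) univ = ENNReal.ofReal (2 * π) := by
      rw [Measure.restrict_apply_univ, Real.volume_Ioo]; congr 1; ring
    have e2 : ∫⁻ θ in Ioo (-π) π, (ENNReal.ofReal ρ * W (polarPt a u ρ θ)) ^ 2 =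
        ENNReal.ofReal ρ * ∫⁻ θ in Ioo (-π) π, ENNReal.ofReal ρ * W (polarPt a u ρ θ) ^ 2 := by
      rw [← lintegral_const_mul _ ((hmρ.pow_const 2).const_mul _)]
      refine lintegral_congr fun θ => ?_
      ring
    rw [e1, e2] at h2
    calc ENNReal.ofReal (l ^ 2 * ρ⁻¹) = ENNReal.ofReal ρ⁻¹ * ENNReal.ofReal l ^ 2 := by
          rw [ENNReal.ofReal_mul (by positivity), ENNReal.ofReal_pow hl, mul_comm]
      _ ≤ ENNReal.ofReal ρ⁻¹ * (ENNReal.ofReal (2 * π) * (ENNReal.ofReal ρ *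
          ∫⁻ θ in Ioo (-π) π, ENNReal.ofReal ρ * W (polarPt a u ρ θ) ^ 2)) := by gcongr
      _ = (ENNReal.ofReal ρ⁻¹ * ENNReal.ofReal ρ) * (ENNReal.ofReal (2 * π) *
          ∫⁻ θ in Ioo (-π) π, ENNReal.ofReal ρ * W (polarPt a u ρ θ) ^ 2) := by ring
      _ = _ := by
        rw [← ENNReal.ofReal_mul (by positivity), inv_mul_cancel₀ hρ0.ne', ENNReal.ofReal_one,
          one_mul]
  have hintg : ∫⁻ ρ in Ioo r₁ r₂, ENNReal.ofReal (l ^ 2 * ρ⁻¹) =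
      ENNReal.ofReal (l ^ 2 * Real.log (r₂ / r₁)) := by
    have hi : IntervalIntegrable (fun ρ : ℝ => l ^ 2 * ρ⁻¹) volume r₁ r₂ := by
      apply IntervalIntegrable.const_mul
      apply intervalIntegral.intervalIntegrable_inv
      · intro x hx
        rw [uIcc_of_le h₁₂.le] at hx
        exact (h₁.trans_le hx.1).ne'
      · exact continuousOn_id
    rw [← integral_inv_of_pos h₁ (h₁.trans h₁₂), ← intervalIntegral.integral_const_mul,
      intervalIntegral.integral_of_le h₁₂.le, integral_Ioc_eq_integral_Ioo,
      ofReal_integral_eq_lintegral_ofReal]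
    · exact (intervalIntegrable_iff_integrableOn_Ioo_of_le h₁₂.le).1 hi
    · filter_upwards [ae_restrict_mem measurableSet_Ioo] with ρ hρ
      have : 0 < ρ := h₁.trans hρ.1
      positivity
  calc ENNReal.ofReal (l ^ 2 * Real.log (r₂ / r₁))
      = ∫⁻ ρ in Ioo r₁ r₂, ENNReal.ofReal (l ^ 2 * ρ⁻¹) := hintg.symm
    _ ≤ ∫⁻ ρ in Ioo r₁ r₂, ENNReal.ofReal (2 * π) *
        ∫⁻ θ in Ioo (-π) π, ENNReal.ofReal ρ * W (polarPt a u ρ θ) ^ 2 :=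
      setLIntegral_mono' measurableSet_Ioo key
    _ = ENNReal.ofReal (2 * π) * ∫⁻ ρ in Ioo r₁ r₂,
        ∫⁻ θ in Ioo (-π) π, ENNReal.ofReal ρ * W (polarPt a u ρ θ) ^ 2 := by
      refine lintegral_const_mul' _ _ ENNReal.ofReal_ne_top
    _ ≤ ENNReal.ofReal (2 * π) * ∫⁻ ρ in Ioi 0,
        ∫⁻ θ in Ioo (-π) π, ENNReal.ofReal ρ * W (polarPt a u ρ θ) ^ 2 := by
      gcongr
      exact fun ρ hρ => h₁.trans hρ.1
    _ = _ := by rw [lintegral_polarPt (hW.pow_const 2) hu]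

/-- The displacement of a `C¹` map along an open circular arc. -/
lemma enorm_sub_le_lintegral_polarPt {E : Type*} [NormedAddCommGroup E] [NormedSpace ℝ E]
    {h : ℂ → E} {U : Set ℂ} (hU : IsOpen U) (hh : ContDiffOn ℝ 1 h U) {a u : ℂ} (hu : ‖u‖ = 1)
    {ρ x y : ℝ} (hρ : 0 ≤ ρ) (hxy : x < y) (hm : ∀ θ ∈ Ioo x y, polarPt a u ρ θ ∈ U)
    {γ : ℝ → E} (hγ : ContinuousOn γ (Icc x y)) (he : ∀ θ ∈ Ioo x y, γ θ = h (polarPt a u ρ θ)) :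
    ‖γ y - γ x‖ₑ ≤ ∫⁻ θ in Ioo x y, ENNReal.ofReal ρ * ‖fderiv ℝ h (polarPt a u ρ θ)‖ₑ := by
  have hcp : ContDiff ℝ 1 (polarPt a u ρ) := by
    unfold polarPt
    have : ContDiff ℝ 1 (fun θ : ℝ => Complex.exp (θ * I)) :=
      (Complex.ofRealCLM.contDiff.mul contDiff_const).cexp
    fun_prop
  have hmain : ∀ x' ∈ Ioo x y, ∀ y' ∈ Ioo x y, x' ≤ y' →
      ‖γ y' - γ x'‖ₑ ≤ ∫⁻ θ in Ioo x y, ENNReal.ofReal ρ * ‖fderiv ℝ h (polarPt a u ρ θ)‖ₑ := by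
    intro x' hx' y' hy' hxy'
    have hsub : Icc x' y' ⊆ Ioo x y := Icc_subset_Ioo hx'.1 hy'.2
    rw [he x' hx', he y' hy']
    have hc : ContDiffOn ℝ 1 (fun θ => h (polarPt a u ρ θ)) (Icc x' y') :=
      hh.comp hcp.contDiffOn (fun θ hθ => hm θ (hsub hθ))
    refine (enorm_sub_le_lintegral_deriv_of_contDiffOn_Icc hc hxy').trans ?_
    refine (setLIntegral_mono' measurableSet_Icc fun θ hθ => ?_).trans (lintegral_mono_set hsub)
    have hd : HasFDerivAt h (fderiv ℝ h (polarPt a u ρ θ)) (polarPt a u ρ θ) :=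
      ((hh.differentiableOn one_ne_zero).differentiableAt
        (hU.mem_nhds (hm θ (hsub hθ)))).hasFDerivAt
    have hd2 := hd.comp_hasDerivAt θ (hasDerivAt_polarPt a u ρ θ)
    have e : deriv (fun θ => h (polarPt a u ρ θ)) θ = _ := hd2.deriv
    rw [e, ← (hasDerivAt_polarPt a u ρ θ).deriv, mul_comm]
    refine (ContinuousLinearMap.le_opENorm _ _).trans_eq ?_
    congr 1
    rw [← ofReal_norm, norm_deriv_polarPt hu hρ]
  set M := ∫⁻ θ in Ioo x y, ENNReal.ofReal ρ * ‖fderiv ℝ h (polarPt a u ρ θ)‖ₑ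
  have hx0 : Tendsto γ (𝓝[>] x) (𝓝 (γ x)) := by
    have := (hγ x (left_mem_Icc.2 hxy.le)).mono (Ioo_subset_Icc_self)
    rwa [ContinuousWithinAt, nhdsWithin_Ioo_eq_nhdsGT hxy] at this
  have hy0 : Tendsto γ (𝓝[<] y) (𝓝 (γ y)) := by
    have := (hγ y (right_mem_Icc.2 hxy.le)).mono (Ioo_subset_Icc_self)
    rwa [ContinuousWithinAt, nhdsWithin_Ioo_eq_nhdsLT hxy] at this
  have step : ∀ x' ∈ Ioo x y, ‖γ y - γ x'‖ₑ ≤ M := by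
    intro x' hx'
    refine le_of_tendsto (f := fun y' => ‖γ y' - γ x'‖ₑ) (x := 𝓝[<] y)
      ((continuous_enorm.tendsto _).comp (hy0.sub_const _)) ?_
    filter_upwards [Ioo_mem_nhdsLT hx'.2] with y' hy'
    exact hmain x' hx' y' ⟨hx'.1.trans hy'.1, hy'.2⟩ hy'.1.le
  refine le_of_tendsto (f := fun x' => ‖γ y - γ x'‖ₑ) (x := 𝓝[>] x)
    ((continuous_enorm.tendsto _).comp (hx0.const_sub _)) ?_
  filter_upwards [Ioo_mem_nhdsGT hxy] with t ht
  exact step t ht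

/-- A continuous function which crosses `[p, q]` does so along a subinterval on which it stays in
`[p, q]`. -/
lemma exists_crossing_aux {φ : ℝ → ℝ} {A B p q : ℝ} (hAB : A ≤ B) (hφ : ContinuousOn φ (Icc A B))
    (hpq : p < q) (hA : φ A ≤ p) (hB : q ≤ φ B) :
    ∃ x y, A ≤ x ∧ x < y ∧ y ≤ B ∧ φ x = p ∧ φ y = q ∧ ∀ t ∈ Icc x y, φ t ∈ Icc p q := by
  have hc1 : IsCompact (Icc A B ∩ φ ⁻¹' Ici q) :=
    isCompact_Icc.of_isClosed_subset (hφ.preimage_isClosed_of_isClosed isClosed_Icc isClosed_Ici)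
      inter_subset_left
  obtain ⟨y, ⟨hyI, hyq⟩, hymin⟩ := hc1.exists_isLeast ⟨B, right_mem_Icc.2 hAB, hB⟩
  have hlt : ∀ t ∈ Ico A y, φ t < q := by
    intro t ht
    by_contra! h
    exact absurd (hymin ⟨⟨ht.1, ht.2.le.trans hyI.2⟩, h⟩) (not_le.2 ht.2)
  have hφy : φ y = q := by
    obtain ⟨t, ht, htq⟩ := intermediate_value_Icc hyI.1 (hφ.mono (Icc_subset_Icc_right hyI.2))
      ⟨hA.trans hpq.le, hyq⟩
    rcases ht.2.eq_or_lt with h | h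
    · rw [← h, htq]
    · exact absurd htq (hlt t ⟨ht.1, h⟩).ne
  have hφ2 : ContinuousOn φ (Icc A y) := hφ.mono (Icc_subset_Icc_right hyI.2)
  have hc2 : IsCompact (Icc A y ∩ φ ⁻¹' Iic p) :=
    isCompact_Icc.of_isClosed_subset (hφ2.preimage_isClosed_of_isClosed isClosed_Icc isClosed_Iic)
      inter_subset_left
  obtain ⟨x, ⟨hxI, hxp⟩, hxmax⟩ := hc2.exists_isGreatest ⟨A, left_mem_Icc.2 hyI.1, hA⟩
  have hgt : ∀ t ∈ Ioc x y, p < φ t := by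
    intro t ht
    by_contra! h
    exact absurd (hxmax ⟨⟨hxI.1.trans ht.1.le, ht.2⟩, h⟩) (not_le.2 ht.1)
  have hφx : φ x = p := by
    obtain ⟨t, ht, htp⟩ := intermediate_value_Icc hxI.2 (hφ2.mono (Icc_subset_Icc_left hxI.1))
      ⟨hxp, hφy ▸ hpq.le⟩
    rcases ht.1.eq_or_lt with h | h
    · rw [h, htp]
    · exact absurd htp (hgt t ⟨h, ht.2⟩).ne'
  have hxy : x < y := by
    rcases hxI.2.eq_or_lt with h | h
    · rw [h, hφy] at hφx; exact absurd hφx hpq.ne'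
    · exact h
  refine ⟨x, y, hxI.1, hxy, hyI.2, hφx, hφy, fun t ht => ⟨?_, ?_⟩⟩
  · rcases ht.1.eq_or_lt with h | h
    · rw [← h, hφx]
    · exact (hgt t ⟨h, ht.2⟩).le
  · rcases ht.2.eq_or_lt with h | h
    · rw [h, hφy]
    · exact (hlt t ⟨hxI.1.trans ht.1, h⟩).le

lemma exists_crossing {φ : ℝ → ℝ} {A B p q : ℝ} (hAB : A ≤ B) (hφ : ContinuousOn φ (Icc A B))
    (hpq : p < q) (h : (φ A ≤ p ∧ q ≤ φ B) ∨ (q ≤ φ A ∧ φ B ≤ p)) :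
    ∃ x y, A ≤ x ∧ x < y ∧ y ≤ B ∧ |φ y - φ x| = q - p ∧ ∀ t ∈ Icc x y, φ t ∈ Icc p q := by
  rcases h with ⟨hA, hB⟩ | ⟨hA, hB⟩
  · obtain ⟨x, y, h1, h2, h3, h4, h5, h6⟩ := exists_crossing_aux hAB hφ hpq hA hB
    exact ⟨x, y, h1, h2, h3, by rw [h4, h5, abs_of_pos (sub_pos.2 hpq)], h6⟩
  · obtain ⟨x, y, h1, h2, h3, h4, h5, h6⟩ := exists_crossing_aux (φ := fun t => -φ t) (p := -q)
      (q := -p) hAB hφ.neg (neg_lt_neg hpq) (neg_le_neg hA) (neg_le_neg hB)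
    refine ⟨x, y, h1, h2, h3, ?_, fun t ht => ?_⟩
    · rw [neg_inj.1 h4, neg_inj.1 h5, abs_sub_comm, abs_of_pos (sub_pos.2 hpq)]
    · have := h6 t ht
      exact ⟨neg_le_neg_iff.1 this.2, neg_le_neg_iff.1 this.1⟩

lemma exists_polarPt_eq {a u z : ℂ} (hu : ‖u‖ = 1) {ρ : ℝ} (hz : dist z a = ρ) :
    ∃ θ ∈ Ioc (-π) π, polarPt a u ρ θ = z := by
  subst hz
  have hu0 : u ≠ 0 := fun h => by simp [h] at hu
  refine ⟨arg ((z - a) / u), ⟨neg_pi_lt_arg _, arg_le_pi _⟩, ?_⟩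
  have h1 := norm_mul_exp_arg_mul_I ((z - a) / u)
  have h2 : ‖(z - a) / u‖ = dist z a := by rw [norm_div, hu, div_one, dist_eq_norm]
  rw [h2] at h1
  rw [polarPt, h1]
  field_simp
  ring

lemma polarPt_mem_ball_iff {ζ : ℂ} (hζ : ‖ζ‖ = 1) {ρ : ℝ} (hρ : 0 < ρ) (θ : ℝ) :
    polarPt ζ (-ζ) ρ θ ∈ ball (0 : ℂ) 1 ↔ ρ < 2 * Real.cos θ := by
  have h1 : polarPt ζ (-ζ) ρ θ = ζ * (1 - ρ * Complex.exp (θ * I)) := by rw [polarPt]; ring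
  rw [mem_ball_zero_iff, h1, norm_mul, hζ, one_mul, ← sq_lt_one_iff₀ (norm_nonneg _),
    ← Complex.normSq_eq_norm_sq, Complex.normSq_apply]
  have h2 := Real.sin_sq_add_cos_sq θ
  simp only [sub_re, one_re, mul_re, ofReal_re, ofReal_im, zero_mul, sub_zero, sub_im, one_im,
    mul_im, exp_ofReal_mul_I_re, exp_ofReal_mul_I_im, add_zero]
  have h3 : (1 - ρ * Real.cos θ) * (1 - ρ * Real.cos θ) +
      (0 - ρ * Real.sin θ) * (0 - ρ * Real.sin θ) = 1 + ρ * (ρ - 2 * Real.cos θ) := by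
    linear_combination ρ ^ 2 * h2
  rw [h3]
  constructor
  · intro h; by_contra! h'; nlinarith [mul_nonneg hρ.le (sub_nonneg.2 h')]
  · intro h; nlinarith [mul_pos hρ (sub_pos.2 h)]

lemma cos_min_le {x y t : ℝ} (hx : -π ≤ x) (hy : y ≤ π) (ht : t ∈ Icc x y) :
    min (Real.cos x) (Real.cos y) ≤ Real.cos t := by
  rcases le_total 0 t with h | h
  · exact (min_le_right _ _).trans (Real.cos_le_cos_of_nonneg_of_le_pi h hy ht.2)
  · rw [← Real.cos_neg x, ← Real.cos_neg t]
    exact (min_le_left _ _).trans (Real.cos_le_cos_of_nonneg_of_le_pi (by linarith) (by linarith)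
      (by linarith [ht.1]))

lemma fderiv_real_eq {F : ℂ → ℂ} {z : ℂ} (h : DifferentiableAt ℂ F z) :
    fderiv ℝ F z = (fderiv ℂ F z).restrictScalars ℝ := (h.hasFDerivAt.restrictScalars ℝ).fderiv

lemma fderiv_real_apply {F : ℂ → ℂ} {z : ℂ} (h : DifferentiableAt ℂ F z) (v : ℂ) :
    fderiv ℝ F z v = deriv F z * v := by
  rw [fderiv_real_eq h]
  simp [mul_comm]

lemma norm_fderiv_real {F : ℂ → ℂ} {z : ℂ} (h : DifferentiableAt ℂ F z) :
    ‖fderiv ℝ F z‖ = ‖deriv F z‖ := by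
  rw [fderiv_real_eq h, ContinuousLinearMap.norm_restrictScalars, norm_deriv_eq_norm_fderiv]

lemma det_fderiv_real {F : ℂ → ℂ} {z : ℂ} (h : DifferentiableAt ℂ F z) :
    (fderiv ℝ F z).det = ‖fderiv ℝ F z‖ ^ 2 := by
  rw [norm_fderiv_real h, det_eq_wirtinger, wirtingerD, wirtingerDBar, fderiv_real_apply h,
    fderiv_real_apply h]
  have h1 : (deriv F z * 1 + I * (deriv F z * I)) / 2 = 0 := by
    have := I_mul_I
    linear_combination (deriv F z / 2) * this
  have h2 : (deriv F z * 1 - I * (deriv F z * I)) / 2 = deriv F z := by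
    have := I_mul_I
    linear_combination (-deriv F z / 2) * this
  rw [h1, h2]; simp

lemma lintegral_enorm_fderiv_sq {F : ℂ → ℂ} {U : Set ℂ} (hU : IsOpen U)
    (hF : DifferentiableOn ℂ F U) (hi : InjOn F U) :
    ∫⁻ z in U, ‖fderiv ℝ F z‖ₑ ^ 2 = volume (F '' U) := by
  have hd : ∀ z ∈ U, DifferentiableAt ℂ F z := fun z hz => hF.differentiableAt (hU.mem_nhds hz)
  rw [← lintegral_abs_det_fderiv_eq_addHaar_image volume hU.measurableSet
    (f' := fun z => fderiv ℝ F z) (fun z hz =>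
      ((hd z hz).restrictScalars ℝ).hasFDerivAt.hasFDerivWithinAt) hi]
  refine setLIntegral_congr_fun hU.measurableSet fun z hz => ?_
  rw [det_fderiv_real (hd z hz), abs_of_nonneg (by positivity), ENNReal.ofReal_pow (norm_nonneg _),
    ofReal_norm]

lemma contDiffOn_real {F : ℂ → ℂ} {U : Set ℂ} (hU : IsOpen U) (hF : DifferentiableOn ℂ F U) :
    ContDiffOn ℝ 1 F U := (hF.contDiffOn hU).restrict_scalars ℝ

/-- A circle on which the crosscut has a short image. -/
lemma exists_short_crosscut {F : ℂ → ℂ} (hd : DifferentiableOn ℂ F (ball 0 1))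
    (hi : InjOn F (ball 0 1)) (hb : IsBounded (F '' ball 0 1)) {ζ : ℂ} (hζ : ‖ζ‖ = 1) {l r₂ : ℝ}
    (hl : 0 < l) (hr₂ : 0 < r₂) :
    ∃ ρ ∈ Ioo 0 r₂, ∀ z ∈ sphere ζ ρ ∩ ball 0 1, ∀ w ∈ sphere ζ ρ ∩ ball 0 1, ‖F z - F w‖ ≤ l := by
  set V := (volume (F '' ball 0 1)).toReal with hV
  have hVt : volume (F '' ball 0 1) ≠ ⊤ := hb.measure_lt_top.ne
  obtain ⟨r₁, hr₁, hr₁₂, hlog⟩ : ∃ r₁, 0 < r₁ ∧ r₁ < r₂ ∧ 2 * π * V < l ^ 2 * Real.log (r₂ / r₁) := by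
    set c := 2 * π * V / l ^ 2 + 1 with hc
    have hc0 : 0 < c := by positivity
    refine ⟨r₂ * Real.exp (-c), by positivity, ?_, ?_⟩
    · exact mul_lt_of_lt_one_right hr₂ (by rw [Real.exp_lt_one_iff]; linarith)
    · have : r₂ / (r₂ * Real.exp (-c)) = Real.exp c := by
        rw [Real.exp_neg]; field_simp
      rw [this, Real.log_exp, hc]
      field_simp
      nlinarith [sq_pos_of_pos hl]
  by_contra! hcon
  set W : ℂ → ℝ≥0∞ := (ball (0 : ℂ) 1).indicator (fun z => ‖fderiv ℝ F z‖ₑ) with hW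
  have hWm : Measurable W := (measurable_fderiv ℝ F).enorm.indicator measurableSet_ball
  have hu : ‖-ζ‖ = 1 := by rwa [norm_neg]
  have hLA := length_area hWm (a := ζ) hu hr₁ hr₁₂ hl.le ?_
  · have hW2 : ∫⁻ z, W z ^ 2 = volume (F '' ball 0 1) := by
      rw [← lintegral_enorm_fderiv_sq isOpen_ball hd hi, ← lintegral_indicator measurableSet_ball]
      refine lintegral_congr fun z => ?_
      by_cases hz : z ∈ ball (0 : ℂ) 1
      · rw [hW, indicator_of_mem hz, indicator_of_mem hz]
      · rw [hW, indicator_of_notMem hz, indicator_of_notMem hz]; simp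
    rw [hW2, ← ENNReal.ofReal_toReal hVt, ← ENNReal.ofReal_mul (by positivity),
      ENNReal.ofReal_le_ofReal_iff (by positivity)] at hLA
    linarith
  · intro ρ hρ
    have hρ0 : 0 < ρ := hr₁.trans hρ.1
    obtain ⟨z, ⟨hzs, hzb⟩, w, ⟨hws, hwb⟩, hzw⟩ := hcon ρ ⟨hρ0, hρ.2⟩
    obtain ⟨x, hx, rfl⟩ := exists_polarPt_eq (a := ζ) (u := -ζ) hu hzs
    obtain ⟨y, hy, rfl⟩ := exists_polarPt_eq (a := ζ) (u := -ζ) hu hws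
    clear hzs hws hcon
    wlog hxy : x < y generalizing x y
    · refine this y hy hwb x hx hzb (by rwa [norm_sub_rev]) ((not_lt.1 hxy).lt_of_ne ?_)
      rintro rfl
      simp at hzw
      linarith
    rw [polarPt_mem_ball_iff hζ hρ0] at hzb hwb
    have hmem : ∀ θ ∈ Icc x y, polarPt ζ (-ζ) ρ θ ∈ ball (0 : ℂ) 1 := by
      intro θ hθ
      rw [polarPt_mem_ball_iff hζ hρ0]
      rcases min_le_iff.1 (cos_min_le hx.1.le hy.2 hθ) with h | h <;> linarith
    have h1 := enorm_sub_le_lintegral_polarPt isOpen_ball (contDiffOn_real isOpen_ball hd)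
      (a := ζ) hu hρ0.le hxy (fun θ hθ => hmem θ (Ioo_subset_Icc_self hθ))
      (γ := fun θ => F (polarPt ζ (-ζ) ρ θ))
      (hd.continuousOn.comp (continuous_polarPt _ _ _).continuousOn hmem) (fun _ _ => rfl)
    calc ENNReal.ofReal l ≤ ‖F (polarPt ζ (-ζ) ρ y) - F (polarPt ζ (-ζ) ρ x)‖ₑ := by
          rw [← ofReal_norm, norm_sub_rev]
          exact ENNReal.ofReal_le_ofReal hzw.le
      _ ≤ _ := h1
      _ ≤ ∫⁻ θ in Ioo x y, ENNReal.ofReal ρ * W (polarPt ζ (-ζ) ρ θ) := by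
          refine setLIntegral_mono' measurableSet_Ioo fun θ hθ => ?_
          rw [hW, indicator_of_mem (hmem θ (Ioo_subset_Icc_self hθ))]
      _ ≤ _ := lintegral_mono_set (Ioo_subset_Ioo hx.1.le hy.2)

/-- Bounded turning in the form used for boundary extension. -/
def HasBoundedTurning (Γ : Set ℂ) (C : ℝ) : Prop :=
  ∀ z₁ ∈ Γ, ∀ z₂ ∈ Γ, ∃ A ⊆ Γ, IsPreconnected A ∧ z₁ ∈ A ∧ z₂ ∈ A ∧ diam A ≤ C * ‖z₁ - z₂‖

/-- A Riemann map onto the interior of a Jordan curve. -/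
structure IsInteriorMap (F : ℂ → ℂ) (Γ Ω : Set ℂ) : Prop where
  isJordanInterior : IsJordanInterior Γ Ω
  isCompact : IsCompact Γ
  isPreconnected : IsPreconnected Γ
  differentiableOn : DifferentiableOn ℂ F (ball 0 1)
  bijOn : BijOn F (ball 0 1) Ω

namespace IsInteriorMap

variable {F : ℂ → ℂ} {Γ Ω : Set ℂ}

lemma exists_inverse (h : IsInteriorMap F Γ Ω)
    : ∃ G : ℂ → ℂ, DifferentiableOn ℂ G Ω ∧ InvOn G F (ball 0 1) Ω ∧
    MapsTo G Ω (ball 0 1) := by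
  obtain ⟨-, G, hG, hGi⟩ := exists_differentiableOn_inverse isOpen_ball
    (convex_ball (0 : ℂ) 1).isPreconnected h.differentiableOn h.bijOn.injOn (a := 0) (b := 1 / 2)
    (by simp) (by norm_num [mem_ball_zero_iff]) (by norm_num)
  rw [h.bijOn.image_eq] at hG hGi
  refine ⟨G, hG, hGi, fun w hw => ?_⟩
  obtain ⟨z, hz, rfl⟩ := h.bijOn.surjOn hw
  rwa [hGi.1 hz]

lemma isOpen_image (h : IsInteriorMap F Γ Ω)
    {N : Set ℂ} (hN : IsOpen N) (hNb : N ⊆ ball 0 1) : IsOpen (F '' N) := by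
  obtain ⟨G, hG, hGi, hGm⟩ := h.exists_inverse
  have : F '' N = Ω ∩ G ⁻¹' N := by
    ext w; constructor
    · rintro ⟨z, hz, rfl⟩
      exact ⟨h.bijOn.mapsTo (hNb hz), by rwa [mem_preimage, hGi.1 (hNb hz)]⟩
    · rintro ⟨hw, hw'⟩
      exact ⟨G w, hw', hGi.2 hw⟩
  rw [this]
  exact hG.continuousOn.isOpen_inter_preimage h.isJordanInterior.isOpen hN

lemma closure_eq (h : IsInteriorMap F Γ Ω) : closure Ω = Ω ∪ Γ := by
  rw [← h.isJordanInterior.frontier_eq, ← closure_eq_self_union_frontier]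

lemma frontier_image_subset (h : IsInteriorMap F Γ Ω)
    {N : Set ℂ} (hN : IsOpen N) (hNb : N ⊆ ball 0 1) :
    frontier (F '' N) ⊆ Γ ∪ F '' ((closure N ∩ ball 0 1) \ N) := by
  obtain ⟨G, hG, hGi, hGm⟩ := h.exists_inverse
  intro x hx
  have hx1 : x ∈ closure Ω :=
    closure_mono ((image_mono hNb).trans h.bijOn.image_eq.subset) (frontier_subset_closure hx)
  rw [h.closure_eq] at hx1
  rcases hx1 with hxΩ | hxΓ
  · right
    refine ⟨G x, ⟨⟨?_, hGm hxΩ⟩, ?_⟩, hGi.2 hxΩ⟩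
    · have hc : ContinuousWithinAt G (F '' N) x :=
        (hG.continuousOn.continuousAt
          (h.isJordanInterior.isOpen.mem_nhds hxΩ)).continuousWithinAt
      refine closure_mono ?_ (hc.mem_closure_image (frontier_subset_closure hx))
      rintro _ ⟨_, ⟨z, hz, rfl⟩, rfl⟩
      rwa [hGi.1 (hNb hz)]
    · intro hxN
      rw [(h.isOpen_image hN hNb).frontier_eq] at hx
      exact hx.2 ⟨G x, hxN, hGi.2 hxΩ⟩
  · exact Or.inl hxΓ

/-- Janiszewski's theorem for the image of a crosscut. -/
lemma not_separated (h : IsInteriorMap F Γ Ω)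
    {N M Y D : Set ℂ} (hN : IsOpen N) (hNb : N ⊆ ball 0 1) (hM : IsOpen M)
    (hMb : M ⊆ ball 0 1) (hNM : Disjoint N M) (hY : IsCompact Y)
    (hNY : F '' ((closure N ∩ ball 0 1) \ N) ⊆ Y) (hΓY : IsPreconnected (Γ ∩ Y)) {u v : ℂ}
    (hu : u ∈ F '' N) (hv : v ∈ F '' M) (hD : IsPreconnected D) (hDY : Disjoint D Y)
    (huD : u ∈ D) (hvD : v ∈ D) : False := by
  have huΩ : u ∈ Ω := h.bijOn.image_eq ▸ image_mono hNb hu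
  have hvΩ : v ∈ Ω := h.bijOn.image_eq ▸ image_mono hMb hv
  have l1 := hasLogOn_sub_div_sub_of_preconnected h.isCompact
    h.isJordanInterior.isConnected.isPreconnected h.isJordanInterior.disjoint huΩ hvΩ
  have l2 := hasLogOn_sub_div_sub_of_preconnected hY hD hDY huD hvD
  refine not_hasLogOn_sub_div_sub_of_frontier
    (h.isJordanInterior.isBounded.subset ((image_mono hNb).trans h.bijOn.image_eq.subset))
    ((h.frontier_image_subset hN hNb).trans (union_subset_union_right _ hNY)) hu ?_
    (l1.union h.isCompact.isClosed hY.isClosed hΓY l2)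
  intro hvc
  have hdis : Disjoint (F '' M) (F '' N) := by
    rw [Set.disjoint_left]
    rintro _ ⟨z, hz, rfl⟩ ⟨w, hw, hwz⟩
    have := h.bijOn.injOn (hNb hw) (hMb hz) hwz
    exact (Set.disjoint_left.1 hNM) (this ▸ hw) hz
  exact Set.disjoint_left.1 (hdis.closure_right (h.isOpen_image hM hMb)) hv hvc

/-- The boundary oscillation of the Riemann map is small. -/
lemma cauchy_at_boundary (h : IsInteriorMap F Γ Ω)
    {C : ℝ} (hC : 0 ≤ C) (hBT : HasBoundedTurning Γ C) {ζ : ℂ}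
    (hζ : ‖ζ‖ = 1) {ε : ℝ} (hε : 0 < ε) :
    ∃ δ > 0, ∀ z ∈ ball ζ δ ∩ ball 0 1, ∀ w ∈ ball ζ δ ∩ ball 0 1, ‖F z - F w‖ ≤ ε := by
  have hbd : IsBounded (F '' ball 0 1) := h.bijOn.image_eq ▸ h.isJordanInterior.isBounded
  set z₁ : ℂ := ζ / 2 with hz₁
  have hz₁n : ‖z₁‖ = 1 / 2 := by rw [hz₁, norm_div, hζ]; simp
  have hz₁b : z₁ ∈ ball (0 : ℂ) 1 := by rw [mem_ball_zero_iff, hz₁n]; norm_num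
  have h0b : (0 : ℂ) ∈ ball (0 : ℂ) 1 := by simp
  set e := ‖F 0 - F z₁‖ with he
  have he0 : 0 < e := by
    rw [he, norm_pos_iff, sub_ne_zero]
    intro h'
    have := h.bijOn.injOn h0b hz₁b h'
    rw [← this] at hz₁n
    norm_num at hz₁n
  set s := min (ε / 2) (e / 4) with hs
  have hs0 : 0 < s := lt_min (by positivity) (by positivity)
  set l := s / (2 * (1 + 2 * C)) with hl
  have hl0 : 0 < l := by positivity
  obtain ⟨ρ, ⟨hρ0, hρ1⟩, hshort⟩ := exists_short_crosscut h.differentiableOn h.bijOn.injOn hbd hζ hl0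
    (r₂ := 1 / 2) (by norm_num)
  refine ⟨ρ, hρ0, ?_⟩
  set Q := closure (F '' (sphere ζ ρ ∩ ball 0 1)) with hQ
  have hQc : IsCompact Q := (hbd.subset (image_mono inter_subset_right)).isCompact_closure
  have hQd : ∀ x ∈ Q, ∀ y ∈ Q, dist x y ≤ l := by
    have hb1 : diam (F '' (sphere ζ ρ ∩ ball 0 1)) ≤ l := by
      refine diam_le_of_forall_dist_le hl0.le ?_
      rintro _ ⟨z, hz, rfl⟩ _ ⟨w, hw, rfl⟩
      rw [dist_eq_norm]; exact hshort z hz w hw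
    intro x hx y hy
    have := dist_le_diam_of_mem hQc.isBounded hx hy
    rw [hQ, diam_closure] at this
    exact this.trans hb1
  -- the point of the crosscut on the radius
  have hpt : ζ * (1 - ρ) ∈ sphere ζ ρ ∩ ball (0 : ℂ) 1 := by
    have e1 : ζ * (1 - ρ) = ζ * ((1 - ρ : ℝ) : ℂ) := by push_cast; ring
    refine ⟨?_, ?_⟩
    · rw [mem_sphere, dist_eq_norm]
      have : ζ * (1 - (ρ : ℂ)) - ζ = ζ * ((-ρ : ℝ) : ℂ) := by push_cast; ring
      rw [this, norm_mul, hζ, Complex.norm_real, norm_neg, Real.norm_of_nonneg hρ0.le, one_mul]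
    · rw [mem_ball_zero_iff, e1, norm_mul, hζ, Complex.norm_real, one_mul, Real.norm_eq_abs,
        abs_lt]
      constructor <;> linarith
  set y₀ := F (ζ * (1 - ρ)) with hy₀
  have hy₀Q : y₀ ∈ Q := subset_closure ⟨_, hpt, rfl⟩
  obtain ⟨A, hAc, hAp, hAΓ, hAQ, hAd⟩ : ∃ A, IsCompact A ∧ IsPreconnected A ∧ A ⊆ Γ ∧ Γ ∩ Q ⊆ A ∧
      ∀ x ∈ A, dist x y₀ ≤ s := by
    have hsl : l + 2 * C * l ≤ s := by
      rw [hl]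
      have : s / (2 * (1 + 2 * C)) + 2 * C * (s / (2 * (1 + 2 * C))) = s / 2 := by
        field_simp
      linarith
    rcases (Γ ∩ Q).eq_empty_or_nonempty with he | ⟨w₁, hw₁⟩
    · exact ⟨∅, isCompact_empty, isPreconnected_empty, empty_subset _, he.subset, by simp⟩
    · choose! B hBΓ hBp hB1 hB2 hBd using hBT w₁ hw₁.1
      have hBb : ∀ w ∈ Γ, IsBounded (B w) := fun w hw => h.isCompact.isBounded.subset (hBΓ w hw)
      refine ⟨closure (⋃ w ∈ Γ ∩ Q, B w), ?_, ?_, ?_, ?_, ?_⟩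
      · exact (h.isCompact.isBounded.subset (iUnion₂_subset fun w hw =>
          hBΓ w hw.1)).isCompact_closure
      · refine IsPreconnected.closure ?_
        refine isPreconnected_of_forall w₁ fun y hy => ?_
        obtain ⟨w, hw, hyw⟩ := mem_iUnion₂.1 hy
        exact ⟨B w, subset_biUnion_of_mem (u := B) hw, hB1 w hw.1, hyw, hBp w hw.1⟩
      · exact h.isCompact.isClosed.closure_subset_iff.2 (iUnion₂_subset fun w hw => hBΓ w hw.1)
      · exact fun w hw => subset_closure (mem_iUnion₂.2 ⟨w, hw, hB2 w hw.1⟩)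
      · intro x hx
        have hsub : closure (⋃ w ∈ Γ ∩ Q, B w) ⊆ closedBall y₀ s := by
          refine isClosed_closedBall.closure_subset_iff.2 (iUnion₂_subset fun w hw y hy => ?_)
          have h1 := (dist_le_diam_of_mem (hBb w hw.1) hy (hB1 w hw.1)).trans (hBd w hw.1)
          have h2 := hQd w₁ hw₁.2 w hw.2
          rw [dist_eq_norm w₁] at h2
          have h3 := hQd w₁ hw₁.2 y₀ hy₀Q
          rw [mem_closedBall]
          calc dist y y₀ ≤ dist y w₁ + dist w₁ y₀ := dist_triangle _ _ _
            _ ≤ C * l + l := by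
              gcongr
              exact h1.trans (by gcongr)
            _ ≤ s := by nlinarith [mul_nonneg hC hl0.le]
        exact hsub hx
  have hls : l ≤ s := by
    rw [hl]
    exact div_le_self hs0.le (by linarith)
  set Y := Q ∪ A with hY
  have hYball : Y ⊆ closedBall y₀ s := by
    rintro x (hx | hx)
    · exact (hQd x hx y₀ hy₀Q).trans hls
    · exact hAd x hx
  set N := ball ζ ρ ∩ ball 0 1 with hN
  set M := (closedBall ζ ρ)ᶜ ∩ ball 0 1 with hM
  have hNo : IsOpen N := isOpen_ball.inter isOpen_ball
  have hMo : IsOpen M := isClosed_closedBall.isOpen_compl.inter isOpen_ball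
  have hdich : ∀ z ∈ N, ∀ w ∈ M, F z ∈ closedBall y₀ s ∨ F w ∈ closedBall y₀ s := by
    intro z hz w hw
    by_contra! hcon
    refine h.not_separated hNo inter_subset_right hMo inter_subset_right ?_ (hQc.union hAc) ?_ ?_
      (mem_image_of_mem F hz) (mem_image_of_mem F hw) (isPreconnected_compl_closedBall y₀ hs0.le)
      ?_ hcon.1 hcon.2
    · rw [Set.disjoint_left]
      exact fun x hx hx' => hx'.1 (ball_subset_closedBall hx.1)
    · refine Subset.trans (image_mono ?_) (subset_closure.trans subset_union_left)
      rintro x ⟨⟨hx1, hx2⟩, hx3⟩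
      refine ⟨?_, hx2⟩
      have h1 : x ∈ closedBall ζ ρ := by
        have := closure_mono (inter_subset_left : N ⊆ ball ζ ρ) hx1
        exact closure_ball_subset_closedBall this
      have h2 : x ∉ ball ζ ρ := fun h' => hx3 ⟨h', hx2⟩
      rw [mem_closedBall] at h1
      rw [mem_ball, not_lt] at h2
      exact le_antisymm h1 h2
    · have : Γ ∩ (Q ∪ A) = A := by
        rw [inter_union_distrib_left, inter_eq_right.2 hAΓ, union_eq_right]
        exact hAQ
      rw [this]; exact hAp
    · exact disjoint_compl_left.mono_right hYball
  have hM0 : (0 : ℂ) ∈ M := by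
    refine ⟨?_, h0b⟩
    rw [mem_compl_iff, mem_closedBall, dist_zero_left, hζ]; linarith
  have hM1 : z₁ ∈ M := by
    refine ⟨?_, hz₁b⟩
    rw [mem_compl_iff, mem_closedBall, dist_eq_norm, hz₁]
    have : ζ / 2 - ζ = -(ζ / 2) := by ring
    rw [this, norm_neg, norm_div, hζ]; norm_num; linarith
  have hNs : ∀ z ∈ N, F z ∈ closedBall y₀ s := by
    intro z hz
    by_contra hcon
    have h1 := (hdich z hz 0 hM0).resolve_left hcon
    have h2 := (hdich z hz z₁ hM1).resolve_left hcon
    rw [mem_closedBall] at h1 h2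
    have h3 : e ≤ s + s := by
      rw [he, ← dist_eq_norm]
      exact (dist_triangle_right _ _ y₀).trans (add_le_add h1 h2)
    have : s ≤ e / 4 := min_le_right _ _
    linarith
  intro z hz w hw
  rw [← dist_eq_norm]
  have h1 := hNs z hz
  have h2 := hNs w hw
  rw [mem_closedBall] at h1 h2
  have : s ≤ ε / 2 := min_le_left _ _
  exact (dist_triangle_right _ _ y₀).trans (by linarith)

end IsInteriorMap

lemma isPreconnected_circle_diff {ζ : ℂ} (hζ : ‖ζ‖ = 1) :
    IsPreconnected (sphere (0 : ℂ) 1 \ {ζ}) := by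
  have hζ0 : ζ ≠ 0 := by rintro rfl; simp at hζ
  have h : sphere (0 : ℂ) 1 \ {ζ} = (fun θ : ℝ => ζ * Complex.exp (θ * I)) '' Ioo 0 (2 * π) := by
    ext z
    simp only [Set.mem_sdiff, mem_sphere_zero_iff_norm, mem_singleton_iff, mem_image, mem_Ioo]
    constructor
    · rintro ⟨hz, hne⟩
      have h1 := Complex.norm_mul_exp_arg_mul_I (-z / ζ)
      rw [norm_div, norm_neg, hz, hζ, div_one, ofReal_one, one_mul] at h1
      have h2 : Complex.arg (-z / ζ) ≠ π := fun h' => by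
        rw [h', Complex.exp_pi_mul_I] at h1
        apply hne
        field_simp at h1
        linear_combination h1
      refine ⟨Complex.arg (-z / ζ) + π, ⟨by linarith [Complex.neg_pi_lt_arg (-z / ζ)], ?_⟩, ?_⟩
      · linarith [lt_of_le_of_ne (Complex.arg_le_pi (-z / ζ)) h2]
      · rw [ofReal_add, add_mul, Complex.exp_add, h1, Complex.exp_pi_mul_I]
        field_simp
    · rintro ⟨θ, hθ, rfl⟩
      refine ⟨by rw [norm_mul, hζ, Complex.norm_exp_ofReal_mul_I, one_mul], fun h' => ?_⟩
      have h1 : Complex.exp (θ * I) = 1 := by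
        apply mul_left_cancel₀ hζ0; rw [h', mul_one]
      obtain ⟨n, hn⟩ := Complex.exp_eq_one_iff.1 h1
      have h2 : θ = n * (2 * π) := by
        have := congrArg Complex.im hn
        simpa using this
      rw [h2] at hθ
      have hp := Real.pi_pos
      have h3 : (0 : ℝ) < n := by
        by_contra! h'; nlinarith
      have h4 : (n : ℝ) < 1 := by
        by_contra! h'; nlinarith
      have h5 : 0 < n := by exact_mod_cast h3
      have h6 : n < 1 := by exact_mod_cast h4
      omega
  rw [h]
  exact isPreconnected_Ioo.image _ (by fun_prop)

lemma IsJordanCurve.isPreconnected_diff {Γ : Set ℂ} (h : IsJordanCurve Γ) {w : ℂ} (hw : w ∈ Γ) :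
    IsPreconnected (Γ \ {w}) := by
  obtain ⟨f, hf, hi, rfl⟩ := h
  obtain ⟨ζ, hζ, rfl⟩ := hw
  have h1 : f '' unitCircleSet \ {f ζ} = f '' (unitCircleSet \ {ζ}) := by
    rw [hi.image_sdiff_subset (by simpa using hζ), image_singleton]
  rw [h1]
  exact (isPreconnected_circle_diff (by simpa [unitCircleSet] using hζ)).image _
    (hf.mono sdiff_subset)

instance neBot_nhdsWithin_ball {ζ : sphere (0 : ℂ) 1} : NeBot (𝓝[ball 0 1] (ζ : ℂ)) := by
  rw [← mem_closure_iff_nhdsWithin_neBot, closure_ball _ one_ne_zero]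
  exact sphere_subset_closedBall ζ.2

lemma neBot_nhdsWithin_ball' {ζ : ℂ} (hζ : ‖ζ‖ = 1) : NeBot (𝓝[ball 0 1] ζ) :=
  neBot_nhdsWithin_ball (ζ := ⟨ζ, by simpa using hζ⟩)

/-- An interior map which extends continuously to the closed disc. -/
structure IsCaratheodoryMap (F : ℂ → ℂ) (Γ Ω : Set ℂ) : Prop extends IsInteriorMap F Γ Ω where
  continuousOn : ContinuousOn F (closedBall 0 1)
  isPreconnected_diff : ∀ w ∈ Γ, IsPreconnected (Γ \ {w})

lemma IsInteriorMap.exists_isCaratheodoryMap {F : ℂ → ℂ} {Γ Ω : Set ℂ} (h : IsInteriorMap F Γ Ω)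
    {C : ℝ} (hC : 0 ≤ C) (hBT : HasBoundedTurning Γ C)
    (hd : ∀ w ∈ Γ, IsPreconnected (Γ \ {w})) :
    ∃ F₁, EqOn F₁ F (ball 0 1) ∧ IsCaratheodoryMap F₁ Γ Ω := by
  have he : EqOn (extendFrom (ball 0 1) F) F (ball 0 1) := fun z hz =>
    extendFrom_eq (subset_closure hz) (h.differentiableOn.continuousOn z hz)
  have hc : ContinuousOn (extendFrom (ball 0 1) F) (closedBall 0 1) := by
    refine continuousOn_extendFrom (closure_ball (0 : ℂ) one_ne_zero).ge fun ζ hζ => ?_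
    by_cases hζ' : ζ ∈ ball (0 : ℂ) 1
    · exact ⟨F ζ, h.differentiableOn.continuousOn ζ hζ'⟩
    have hn : ‖ζ‖ = 1 := by
      rw [mem_closedBall_zero_iff] at hζ; rw [mem_ball_zero_iff, not_lt] at hζ'
      exact le_antisymm hζ hζ'
    have := neBot_nhdsWithin_ball' hn
    refine CompleteSpace.complete (f := map F (𝓝[ball 0 1] ζ)) ?_
    rw [Metric.cauchy_iff]
    refine ⟨inferInstance, fun ε hε => ?_⟩
    obtain ⟨δ, hδ, hδ'⟩ := h.cauchy_at_boundary hC hBT hn (half_pos hε)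
    refine ⟨F '' (ball ζ δ ∩ ball 0 1), image_mem_map
      (inter_comm _ _ ▸ inter_mem_nhdsWithin _ (ball_mem_nhds _ hδ)), ?_⟩
    rintro _ ⟨z, hz, rfl⟩ _ ⟨w, hw, rfl⟩
    rw [dist_eq_norm]
    linarith [hδ' z hz w hw]
  exact ⟨_, he, ⟨h.1, h.2, h.3, h.differentiableOn.congr he, h.bijOn.congr he.symm⟩, hc, hd⟩

namespace IsCaratheodoryMap

variable {F : ℂ → ℂ} {Γ Ω : Set ℂ}

lemma mapsTo_sphere (h : IsCaratheodoryMap F Γ Ω) {ζ : ℂ} (hζ : ‖ζ‖ = 1) : F ζ ∈ Γ := by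
  obtain ⟨G, hG, hGi, hGm⟩ := h.exists_inverse
  have := neBot_nhdsWithin_ball' hζ
  have h1 : Tendsto F (𝓝[ball 0 1] ζ) (𝓝 (F ζ)) :=
    (h.continuousOn ζ (by simp [hζ])).mono_left (nhdsWithin_mono _ ball_subset_closedBall)
  have h2 : F ζ ∈ closure Ω := mem_closure_of_tendsto h1
    (eventually_mem_nhdsWithin.mono fun z hz => h.bijOn.mapsTo hz)
  rw [h.closure_eq] at h2
  refine h2.resolve_left fun h3 => ?_
  have h4 : Tendsto (G ∘ F) (𝓝[ball 0 1] ζ) (𝓝 (G (F ζ))) :=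
    (hG.continuousOn.continuousAt (h.isJordanInterior.isOpen.mem_nhds h3)).tendsto.comp h1
  have h5 : Tendsto (G ∘ F) (𝓝[ball 0 1] ζ) (𝓝 ζ) :=
    (tendsto_id.mono_left nhdsWithin_le_nhds : Tendsto id (𝓝[ball 0 1] ζ) (𝓝 ζ)).congr'
      (eventually_mem_nhdsWithin.mono fun z hz => (hGi.1 hz).symm)
  have h6 := hGm h3
  rw [tendsto_nhds_unique h4 h5, mem_ball_zero_iff, hζ] at h6
  exact lt_irrefl _ h6

lemma image_sphere (h : IsCaratheodoryMap F Γ Ω) : F '' sphere 0 1 = Γ := by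
  apply Subset.antisymm
  · rintro _ ⟨z, hz, rfl⟩
    exact h.mapsTo_sphere (by simpa using hz)
  · intro w hw
    have h1 : closure Ω ⊆ F '' closedBall 0 1 := by
      refine closure_minimal ?_ ((isCompact_closedBall _ _).image_of_continuousOn
        h.continuousOn).isClosed
      rw [← h.bijOn.image_eq]
      exact image_mono ball_subset_closedBall
    obtain ⟨z, hz, rfl⟩ := h1 (h.closure_eq.symm.subset (Or.inr hw))
    refine ⟨z, ?_, rfl⟩
    rw [mem_closedBall_zero_iff] at hz
    rw [mem_sphere_zero_iff_norm]
    refine hz.eq_of_not_lt fun hlt => ?_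
    exact Set.disjoint_left.1 h.isJordanInterior.disjoint
      (h.bijOn.mapsTo (mem_ball_zero_iff.2 hlt)) hw

lemma not_eqOn_arc (h : IsCaratheodoryMap F Γ Ω)
    {W : Set ℂ} (hW : IsOpen W) {ζ w : ℂ} (hζ : ‖ζ‖ = 1) (hζW : ζ ∈ W)
    (hw : w ∈ Γ) (he : ∀ z ∈ W, ‖z‖ = 1 → F z = w) : False := by
  obtain ⟨δ, hδ, hδW⟩ := Metric.isOpen_iff.1 hW ζ hζW
  obtain ⟨T, hT, hTf, hTc⟩ := (isCompact_sphere (0 : ℂ) 1).finite_cover_balls hδ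
  lift T to Finset ℂ using hTf
  have hn : ∀ c ∈ T, ∀ z : ℂ, ‖ζ * conj c * z‖ = ‖z‖ := fun c hc z => by
    have : ‖c‖ = 1 := by simpa using hT hc
    rw [norm_mul, norm_mul, hζ, RCLike.norm_conj, this, one_mul, one_mul]
  have hcl : ∀ c ∈ T, DiffContOnCl ℂ (fun z => F (ζ * conj c * z)) (ball 0 1) := by
    intro c hc
    refine ⟨h.differentiableOn.comp (g := F) (by fun_prop) fun z hz => ?_, ?_⟩
    · rw [mem_ball_zero_iff] at hz ⊢
      rwa [hn c hc]
    · rw [closure_ball _ one_ne_zero]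
      refine h.continuousOn.comp (g := F) (by fun_prop) fun z hz => ?_
      rw [mem_closedBall_zero_iff] at hz ⊢
      rwa [hn c hc]
  have hg : DiffContOnCl ℂ (fun z => ∏ c ∈ T, (F (ζ * conj c * z) - w)) (ball 0 1) := by
    refine ⟨DifferentiableOn.fun_finsetProd fun c hc => (hcl c hc).1.sub_const w, ?_⟩
    exact continuousOn_finsetProd _ fun c hc => (hcl c hc).2.sub continuousOn_const
  have h0 := Complex.norm_le_of_forall_mem_frontier_norm_le isBounded_ball hg (C := 0)
    (fun z hz => ?_) (subset_closure (mem_ball_self one_pos))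
  · rw [norm_le_zero_iff, Finset.prod_eq_zero_iff] at h0
    obtain ⟨c, hc, h1⟩ := h0
    rw [mul_zero, sub_eq_zero] at h1
    exact Set.disjoint_left.1 h.isJordanInterior.disjoint
      (h.bijOn.mapsTo (mem_ball_self one_pos)) (h1 ▸ hw)
  · rw [frontier_ball _ one_ne_zero] at hz
    obtain ⟨c, hc, hzc⟩ := mem_iUnion₂.1 (hTc hz)
    have hc1 : ‖c‖ = 1 := by simpa using hT hc
    rw [norm_le_zero_iff]
    refine Finset.prod_eq_zero hc (sub_eq_zero.2 (he _ (hδW ?_) ?_))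
    · have h2 : ζ * conj c * z - ζ = ζ * conj c * (z - c) := by
        have : conj c * c = 1 := by
          rw [mul_comm, Complex.mul_conj, Complex.normSq_eq_norm_sq, hc1]; simp
        linear_combination ζ * this
      rw [mem_ball, dist_eq_norm, h2, hn c hc, ← dist_eq_norm]
      exact hzc
    · rw [hn c hc]; simpa using hz

lemma injOn_sphere (h : IsCaratheodoryMap F Γ Ω) : InjOn F (sphere 0 1) := by
  intro ζ hζ η hη hFe
  rw [mem_sphere_zero_iff_norm] at hζ hη
  by_contra hne
  set w := F ζ with hwdef
  have hw : w ∈ Γ := h.mapsTo_sphere hζ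
  set l : ℂ → ℝ := fun z => ((z - ζ) * conj (η - ζ)).im with hl
  have hlc : Continuous l := by rw [hl]; fun_prop
  have hd0 : 0 < ‖η - ζ‖ := norm_pos_iff.2 (sub_ne_zero.2 (Ne.symm hne))
  have hl0 : ∀ z, ‖z‖ = 1 → l z = 0 → F z = w := by
    intro z hz h0
    have h1 : ((z - ζ) * conj (η - ζ)) * ((z - ζ) * conj (η - ζ)).im = 0 := by
      have : ((z - ζ) * conj (η - ζ)).im = 0 := h0
      rw [this]; simp
    have e1 : z.re ^ 2 + z.im ^ 2 = 1 := by
      have := Complex.normSq_eq_norm_sq z; rw [hz, Complex.normSq_apply] at this; linarith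
    have e2 : ζ.re ^ 2 + ζ.im ^ 2 = 1 := by
      have := Complex.normSq_eq_norm_sq ζ; rw [hζ, Complex.normSq_apply] at this; linarith
    have e3 : η.re ^ 2 + η.im ^ 2 = 1 := by
      have := Complex.normSq_eq_norm_sq η; rw [hη, Complex.normSq_apply] at this; linarith
    have h2 : (z.im - ζ.im) * (η.re - ζ.re) - (z.re - ζ.re) * (η.im - ζ.im) = 0 := by
      have : l z = 0 := h0
      simp only [hl, mul_im, sub_re, sub_im, conj_re, conj_im, map_sub] at this
      linarith
    have hD : 0 < (η.re - ζ.re) ^ 2 + (η.im - ζ.im) ^ 2 := by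
      have := Complex.normSq_eq_norm_sq (η - ζ); rw [Complex.normSq_apply] at this
      have h3 := pow_pos hd0 2
      rw [← this, sub_re, sub_im] at h3
      linarith
    set t := ((z.re - ζ.re) * (η.re - ζ.re) + (z.im - ζ.im) * (η.im - ζ.im)) /
      ((η.re - ζ.re) ^ 2 + (η.im - ζ.im) ^ 2) with ht
    have hx : z.re - ζ.re = t * (η.re - ζ.re) := by
      rw [ht]; field_simp; linear_combination -(η.im - ζ.im) * h2
    have hy : z.im - ζ.im = t * (η.im - ζ.im) := by
      rw [ht]; field_simp; linear_combination (η.re - ζ.re) * h2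
    have h4 : t * (t - 1) = 0 := by
      have h5 : t * (t - 1) * ((η.re - ζ.re) ^ 2 + (η.im - ζ.im) ^ 2) = 0 := by
        have hx' : z.re = ζ.re + t * (η.re - ζ.re) := by linarith
        have hy' : z.im = ζ.im + t * (η.im - ζ.im) := by linarith
        rw [hx', hy'] at e1
        linear_combination e1 - (1 - t) * e2 - t * e3
      exact (mul_eq_zero.1 h5).resolve_right hD.ne'
    rcases mul_eq_zero.1 h4 with h4 | h4
    · have : z = ζ := by
        rw [h4] at hx hy; apply Complex.ext <;> linarith
      rw [this]
    · have h4 : t = 1 := by linarith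
      have : z = η := by
        rw [h4] at hx hy; apply Complex.ext <;> linarith
      rw [this, ← hFe]
  set Y := F '' (l ⁻¹' {0} ∩ closedBall 0 1) with hY
  have hYc : IsCompact Y := by
    refine IsCompact.image_of_continuousOn ?_ (h.continuousOn.mono inter_subset_right)
    exact (isCompact_closedBall _ _).inter_left (isClosed_singleton.preimage hlc)
  have hYw : ∀ y ∈ Γ, y ∈ Y → y = w := by
    rintro _ hyΓ ⟨z, ⟨hz0, hz⟩, rfl⟩
    refine hl0 z ((mem_closedBall_zero_iff.1 hz).eq_of_not_lt fun hlt => ?_) hz0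
    exact Set.disjoint_left.1 h.isJordanInterior.disjoint
      (h.bijOn.mapsTo (mem_ball_zero_iff.2 hlt)) hyΓ
  have key : ∀ x y, ‖x‖ = 1 → ‖y‖ = 1 → 0 < l x → l y < 0 → F x ≠ w → F y ≠ w → False := by
    intro x y hx hy hlx hly hFx hFy
    have hnb : ∀ x, ‖x‖ = 1 → F x ≠ w → ∃ r > 0, Disjoint (ball (F x) r) Y := by
      intro x hx hFx
      obtain ⟨r, hr, hr'⟩ := Metric.isOpen_iff.1 hYc.isClosed.isOpen_compl (F x)
        fun hxY => hFx (hYw _ (h.mapsTo_sphere hx) hxY)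
      exact ⟨r, hr, disjoint_compl_right_iff_subset.2 hr' |>.mono_right (by simp)⟩
    have hnp : ∀ x, ‖x‖ = 1 → ∀ r > 0, ∀ V, IsOpen V → x ∈ V →
        ∃ z ∈ V ∩ ball 0 1, F z ∈ ball (F x) r := by
      intro x hx r hr V hV hxV
      have := neBot_nhdsWithin_ball' hx
      have h1 : Tendsto F (𝓝[ball 0 1] x) (𝓝 (F x)) :=
        (h.continuousOn x (by simp [hx])).mono_left (nhdsWithin_mono _ ball_subset_closedBall)
      obtain ⟨z, ⟨hz1, hz2⟩, hz3⟩ := ((h1.eventually (ball_mem_nhds _ hr)).and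
        (nhdsWithin_le_nhds (hV.mem_nhds hxV))).and eventually_mem_nhdsWithin |>.exists
      exact ⟨z, ⟨hz2, hz3⟩, hz1⟩
    obtain ⟨r, hr, hrY⟩ := hnb x hx hFx
    obtain ⟨s, hs, hsY⟩ := hnb y hy hFy
    obtain ⟨x', hx', hFx'⟩ := hnp x hx r hr (l ⁻¹' Ioi 0) (isOpen_Ioi.preimage hlc) hlx
    obtain ⟨y', hy', hFy'⟩ := hnp y hy s hs (l ⁻¹' Iio 0) (isOpen_Iio.preimage hlc) hly
    refine h.not_separated (N := l ⁻¹' Ioi 0 ∩ ball 0 1) (M := l ⁻¹' Iio 0 ∩ ball 0 1) (Y := Y)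
      (D := (Γ \ {w} ∪ ball (F x) r) ∪ ball (F y) s)
      ((isOpen_Ioi.preimage hlc).inter isOpen_ball) inter_subset_right
      ((isOpen_Iio.preimage hlc).inter isOpen_ball) inter_subset_right ?_ hYc ?_ ?_
      (mem_image_of_mem _ hx') (mem_image_of_mem _ hy') ?_ ?_ ?_ ?_
    · rw [Set.disjoint_left]
      rintro z ⟨hz, -⟩ ⟨hz', -⟩
      exact lt_asymm (show 0 < l z from hz) hz'
    · refine image_mono ?_
      rintro z ⟨⟨hz1, hz2⟩, hz3⟩
      have h1 : z ∈ l ⁻¹' Ici 0 := by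
        refine closure_minimal ?_ (isClosed_Ici.preimage hlc) hz1
        rintro z ⟨hz, -⟩
        exact le_of_lt (show 0 < l z from hz)
      have h2 : ¬ 0 < l z := fun h' => hz3 ⟨h', hz2⟩
      exact ⟨le_antisymm (not_lt.1 h2) h1, ball_subset_closedBall hz2⟩
    · refine Set.Subsingleton.isPreconnected ?_
      rintro a ⟨ha, ha'⟩ b ⟨hb, hb'⟩
      rw [hYw a ha ha', hYw b hb hb']
    · refine IsPreconnected.union (F y) ?_ (mem_ball_self hs)
        (IsPreconnected.union (F x) ⟨h.mapsTo_sphere hx, hFx⟩ (mem_ball_self hr)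
          (h.isPreconnected_diff w hw) (convex_ball _ _).isPreconnected)
        (convex_ball _ _).isPreconnected
      exact Or.inl ⟨h.mapsTo_sphere hy, hFy⟩
    · rw [Set.disjoint_union_left, Set.disjoint_union_left]
      refine ⟨⟨?_, hrY⟩, hsY⟩
      rw [Set.disjoint_left]
      exact fun a ha ha' => ha.2 (hYw a ha.1 ha')
    · exact Or.inl (Or.inr hFx')
    · exact Or.inr hFy'
  set u : ℂ := I * (η - ζ) / ‖η - ζ‖ with hu
  have hun : ‖u‖ = 1 := by
    rw [hu, norm_div, norm_mul, norm_I, one_mul, norm_real, norm_norm, div_self hd0.ne']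
  have hlu : ∀ s : ℝ, l (s * u) = s * ‖η - ζ‖ - (ζ * conj (η - ζ)).im := by
    intro s
    have h1 : (s * u - ζ) * conj (η - ζ) = ((s * ‖η - ζ‖ : ℝ) : ℂ) * I - ζ * conj (η - ζ) := by
      have h2 : (η - ζ) * conj (η - ζ) = ‖η - ζ‖ ^ 2 := by
        rw [Complex.mul_conj, Complex.normSq_eq_norm_sq]; simp
      have h3 : (‖η - ζ‖ : ℂ) ≠ 0 := by exact_mod_cast hd0.ne'
      rw [hu, sub_mul, sub_left_inj]
      push_cast
      field_simp
      linear_combination (s : ℂ) * h2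
    simp only [hl]
    rw [h1, sub_im, mul_I_im, ofReal_re]
  have hdist : |(ζ * conj (η - ζ)).im| < ‖η - ζ‖ := by
    have e : ‖ζ * conj (η - ζ)‖ = ‖η - ζ‖ := by rw [norm_mul, hζ, RCLike.norm_conj, one_mul]
    refine lt_of_le_of_ne (e ▸ Complex.abs_im_le_norm _) fun h' => ?_
    rw [← e] at h'
    have h2 : (ζ * conj (η - ζ)).re = 0 := Complex.abs_im_eq_norm.1 h'
    have e2 : ζ.re ^ 2 + ζ.im ^ 2 = 1 := by
      have := Complex.normSq_eq_norm_sq ζ; rw [hζ, Complex.normSq_apply] at this; linarith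
    have e3 : η.re ^ 2 + η.im ^ 2 = 1 := by
      have := Complex.normSq_eq_norm_sq η; rw [hη, Complex.normSq_apply] at this; linarith
    simp only [mul_re, conj_re, conj_im, sub_re, sub_im] at h2
    have h3 := pow_pos hd0 2
    rw [← Complex.normSq_eq_norm_sq, Complex.normSq_apply, sub_re, sub_im] at h3
    nlinarith
  rw [abs_lt] at hdist
  have hp : 0 < l u := by have := hlu 1; rw [ofReal_one, one_mul] at this; rw [this]; linarith
  have hm : l (-u) < 0 := by
    have := hlu (-1); rw [ofReal_neg, ofReal_one, neg_one_mul] at this; rw [this]; linarith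
  by_cases hall : ∀ z ∈ l ⁻¹' Ioi 0, ‖z‖ = 1 → F z = w
  · exact h.not_eqOn_arc (isOpen_Ioi.preimage hlc) hun hp hw hall
  · push Not at hall
    obtain ⟨x, hx, hx1, hxw⟩ := hall
    refine h.not_eqOn_arc (isOpen_Iio.preimage hlc) (by rwa [norm_neg]) hm hw fun y hy hy1 => ?_
    by_contra hyw
    exact key x y hx1 hy1 hx hy hxw hyw

lemma injOn (h : IsCaratheodoryMap F Γ Ω) : InjOn F (closedBall 0 1) := by
  have hs : ∀ z ∈ closedBall (0 : ℂ) 1, z ∉ ball (0 : ℂ) 1 → z ∈ sphere (0 : ℂ) 1 := by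
    intro z hz hz'
    rw [mem_closedBall] at hz; rw [mem_ball, not_lt] at hz'
    exact le_antisymm hz hz'
  have hdis := Set.disjoint_left.1 h.isJordanInterior.disjoint
  intro z hz w hw he
  by_cases hz' : z ∈ ball (0 : ℂ) 1 <;> by_cases hw' : w ∈ ball (0 : ℂ) 1
  · exact h.bijOn.injOn hz' hw' he
  · exact (hdis (h.bijOn.mapsTo hz')
      (he ▸ h.mapsTo_sphere (mem_sphere_zero_iff_norm.1 (hs w hw hw')))).elim
  · exact (hdis (h.bijOn.mapsTo hw')
      (he ▸ h.mapsTo_sphere (mem_sphere_zero_iff_norm.1 (hs z hz hz')))).elim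
  · exact h.injOn_sphere (hs z hz hz') (hs w hw hw') he

lemma image_closedBall (h : IsCaratheodoryMap F Γ Ω) : F '' closedBall 0 1 = Ω ∪ Γ := by
  rw [← ball_union_sphere, image_union, h.bijOn.image_eq, h.image_sphere]

end IsCaratheodoryMap

lemma exists_isArcPair {Γ : Set ℂ} (hΓ : IsJordanCurve Γ) {z₁ z₂ : ℂ} (h₁ : z₁ ∈ Γ) (h₂ : z₂ ∈ Γ)
    (hne : z₁ ≠ z₂) : ∃ A B, IsArcPair Γ z₁ z₂ A B := by
  obtain ⟨f, hf, hi, rfl⟩ := hΓ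
  obtain ⟨ζ, hζ, rfl⟩ := h₁
  obtain ⟨η, hη, rfl⟩ := h₂
  have hζη : ζ ≠ η := fun h => hne (h ▸ rfl)
  have hζ1 : ‖ζ‖ = 1 := by simpa [unitCircleSet] using hζ
  have hη1 : ‖η‖ = 1 := by simpa [unitCircleSet] using hη
  have hζ0 : ζ ≠ 0 := by rintro rfl; simp at hζ1
  set g : ℝ → ℂ := fun θ => ζ * Complex.exp (θ * I) with hg
  have hgc : Continuous g := by fun_prop
  have hgS : ∀ θ, g θ ∈ unitCircleSet := fun θ => by
    simp [unitCircleSet, hg, hζ1]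
  have hgi : ∀ s t, g s = g t → ∃ n : ℤ, s - t = n * (2 * π) := fun s t h => by
    have h1 : Complex.exp (s * I) = Complex.exp (t * I) := mul_left_cancel₀ hζ0 h
    obtain ⟨n, hn⟩ := Complex.exp_eq_exp_iff_exists_int.1 h1
    refine ⟨n, ?_⟩
    have := congrArg Complex.im hn
    simp at this
    linarith
  have hgs : ∀ z ∈ unitCircleSet, ∃ θ ∈ Ico 0 (2 * π), g θ = z := fun z hz => by
    have hz1 : ‖z‖ = 1 := by simpa [unitCircleSet] using hz
    have h1 := Complex.norm_mul_exp_arg_mul_I (z / ζ)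
    rw [norm_div, hz1, hζ1, div_one, ofReal_one, one_mul] at h1
    have hp := Real.two_pi_pos
    refine ⟨toIcoMod hp 0 (arg (z / ζ)), by simpa using toIcoMod_mem_Ico hp 0 (arg (z / ζ)), ?_⟩
    have h2 := self_sub_toIcoDiv_zsmul hp 0 (arg (z / ζ))
    simp only [hg]
    rw [← h2, zsmul_eq_mul]
    push_cast
    have h3 : (arg (z / ζ) - toIcoDiv hp 0 (arg (z / ζ)) * (2 * π) : ℂ) * I = arg (z / ζ) * I -
      (toIcoDiv hp 0 (arg (z / ζ))) * (2 * π * I) := by ring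
    rw [h3, Complex.exp_sub, h1, Complex.exp_int_mul_two_pi_mul_I]
    field_simp
  have hg0 : g 0 = ζ := by simp [hg]
  have hg2 : g (2 * π) = ζ := by simp [hg]
  obtain ⟨α, ⟨hα0, hα2⟩, hgα⟩ := hgs η hη
  have hα : 0 < α := lt_of_le_of_ne hα0 fun h => hζη (by rw [← hg0, h, hgα])
  have hgI : ∀ s ∈ Icc 0 α, ∀ t ∈ Icc α (2 * π), g s = g t → g s = ζ ∨ g s = η := by
    intro s hs t ht hst
    obtain ⟨n, hn⟩ := hgi s t hst
    have hp := Real.pi_pos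
    have h1 : n ≤ 0 := by
      by_contra! h
      have : (1 : ℝ) ≤ n := by exact_mod_cast h
      nlinarith [hs.2, ht.1]
    have h2 : -1 ≤ n := by
      by_contra! h
      have : (n : ℝ) ≤ -2 := by exact_mod_cast (by omega : n ≤ -2)
      nlinarith [hs.1, ht.2]
    obtain rfl | rfl : n = 0 ∨ n = -1 := by omega
    · right
      have : s = α := by
        norm_num at hn; linarith [hs.2, ht.1]
      rw [this, hgα]
    · left
      have : s = 0 := by
        norm_num at hn; linarith [hs.1, ht.2]
      rw [this, hg0]
  have hc : ∀ a b, a ≤ b → IsClosed (f '' (g '' Icc a b)) ∧ IsConnected (f '' (g '' Icc a b)) := by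
    intro a b hab
    have hsub : g '' Icc a b ⊆ unitCircleSet := by rintro _ ⟨θ, -, rfl⟩; exact hgS θ
    exact ⟨((isCompact_Icc.image hgc).image_of_continuousOn (hf.mono hsub)).isClosed,
      ((isConnected_Icc hab).image g hgc.continuousOn).image f (hf.mono hsub)⟩
  refine ⟨f '' (g '' Icc 0 α), f '' (g '' Icc α (2 * π)), ?_, ?_, (hc _ _ hα0).1,
    (hc _ _ hα2.le).1, (hc _ _ hα0).2, (hc _ _ hα2.le).2⟩
  · rw [← image_union, ← image_union, Icc_union_Icc_eq_Icc hα0 hα2.le]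
    apply Subset.antisymm
    · refine image_mono ?_
      rintro _ ⟨θ, -, rfl⟩; exact hgS θ
    · refine image_mono fun z hz => ?_
      obtain ⟨θ, hθ, rfl⟩ := hgs z hz
      exact mem_image_of_mem g (Ico_subset_Icc_self hθ)
  · apply Subset.antisymm
    · rintro _ ⟨⟨_, ⟨s, hs, rfl⟩, rfl⟩, ⟨_, ⟨t, ht, rfl⟩, hst⟩⟩
      rcases hgI s hs t ht (hi (hgS t) (hgS s) hst).symm with h | h
      · left; rw [h]
      · right; rw [mem_singleton_iff, h]
    · rintro x (rfl | hx)
      · exact ⟨⟨ζ, ⟨0, ⟨le_rfl, hα0⟩, hg0⟩, rfl⟩, ⟨ζ, ⟨2 * π, ⟨hα2.le, le_rfl⟩, hg2⟩, rfl⟩⟩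
      · rw [mem_singleton_iff] at hx; subst hx
        exact ⟨⟨η, ⟨α, ⟨hα0, le_rfl⟩, hgα⟩, rfl⟩, ⟨η, ⟨α, ⟨le_rfl, hα2.le⟩, hgα⟩, rfl⟩⟩

lemma hasBoundedTurning_of_isArcPair {Γ : Set ℂ} (hΓ : IsJordanCurve Γ) {C : ℝ}
    (h : ∀ z₁ ∈ Γ, ∀ z₂ ∈ Γ, ∀ A B : Set ℂ, IsArcPair Γ z₁ z₂ A B →
      min (Metric.diam A) (Metric.diam B) ≤ C * ‖z₁ - z₂‖) : HasBoundedTurning Γ C := by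
  intro z₁ h₁ z₂ h₂
  by_cases hne : z₁ = z₂
  · subst hne
    exact ⟨{z₁}, by simpa using h₁, isPreconnected_singleton, rfl, rfl, by simp⟩
  obtain ⟨A, B, hAB⟩ := exists_isArcPair hΓ h₁ h₂ hne
  have hd := h z₁ h₁ z₂ h₂ A B hAB
  obtain ⟨hU, hI, -, -, hA, hB⟩ := hAB
  have m₁ : z₁ ∈ A ∩ B := hI ▸ mem_insert _ _
  have m₂ : z₂ ∈ A ∩ B := hI ▸ mem_insert_of_mem _ rfl
  rcases min_le_iff.1 hd with hd | hd
  · exact ⟨A, hU ▸ subset_union_left, hA.isPreconnected, m₁.1, m₂.1, hd⟩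
  · exact ⟨B, hU ▸ subset_union_right, hB.isPreconnected, m₁.2, m₂.2, hd⟩

lemma exists_norm_sub_bounds {Γ : Set ℂ} (hΓ : IsCompact Γ) {p : ℂ} (hp : p ∉ Γ) :
    ∃ a b : ℝ, 0 < a ∧ 0 < b ∧ ∀ z ∈ Γ, a ≤ ‖z - p‖ ∧ ‖z - p‖ ≤ b := by
  obtain ⟨a, ha, ha'⟩ := Metric.isOpen_iff.1 hΓ.isClosed.isOpen_compl p hp
  obtain ⟨b, hb, hb'⟩ := hΓ.isBounded.subset_closedBall_lt 0 p
  refine ⟨a, b, ha, hb, fun z hz => ⟨?_, ?_⟩⟩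
  · by_contra! h
    exact ha' (mem_ball_iff_norm.2 h) hz
  · exact mem_closedBall_iff_norm.1 (hb' hz)

lemma inv_sub_bounds {p z w : ℂ} {a b : ℝ} (ha : 0 < a) (hb : 0 < b) (hz : a ≤ ‖z - p‖ ∧ ‖z - p‖ ≤ b)
    (hw : a ≤ ‖w - p‖ ∧ ‖w - p‖ ≤ b) :
    ‖z - w‖ ≤ b ^ 2 * ‖(z - p)⁻¹ - (w - p)⁻¹‖ ∧ ‖(z - p)⁻¹ - (w - p)⁻¹‖ ≤ ‖z - w‖ / a ^ 2 := by
  have h1 : z - p ≠ 0 := norm_pos_iff.1 (ha.trans_le hz.1)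
  have h2 : w - p ≠ 0 := norm_pos_iff.1 (ha.trans_le hw.1)
  have h3 : (z - p)⁻¹ - (w - p)⁻¹ = -(z - w) / ((z - p) * (w - p)) := by field_simp; ring
  have h4 : 0 < ‖z - p‖ * ‖w - p‖ := mul_pos (norm_pos_iff.2 h1) (norm_pos_iff.2 h2)
  rw [h3, norm_div, norm_neg, norm_mul]
  constructor
  · rw [mul_div_assoc', le_div_iff₀ h4, mul_comm]
    refine mul_le_mul_of_nonneg_right ?_ (norm_nonneg _)
    rw [sq]
    exact mul_le_mul hz.2 hw.2 (norm_nonneg _) hb.le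
  · refine div_le_div_of_nonneg_left (norm_nonneg _) (by positivity) ?_
    rw [sq]
    exact mul_le_mul hz.1 hw.1 ha.le (norm_nonneg _)

lemma HasBoundedTurning.image_inv {Γ : Set ℂ} (hΓ : IsCompact Γ) {C : ℝ} (hC : 0 ≤ C)
    (h : HasBoundedTurning Γ C) {p : ℂ} (hp : p ∉ Γ) :
    ∃ C', 0 ≤ C' ∧ HasBoundedTurning ((fun z => (z - p)⁻¹) '' Γ) C' := by
  obtain ⟨a, b, ha, hb, hab⟩ := exists_norm_sub_bounds hΓ hp
  refine ⟨C * b ^ 2 / a ^ 2, by positivity, ?_⟩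
  rintro _ ⟨z, hz, rfl⟩ _ ⟨w, hw, rfl⟩
  obtain ⟨A, hA, hAc, hzA, hwA, hd⟩ := h z hz w hw
  refine ⟨_, image_mono hA, hAc.image _ ?_, mem_image_of_mem _ hzA, mem_image_of_mem _ hwA, ?_⟩
  · refine ContinuousOn.inv₀ (by fun_prop) fun x hx h0 => hp ?_
    rw [← sub_eq_zero.1 h0]; exact hA hx
  · refine Metric.diam_le_of_forall_dist_le (by positivity) ?_
    rintro _ ⟨x, hx, rfl⟩ _ ⟨y, hy, rfl⟩
    rw [dist_eq_norm]
    refine (inv_sub_bounds ha hb (hab x (hA hx)) (hab y (hA hy))).2.trans ?_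
    have h1 : ‖x - y‖ ≤ C * (b ^ 2 * ‖(z - p)⁻¹ - (w - p)⁻¹‖) := by
      rw [← dist_eq_norm]
      refine (Metric.dist_le_diam_of_mem (hΓ.isBounded.subset hA) hx hy).trans (hd.trans ?_)
      exact mul_le_mul_of_nonneg_left (inv_sub_bounds ha hb (hab z hz) (hab w hw)).1 hC
    rw [div_le_iff₀ (by positivity)]
    refine h1.trans (le_of_eq ?_)
    field_simp

lemma exists_isCaratheodoryMap {Γ Ω : Set ℂ} (hΓ : IsJordanCurve Γ) {C : ℝ} (hC : 0 ≤ C)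
    (hBT : HasBoundedTurning Γ C) (hΩ : IsJordanInterior Γ Ω) {p : ℂ} (hp : p ∈ Ω) :
    ∃ F, IsCaratheodoryMap F Γ Ω ∧ F 0 = p := by
  obtain ⟨F, hF, hb, h0⟩ := exists_riemann_map hΩ.isOpen hΩ.isConnected.isPreconnected
    hΩ.isBounded (fun φ hφ h => hasLogOn_of_isPreconnected_compl_of_isOpen hΩ.isOpen
      hΩ.isConnected hΩ.isBounded hΩ.isPreconnected_compl hφ h) hp
  have h : IsInteriorMap F Γ Ω := ⟨hΩ, hΓ.isCompact, hΓ.isPreconnected, hF, hb⟩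
  obtain ⟨F₁, he, h₁⟩ := h.exists_isCaratheodoryMap hC hBT fun w hw => hΓ.isPreconnected_diff hw
  exact ⟨F₁, h₁, by rw [he (mem_ball_self one_pos), h0]⟩

lemma IsJordanCurve.image {Γ : Set ℂ} (hΓ : IsJordanCurve Γ) {g : ℂ → ℂ} (hg : ContinuousOn g Γ)
    (hi : InjOn g Γ) : IsJordanCurve (g '' Γ) := by
  obtain ⟨f, hf, hfi, rfl⟩ := hΓ
  exact ⟨g ∘ f, hg.comp hf (mapsTo_image _ _), hi.comp hfi (mapsTo_image _ _), image_comp _ _ _⟩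

lemma IsCaratheodoryMap.hasLogOn_sub {F : ℂ → ℂ} {Γ Ω : Set ℂ} (h : IsCaratheodoryMap F Γ Ω)
    {q : ℂ} (hq : q ∉ Ω ∪ Γ) : HasLogOn (fun z => z - q) Γ := by
  obtain ⟨g, hg, -, hfg⟩ := exists_continuousOn_inverse (isCompact_closedBall _ _) h.continuousOn
    h.injOn
  rw [h.image_closedBall] at hg hfg
  have h1 : HasLogOn (fun z => F z - q) (closedBall 0 1) := by
    refine hasLogOn_closedBall (h.continuousOn.sub continuousOn_const) fun z hz h0 => hq ?_
    rw [← sub_eq_zero.1 h0, ← h.image_closedBall]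
    exact mem_image_of_mem _ hz
  refine ((h1.comp hg fun w hw => (hfg w hw).1).mono subset_union_right).congr fun w hw => ?_
  rw [(hfg w (Or.inr hw)).2]

lemma exists_exterior {F : ℂ → ℂ} {Γ Ω : Set ℂ} (hΓ : IsJordanCurve Γ)
    (h : IsCaratheodoryMap F Γ Ω) {p : ℂ} (hp : p ∈ Ω) :
    ∃ Ω', IsJordanInterior ((fun z => (z - p)⁻¹) '' Γ) Ω' ∧ 0 ∈ Ω' ∧
      ∀ z, z ≠ p → (z ∉ Ω ↔ (z - p)⁻¹ ∈ Ω' ∪ (fun z => (z - p)⁻¹) '' Γ) := by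
  have hdis := Set.disjoint_left.1 h.isJordanInterior.disjoint
  have hpΓ : p ∉ Γ := hdis hp
  have hne : ∀ z ∈ Γ, z - p ≠ 0 := fun z hz h0 => hpΓ (sub_eq_zero.1 h0 ▸ hz)
  set κ : ℂ → ℂ := fun z => (z - p)⁻¹ with hκ
  have hκc : ContinuousOn κ Γ := ContinuousOn.inv₀ (by fun_prop) hne
  have hκi : Function.Injective κ := fun z w hzw => by
    have := inv_injective hzw
    exact sub_left_injective this
  have hJ := hΓ.image hκc hκi.injOn
  have h0 : (0 : ℂ) ∉ κ '' Γ := by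
    rintro ⟨z, hz, hz0⟩
    exact hne z hz (inv_eq_zero.1 hz0)
  have hn0 : ∀ w ∈ κ '' Γ, w ≠ 0 := fun w hw h' => h0 (h' ▸ hw)
  have hlp : ¬ HasLogOn (fun z => z - p) Γ :=
    not_hasLogOn_sub_of_frontier h.isJordanInterior.isBounded h.isJordanInterior.frontier_eq.subset
      hp
  set Ω' := connectedComponentIn (κ '' Γ)ᶜ 0 with hΩ'
  have h0Ω : (0 : ℂ) ∈ Ω' := mem_connectedComponentIn h0
  have hb : IsBounded Ω' := by
    by_contra hb
    have hl := hasLogOn_sub_of_unbounded hJ.isCompact isPreconnected_connectedComponentIn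
      (Set.disjoint_left.2 fun x hx => connectedComponentIn_subset _ _ hx) hb h0Ω
    refine hlp ((hl.comp hκc (mapsTo_image _ _)).inv.congr fun z hz => ?_)
    simp [hκ]
  have hI := hJ.isJordanInterior h0 hb
  refine ⟨Ω', hI, h0Ω, fun z hzp => ?_⟩
  have hzp' : z - p ≠ 0 := sub_ne_zero.2 hzp
  have hgm : MapsTo (fun w => p + w⁻¹) (κ '' Γ) Γ := by
    rintro _ ⟨x, hx, rfl⟩
    simpa [hκ] using hx
  have hgc : ContinuousOn (fun w : ℂ => p + w⁻¹) (κ '' Γ) :=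
    continuousOn_const.add (continuousOn_id.inv₀ hn0)
  constructor
  · intro hzΩ
    by_contra hcon
    have hzΓ : z ∉ Γ := fun hz => hcon (Or.inr (mem_image_of_mem _ hz))
    have hl := (h.hasLogOn_sub (q := z) (by rintro (h' | h') <;> contradiction)).comp hgc hgm
    refine not_hasLogOn_sub_div_sub_of_frontier hb hI.frontier_eq.subset h0Ω (v := (z - p)⁻¹) ?_
      (((hasLogOn_const (c := -(z - p)) (neg_ne_zero.2 hzp') _).mul hl.inv).congr
        fun w hw => ?_)
    · rwa [closure_eq_self_union_frontier, hI.frontier_eq]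
    · have hw0 := hn0 w hw
      have h1 : w - (z - p)⁻¹ ≠ 0 := fun h' => hcon (Or.inr (sub_eq_zero.1 h' ▸ hw))
      have h2 : p + w⁻¹ - z = -((z - p) * (w - (z - p)⁻¹) / w) := by
        field_simp; ring
      rw [h2, sub_zero]
      generalize w - (z - p)⁻¹ = q at h1
      field_simp
  · intro hz hzΩ
    rcases hz with hz | hz
    · have hl := (hasLogOn_sub_div_sub_of_preconnected hΓ.isCompact
        h.isJordanInterior.isConnected.isPreconnected h.isJordanInterior.disjoint hzΩ hp).comp
          hgc hgm
      refine not_hasLogOn_sub_of_frontier hb hI.frontier_eq.subset hz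
        (((hasLogOn_const (c := -(z - p)⁻¹) (by simpa using hzp') _).mul hl).congr fun w hw => ?_)
      have hw0 := hn0 w hw
      field_simp
      ring
    · obtain ⟨x, hx, hxz⟩ := hz
      exact hdis hzΩ (hκi hxz ▸ hx)

/-- Riemann maps onto both sides of a Jordan curve, with the conformal welding `σ`. -/
structure IsWelding (Γ Ω Ω' : Set ℂ) (p : ℂ) (F G : ℂ → ℂ) (σ : ℝ → ℝ) : Prop where
  mem : p ∈ Ω
  inner : IsCaratheodoryMap F Γ Ω
  outer : IsCaratheodoryMap G ((fun z => (z - p)⁻¹) '' Γ) Ω'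
  outer_zero : G 0 = 0
  notMem_iff : ∀ z, z ≠ p → (z ∉ Ω ↔ (z - p)⁻¹ ∈ Ω' ∪ (fun z => (z - p)⁻¹) '' Γ)
  continuous : Continuous σ
  strictMono : StrictMono σ
  add_two_pi : ∀ t, σ (t + 2 * π) = σ t + 2 * π
  mul_eq : ∀ t : ℝ, (F (Complex.exp (t * I)) - p) * G (Complex.exp (-(σ t) * I)) = 1

lemma IsCaratheodoryMap.exists_log {F : ℂ → ℂ} {Γ Ω : Set ℂ} (h : IsCaratheodoryMap F Γ Ω) :
    ∃ L : ℂ → ℂ, ContinuousOn L (closedBall 0 1) ∧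
      ∀ z ∈ closedBall (0 : ℂ) 1, F z - F 0 = z * Complex.exp (L z) := by
  obtain ⟨G, hG, hGi, -⟩ := h.exists_inverse
  have h0 : (0 : ℂ) ∈ ball (0 : ℂ) 1 := mem_ball_self one_pos
  have hd := h.differentiableOn.differentiableAt (isOpen_ball.mem_nhds h0)
  have hd0 : deriv F 0 ≠ 0 := by
    intro hz
    have h1 := (hG.differentiableAt (h.isJordanInterior.isOpen.mem_nhds
      (h.bijOn.mapsTo h0))).hasDerivAt.comp 0 hd.hasDerivAt
    rw [hz, mul_zero] at h1
    have h2 : HasDerivAt (G ∘ F) 1 0 := (hasDerivAt_id (0 : ℂ)).congr_of_eventuallyEq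
      (Filter.eventuallyEq_of_mem (isOpen_ball.mem_nhds h0) fun z hz => hGi.1 hz)
    exact zero_ne_one (h1.unique h2)
  have hc : ContinuousOn (dslope F 0) (closedBall 0 1) :=
    (continuousOn_dslope (closedBall_mem_nhds _ one_pos)).2 ⟨h.continuousOn, hd⟩
  obtain ⟨L, hL, he⟩ := hasLogOn_closedBall hc fun z hz => by
    by_cases hz0 : z = 0
    · rw [hz0, dslope_same]; exact hd0
    · rw [dslope_of_ne _ hz0, slope_def_field, div_ne_zero_iff, sub_ne_zero, sub_ne_zero]
      exact ⟨fun h' => hz0 (h.injOn hz (ball_subset_closedBall h0) h'), hz0⟩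
  refine ⟨L, hL, fun z hz => ?_⟩
  rw [he z hz]
  have := sub_smul_dslope F 0 z
  rw [sub_zero, smul_eq_mul] at this
  exact this.symm

lemma exists_isWelding {Γ : Set ℂ} (hΓ : IsJordanCurve Γ) {C : ℝ} (hC : 0 ≤ C)
    (hBT : HasBoundedTurning Γ C) :
    ∃ (Ω Ω' : Set ℂ) (p : ℂ) (F G : ℂ → ℂ) (σ : ℝ → ℝ), IsWelding Γ Ω Ω' p F G σ := by
  obtain ⟨Ω, hΩ⟩ := hΓ.exists_isJordanInterior
  obtain ⟨p, hp⟩ := hΩ.isConnected.nonempty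
  obtain ⟨F, hF, hF0⟩ := exists_isCaratheodoryMap hΓ hC hBT hΩ hp
  obtain ⟨Ω', hΩ', h0, hiff⟩ := exists_exterior hΓ hF hp
  have hpΓ : p ∉ Γ := Set.disjoint_left.1 hΩ.disjoint hp
  have hne : ∀ z ∈ Γ, z - p ≠ 0 := fun z hz h0 => hpΓ (sub_eq_zero.1 h0 ▸ hz)
  obtain ⟨C', hC', hBT'⟩ := hBT.image_inv hΓ.isCompact hC hpΓ
  have hκc : ContinuousOn (fun z => (z - p)⁻¹) Γ := ContinuousOn.inv₀ (by fun_prop) hne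
  have hJ := hΓ.image hκc fun z _ w _ hzw => sub_left_injective (inv_injective hzw)
  obtain ⟨G, hG, hG0⟩ := exists_isCaratheodoryMap hJ hC' hBT' hΩ' h0
  obtain ⟨L, hL, hLe⟩ := hF.exists_log
  obtain ⟨M, hM, hMe⟩ := hG.exists_log
  rw [hF0] at hLe
  simp only [hG0, sub_zero] at hMe
  obtain ⟨g, hg, hgG, hGg⟩ := exists_continuousOn_inverse (isCompact_sphere _ _)
    (hG.continuousOn.mono sphere_subset_closedBall) hG.injOn_sphere
  rw [hG.image_sphere] at hg hGg
  have he : ∀ t : ℝ, Complex.exp (t * I) ∈ sphere (0 : ℂ) 1 := fun t => by simp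
  have hFΓ : ∀ t : ℝ, F (Complex.exp (t * I)) ∈ Γ := fun t =>
    hF.image_sphere ▸ mem_image_of_mem F (he t)
  have hFc : Continuous fun t : ℝ => F (Complex.exp (t * I)) :=
    hF.continuousOn.comp_continuous (by fun_prop) fun t => sphere_subset_closedBall (he t)
  have hgc : Continuous fun t : ℝ => g (F (Complex.exp (t * I)) - p)⁻¹ :=
    hg.comp_continuous (hκc.comp_continuous hFc hFΓ) fun t => mem_image_of_mem _ (hFΓ t)
  have hgs : ∀ t : ℝ, ‖g (F (Complex.exp (t * I)) - p)⁻¹‖ = 1 := fun t => by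
    simpa using (hGg _ (mem_image_of_mem _ (hFΓ t))).1
  obtain ⟨N, hN, hNe⟩ := hasLogOn_univ_of_contractible hgc fun t h' => by
    have := hgs t; rw [h'] at this; simp at this
  replace hNe : ∀ t, Complex.exp (N t) = g (F (Complex.exp (t * I)) - p)⁻¹ :=
    fun t => hNe t (mem_univ t)
  set σ : ℝ → ℝ := fun t => -(N t).im with hσ
  have hσc : Continuous σ := (Complex.continuous_im.comp (continuousOn_univ.1 hN)).neg
  have hNσ : ∀ t, Complex.exp (-(σ t) * I) = g (F (Complex.exp (t * I)) - p)⁻¹ := fun t => by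
    rw [← hNe]
    congr 1
    have h1 := hgs t
    rw [← hNe, Complex.norm_exp, Real.exp_eq_one_iff] at h1
    apply Complex.ext <;> simp [hσ, h1]
  have hmul : ∀ t : ℝ, (F (Complex.exp (t * I)) - p) * G (Complex.exp (-(σ t) * I)) = 1 := by
    intro t
    rw [hNσ, (hGg _ (mem_image_of_mem _ (hFΓ t))).2, mul_inv_cancel₀ (hne _ (hFΓ t))]
  have hper : ∀ t : ℝ, Complex.exp ((t + 2 * π : ℝ) * I) = Complex.exp (t * I) := fun t => by
    rw [ofReal_add, add_mul, Complex.exp_add, ofReal_mul, ofReal_ofNat,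
      Complex.exp_two_pi_mul_I, mul_one]
  have heσ : ∀ t, Complex.exp (-(σ t) * I) ∈ sphere (0 : ℂ) 1 := fun t => by
    have := he (-(σ t)); rwa [ofReal_neg] at this
  have hD : Continuous fun t : ℝ => (t * I - σ t * I) + L (Complex.exp (t * I)) +
      M (Complex.exp (-(σ t) * I)) := by
    have h1 : Continuous fun t : ℝ => L (Complex.exp (t * I)) :=
      hL.comp_continuous (by fun_prop) fun t => sphere_subset_closedBall (he t)
    have h2 : Continuous fun t : ℝ => M (Complex.exp (-(σ t) * I)) :=
      hM.comp_continuous (by fun_prop) fun t => sphere_subset_closedBall (heσ t)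
    exact (Continuous.add (by fun_prop) h1).add h2
  have hadd : ∀ t, σ (t + 2 * π) = σ t + 2 * π := by
    intro t
    have h1 := eq_of_exp_eq_const (isPreconnected_univ (α := ℝ)) hD.continuousOn (c := 1)
      (fun t _ => by
        rw [← hmul t, hLe _ (sphere_subset_closedBall (he t)),
          hMe _ (sphere_subset_closedBall (heσ t)), Complex.exp_add, Complex.exp_add,
          sub_eq_add_neg, Complex.exp_add, neg_mul]
        ring) (mem_univ (t + 2 * π)) (mem_univ t)
    have h2 : Complex.exp (-(σ (t + 2 * π)) * I) = Complex.exp (-(σ t) * I) := by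
      rw [hNσ, hNσ, hper]
    simp only [h2, hper] at h1
    have h3 := congrArg Complex.im h1
    simp at h3
    linarith
  have hinj : Function.Injective σ := by
    intro s t hst
    have h1 : F (Complex.exp (s * I)) = F (Complex.exp (t * I)) := by
      have h2 := (hmul s).trans (hmul t).symm
      rw [hst] at h2
      have h3 := mul_right_cancel₀ (right_ne_zero_of_mul_eq_one (hmul t)) h2
      exact sub_left_injective h3
    have h2 := hF.injOn_sphere (he s) (he t) h1
    obtain ⟨n, hn⟩ := Complex.exp_eq_exp_iff_exists_int.1 h2
    have h3 : s = t + n * (2 * π) := by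
      have := congrArg Complex.im hn
      simpa using this
    have h4 : σ (t + n * (2 * π)) = σ t + n * (2 * π) := by
      have hpp : Function.Periodic (fun x => σ x - x) (2 * π) := fun x => by
        simp only [hadd]; ring
      have := hpp.int_mul n t
      linarith
    rw [h3, h4] at hst
    linarith
  have hmono : StrictMono σ := by
    rcases hσc.strictMono_of_inj hinj with h' | h'
    · exact h'
    · have h1 := h' (show (0 : ℝ) < 0 + 2 * π by linarith [Real.two_pi_pos])
      rw [hadd] at h1
      linarith [Real.two_pi_pos]
  exact ⟨Ω, Ω', p, F, G, σ, hp, hF, hG, hG0, hiff, hσc, hmono, hadd, hmul⟩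

lemma continuous_circlePt : Continuous circlePt := by unfold circlePt; fun_prop

lemma norm_circlePt (t : ℝ) : ‖circlePt t‖ = 1 := Complex.norm_exp_ofReal_mul_I t

lemma circlePt_add_two_pi (t : ℝ) : circlePt (t + 2 * π) = circlePt t := by
  unfold circlePt
  push_cast
  rw [add_mul, Complex.exp_add, Complex.exp_two_pi_mul_I, mul_one]

lemma polarPt_circlePt (b τ : ℝ) :
    polarPt (circlePt b) (-circlePt b) (2 * Real.sin (τ / 2)) (π / 2 - τ / 2) =
      circlePt (b - τ) := by
  have h1 : Complex.exp (((π / 2 - τ / 2 : ℝ) : ℂ) * I) = I * Complex.exp (-(τ / 2 : ℂ) * I) := by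
    calc Complex.exp (((π / 2 - τ / 2 : ℝ) : ℂ) * I)
        = Complex.exp ((π / 2 : ℂ) * I + -(τ / 2 : ℂ) * I) := by push_cast; ring_nf
      _ = _ := by rw [Complex.exp_add, Complex.exp_pi_div_two_mul_I]
  have h2 : ((2 * Real.sin (τ / 2) : ℝ) : ℂ) =
      (Complex.exp (-(τ / 2 : ℂ) * I) - Complex.exp ((τ / 2 : ℂ) * I)) * I := by
    push_cast
    rw [Complex.sin]; ring
  have h3 : Complex.exp (-(τ / 2 : ℂ) * I) * Complex.exp ((τ / 2 : ℂ) * I) = 1 := by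
    rw [← Complex.exp_add]; simp
  have h4 : circlePt (b - τ) = circlePt b * Complex.exp (-(τ / 2 : ℂ) * I) ^ 2 := by
    unfold circlePt
    rw [← Complex.exp_nat_mul, ← Complex.exp_add]
    push_cast; ring_nf
  rw [polarPt, h1, h2, h4]
  linear_combination (1 - Complex.exp (-(τ / 2 : ℂ) * I) ^ 2) * circlePt b * I_sq +
    circlePt b * h3 * I ^ 2

lemma polarPt_circlePt' (b τ : ℝ) :
    polarPt (circlePt b) (-circlePt b) (2 * Real.sin (τ / 2)) (-(π / 2 - τ / 2)) =
      circlePt (b + τ) := by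
  have := polarPt_circlePt b (-τ)
  rw [← sub_neg_eq_add, ← this, polarPt, polarPt, neg_div, Real.sin_neg]
  have : Complex.exp (((π / 2 - -(τ / 2) : ℝ) : ℂ) * I) =
      - Complex.exp (((-(π / 2 - τ / 2) : ℝ) : ℂ) * I) := by
    calc Complex.exp (((π / 2 - -(τ / 2) : ℝ) : ℂ) * I)
        = Complex.exp (π * I + ((-(π / 2 - τ / 2) : ℝ) : ℂ) * I) := by push_cast; ring_nf
      _ = _ := by rw [Complex.exp_add, Complex.exp_pi_mul_I, neg_one_mul]
  rw [this]
  push_cast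
  ring

/-- The length–area inequality for circular crosscuts of the unit disc centred at a boundary
point, along which a continuous function crosses the interval `[p, q]`. -/
lemma circle_length_area {u : ℂ → ℝ} (hu : ContinuousOn u (closedBall 0 1)) {b τ₁ τ₂ p q l : ℝ}
    (h₁ : 0 < τ₁) (h₁₂ : τ₁ < τ₂) (h₂ : τ₂ ≤ π) (hpq : p < q)
    (hends : ∀ τ ∈ Ioo τ₁ τ₂, (u (circlePt (b - τ)) ≤ p ∧ q ≤ u (circlePt (b + τ))) ∨
      (q ≤ u (circlePt (b - τ)) ∧ u (circlePt (b + τ)) ≤ p)) {W : ℂ → ℝ≥0∞} (hW : Measurable W)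
    (hl : 0 ≤ l)
    (h : ∀ ρ x y, 0 < ρ → x < y →
      (∀ θ ∈ Icc x y, polarPt (circlePt b) (-circlePt b) ρ θ ∈ closedBall 0 1 ∧
        u (polarPt (circlePt b) (-circlePt b) ρ θ) ∈ Icc p q) →
      (∀ θ ∈ Ioo x y, polarPt (circlePt b) (-circlePt b) ρ θ ∈ ball 0 1) →
      |u (polarPt (circlePt b) (-circlePt b) ρ y) - u (polarPt (circlePt b) (-circlePt b) ρ x)| =
        q - p →
      ENNReal.ofReal l ≤
        ∫⁻ θ in Ioo x y, ENNReal.ofReal ρ * W (polarPt (circlePt b) (-circlePt b) ρ θ)) :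
    ENNReal.ofReal (l ^ 2 * Real.log (Real.sin (τ₂ / 2) / Real.sin (τ₁ / 2))) ≤
      ENNReal.ofReal (2 * π) * ∫⁻ z, W z ^ 2 := by
  have hpi := Real.pi_pos
  have hs : ∀ {τ}, 0 < τ → τ ≤ π → 0 < Real.sin (τ / 2) := fun h h' =>
    Real.sin_pos_of_pos_of_lt_pi (by linarith) (by linarith)
  have key := length_area hW (a := circlePt b) (u := -circlePt b)
    (r₁ := 2 * Real.sin (τ₁ / 2)) (r₂ := 2 * Real.sin (τ₂ / 2)) (l := l)
    (by rw [norm_neg, norm_circlePt]) (by linarith [hs h₁ (h₁₂.le.trans h₂)])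
    (by have := Real.sin_lt_sin_of_lt_of_le_pi_div_two (x := τ₁ / 2) (y := τ₂ / 2)
          (by linarith) (by linarith) (by linarith)
        linarith) hl ?_
  · rwa [mul_div_mul_left _ _ two_ne_zero] at key
  intro ρ hρ
  have hρ0 : 0 < ρ := by linarith [hs h₁ (h₁₂.le.trans h₂), hρ.1]
  obtain ⟨τ, hτ, rfl⟩ : ∃ τ ∈ Ioo τ₁ τ₂, 2 * Real.sin (τ / 2) = ρ := by
    refine ⟨2 * Real.arcsin (ρ / 2), ⟨?_, ?_⟩, ?_⟩
    · have := (Real.lt_arcsin_iff_sin_lt' (x := τ₁ / 2) (y := ρ / 2)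
        ⟨by linarith, by linarith⟩).2 (by linarith [hρ.1])
      linarith
    · have := (Real.arcsin_lt_iff_lt_sin' (x := ρ / 2) (y := τ₂ / 2)
        ⟨by linarith, by linarith⟩).2 (by linarith [hρ.2])
      linarith
    · rw [mul_div_cancel_left₀ _ two_ne_zero, Real.sin_arcsin]
      · ring
      · linarith
      · linarith [hρ.2, Real.sin_le_one (τ₂ / 2)]
  have hτ0 : 0 < τ := h₁.trans hτ.1
  have hτp : τ < π := hτ.2.trans_le h₂
  set θ₀ := π / 2 - τ / 2 with hθ₀
  have hcos : Real.cos θ₀ = Real.sin (τ / 2) := Real.cos_pi_div_two_sub _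
  have hin : ∀ θ ∈ Ioo (-θ₀) θ₀,
      polarPt (circlePt b) (-circlePt b) (2 * Real.sin (τ / 2)) θ ∈ ball 0 1 := by
    intro θ hθ
    rw [polarPt_mem_ball_iff (norm_circlePt b) hρ0, ← hcos, ← Real.cos_abs θ]
    have := Real.cos_lt_cos_of_nonneg_of_le_pi (x := |θ|) (y := θ₀) (abs_nonneg _) (by linarith)
      (abs_lt.2 hθ)
    linarith
  have hcl : ∀ θ ∈ Icc (-θ₀) θ₀,
      polarPt (circlePt b) (-circlePt b) (2 * Real.sin (τ / 2)) θ ∈ closedBall 0 1 := by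
    intro θ hθ
    rw [← closure_ball (0 : ℂ) one_ne_zero]
    rw [← closure_Ioo (by linarith : -θ₀ ≠ θ₀)] at hθ
    exact map_mem_closure (continuous_polarPt _ _ _) hθ hin
  obtain ⟨x, y, hx, hxy, hy, hd, hI⟩ := exists_crossing (A := -θ₀) (B := θ₀) (by linarith)
    (φ := fun θ => u (polarPt (circlePt b) (-circlePt b) (2 * Real.sin (τ / 2)) θ))
    (hu.comp (continuous_polarPt _ _ _).continuousOn hcl) hpq (by
      simp only [hθ₀, polarPt_circlePt, polarPt_circlePt']
      rcases hends τ hτ with h | h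
      · exact Or.inr ⟨h.2, h.1⟩
      · exact Or.inl ⟨h.2, h.1⟩)
  refine (h _ x y hρ0 hxy (fun θ hθ => ⟨hcl θ ⟨hx.trans hθ.1, hθ.2.trans hy⟩, hI θ hθ⟩)
    (fun θ hθ => hin θ ⟨hx.trans_lt hθ.1, hθ.2.trans_le hy⟩) hd).trans ?_
  exact lintegral_mono_set (Ioo_subset_Ioo (by linarith) (by linarith))

lemma lintegral_enorm_fderiv_sq_mul {F : ℂ → ℂ} {U : Set ℂ} (hU : IsOpen U)
    (hF : DifferentiableOn ℂ F U) (hi : InjOn F U) (g : ℂ → ℝ≥0∞) :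
    ∫⁻ z in U, ‖fderiv ℝ F z‖ₑ ^ 2 * g (F z) = ∫⁻ w in F '' U, g w := by
  have hd : ∀ z ∈ U, DifferentiableAt ℂ F z := fun z hz => hF.differentiableAt (hU.mem_nhds hz)
  rw [lintegral_image_eq_lintegral_abs_det_fderiv_mul volume hU.measurableSet
    (f' := fun z => fderiv ℝ F z) (fun z hz =>
      ((hd z hz).restrictScalars ℝ).hasFDerivAt.hasFDerivWithinAt) hi]
  refine setLIntegral_congr_fun hU.measurableSet fun z hz => ?_
  rw [det_fderiv_real (hd z hz), abs_of_nonneg (by positivity), ENNReal.ofReal_pow (norm_nonneg _),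
    ofReal_norm]

/-- The pullback of the density `g` under `F`, on the unit disc. -/
def pullbackDensity (F : ℂ → ℂ) (g : ℂ → ℝ≥0∞) : ℂ → ℝ≥0∞ :=
  (ball 0 1).indicator fun z => ‖fderiv ℝ F z‖ₑ * g (F z)

lemma measurable_pullbackDensity {F : ℂ → ℂ} (hF : ContinuousOn F (ball 0 1)) {g : ℂ → ℝ≥0∞}
    (hg : Measurable g) : Measurable (pullbackDensity F g) := by
  classical
  have h1 : Measurable ((ball (0 : ℂ) 1).piecewise F fun _ => 0) :=
    hF.measurable_piecewise continuousOn_const measurableSet_ball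
  have h2 : pullbackDensity F g = (ball 0 1).indicator fun z =>
      ‖fderiv ℝ F z‖ₑ * g ((ball (0 : ℂ) 1).piecewise F (fun _ => 0) z) := by
    refine indicator_congr fun z hz => ?_
    rw [piecewise_eq_of_mem _ _ _ hz]
  rw [h2]
  exact ((measurable_fderiv ℝ F).enorm.mul (hg.comp h1)).indicator measurableSet_ball

lemma lintegral_pullbackDensity_sq_le {F : ℂ → ℂ} (hF : DifferentiableOn ℂ F (ball 0 1))
    (hi : InjOn F (ball 0 1)) (g : ℂ → ℝ≥0∞) :
    ∫⁻ z, pullbackDensity F g z ^ 2 ≤ ∫⁻ w, g w ^ 2 := by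
  calc ∫⁻ z, pullbackDensity F g z ^ 2
      = ∫⁻ z in ball 0 1, ‖fderiv ℝ F z‖ₑ ^ 2 * g (F z) ^ 2 := by
        rw [← lintegral_indicator measurableSet_ball]
        refine lintegral_congr fun z => ?_
        by_cases hz : z ∈ ball (0 : ℂ) 1
        · rw [pullbackDensity, indicator_of_mem hz, indicator_of_mem hz, mul_pow]
        · rw [pullbackDensity, indicator_of_notMem hz, indicator_of_notMem hz, zero_pow two_ne_zero]
    _ = ∫⁻ w in F '' ball 0 1, g w ^ 2 :=
        lintegral_enorm_fderiv_sq_mul isOpen_ball hF hi fun w => g w ^ 2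
    _ ≤ _ := setLIntegral_le_lintegral _ _

/-- The density `1 / |w - z|` restricted to the annulus `p ≤ |w - z| ≤ q`. -/
def annulusDensity (z : ℂ) (p q : ℝ) : ℂ → ℝ≥0∞ :=
  {w | ‖w - z‖ ∈ Icc p q}.indicator fun w => ENNReal.ofReal ‖w - z‖⁻¹

lemma measurable_annulusDensity (z : ℂ) (p q : ℝ) : Measurable (annulusDensity z p q) := by
  refine Measurable.indicator (by fun_prop) ?_
  exact (show Measurable fun w : ℂ => ‖w - z‖ by fun_prop) measurableSet_Icc

lemma lintegral_annulusDensity_sq (z : ℂ) {p q : ℝ} (hp : 0 < p) (hpq : p ≤ q) :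
    ∫⁻ w, annulusDensity z p q w ^ 2 = ENNReal.ofReal (2 * π * Real.log (q / p)) := by
  have hi : IntervalIntegrable (fun ρ : ℝ => ρ⁻¹) volume p q := by
    apply intervalIntegral.intervalIntegrable_inv
    · intro x hx
      rw [uIcc_of_le hpq] at hx
      exact (hp.trans_le hx.1).ne'
    · exact continuousOn_id
  have hintg : ∫⁻ ρ in Icc p q, ENNReal.ofReal ρ⁻¹ = ENNReal.ofReal (Real.log (q / p)) := by
    rw [← integral_inv_of_pos hp (hp.trans_le hpq), intervalIntegral.integral_of_le hpq,
      ← integral_Icc_eq_integral_Ioc, ofReal_integral_eq_lintegral_ofReal]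
    · exact (intervalIntegrable_iff_integrableOn_Icc_of_le hpq).1 hi
    · filter_upwards [ae_restrict_mem measurableSet_Icc] with ρ hρ
      have : 0 < ρ := hp.trans_le hρ.1
      positivity
  rw [← lintegral_polarPt ((measurable_annulusDensity z p q).pow_const 2) (a := z) norm_one]
  calc _ = ∫⁻ ρ in Ioi (0 : ℝ), (Icc p q).indicator
        (fun ρ => ENNReal.ofReal (2 * π) * ENNReal.ofReal ρ⁻¹) ρ := by
        refine setLIntegral_congr_fun measurableSet_Ioi fun ρ (hρ : 0 < ρ) => ?_
        have hn : ∀ θ, ‖polarPt z 1 ρ θ - z‖ = ρ := fun θ => by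
          rw [← dist_eq_norm, dist_polarPt norm_one hρ.le]
        have hv : ∀ θ, annulusDensity z p q (polarPt z 1 ρ θ) =
            (Icc p q).indicator (fun ρ => ENNReal.ofReal ρ⁻¹) ρ := by
          intro θ
          unfold annulusDensity indicator
          simp only [mem_ofPred_eq, hn]
        simp only [hv, lintegral_const, Measure.restrict_apply_univ, Real.volume_Ioo]
        unfold indicator
        split_ifs
        · rw [sq, ← mul_assoc, ← ENNReal.ofReal_mul hρ.le, mul_inv_cancel₀ hρ.ne',
            ENNReal.ofReal_one, one_mul, mul_comm]
          congr 2; ring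
        · simp
    _ = ∫⁻ ρ in Icc p q, ENNReal.ofReal (2 * π) * ENNReal.ofReal ρ⁻¹ := by
        rw [lintegral_indicator measurableSet_Icc, Measure.restrict_restrict measurableSet_Icc,
          inter_eq_left.2 (show Icc p q ⊆ Ioi 0 from fun x hx => hp.trans_le hx.1)]
    _ = _ := by
        rw [lintegral_const_mul' _ _ ENNReal.ofReal_ne_top, hintg,
          ← ENNReal.ofReal_mul (by positivity)]

/-- Arcs of the circle whose images are far apart relative to the smaller diameter. -/
lemma log_le_of_infDist {F : ℂ → ℂ} (hc : ContinuousOn F (closedBall 0 1))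
    (hd : DifferentiableOn ℂ F (ball 0 1)) (hi : InjOn F (ball 0 1)) {b τ₁ τ₂ δ : ℝ}
    (h₁ : 0 < τ₁) (h₁₂ : τ₁ < τ₂) (h₂ : τ₂ ≤ π) (hδ : 0 < δ) {X : Set ℂ} (hX : X.Nonempty)
    (hXb : IsBounded X) (hX0 : 0 < diam X)
    (hends : ∀ τ ∈ Ioo τ₁ τ₂,
      (F (circlePt (b - τ)) ∈ X ∧ δ * diam X ≤ infDist (F (circlePt (b + τ))) X) ∨
      (δ * diam X ≤ infDist (F (circlePt (b - τ))) X ∧ F (circlePt (b + τ)) ∈ X)) :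
    Real.log (Real.sin (τ₂ / 2) / Real.sin (τ₁ / 2)) ≤ 2 * π ^ 2 * (1 + δ) ^ 2 / δ ^ 2 := by
  set m := diam X
  obtain ⟨x₀, hx₀⟩ := hX
  have hZ : MeasurableSet {w | infDist w X ≤ δ * m} :=
    (isClosed_le (continuous_infDist_pt X) continuous_const).measurableSet
  set g : ℂ → ℝ≥0∞ := {w | infDist w X ≤ δ * m}.indicator 1
  have hg : Measurable g := measurable_one.indicator hZ
  have hcb : ContinuousOn F (ball 0 1) := hc.mono ball_subset_closedBall
  have key := circle_length_area (u := fun z => infDist (F z) X)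
    ((continuous_infDist_pt X).comp_continuousOn hc) (b := b) h₁ h₁₂ h₂ (p := 0) (q := δ * m)
    (by positivity) (fun τ hτ => by
      refine (hends τ hτ).imp (fun h => ⟨(infDist_zero_of_mem h.1).le, h.2⟩)
        (fun h => ⟨h.1, (infDist_zero_of_mem h.2).le⟩))
    (measurable_pullbackDensity hcb hg) (l := δ * m) (by positivity) ?_
  · have hvol : ∫⁻ w, g w ^ 2 ≤ ENNReal.ofReal (π * (m + δ * m) ^ 2) := by
      calc ∫⁻ w, g w ^ 2 = volume {w | infDist w X ≤ δ * m} := by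
            rw [← lintegral_indicator_one hZ]
            refine lintegral_congr fun w => ?_
            simp only [g, indicator]
            split_ifs <;> simp
        _ ≤ volume (closedBall x₀ (m + δ * m)) := by
            refine measure_mono fun w hw => ?_
            rw [mem_closedBall]
            refine le_of_forall_pos_le_add fun ε hε => ?_
            obtain ⟨y, hy, hwy⟩ := (infDist_lt_iff ⟨x₀, hx₀⟩).1
              (lt_of_le_of_lt hw (lt_add_of_pos_right (δ * m) hε))
            have := dist_le_diam_of_mem hXb hy hx₀
            linarith [dist_triangle w y x₀, dist_le_diam_of_mem hXb hy hx₀]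
        _ = _ := by
            rw [Complex.volume_closedBall, mul_comm, ENNReal.ofReal_mul Real.pi_pos.le,
              ENNReal.ofReal_pow (by positivity), ← ENNReal.ofReal_coe_nnreal, NNReal.coe_real_pi]
    have h3 := key.trans (mul_le_mul_right ((lintegral_pullbackDensity_sq_le hd hi g).trans hvol)
      (ENNReal.ofReal (2 * π)))
    rw [← ENNReal.ofReal_mul (by positivity), ENNReal.ofReal_le_ofReal_iff (by positivity)] at h3
    rw [le_div_iff₀ (by positivity)]
    have hm2 : 0 < m ^ 2 := by positivity
    refine le_of_mul_le_mul_left ?_ hm2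
    linarith [h3]
  · intro ρ x y hρ hxy hcl hop hdiff
    simp only [sub_zero] at hdiff
    have hF := enorm_sub_le_lintegral_polarPt isOpen_ball (contDiffOn_real isOpen_ball hd)
      (a := circlePt b) (u := -circlePt b) (by rw [norm_neg, norm_circlePt]) hρ.le hxy hop
      (γ := fun θ => F (polarPt (circlePt b) (-circlePt b) ρ θ))
      (hc.comp (continuous_polarPt _ _ _).continuousOn fun θ hθ => (hcl θ hθ).1)
      (fun θ _ => rfl)
    calc ENNReal.ofReal (δ * m) ≤ ∫⁻ θ in Ioo x y, ENNReal.ofReal ρ *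
            ‖fderiv ℝ F (polarPt (circlePt b) (-circlePt b) ρ θ)‖ₑ := by
          rw [← hdiff, ← Real.norm_eq_abs, ofReal_norm]
          refine le_trans ?_ hF
          rw [← ofReal_norm, ← ofReal_norm]
          refine ENNReal.ofReal_le_ofReal ?_
          have := (lipschitz_infDist_pt X).dist_le_mul
            (F (polarPt (circlePt b) (-circlePt b) ρ y)) (F (polarPt (circlePt b) (-circlePt b) ρ x))
          simpa [dist_eq_norm] using this
      _ = _ := by
          refine setLIntegral_congr_fun measurableSet_Ioo fun θ hθ => ?_
          have h5 : F (polarPt (circlePt b) (-circlePt b) ρ θ) ∈ {w | infDist w X ≤ δ * m} :=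
            (hcl θ (Ioo_subset_Icc_self hθ)).2.2
          simp only [pullbackDensity]
          rw [indicator_of_mem (hop θ hθ)]
          simp only [g]
          rw [indicator_of_mem h5, Pi.one_apply, mul_one]

lemma circlePt_eq_iff {x y : ℝ} : circlePt x = circlePt y ↔ ∃ n : ℤ, x = y + n * (2 * π) := by
  unfold circlePt
  rw [Complex.exp_eq_exp_iff_exists_int]
  refine exists_congr fun n => ⟨fun h => ?_, fun h => ?_⟩
  · have := congrArg Complex.im h
    simpa using this
  · rw [h]; push_cast; ring

lemma circlePt_ne {x y : ℝ} (h : x < y) (h' : y < x + 2 * π) : circlePt x ≠ circlePt y := by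
  intro he
  obtain ⟨n, hn⟩ := circlePt_eq_iff.1 he
  have hpi := Real.pi_pos
  have h1 : (-1 : ℝ) < n := by
    by_contra hc
    push Not at hc
    nlinarith
  have h2 : (n : ℝ) < 0 := by
    by_contra hc
    push Not at hc
    nlinarith
  norm_cast at h1 h2
  omega

lemma circlePt_mem_sphere (t : ℝ) : circlePt t ∈ sphere (0 : ℂ) 1 := by
  simp [norm_circlePt]

lemma circlePt_mem_closedBall (t : ℝ) : circlePt t ∈ closedBall (0 : ℂ) 1 :=
  sphere_subset_closedBall (circlePt_mem_sphere t)

lemma exists_circlePt_eq {z : ℂ} (hz : ‖z‖ = 1) (a : ℝ) :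
    ∃ t ∈ Ico a (a + 2 * π), circlePt t = z := by
  have h1 : circlePt (Complex.arg z) = z := by
    have := Complex.norm_mul_exp_arg_mul_I z
    rw [hz, ofReal_one, one_mul] at this
    exact this
  obtain ⟨n, hn, -⟩ := existsUnique_add_zsmul_mem_Ico Real.two_pi_pos (Complex.arg z) a
  exact ⟨_, hn, (circlePt_eq_iff.2 ⟨n, by simp⟩).trans h1⟩

/-- The image under `F` of the arc of the unit circle between the arguments `a` and `b`. -/
def arcImage (F : ℂ → ℂ) (a b : ℝ) : Set ℂ := (fun t => F (circlePt t)) '' Icc a b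

section

variable {F : ℂ → ℂ}

lemma continuous_comp_circlePt (hc : ContinuousOn F (closedBall 0 1))
    : Continuous fun t => F (circlePt t) :=
  hc.comp_continuous continuous_circlePt circlePt_mem_closedBall

lemma isCompact_arcImage (hc : ContinuousOn F (closedBall 0 1))
    (a b : ℝ) : IsCompact (arcImage F a b) :=
  isCompact_Icc.image (continuous_comp_circlePt hc)

lemma diam_arcImage_pos (hc : ContinuousOn F (closedBall 0 1))
    (hi : InjOn F (closedBall 0 1)) {a b : ℝ} (hab : a < b) :
    0 < diam (arcImage F a b) := by
  have hpi := Real.pi_pos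
  set b' := min b (a + π)
  have h1 : a < b' := lt_min hab (by linarith)
  have h2 : b' ≤ a + π := min_le_right _ _
  have h3 : F (circlePt a) ≠ F (circlePt b') := fun h =>
    circlePt_ne h1 (by linarith) (hi (circlePt_mem_closedBall _) (circlePt_mem_closedBall _) h)
  refine (dist_pos.2 h3).trans_le (dist_le_diam_of_mem (isCompact_arcImage hc a b).isBounded
    ⟨a, left_mem_Icc.2 hab.le, rfl⟩ ⟨b', ⟨h1.le, min_le_left _ _⟩, rfl⟩)

/-- Arcs which are far apart relative to the smaller diameter of their images are far apart relative
to their own length. -/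
lemma exists_sub_le_mul_sub (hc : ContinuousOn F (closedBall 0 1))
    (hd : DifferentiableOn ℂ F (ball 0 1)) (hi : InjOn F (closedBall 0 1))
    {δ : ℝ} (hδ : 0 < δ) : ∃ M : ℝ, 1 ≤ M ∧ ∀ a b c d, a < b → b < c → c < d → b - a ≤ π →
      b - a ≤ d - b →
      (∀ x ∈ Icc a b, ∀ y ∈ Icc c d, δ * min (diam (arcImage F a b)) (diam (arcImage F c d)) ≤
        ‖F (circlePt x) - F (circlePt y)‖) → b - a ≤ M * (c - b) := by
  have hpi := Real.pi_pos
  set L := 2 * π ^ 2 * (1 + δ) ^ 2 / δ ^ 2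
  have hL : 0 ≤ L := by positivity
  have hM : 1 ≤ π * Real.exp L := by
    nlinarith [Real.one_le_exp hL, Real.pi_gt_three]
  refine ⟨π * Real.exp L, hM, fun a b c d hab hbc hcd hp hpd h => ?_⟩
  by_cases hcase : b - a ≤ c - b
  · nlinarith
  push Not at hcase
  have hX : ∃ X : Set ℂ, X.Nonempty ∧ IsBounded X ∧ 0 < diam X ∧
      ∀ τ ∈ Ioo (c - b) (b - a),
      (F (circlePt (b - τ)) ∈ X ∧ δ * diam X ≤ infDist (F (circlePt (b + τ))) X) ∨
      (δ * diam X ≤ infDist (F (circlePt (b - τ))) X ∧ F (circlePt (b + τ)) ∈ X) := by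
    have hm1 : ∀ τ ∈ Ioo (c - b) (b - a), b - τ ∈ Icc a b := fun τ hτ =>
      ⟨by linarith [hτ.2], by linarith [hτ.1]⟩
    have hm2 : ∀ τ ∈ Ioo (c - b) (b - a), b + τ ∈ Icc c d := fun τ hτ =>
      ⟨by linarith [hτ.1], by linarith [hτ.2]⟩
    rcases le_total (diam (arcImage F a b)) (diam (arcImage F c d)) with hle | hle
    · have hne : (arcImage F a b).Nonempty := (nonempty_Icc.2 hab.le).image _
      refine ⟨arcImage F a b, hne, (isCompact_arcImage hc a b).isBounded,
        diam_arcImage_pos hc hi hab, fun τ hτ => Or.inl ⟨⟨_, hm1 τ hτ, rfl⟩, ?_⟩⟩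
      rw [le_infDist hne]
      rintro _ ⟨x, hx, rfl⟩
      have := h x hx _ (hm2 τ hτ)
      rwa [min_eq_left hle, ← dist_eq_norm, dist_comm] at this
    · have hne : (arcImage F c d).Nonempty := (nonempty_Icc.2 hcd.le).image _
      refine ⟨arcImage F c d, hne, (isCompact_arcImage hc c d).isBounded,
        diam_arcImage_pos hc hi hcd, fun τ hτ => Or.inr ⟨?_, ⟨_, hm2 τ hτ, rfl⟩⟩⟩
      rw [le_infDist hne]
      rintro _ ⟨x, hx, rfl⟩
      have := h _ (hm1 τ hτ) x hx
      rwa [min_eq_right hle, ← dist_eq_norm] at this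
  obtain ⟨X, hne, hXb, hX0, hends⟩ := hX
  have key := log_le_of_infDist hc hd (hi.mono ball_subset_closedBall) (sub_pos.2 hbc) hcase hp hδ
    hne hXb hX0 hends
  have hs1 : 0 < Real.sin ((c - b) / 2) :=
    Real.sin_pos_of_pos_of_lt_pi (by linarith) (by linarith)
  have hs2 : 0 < Real.sin ((b - a) / 2) :=
    Real.sin_pos_of_pos_of_lt_pi (by linarith) (by linarith)
  rw [Real.log_le_iff_le_exp (div_pos hs2 hs1), div_le_iff₀ hs1] at key
  have h1 : Real.sin ((c - b) / 2) ≤ (c - b) / 2 := Real.sin_le (by linarith)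
  have h2 : 2 / π * ((b - a) / 2) ≤ Real.sin ((b - a) / 2) :=
    Real.mul_le_sin (by linarith) (by linarith)
  have h3 : (b - a) / π ≤ Real.exp L * ((c - b) / 2) := by
    calc (b - a) / π = 2 / π * ((b - a) / 2) := by ring
      _ ≤ _ := h2.trans (key.trans (by gcongr))
  rw [div_le_iff₀ hpi] at h3
  nlinarith [Real.exp_pos L, mul_pos (mul_pos (Real.exp_pos L) hpi) (sub_pos.2 hbc)]

end

namespace IsCaratheodoryMap

variable {F : ℂ → ℂ} {Γ Ω : Set ℂ}

lemma apply_circlePt_ne (h : IsCaratheodoryMap F Γ Ω) {x y : ℝ} (hxy : x < y) (hy : y < x + 2 * π) :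
    F (circlePt x) ≠ F (circlePt y) := fun he =>
  circlePt_ne hxy hy (h.injOn (circlePt_mem_closedBall _) (circlePt_mem_closedBall _) he)

lemma arcImage_subset_or (h : IsCaratheodoryMap F Γ Ω)
    {a b c d x y : ℝ} (hx : x ∈ Icc a b) (hy : y ∈ Icc c d) {A : Set ℂ} (hA : A ⊆ Γ)
    (hAc : IsPreconnected A) (hxA : F (circlePt x) ∈ A) (hyA : F (circlePt y) ∈ A) :
    arcImage F b c ⊆ A ∨ arcImage F d (a + 2 * π) ⊆ A := by
  have hpi := Real.pi_pos
  by_contra! hcon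
  obtain ⟨hs, ht⟩ := hcon
  rw [not_subset] at hs ht
  obtain ⟨_, ⟨s, hs, rfl⟩, hsA⟩ := hs
  obtain ⟨_, ⟨t, ht, rfl⟩, htA⟩ := ht
  have hcov : A ⊆ arcImage F s t ∪ arcImage F t (s + 2 * π) := by
    intro w hw
    obtain ⟨z, hz, rfl⟩ := (h.image_sphere.symm ▸ hA hw : w ∈ F '' sphere 0 1)
    obtain ⟨r, hr, rfl⟩ := exists_circlePt_eq (mem_sphere_zero_iff_norm.1 hz) s
    rcases le_total r t with hrt | hrt
    · exact Or.inl ⟨r, ⟨hr.1, hrt⟩, rfl⟩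
    · exact Or.inr ⟨r, ⟨hrt, hr.2.le⟩, rfl⟩
  obtain ⟨w, hwA, ⟨r, hr, rfl⟩, ⟨r', hr', hrr⟩⟩ := isPreconnected_closed_iff.1 hAc _ _
    (isCompact_arcImage h.continuousOn s t).isClosed
    (isCompact_arcImage h.continuousOn t (s + 2 * π)).isClosed hcov
    ⟨_, hyA, ⟨y, ⟨hs.2.trans hy.1, hy.2.trans ht.1⟩, rfl⟩⟩
    ⟨_, hxA, ⟨x + 2 * π, ⟨by linarith [ht.2, hx.1], by linarith [hx.2, hs.1]⟩, by
      simp only [circlePt_add_two_pi]⟩⟩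
  simp only at hrr hwA
  rcases eq_or_lt_of_le (hr.2.trans hr'.1) with he | hlt
  · have : r = t := le_antisymm hr.2 (he ▸ hr'.1)
    exact htA (this ▸ hwA)
  · rcases eq_or_lt_of_le (show r' ≤ r + 2 * π by linarith [hr.1, hr'.2]) with he | hlt'
    · have : r = s := by linarith [hr.1, hr'.2]
      exact hsA (this ▸ hwA)
    · exact h.apply_circlePt_ne hlt hlt' hrr.symm

lemma min_diam_le (h : IsCaratheodoryMap F Γ Ω)
    {C : ℝ} (hBT : HasBoundedTurning Γ C) {a b c d x y : ℝ}
    (hx : x ∈ Icc b c) (hy : y ∈ Icc d (a + 2 * π)) :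
    min (diam (arcImage F a b)) (diam (arcImage F c d)) ≤
      C * ‖F (circlePt x) - F (circlePt y)‖ := by
  obtain ⟨A, hAΓ, hAc, hxA, hyA, hdA⟩ := hBT _ (h.mapsTo_sphere (norm_circlePt x)) _
    (h.mapsTo_sphere (norm_circlePt y))
  have hAb : IsBounded A := h.isCompact.isBounded.subset hAΓ
  refine le_trans ?_ hdA
  rcases h.arcImage_subset_or hx hy hAΓ hAc hxA hyA with h1 | h1
  · exact (min_le_right _ _).trans (diam_mono h1 hAb)
  · refine (min_le_left _ _).trans (diam_mono (fun w hw => h1 ?_) hAb)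
    obtain ⟨t, ht, rfl⟩ := hw
    exact ⟨t + 2 * π, ⟨by linarith [ht.1], by linarith [ht.2]⟩, by
      simp only [circlePt_add_two_pi]⟩

/-- The length–area estimate on the part of circular crosscuts mapped into an annulus centred at a
boundary point. -/
lemma log_le_of_annulus (h : IsCaratheodoryMap F Γ Ω) {z₁ : ℂ} (hz₁ : z₁ ∈ Γ) {b τ₁ τ₂ p q : ℝ}
    (h₁ : 0 < τ₁) (h₁₂ : τ₁ < τ₂) (h₂ : τ₂ ≤ π) (hp : 0 < p) (hpq : p < q)
    (hends : ∀ τ ∈ Ioo τ₁ τ₂,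
      (‖F (circlePt (b - τ)) - z₁‖ ≤ p ∧ q ≤ ‖F (circlePt (b + τ)) - z₁‖) ∨
      (q ≤ ‖F (circlePt (b - τ)) - z₁‖ ∧ ‖F (circlePt (b + τ)) - z₁‖ ≤ p)) :
    Real.log (q / p) * Real.log (Real.sin (τ₂ / 2) / Real.sin (τ₁ / 2)) ≤ 4 * π ^ 2 := by
  have hpi := Real.pi_pos
  have hq : 0 < q := hp.trans hpq
  have hl : 0 < Real.log (q / p) := Real.log_pos ((one_lt_div hp).2 hpq)
  have hcb : ContinuousOn F (ball 0 1) := h.continuousOn.mono ball_subset_closedBall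
  have hne : ∀ z ∈ ball (0 : ℂ) 1, F z - z₁ ≠ 0 := fun z hz he =>
    h.isJordanInterior.disjoint.le_bot ⟨h.bijOn.mapsTo hz, (sub_eq_zero.1 he) ▸ hz₁⟩
  have hh : ContDiffOn ℝ 1 (fun z => Real.log ‖F z - z₁‖) (ball 0 1) := by
    have h1 : ContDiffOn ℝ 1 (fun z => ‖F z - z₁‖) (ball 0 1) :=
      ((contDiffOn_real isOpen_ball h.differentiableOn).sub contDiffOn_const).norm ℝ hne
    exact h1.log fun z hz => norm_ne_zero_iff.2 (hne z hz)
  have hder : ∀ z ∈ ball (0 : ℂ) 1, ‖fderiv ℝ (fun z => Real.log ‖F z - z₁‖) z‖ₑ ≤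
      ‖fderiv ℝ F z‖ₑ * ENNReal.ofReal ‖F z - z₁‖⁻¹ := by
    intro z hz
    have hF : HasFDerivAt F (fderiv ℝ F z) z := ((h.differentiableOn.differentiableAt
      (isOpen_ball.mem_nhds hz)).restrictScalars ℝ).hasFDerivAt
    have hN : HasFDerivAt (fun w : ℂ => ‖w‖) (fderiv ℝ (fun w : ℂ => ‖w‖) (F z - z₁)) (F z - z₁) :=
      ((contDiffAt_norm ℝ (hne z hz)).differentiableAt one_ne_zero).hasFDerivAt
    have h1 := ((hN.comp z (hF.sub_const z₁)).log (norm_ne_zero_iff.2 (hne z hz))).fderiv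
    have h2 : ‖fderiv ℝ (fun w : ℂ => ‖w‖) (F z - z₁)‖ ≤ 1 := by
      simpa using norm_fderiv_le_of_lipschitz ℝ (lipschitzWith_one_norm (E := ℂ))
        (x₀ := F z - z₁)
    simp only [Function.comp_apply] at h1
    rw [← ofReal_norm, ← ofReal_norm, ← ENNReal.ofReal_mul (norm_nonneg _)]
    refine ENNReal.ofReal_le_ofReal ?_
    change ‖fderiv ℝ (fun z => Real.log ‖F z - z₁‖) z‖ ≤ _
    have h3 : fderiv ℝ (fun z => Real.log ‖F z - z₁‖) z = _ := h1
    rw [h3, norm_smul, mul_comm, norm_inv, norm_norm]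
    refine mul_le_mul_of_nonneg_right ?_ (by positivity)
    refine (ContinuousLinearMap.opNorm_comp_le _ _).trans ?_
    exact mul_le_of_le_one_left (norm_nonneg _) h2
  have key := circle_length_area (u := fun z => ‖F z - z₁‖)
    (h.continuousOn.sub continuousOn_const).norm h₁ h₁₂ h₂ hpq hends
    (measurable_pullbackDensity hcb (measurable_annulusDensity z₁ p q)) (l := Real.log (q / p))
    hl.le ?_
  · have h3 := key.trans (mul_le_mul_right ((lintegral_pullbackDensity_sq_le h.differentiableOn
      h.bijOn.injOn _).trans (lintegral_annulusDensity_sq z₁ hp hpq.le).le)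
      (ENNReal.ofReal (2 * π)))
    rw [← ENNReal.ofReal_mul (by positivity), ENNReal.ofReal_le_ofReal_iff (by positivity)] at h3
    refine le_of_mul_le_mul_left ?_ hl
    linarith [h3]
  · intro ρ x y hρ hxy hcl hop hdiff
    have hlog := enorm_sub_le_lintegral_polarPt isOpen_ball hh
      (a := circlePt b) (u := -circlePt b) (by rw [norm_neg, norm_circlePt]) hρ.le hxy hop
      (γ := fun θ => Real.log ‖F (polarPt (circlePt b) (-circlePt b) ρ θ) - z₁‖)
      (by
        refine ContinuousOn.log ?_ fun θ hθ => (hp.trans_le (hcl θ hθ).2.1).ne'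
        exact ((h.continuousOn.comp (continuous_polarPt _ _ _).continuousOn fun θ hθ =>
          (hcl θ hθ).1).sub continuousOn_const).norm)
      (fun θ _ => rfl)
    have hxI := (hcl x (left_mem_Icc.2 hxy.le)).2
    have hyI := (hcl y (right_mem_Icc.2 hxy.le)).2
    calc ENNReal.ofReal (Real.log (q / p)) ≤ ∫⁻ θ in Ioo x y, ENNReal.ofReal ρ *
            ‖fderiv ℝ (fun z => Real.log ‖F z - z₁‖) (polarPt (circlePt b) (-circlePt b) ρ θ)‖ₑ := by
          refine le_trans ?_ hlog
          rw [← ofReal_norm, Real.norm_eq_abs]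
          refine ENNReal.ofReal_le_ofReal ?_
          rw [Real.log_div hq.ne' hp.ne']
          rcases abs_cases (‖F (polarPt (circlePt b) (-circlePt b) ρ y) - z₁‖ -
            ‖F (polarPt (circlePt b) (-circlePt b) ρ x) - z₁‖) with hh | hh
          · rw [show ‖F (polarPt (circlePt b) (-circlePt b) ρ y) - z₁‖ = q by
                linarith [hxI.1, hyI.2, hh.1],
              show ‖F (polarPt (circlePt b) (-circlePt b) ρ x) - z₁‖ = p by
                linarith [hxI.1, hyI.2, hh.1]]
            exact le_abs_self _
          · rw [show ‖F (polarPt (circlePt b) (-circlePt b) ρ x) - z₁‖ = q by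
                linarith [hyI.1, hxI.2, hh.1],
              show ‖F (polarPt (circlePt b) (-circlePt b) ρ y) - z₁‖ = p by
                linarith [hyI.1, hxI.2, hh.1], abs_sub_comm]
            exact le_abs_self _
      _ ≤ _ := by
          refine setLIntegral_mono' measurableSet_Ioo fun θ hθ => ?_
          gcongr
          have h5 : F (polarPt (circlePt b) (-circlePt b) ρ θ) ∈ {w | ‖w - z₁‖ ∈ Icc p q} :=
            (hcl θ (Ioo_subset_Icc_self hθ)).2
          simp only [pullbackDensity]
          rw [indicator_of_mem (hop θ hθ)]
          simp only [annulusDensity]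
          rw [indicator_of_mem h5]
          exact hder _ (hop θ hθ)

/-- Arcs which are comparable to their separation have images which are far apart relative to the
smaller diameter. -/
lemma exists_le_norm_sub (h : IsCaratheodoryMap F Γ Ω)
    {C : ℝ} (hC : 1 ≤ C) (hBT : HasBoundedTurning Γ C) :
    ∃ δ : ℝ, 0 < δ ∧ ∀ a t, 0 < t → 3 * t ≤ π → ∀ x ∈ Icc a (a + t),
      ∀ y ∈ Icc (a + 2 * t) (a + t + π),
      δ * min (diam (arcImage F a (a + t))) (diam (arcImage F (a + 2 * t) (a + t + π))) ≤
        ‖F (circlePt x) - F (circlePt y)‖ := by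
  have hpi := Real.pi_pos
  have hC0 : 0 < C := by linarith
  have h3 : 1 < √3 := by
    rw [Real.lt_sqrt] <;> norm_num
  have hl3 := Real.log_pos h3
  set L := 4 * π ^ 2 / Real.log √3
  have hL : 0 ≤ L := by positivity
  have hE : 1 ≤ Real.exp L := Real.one_le_exp hL
  refine ⟨1 / (C ^ 2 * (1 + Real.exp L)), by positivity, fun a t ht ht3 x hx y hy => ?_⟩
  set m := min (diam (arcImage F a (a + t))) (diam (arcImage F (a + 2 * t) (a + t + π))) with hm
  set r := ‖F (circlePt x) - F (circlePt y)‖ with hr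
  have hr0 : 0 < r := norm_pos_iff.2 (sub_ne_zero.2 (h.apply_circlePt_ne
    (by linarith [hx.2, hy.1]) (by linarith [hx.1, hy.2])))
  suffices hs : m / C - C * r ≤ Real.exp L * (C * r) by
    rw [one_div_mul_eq_div, div_le_iff₀ (by positivity)]
    have : m / C ≤ C * r * (1 + Real.exp L) := by linarith
    rw [div_le_iff₀ hC0] at this
    linarith
  by_contra! hcon
  have hpq : C * r < m / C - C * r := by nlinarith [mul_pos hC0 hr0]
  obtain ⟨A, hAΓ, hAc, hxA, hyA, hdA⟩ := hBT _ (h.mapsTo_sphere (norm_circlePt x)) _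
    (h.mapsTo_sphere (norm_circlePt y))
  have hAb : IsBounded A := h.isCompact.isBounded.subset hAΓ
  have hnear : ∀ w ∈ A, ‖w - F (circlePt x)‖ ≤ C * r := fun w hw => by
    rw [← dist_eq_norm]; exact (dist_le_diam_of_mem hAb hw hxA).trans hdA
  have hfar : ∀ s ∈ Icc (a + t) (a + 2 * t), ∀ s' ∈ Icc (a + t + π) (a + 2 * π),
      m / C ≤ ‖F (circlePt s) - F (circlePt s')‖ := by
    intro s hs s' hs'
    rw [div_le_iff₀ hC0, mul_comm]
    exact h.min_diam_le hBT hs hs'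
  have hm1 : ∀ τ ∈ Ioo t (2 * t), a + τ ∈ Icc (a + t) (a + 2 * t) := fun τ hτ =>
    ⟨by linarith [hτ.1], by linarith [hτ.2]⟩
  have hm2 : ∀ τ ∈ Ioo t (2 * t), a - τ + 2 * π ∈ Icc (a + t + π) (a + 2 * π) := fun τ hτ =>
    ⟨by linarith [hτ.2], by linarith [hτ.1]⟩
  have key := h.log_le_of_annulus (h.mapsTo_sphere (norm_circlePt x)) (b := a) (τ₁ := t)
    (τ₂ := 2 * t) ht (by linarith) (by linarith) (mul_pos hC0 hr0) hpq (by
      rcases h.arcImage_subset_or hx hy hAΓ hAc hxA hyA with h1 | h1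
      · refine fun τ hτ => Or.inr ?_
        have hn := hnear _ (h1 ⟨_, hm1 τ hτ, rfl⟩)
        refine ⟨?_, hn⟩
        have hf := hfar _ (hm1 τ hτ) _ (hm2 τ hτ)
        rw [circlePt_add_two_pi] at hf
        have := norm_sub_le_norm_sub_add_norm_sub (F (circlePt (a + τ))) (F (circlePt x))
          (F (circlePt (a - τ)))
        rw [norm_sub_rev (F (circlePt x))] at this
        simp only at hn
        linarith
      · refine fun τ hτ => Or.inl ?_
        have hn := hnear _ (h1 ⟨_, hm2 τ hτ, rfl⟩)
        simp only [circlePt_add_two_pi] at hn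
        refine ⟨hn, ?_⟩
        have hf := hfar _ (hm1 τ hτ) _ (hm2 τ hτ)
        rw [circlePt_add_two_pi] at hf
        have := norm_sub_le_norm_sub_add_norm_sub (F (circlePt (a + τ))) (F (circlePt x))
          (F (circlePt (a - τ)))
        rw [norm_sub_rev (F (circlePt x))] at this
        linarith)
  have hs1 : 0 < Real.sin (t / 2) := Real.sin_pos_of_pos_of_lt_pi (by linarith) (by linarith)
  have hratio : √3 ≤ Real.sin (2 * t / 2) / Real.sin (t / 2) := by
    rw [le_div_iff₀ hs1, show 2 * t / 2 = 2 * (t / 2) by ring, Real.sin_two_mul]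
    have : Real.cos (π / 6) ≤ Real.cos (t / 2) :=
      Real.cos_le_cos_of_nonneg_of_le_pi (by linarith) (by linarith) (by linarith)
    rw [Real.cos_pi_div_six] at this
    nlinarith
  have hp0 : 0 < C * r := by positivity
  have hlq : 0 < Real.log ((m / C - C * r) / (C * r)) := Real.log_pos ((one_lt_div hp0).2 hpq)
  have h5 : Real.log ((m / C - C * r) / (C * r)) ≤ L := by
    rw [le_div_iff₀ hl3]
    refine le_trans ?_ key
    gcongr
  rw [Real.log_le_iff_le_exp (div_pos (hp0.trans hpq) hp0), div_le_iff₀ hp0] at h5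
  linarith

end IsCaratheodoryMap

/-- Lifts to the line of the orientation preserving homeomorphisms of the circle. -/
structure IsCircleLift (σ : ℝ → ℝ) : Prop where
  continuous : Continuous σ
  strictMono : StrictMono σ
  add_two_pi : ∀ t, σ (t + 2 * π) = σ t + 2 * π

namespace IsCircleLift

variable {σ : ℝ → ℝ}

lemma reflect (h : IsCircleLift σ) : IsCircleLift fun t => -σ (-t) where
  continuous := (h.continuous.comp continuous_neg).neg
  strictMono := fun x y hxy => neg_lt_neg (h.strictMono (neg_lt_neg hxy))
  add_two_pi := fun t => by
    have := h.add_two_pi (-(t + 2 * π))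
    rw [show -(t + 2 * π) + 2 * π = -t by ring] at this
    linarith

lemma periodic (h : IsCircleLift σ)
    (s : ℝ) : Function.Periodic (fun x => σ (x + s) - σ x) (2 * π) := fun x => by
  simp only
  rw [add_right_comm, h.add_two_pi, h.add_two_pi]; ring

lemma exists_le_sub (h : IsCircleLift σ)
    {s : ℝ} (hs : 0 < s) : ∃ c, 0 < c ∧ ∀ x, c ≤ σ (x + s) - σ x := by
  have hk := (h.periodic s).compact_of_continuous Real.two_pi_pos.ne'
    ((h.continuous.comp (continuous_id.add continuous_const)).sub h.continuous)
  obtain ⟨c, ⟨x, hx⟩, hc⟩ := hk.exists_isLeast (range_nonempty _)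
  refine ⟨c, ?_, fun y => hc ⟨y, rfl⟩⟩
  rw [← hx]
  exact sub_pos.2 (h.strictMono (lt_add_of_pos_right x hs))

lemma exists_sub_le (h : IsCircleLift σ) {ε : ℝ} (hε : 0 < ε) :
    ∃ t₀, 0 < t₀ ∧ ∀ x t, 0 ≤ t → t ≤ t₀ → σ (x + t) - σ x ≤ ε := by
  have hu := isCompact_Icc.uniformContinuousOn_of_continuous
    (h.continuous.continuousOn (s := Icc 0 (2 * π + 1)))
  obtain ⟨δ, hδ, H⟩ := Metric.uniformContinuousOn_iff.1 hu ε hε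
  refine ⟨min (δ / 2) 1, by positivity, fun x t ht ht' => ?_⟩
  obtain ⟨y, hy, hxy⟩ := (h.periodic t).exists_mem_Ico₀ Real.two_pi_pos x
  rw [hxy]
  have h1 := ht'.trans (min_le_left _ _)
  have h2 := ht'.trans (min_le_right _ _)
  have := H (y + t) ⟨by linarith [hy.1], by linarith [hy.2]⟩ y ⟨hy.1, by linarith [hy.2]⟩ (by
    rw [Real.dist_eq, add_sub_cancel_left, abs_of_nonneg ht]; linarith)
  exact (le_abs_self _).trans this.le

lemma sub_bounds (h : IsCircleLift σ) (x y : ℝ) :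
    y - x - 2 * π ≤ σ y - σ x ∧ σ y - σ x ≤ y - x + 2 * π := by
  have hp : Function.Periodic (fun x => σ x - x) (2 * π) := fun x => by
    simp only [h.add_two_pi]; ring
  have hpi := Real.two_pi_pos
  obtain ⟨z, hz, he⟩ := hp.exists_mem_Ico hpi y x
  have h1 := h.strictMono.monotone hz.1
  have h2 := h.strictMono.monotone hz.2.le
  rw [h.add_two_pi] at h2
  constructor <;> linarith [hz.1, hz.2]

lemma image_Icc (h : IsCircleLift σ) (a b : ℝ) (hab : a ≤ b) : σ '' Icc a b = Icc (σ a) (σ b) := by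
  refine Subset.antisymm ?_ (intermediate_value_Icc hab h.continuous.continuousOn)
  rintro _ ⟨t, ht, rfl⟩
  exact ⟨h.strictMono.monotone ht.1, h.strictMono.monotone ht.2⟩

/-- An inequality between neighbouring increments at small scales extends to all scales. -/
lemma exists_of_small (h : IsCircleLift σ) {M t₀ : ℝ} (ht₀ : 0 < t₀)
    (hM : ∀ a t, 0 < t → t ≤ t₀ → σ (a + t) - σ a ≤ M * (σ (a + 2 * t) - σ (a + t))) :
    ∃ M', 1 ≤ M' ∧ ∀ x t, 0 < t → σ x - σ (x - t) ≤ M' * (σ (x + t) - σ x) := by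
  have hpi := Real.pi_pos
  obtain ⟨c, hc, hc'⟩ := h.exists_le_sub ht₀
  refine ⟨max (max M 3) (6 * π / c), le_max_of_le_left (le_max_of_le_right (by norm_num)),
    fun x t ht => ?_⟩
  have hpos : 0 < σ (x + t) - σ x := sub_pos.2 (h.strictMono (by linarith))
  have hb := h.sub_bounds (x - t) x
  have hb' := h.sub_bounds x (x + t)
  rcases le_total t t₀ with h1 | h1
  · have := hM (x - t) t ht h1
    rw [sub_add_cancel, show x - t + 2 * t = x + t by ring] at this
    refine this.trans ?_
    gcongr
    exact le_max_of_le_left (le_max_left _ _)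
  · rcases le_total t (4 * π) with h2 | h2
    · have h3 : c ≤ σ (x + t) - σ x :=
        (hc' x).trans (by linarith [h.strictMono.monotone (show x + t₀ ≤ x + t by linarith)])
      calc σ x - σ (x - t) ≤ 6 * π / c * c := by rw [div_mul_cancel₀ _ hc.ne']; linarith [hb.2]
        _ ≤ max (max M 3) (6 * π / c) * (σ (x + t) - σ x) := by
          gcongr
          exact le_max_right _ _
    · calc σ x - σ (x - t) ≤ 3 * (σ (x + t) - σ x) := by linarith [hb.2, hb'.1]
        _ ≤ max (max M 3) (6 * π / c) * (σ (x + t) - σ x) := by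
          gcongr
          exact le_max_of_le_left (le_max_right _ _)

end IsCircleLift

/-- One half of quasisymmetry for a welding homeomorphism. -/
lemma exists_sub_le_mul_of_welding {F H : ℂ → ℂ} {Γ Ω : Set ℂ} {σ : ℝ → ℝ} {C k₁ k₂ : ℝ}
    (hF : IsCaratheodoryMap F Γ Ω) (hC : 1 ≤ C) (hBT : HasBoundedTurning Γ C)
    (hc : ContinuousOn H (closedBall 0 1)) (hd : DifferentiableOn ℂ H (ball 0 1))
    (hi : InjOn H (closedBall 0 1)) (hσ : IsCircleLift σ) (hk₁ : 0 < k₁) (hk₂ : 0 < k₂)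
    (h₁ : ∀ s t, k₁ * ‖F (circlePt s) - F (circlePt t)‖ ≤
      ‖H (circlePt (σ s)) - H (circlePt (σ t))‖)
    (h₂ : ∀ s t, ‖H (circlePt (σ s)) - H (circlePt (σ t))‖ ≤
      k₂ * ‖F (circlePt s) - F (circlePt t)‖) :
    ∃ M, 1 ≤ M ∧ ∀ x t, 0 < t → σ x - σ (x - t) ≤ M * (σ (x + t) - σ x) := by
  have hpi := Real.pi_pos
  obtain ⟨δ, hδ, H1⟩ := hF.exists_le_norm_sub hC hBT
  obtain ⟨M, hM, H2⟩ := exists_sub_le_mul_sub hc hd hi (δ := k₁ * δ / k₂) (by positivity)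
  obtain ⟨c, hc0, hcπ⟩ := hσ.exists_le_sub hpi
  obtain ⟨t₀, ht₀, hsm⟩ := hσ.exists_sub_le (ε := min π c) (by positivity)
  refine hσ.exists_of_small (M := M) (t₀ := min t₀ (π / 3)) (by positivity) fun a t ht ht' => ?_
  have ht1 := ht'.trans (min_le_left _ _)
  have ht2 := ht'.trans (min_le_right _ _)
  have hdiam : ∀ a b, a ≤ b → diam (arcImage H (σ a) (σ b)) ≤ k₂ * diam (arcImage F a b) := by
    intro a b hab
    refine diam_le_of_forall_dist_le (mul_nonneg hk₂.le diam_nonneg) ?_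
    rintro _ ⟨x, hx, rfl⟩ _ ⟨y, hy, rfl⟩
    rw [← hσ.image_Icc a b hab] at hx hy
    obtain ⟨x, hx, rfl⟩ := hx
    obtain ⟨y, hy, rfl⟩ := hy
    rw [dist_eq_norm]
    refine (h₂ x y).trans ?_
    gcongr
    rw [← dist_eq_norm]
    exact dist_le_diam_of_mem (isCompact_arcImage hF.continuousOn a b).isBounded
      ⟨x, hx, rfl⟩ ⟨y, hy, rfl⟩
  have hsm' := hsm a t ht.le ht1
  refine H2 (σ a) (σ (a + t)) (σ (a + 2 * t)) (σ (a + t + π)) (hσ.strictMono (by linarith))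
    (hσ.strictMono (by linarith)) (hσ.strictMono (by linarith))
    (hsm'.trans (min_le_left _ _)) ((hsm'.trans (min_le_right _ _)).trans (hcπ _)) ?_
  intro x hx y hy
  rw [← hσ.image_Icc _ _ (by linarith)] at hx hy
  obtain ⟨x, hx, rfl⟩ := hx
  obtain ⟨y, hy, rfl⟩ := hy
  have hm : min (diam (arcImage H (σ a) (σ (a + t))))
      (diam (arcImage H (σ (a + 2 * t)) (σ (a + t + π)))) ≤
      k₂ * min (diam (arcImage F a (a + t))) (diam (arcImage F (a + 2 * t) (a + t + π))) := by
    rw [mul_min_of_nonneg _ _ hk₂.le]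
    exact min_le_min (hdiam _ _ (by linarith)) (hdiam _ _ (by linarith))
  calc _ ≤ k₁ * δ / k₂ * (k₂ * min (diam (arcImage F a (a + t)))
        (diam (arcImage F (a + 2 * t) (a + t + π)))) := by gcongr
    _ = k₁ * (δ * min (diam (arcImage F a (a + t)))
        (diam (arcImage F (a + 2 * t) (a + t + π)))) := by field_simp
    _ ≤ k₁ * ‖F (circlePt x) - F (circlePt y)‖ := by
        gcongr
        exact H1 a t ht (by linarith) x hx y hy
    _ ≤ _ := h₁ x y

lemma HasBoundedTurning.conj {Γ : Set ℂ} {C : ℝ} (h : HasBoundedTurning Γ C) :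
    HasBoundedTurning (conj '' Γ) C := by
  rintro _ ⟨z, hz, rfl⟩ _ ⟨w, hw, rfl⟩
  obtain ⟨A, hA, hAc, hzA, hwA, hd⟩ := h z hz w hw
  refine ⟨conj '' A, image_mono hA, hAc.image _ Complex.continuous_conj.continuousOn,
    mem_image_of_mem _ hzA, mem_image_of_mem _ hwA, ?_⟩
  have h1 : diam (⇑conjLIE '' A) = diam A := conjLIE.isometry.diam_image A
  calc _ = diam A := h1
    _ ≤ _ := hd
    _ = _ := by rw [← map_sub, Complex.norm_conj]

lemma conj_mem_ball {z : ℂ} : conj z ∈ ball (0 : ℂ) 1 ↔ z ∈ ball (0 : ℂ) 1 := by simp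

lemma conj_mem_closedBall {z : ℂ} : conj z ∈ closedBall (0 : ℂ) 1 ↔ z ∈ closedBall (0 : ℂ) 1 := by
  simp

lemma continuousOn_conj_comp_conj {F : ℂ → ℂ} (h : ContinuousOn F (closedBall 0 1)) :
    ContinuousOn (fun z => conj (F (conj z))) (closedBall 0 1) :=
  Complex.continuous_conj.comp_continuousOn
    (h.comp Complex.continuous_conj.continuousOn fun _ hz => conj_mem_closedBall.2 hz)

lemma differentiableOn_conj_comp_conj {F : ℂ → ℂ} (h : DifferentiableOn ℂ F (ball 0 1)) :
    DifferentiableOn ℂ (fun z => conj (F (conj z))) (ball 0 1) := fun z hz => by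
  have h1 := (h.differentiableAt (isOpen_ball.mem_nhds (conj_mem_ball.2 hz))).conj_conj
  rw [Complex.conj_conj] at h1
  exact h1.differentiableWithinAt

lemma injOn_conj_comp_conj {F : ℂ → ℂ} {A B : Set ℂ} (h : InjOn F A) (hm : MapsTo conj B A) :
    InjOn (fun z => conj (F (conj z))) B := fun _ hz _ hw he =>
  (starRingEnd ℂ).injective (h (hm hz) (hm hw) ((starRingEnd ℂ).injective he))

lemma IsCaratheodoryMap.conj {F : ℂ → ℂ} {Γ Ω : Set ℂ} (h : IsCaratheodoryMap F Γ Ω) :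
    IsCaratheodoryMap (fun z => conj (F (conj z))) (conj '' Γ) (conj '' Ω) := by
  set e : ℂ ≃ₜ ℂ := conjLIE.toHomeomorph
  have he : ∀ A : Set ℂ, (conj '' A : Set ℂ) = e '' A := fun A => rfl
  have hcc := Complex.continuous_conj
  refine ⟨⟨⟨?_, ?_, ?_, ?_, ?_, ?_⟩, h.isCompact.image hcc, h.isPreconnected.image _ hcc.continuousOn,
    differentiableOn_conj_comp_conj h.differentiableOn, ?_⟩,
    continuousOn_conj_comp_conj h.continuousOn, ?_⟩
  · rw [he]; exact e.isOpenMap _ h.isJordanInterior.isOpen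
  · exact h.isJordanInterior.isConnected.image _ hcc.continuousOn
  · exact conjLIE.isometry.lipschitz.isBounded_image h.isJordanInterior.isBounded
  · exact (disjoint_image_iff (starRingEnd ℂ).injective).2 h.isJordanInterior.disjoint
  · rw [he, he, ← e.image_frontier, h.isJordanInterior.frontier_eq]
  · rw [he, ← e.image_compl]
    exact h.isJordanInterior.isPreconnected_compl.image _ e.continuous.continuousOn
  · refine ⟨fun z hz => ⟨_, h.bijOn.mapsTo (conj_mem_ball.2 hz), rfl⟩,
      injOn_conj_comp_conj h.bijOn.injOn fun z hz => conj_mem_ball.2 hz, ?_⟩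
    rintro _ ⟨w, hw, rfl⟩
    obtain ⟨z, hz, rfl⟩ := h.bijOn.surjOn hw
    exact ⟨conj z, conj_mem_ball.2 hz, by simp⟩
  · rintro _ ⟨w, hw, rfl⟩
    rw [← image_singleton, ← image_sdiff (starRingEnd ℂ).injective]
    exact (h.isPreconnected_diff w hw).image _ hcc.continuousOn

lemma conj_circlePt (t : ℝ) : conj (circlePt t) = circlePt (-t) := by
  unfold circlePt
  rw [← Complex.exp_conj]
  simp

/-- The quasisymmetry condition of Beurling and Ahlfors. -/
structure IsQuasisymmetricLift (σ : ℝ → ℝ) (M : ℝ) : Prop extends IsCircleLift σ where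
  one_le : 1 ≤ M
  left_le : ∀ x t, 0 < t → σ x - σ (x - t) ≤ M * (σ (x + t) - σ x)
  right_le : ∀ x t, 0 < t → σ (x + t) - σ x ≤ M * (σ x - σ (x - t))

lemma IsWelding.exists_isQuasisymmetricLift {Γ Ω Ω' : Set ℂ} {p : ℂ} {F G : ℂ → ℂ} {σ : ℝ → ℝ}
    (h : IsWelding Γ Ω Ω' p F G σ) {C : ℝ} (hC : 1 ≤ C) (hBT : HasBoundedTurning Γ C) :
    ∃ M, IsQuasisymmetricLift σ M := by
  have hσ : IsCircleLift σ := ⟨h.continuous, h.strictMono, h.add_two_pi⟩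
  have hpΓ : p ∉ Γ := fun hp => h.inner.isJordanInterior.disjoint.le_bot ⟨h.mem, hp⟩
  obtain ⟨a, b, ha, hb, hab⟩ := exists_norm_sub_bounds h.inner.isCompact hpΓ
  have hG : ∀ t, G (circlePt (-σ t)) = (F (circlePt t) - p)⁻¹ := fun t => by
    refine eq_inv_of_mul_eq_one_right ?_
    have := h.mul_eq t
    unfold circlePt
    push_cast
    exact this
  have hbd : ∀ s t, (b ^ 2)⁻¹ * ‖F (circlePt s) - F (circlePt t)‖ ≤
      ‖G (circlePt (-σ s)) - G (circlePt (-σ t))‖ ∧ ‖G (circlePt (-σ s)) - G (circlePt (-σ t))‖ ≤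
      (a ^ 2)⁻¹ * ‖F (circlePt s) - F (circlePt t)‖ := by
    intro s t
    rw [hG, hG]
    have := inv_sub_bounds ha hb (hab _ (h.inner.mapsTo_sphere (norm_circlePt s)))
      (hab _ (h.inner.mapsTo_sphere (norm_circlePt t)))
    rw [inv_mul_le_iff₀ (by positivity), inv_mul_eq_div]
    exact this
  have hconj : ∀ z w : ℂ, ‖conj z - conj w‖ = ‖z - w‖ := fun z w => by
    rw [← map_sub, Complex.norm_conj]
  obtain ⟨M₁, hM₁, h1⟩ := exists_sub_le_mul_of_welding (H := fun z => conj (G (conj z))) h.inner hC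
    hBT (continuousOn_conj_comp_conj h.outer.continuousOn)
    (differentiableOn_conj_comp_conj h.outer.differentiableOn)
    (injOn_conj_comp_conj h.outer.injOn fun z hz => conj_mem_closedBall.2 hz) hσ
    (k₁ := (b ^ 2)⁻¹) (k₂ := (a ^ 2)⁻¹) (by positivity) (by positivity)
    (fun s t => by
      simp only [hconj, conj_circlePt]; exact (hbd s t).1)
    (fun s t => by
      simp only [hconj, conj_circlePt]; exact (hbd s t).2)
  obtain ⟨M₂, hM₂, h2⟩ := exists_sub_le_mul_of_welding (H := G) h.inner.conj hC
    hBT.conj h.outer.continuousOn h.outer.differentiableOn h.outer.injOn hσ.reflect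
    (k₁ := (b ^ 2)⁻¹) (k₂ := (a ^ 2)⁻¹) (by positivity) (by positivity)
    (fun s t => by
      simp only [hconj, conj_circlePt]; exact (hbd (-s) (-t)).1)
    (fun s t => by
      simp only [hconj, conj_circlePt]; exact (hbd (-s) (-t)).2)
  refine ⟨max M₁ M₂, hσ, hM₁.trans (le_max_left _ _), fun x t ht => ?_, fun x t ht => ?_⟩
  · have h0 : 0 < σ (x + t) - σ x := sub_pos.2 (h.strictMono (by linarith))
    refine (h1 x t ht).trans ?_
    gcongr
    exact le_max_left _ _
  · have h0 : 0 < σ x - σ (x - t) := sub_pos.2 (h.strictMono (by linarith))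
    have h3 := h2 (-x) t ht
    rw [neg_neg, show -(-x - t) = x + t by ring, show -(-x + t) = x - t by ring] at h3
    calc σ (x + t) - σ x ≤ M₂ * (σ x - σ (x - t)) := by linarith
      _ ≤ _ := by
        gcongr
        exact le_max_right _ _

/-- The average of `σ` over the segment from `x` to `x + h`. -/
def segMean (σ : ℝ → ℝ) (x h : ℝ) : ℝ := ∫ t in (0 : ℝ)..1, σ (x + t * h)

/-- The Beurling–Ahlfors extension of `σ`, in coordinates where the boundary is the imaginary
axis. -/
def beurlingAhlfors (σ : ℝ → ℝ) (w : ℂ) : ℂ :=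
  ((segMean σ w.im w.re - segMean σ w.im (-w.re)) / 2 : ℝ) +
    ((segMean σ w.im w.re + segMean σ w.im (-w.re)) / 2 : ℝ) * I

lemma segMean_zero (σ : ℝ → ℝ) (x : ℝ) : segMean σ x 0 = σ x := by
  simp [segMean]

lemma beurlingAhlfors_re (σ : ℝ → ℝ) (w : ℂ) : (beurlingAhlfors σ w).re =
    (segMean σ w.im w.re - segMean σ w.im (-w.re)) / 2 := by
  simp [beurlingAhlfors, -ofReal_div, -ofReal_sub, -ofReal_add]

lemma beurlingAhlfors_im (σ : ℝ → ℝ) (w : ℂ) : (beurlingAhlfors σ w).im =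
    (segMean σ w.im w.re + segMean σ w.im (-w.re)) / 2 := by
  simp [beurlingAhlfors, -ofReal_div, -ofReal_sub, -ofReal_add]

lemma beurlingAhlfors_mul_I (σ : ℝ → ℝ) (t : ℝ) : beurlingAhlfors σ (t * I) = σ t * I := by
  apply Complex.ext
  · simp [beurlingAhlfors_re]
  · simp [beurlingAhlfors_im, segMean_zero]

namespace IsCircleLift

variable {σ : ℝ → ℝ}

lemma continuous_segMean (h : IsCircleLift σ) : Continuous fun p : ℝ × ℝ => segMean σ p.1 p.2 := by
  have hc := h.continuous
  exact intervalIntegral.continuous_parametric_intervalIntegral_of_continuous' (by fun_prop) 0 1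

lemma continuous_beurlingAhlfors (h : IsCircleLift σ) : Continuous (beurlingAhlfors σ) := by
  have h1 : Continuous fun w : ℂ => segMean σ w.im w.re :=
    h.continuous_segMean.comp (continuous_im.prodMk continuous_re)
  have h2 : Continuous fun w : ℂ => segMean σ w.im (-w.re) :=
    h.continuous_segMean.comp (continuous_im.prodMk continuous_re.neg)
  unfold beurlingAhlfors
  fun_prop

lemma segMean_lt (h : IsCircleLift σ) {x k x' k' : ℝ} (h1 : x ≤ x') (h2 : x + k ≤ x' + k')
    (h3 : x < x' ∨ x + k < x' + k') : segMean σ x k < segMean σ x' k' := by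
  have hc := h.continuous
  refine intervalIntegral.integral_lt_integral_of_continuousOn_of_le_of_exists_lt one_pos
    (by fun_prop) (by fun_prop) (fun t ht => h.strictMono.monotone ?_) ?_
  · nlinarith [mul_le_mul_of_nonneg_left h1 (sub_nonneg.2 ht.2),
      mul_le_mul_of_nonneg_left h2 ht.1.le]
  · rcases h3 with h3 | h3
    · exact ⟨0, by simp, h.strictMono (by simpa using h3)⟩
    · exact ⟨1, by simp, h.strictMono (by simpa using h3)⟩

lemma segMean_le (h : IsCircleLift σ) {x k x' k' : ℝ} (h1 : x ≤ x') (h2 : x + k ≤ x' + k') :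
    segMean σ x k ≤ segMean σ x' k' := by
  by_cases h3 : x < x' ∨ x + k < x' + k'
  · exact (h.segMean_lt h1 h2 h3).le
  · push Not at h3
    obtain rfl : x = x' := le_antisymm h1 h3.1
    obtain rfl : k = k' := by linarith [h3.2]
    rfl

lemma segMean_split (h : IsCircleLift σ) (x k : ℝ) :
    segMean σ x k = (segMean σ x (k / 2) + segMean σ (x + k / 2) (k / 2)) / 2 := by
  have hc := h.continuous
  have hi : ∀ a b : ℝ, IntervalIntegrable (fun t => σ (x + t * k)) volume a b := fun a b =>
    Continuous.intervalIntegrable (by fun_prop) a b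
  have e1 := intervalIntegral.integral_comp_add_mul (a := 0) (b := 1)
    (fun t => σ (x + t * k)) (c := 1 / 2) (by norm_num) 0
  have e2 := intervalIntegral.integral_comp_add_mul (a := 0) (b := 1)
    (fun t => σ (x + t * k)) (c := 1 / 2) (by norm_num) (1 / 2)
  have e3 := intervalIntegral.integral_add_adjacent_intervals (hi 0 (1 / 2)) (hi (1 / 2) 1)
  have f1 : segMean σ x (k / 2) = ∫ t in (0 : ℝ)..1, σ (x + (0 + 1 / 2 * t) * k) := by
    unfold segMean; congr 1; ext t; ring_nf
  have f2 : segMean σ (x + k / 2) (k / 2) =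
      ∫ t in (0 : ℝ)..1, σ (x + (1 / 2 + 1 / 2 * t) * k) := by
    unfold segMean; congr 1; ext t; ring_nf
  rw [f1, f2, e1, e2]
  norm_num at e3 ⊢
  rw [segMean, ← e3]; ring

lemma segMean_add_two_pi (h : IsCircleLift σ)
    (x k : ℝ) : segMean σ (x + 2 * π) k = segMean σ x k + 2 * π := by
  have hc := h.continuous
  have hi : IntervalIntegrable (fun t => σ (x + t * k)) volume 0 1 :=
    Continuous.intervalIntegrable (by fun_prop) _ _
  simp only [segMean, add_right_comm x (2 * π), h.add_two_pi]
  rw [intervalIntegral.integral_add hi (by simp)]; simp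

lemma abs_segMean_sub_le (h : IsCircleLift σ)
    (x k : ℝ) : |segMean σ x k - (σ 0 + x + k / 2)| ≤ 2 * π := by
  have hc := h.continuous
  have hi : IntervalIntegrable (fun t => σ (x + t * k)) volume 0 1 :=
    Continuous.intervalIntegrable (by fun_prop) _ _
  have hj : IntervalIntegrable (fun t => σ 0 + x + t * k) volume 0 1 :=
    Continuous.intervalIntegrable (by fun_prop) _ _
  have e : segMean σ x k - (σ 0 + x + k / 2) =
      ∫ t in (0 : ℝ)..1, (σ (x + t * k) - (σ 0 + x + t * k)) := by
    rw [intervalIntegral.integral_sub hi hj, intervalIntegral.integral_add (by simp)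
      (Continuous.intervalIntegrable (by fun_prop) _ _), intervalIntegral.integral_mul_const]
    simp [segMean]; ring
  rw [e]
  have := intervalIntegral.norm_integral_le_of_norm_le_const (a := 0) (b := 1) (C := 2 * π)
    (f := fun t => σ (x + t * k) - (σ 0 + x + t * k)) fun t _ => by
      obtain ⟨h1, h2⟩ := h.sub_bounds 0 (x + t * k)
      rw [Real.norm_eq_abs, abs_le]; constructor <;> linarith
  simpa using this

lemma beurlingAhlfors_add_two_pi (h : IsCircleLift σ) (w : ℂ) :
    beurlingAhlfors σ (w + 2 * π * I) = beurlingAhlfors σ w + 2 * π * I := by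
  have e1 : (w + 2 * π * I).im = w.im + 2 * π := by simp
  have e2 : (w + 2 * π * I).re = w.re := by simp
  apply Complex.ext
  · rw [beurlingAhlfors_re, e1, e2, h.segMean_add_two_pi, h.segMean_add_two_pi]
    simp [beurlingAhlfors_re]
  · rw [beurlingAhlfors_im, e1, e2, h.segMean_add_two_pi, h.segMean_add_two_pi]
    simp [beurlingAhlfors_im]; ring

lemma beurlingAhlfors_re_pos (h : IsCircleLift σ)
    {w : ℂ} (hw : 0 < w.re) : 0 < (beurlingAhlfors σ w).re := by
  rw [beurlingAhlfors_re]
  have := h.segMean_lt (x := w.im) (k := -w.re) (x' := w.im) (k' := w.re) le_rfl (by linarith)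
    (Or.inr (by linarith))
  linarith

lemma abs_beurlingAhlfors_re_sub_le (h : IsCircleLift σ)
    (w : ℂ) : |(beurlingAhlfors σ w).re - w.re / 2| ≤ 2 * π := by
  have h1 := abs_le.1 (h.abs_segMean_sub_le w.im w.re)
  have h2 := abs_le.1 (h.abs_segMean_sub_le w.im (-w.re))
  rw [beurlingAhlfors_re, abs_le]
  constructor <;> linarith [h1.1, h1.2, h2.1, h2.2]

lemma abs_beurlingAhlfors_im_sub_le (h : IsCircleLift σ) (w : ℂ) :
    |(beurlingAhlfors σ w).im - (w.im + σ 0)| ≤ 2 * π := by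
  have h1 := abs_le.1 (h.abs_segMean_sub_le w.im w.re)
  have h2 := abs_le.1 (h.abs_segMean_sub_le w.im (-w.re))
  rw [beurlingAhlfors_im, abs_le]
  constructor <;> linarith [h1.1, h1.2, h2.1, h2.2]

lemma injOn_beurlingAhlfors (h : IsCircleLift σ) : InjOn (beurlingAhlfors σ) {w | 0 ≤ w.re} := by
  have key : ∀ x y x' y' : ℝ, 0 ≤ y → 0 ≤ y' → x < x' →
      segMean σ x y = segMean σ x' y' → segMean σ x (-y) = segMean σ x' (-y') → False := by
    intro x y x' y' hy hy' hx h1 h2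
    by_cases hc : x + y ≤ x' + y'
    · exact (h.segMean_lt hx.le hc (Or.inl hx)).ne h1
    · exact (h.segMean_lt hx.le (by linarith) (Or.inl hx)).ne h2
  intro w hw w' hw' he
  have hr := congrArg re he
  have hi := congrArg im he
  rw [beurlingAhlfors_re, beurlingAhlfors_re] at hr
  rw [beurlingAhlfors_im, beurlingAhlfors_im] at hi
  have h1 : segMean σ w.im w.re = segMean σ w'.im w'.re := by linarith
  have h2 : segMean σ w.im (-w.re) = segMean σ w'.im (-w'.re) := by linarith
  have him : w.im = w'.im := by
    rcases lt_trichotomy w.im w'.im with hlt | heq | hgt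
    · exact (key _ _ _ _ hw hw' hlt h1 h2).elim
    · exact heq
    · exact (key _ _ _ _ hw' hw hgt h1.symm h2.symm).elim
  refine Complex.ext ?_ him
  rw [him] at h1
  rcases lt_trichotomy w.re w'.re with hlt | heq | hgt
  · exact absurd h1 (h.segMean_lt le_rfl (by linarith) (Or.inr (by linarith))).ne
  · exact heq
  · exact absurd h1 (h.segMean_lt le_rfl (by linarith) (Or.inr (by linarith))).ne'

lemma hasStrictFDerivAt_segMean (h : IsCircleLift σ) {w : ℂ} {c : ℝ} (hw : c * w.re ≠ 0) :
    HasStrictFDerivAt (fun z : ℂ => segMean σ z.im (c * z.re))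
      (((σ (w.im + c * w.re) - σ w.im) / (c * w.re)) • imCLM +
        (c * ((σ (w.im + c * w.re) - segMean σ w.im (c * w.re)) / (c * w.re))) • reCLM) w := by
  have hS := fun b => h.continuous.integral_hasStrictDerivAt 0 b
  set S : ℝ → ℝ := fun u => ∫ x in (0 : ℝ)..u, σ x with hSdef
  have hmean : ∀ x k : ℝ, k ≠ 0 → segMean σ x k = k⁻¹ * (S (x + k) - S x) := fun x k hk => by
    have hi : ∀ a b, IntervalIntegrable σ volume a b := fun a b =>
      h.continuous.intervalIntegrable a b
    rw [hSdef, intervalIntegral.integral_interval_sub_left (hi _ _) (hi _ _)]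
    have := intervalIntegral.integral_comp_add_mul (a := 0) (b := 1) σ hk x
    simp only [mul_zero, add_zero, mul_one, smul_eq_mul] at this
    rw [← this, segMean]; congr 1; ext t; ring_nf
  have him : HasStrictFDerivAt (fun z : ℂ => z.im) imCLM w := imCLM.hasStrictFDerivAt
  have hre : HasStrictFDerivAt (fun z : ℂ => c * z.re) (c • reCLM) w :=
    reCLM.hasStrictFDerivAt.const_mul c
  have h1 := (hS (w.im + c * w.re)).comp_hasStrictFDerivAt w (him.add hre)
  have h2 := (hS w.im).comp_hasStrictFDerivAt w him
  have h3 := (hasStrictDerivAt_inv hw).comp_hasStrictFDerivAt w hre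
  have h4 := h3.mul (h1.sub h2)
  refine (h4.congr_of_eventuallyEq ?_).congr_fderiv ?_
  · have : ∀ᶠ z : ℂ in 𝓝 w, c * z.re ≠ 0 :=
      (continuous_const.mul continuous_re).continuousAt.eventually_ne hw
    filter_upwards [this] with z hz
    exact (hmean _ _ hz).symm
  · rw [hmean _ _ hw]
    obtain ⟨hc0, hw0⟩ := mul_ne_zero_iff.1 hw
    ext v
    simp
    field_simp
    ring

end IsCircleLift

/-- The derivative of `f` at `z` is invertible, and `f` is `K`-quasiconformal there. -/
structure HasQCDerivAt (f : ℂ → ℂ) (L : ℂ →L[ℝ] ℂ) (K : ℝ) (z : ℂ) : Prop where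
  hasStrictFDerivAt : HasStrictFDerivAt f L z
  det_pos : 0 < L.det
  norm_sq_le : ‖L‖ ^ 2 ≤ K * L.det

lemma norm_sq_le_norm_one_add_norm_I (L : ℂ →L[ℝ] ℂ) : ‖L‖ ^ 2 ≤ ‖L 1‖ ^ 2 + ‖L I‖ ^ 2 := by
  have : ‖L‖ ≤ √(‖L 1‖ ^ 2 + ‖L I‖ ^ 2) := by
    refine L.opNorm_le_bound (Real.sqrt_nonneg _) fun z => ?_
    have hz : L z = z.re • L 1 + z.im • L I := by
      rw [← map_smul, ← map_smul, ← map_add]; congr 1; simp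
    refine abs_le_of_sq_le_sq' ?_ (by positivity) |>.2
    rw [mul_pow, Real.sq_sqrt (by positivity), ← normSq_eq_norm_sq z, normSq_apply, hz]
    have h1 : ‖z.re • L 1 + z.im • L I‖ ≤ |z.re| * ‖L 1‖ + |z.im| * ‖L I‖ :=
      (norm_add_le _ _).trans (by rw [norm_smul, norm_smul, Real.norm_eq_abs, Real.norm_eq_abs])
    calc ‖z.re • L 1 + z.im • L I‖ ^ 2 ≤ (|z.re| * ‖L 1‖ + |z.im| * ‖L I‖) ^ 2 := by gcongr
      _ ≤ _ := by nlinarith [sq_nonneg (|z.re| * ‖L I‖ - |z.im| * ‖L 1‖), sq_abs z.re, sq_abs z.im]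
  calc ‖L‖ ^ 2 ≤ √(‖L 1‖ ^ 2 + ‖L I‖ ^ 2) ^ 2 := by gcongr
    _ = _ := Real.sq_sqrt (by positivity)

lemma IsCircleLift.exists_hasStrictFDerivAt_beurlingAhlfors {σ : ℝ → ℝ} (h : IsCircleLift σ)
    {w : ℂ} (hw : 0 < w.re) : ∃ L : ℂ →L[ℝ] ℂ, HasStrictFDerivAt (beurlingAhlfors σ) L w ∧
      (L 1).re = ((σ (w.im + w.re) - segMean σ w.im w.re) +
        (segMean σ w.im (-w.re) - σ (w.im - w.re))) / (2 * w.re) ∧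
      (L 1).im = ((σ (w.im + w.re) - segMean σ w.im w.re) -
        (segMean σ w.im (-w.re) - σ (w.im - w.re))) / (2 * w.re) ∧
      (L I).re = ((σ (w.im + w.re) - σ w.im) - (σ w.im - σ (w.im - w.re))) / (2 * w.re) ∧
      (L I).im = ((σ (w.im + w.re) - σ w.im) + (σ w.im - σ (w.im - w.re))) / (2 * w.re) := by
  have hd1 := h.hasStrictFDerivAt_segMean (w := w) (c := 1) (by simpa using hw.ne')
  have hd2 := h.hasStrictFDerivAt_segMean (w := w) (c := -1) (by simpa using hw.ne')
  simp only [one_mul, neg_one_mul] at hd1 hd2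
  rw [← sub_eq_add_neg] at hd2
  have c1 : (σ (w.im - w.re) - σ w.im) / -w.re = (σ w.im - σ (w.im - w.re)) / w.re := by
    rw [div_neg, ← neg_div, neg_sub]
  have c2 : -((σ (w.im - w.re) - segMean σ w.im (-w.re)) / -w.re) =
      -((segMean σ w.im (-w.re) - σ (w.im - w.re)) / w.re) := by
    rw [div_neg, ← neg_div, neg_sub]
  rw [c1, c2] at hd2
  generalize σ (w.im + w.re) - σ w.im = α at *
  generalize σ w.im - σ (w.im - w.re) = β at *
  generalize σ (w.im + w.re) - segMean σ w.im w.re = P at *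
  generalize segMean σ w.im (-w.re) - σ (w.im - w.re) = Q at *
  have hv := (hd1.sub hd2).const_mul (1 / 2 : ℝ)
  have hu := (hd1.add hd2).const_mul (1 / 2 : ℝ)
  have hL := ((ofRealCLM.hasStrictFDerivAt.comp w hv).add
    ((ofRealCLM.hasStrictFDerivAt.comp w hu).mul_const I)).congr_of_eventuallyEq
    (f₁ := beurlingAhlfors σ) (Eventually.of_forall fun z => by
    apply Complex.ext <;> simp [beurlingAhlfors_re, beurlingAhlfors_im] <;> ring)
  refine ⟨_, hL, ?_, ?_, ?_, ?_⟩ <;> simp <;> field_simp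
  ring

lemma distortion_aux {M α β P Q : ℝ} (hM : 1 ≤ M) (hα : 0 < α) (hβ : 0 < β) (hP : 0 ≤ P)
    (hQ : 0 ≤ Q) (hPα : P ≤ α) (hQβ : Q ≤ β) (h1 : α ≤ 2 * (M + 1) * P)
    (h2 : β ≤ 2 * (M + 1) * Q) (h3 : β ≤ M * α) (h4 : α ≤ M * β) :
    P ^ 2 + Q ^ 2 + α ^ 2 + β ^ 2 ≤ 4 * M * (M + 1) * (α * Q + β * P) := by
  have i1 : P ^ 2 ≤ α ^ 2 := by gcongr
  have i2 : Q ^ 2 ≤ β ^ 2 := by gcongr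
  have i3 : α ^ 2 ≤ M * (α * β) := by linarith [mul_le_mul_of_nonneg_left h4 hα.le]
  have i4 : β ^ 2 ≤ M * (α * β) := by linarith [mul_le_mul_of_nonneg_left h3 hβ.le]
  have i5 : α * β ≤ (M + 1) * (α * Q + β * P) := by
    linarith [mul_le_mul_of_nonneg_left h2 hα.le, mul_le_mul_of_nonneg_left h1 hβ.le]
  linarith [mul_le_mul_of_nonneg_left i5 (show 0 ≤ M by linarith)]

namespace IsQuasisymmetricLift

variable {σ : ℝ → ℝ} {M : ℝ}

lemma exists_hasQCDerivAt_beurlingAhlfors (h : IsQuasisymmetricLift σ M) {w : ℂ} (hw : 0 < w.re) :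
    ∃ L, HasQCDerivAt (beurlingAhlfors σ) L (4 * M * (M + 1)) w := by
  have hM := h.one_le
  have hl := h.left_le w.im w.re hw
  have hr := h.right_le w.im w.re hw
  have hP1 := h.left_le (w.im + w.re / 2) (w.re / 2) (half_pos hw)
  have hQ1 := h.right_le (w.im - w.re / 2) (w.re / 2) (half_pos hw)
  have e1 := h.segMean_split w.im w.re
  have e2 := h.segMean_split w.im (-w.re)
  have m1 : ∀ x k, 0 ≤ k → segMean σ x k ≤ σ (x + k) := fun x k hk => by
    rw [← segMean_zero σ (x + k)]; exact h.segMean_le (by linarith) (by linarith)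
  have m2 : ∀ x k, 0 ≤ k → σ x ≤ segMean σ x k := fun x k hk => by
    rw [← segMean_zero σ x]; exact h.segMean_le (by linarith) (by linarith)
  have m3 : ∀ x k, k ≤ 0 → segMean σ x k ≤ σ x := fun x k hk => by
    rw [← segMean_zero σ x]; exact h.segMean_le (by linarith) (by linarith)
  have m4 : ∀ x k, k ≤ 0 → σ (x + k) ≤ segMean σ x k := fun x k hk => by
    rw [← segMean_zero σ (x + k)]; exact h.segMean_le (by linarith) (by linarith)
  have a1 := m1 w.im (w.re / 2) (by linarith)
  have a2 := m1 (w.im + w.re / 2) (w.re / 2) (by linarith)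
  have a3 := m2 w.im w.re hw.le
  have b1 := m4 w.im (-w.re / 2) (by linarith)
  have b2 := m4 (w.im + -w.re / 2) (-w.re / 2) (by linarith)
  have b3 := m3 w.im (-w.re) (by linarith)
  have hα := h.strictMono (show w.im < w.im + w.re by linarith)
  have hβ := h.strictMono (show w.im - w.re < w.im by linarith)
  rw [show w.im + w.re / 2 + w.re / 2 = w.im + w.re by ring] at hP1 a2
  rw [show w.im + w.re / 2 - w.re / 2 = w.im by ring] at hP1
  rw [show w.im - w.re / 2 + w.re / 2 = w.im by ring] at hQ1
  rw [show w.im - w.re / 2 - w.re / 2 = w.im - w.re by ring] at hQ1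
  rw [show w.im + -w.re / 2 + -w.re / 2 = w.im - w.re by ring] at b2
  rw [show w.im + -w.re / 2 = w.im - w.re / 2 by ring] at b1 b2 e2
  set y := w.re
  set α := σ (w.im + y) - σ w.im with hαd
  set β := σ w.im - σ (w.im - y) with hβd
  set P := σ (w.im + y) - segMean σ w.im y with hPd
  set Q := segMean σ w.im (-y) - σ (w.im - y) with hQd
  have hP : α ≤ 2 * (M + 1) * P := by nlinarith
  have hQ : β ≤ 2 * (M + 1) * Q := by nlinarith
  have hPα : P ≤ α := by linarith
  have hQβ : Q ≤ β := by linarith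
  have hα0 : 0 < α := by linarith
  have hβ0 : 0 < β := by linarith
  have hP0 : 0 < P := by nlinarith
  have hQ0 : 0 < Q := by nlinarith
  obtain ⟨L, hL, L1r, L1i, LIr, LIi⟩ := h.exists_hasStrictFDerivAt_beurlingAhlfors hw
  change (L 1).re = (P + Q) / (2 * y) at L1r
  change (L 1).im = (P - Q) / (2 * y) at L1i
  change (L I).re = (α - β) / (2 * y) at LIr
  change (L I).im = (α + β) / (2 * y) at LIi
  have hy : y ≠ 0 := hw.ne'
  have hdet : L.det = (α * Q + β * P) / (2 * y ^ 2) := by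
    rw [det_eq_re_im, L1r, L1i, LIr, LIi]; field_simp; ring
  refine ⟨L, hL, ?_, (norm_sq_le_norm_one_add_norm_I L).trans ?_⟩
  · rw [hdet]; positivity
  · rw [hdet, ← normSq_eq_norm_sq, ← normSq_eq_norm_sq, normSq_apply, normSq_apply, L1r, L1i,
      LIr, LIi]
    have : P ^ 2 + Q ^ 2 + α ^ 2 + β ^ 2 ≤ 4 * M * (M + 1) * (α * Q + β * P) :=
      distortion_aux hM hα0 hβ0 hP0.le hQ0.le hPα hQβ hP hQ hl hr
    calc _ = (P ^ 2 + Q ^ 2 + α ^ 2 + β ^ 2) / (2 * y ^ 2) := by field_simp; ring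
      _ ≤ 4 * M * (M + 1) * (α * Q + β * P) / (2 * y ^ 2) := by gcongr
      _ = _ := by ring

end IsQuasisymmetricLift

lemma HasQCDerivAt.map_nhds_eq {f : ℂ → ℂ} {L : ℂ →L[ℝ] ℂ} {K : ℝ} {z : ℂ}
    (h : HasQCDerivAt f L K z) : map f (𝓝 z) = 𝓝 (f z) := by
  have h1 := h.hasStrictFDerivAt
  rw [← L.coe_toContinuousLinearEquivOfDetNeZero h.det_pos.ne'] at h1
  exact h1.map_nhds_eq_of_equiv

lemma IsCircleLift.tendsto_beurlingAhlfors {σ : ℝ → ℝ} (h : IsCircleLift σ) :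
    Tendsto (beurlingAhlfors σ) (cocompact ℂ) (cocompact ℂ) := by
  rw [← Metric.cobounded_eq_cocompact, ← comap_norm_atTop, tendsto_comap_iff,
    comap_norm_atTop, Metric.cobounded_eq_cocompact]
  have : ∀ w : ℂ, (1 / 2) * ‖w‖ + -(4 * π + |σ 0|) ≤ ‖beurlingAhlfors σ w‖ := fun w => by
    have h1 := h.abs_beurlingAhlfors_re_sub_le w
    have h2 := h.abs_beurlingAhlfors_im_sub_le w
    set b := beurlingAhlfors σ w
    have e : (w.re / 2 : ℝ) + (w.im : ℝ) * I = b - (((b.re - w.re / 2 : ℝ) : ℂ) +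
      ((b.im - (w.im + σ 0) + σ 0 : ℝ) : ℂ) * I) := by
      apply Complex.ext
      · simp
      · simp; ring
    have h3 : (1 / 2) * ‖w‖ ≤ ‖((w.re / 2 : ℝ) : ℂ) + (w.im : ℝ) * I‖ := by
      refine abs_le_of_sq_le_sq' ?_ (norm_nonneg _) |>.2
      rw [mul_pow, ← normSq_eq_norm_sq, ← normSq_eq_norm_sq, normSq_apply, normSq_apply]
      simp
      nlinarith [sq_nonneg w.im]
    have h4 : ‖((b.re - w.re / 2 : ℝ) : ℂ) + ((b.im - (w.im + σ 0) + σ 0 : ℝ) : ℂ) * I‖ ≤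
        2 * π + (2 * π + |σ 0|) := by
      refine (norm_add_le _ _).trans ?_
      rw [norm_mul, norm_I, mul_one, norm_real, norm_real, Real.norm_eq_abs, Real.norm_eq_abs]
      exact add_le_add h1 ((abs_add_le _ _).trans (by linarith))
    have h5 := norm_sub_le b (((b.re - w.re / 2 : ℝ) : ℂ) +
      ((b.im - (w.im + σ 0) + σ 0 : ℝ) : ℂ) * I)
    rw [← e] at h5
    linarith
  refine tendsto_atTop_mono this ?_
  exact tendsto_atTop_add_const_right _ _
    ((tendsto_norm_cocompact_atTop).const_mul_atTop (by norm_num))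

lemma IsQuasisymmetricLift.image_beurlingAhlfors {σ : ℝ → ℝ} {M : ℝ}
    (h : IsQuasisymmetricLift σ M) : beurlingAhlfors σ '' {w | 0 < w.re} = {w | 0 < w.re} := by
  refine Subset.antisymm (image_subset_iff.2 fun w hw => h.beurlingAhlfors_re_pos hw) ?_
  have hconv : Convex ℝ {w : ℂ | 0 < w.re} := convex_halfSpace_re_gt 0
  have hcl : IsClosedMap (beurlingAhlfors σ) :=
    (isProperMap_iff_tendsto_cocompact.2
      ⟨h.continuous_beurlingAhlfors, h.tendsto_beurlingAhlfors⟩).isClosedMap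
  have hclosed : IsClosed (beurlingAhlfors σ '' {w | 0 ≤ w.re}) :=
    hcl _ (isClosed_le continuous_const continuous_re)
  refine hconv.isPreconnected.subset_of_closure_inter_subset ?_ ?_ ?_
  · rw [isOpen_iff_mem_nhds]
    rintro _ ⟨w, hw, rfl⟩
    obtain ⟨L, hL⟩ := h.exists_hasQCDerivAt_beurlingAhlfors hw
    rw [← hL.map_nhds_eq]
    exact image_mem_map ((isOpen_lt continuous_const continuous_re).mem_nhds hw)
  · exact ⟨_, h.beurlingAhlfors_re_pos (w := 1) (by simp), 1, by simp, rfl⟩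
  · have hle : {w : ℂ | 0 < w.re} ⊆ {w | 0 ≤ w.re} := fun w (hw : 0 < w.re) => hw.le
    rintro z ⟨hz, hz0⟩
    obtain ⟨w, hw, rfl⟩ := closure_minimal
      (image_mono hle) hclosed hz
    refine ⟨w, show 0 < w.re from lt_of_le_of_ne hw fun h0 => ?_, rfl⟩
    have : w = (w.im : ℝ) * I := by apply Complex.ext <;> simp [← h0]
    rw [this, mem_ofPred_eq, beurlingAhlfors_mul_I] at hz0
    simp at hz0

lemma norm_sq_smul_le {L : ℂ →L[ℝ] ℂ} {K : ℝ} (h : ‖L‖ ^ 2 ≤ K * L.det) (c : ℂ) :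
    ‖c • L‖ ^ 2 ≤ K * (c • L).det := by
  have hd : (c • L).det = ‖c‖ ^ 2 * L.det := by
    rw [det_eq_re_im, det_eq_re_im, ← normSq_eq_norm_sq, normSq_apply]; simp; ring
  rw [norm_smul, mul_pow, hd]
  nlinarith [sq_nonneg ‖c‖]

lemma norm_sq_comp_smul_le {L : ℂ →L[ℝ] ℂ} {K : ℝ} (h : ‖L‖ ^ 2 ≤ K * L.det) (c : ℂ) :
    ‖L ∘L (c • (1 : ℂ →L[ℝ] ℂ))‖ ^ 2 ≤ K * (L ∘L (c • (1 : ℂ →L[ℝ] ℂ))).det := by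
  have e : ∀ z, L z = z.re • L 1 + z.im • L I := fun z => by
    rw [← map_smul, ← map_smul, ← map_add]; congr 1; simp
  have hd : (L ∘L (c • (1 : ℂ →L[ℝ] ℂ))).det = ‖c‖ ^ 2 * L.det := by
    rw [det_eq_re_im, det_eq_re_im, ← normSq_eq_norm_sq, normSq_apply]
    have e1 : (L ∘L (c • (1 : ℂ →L[ℝ] ℂ))) 1 = L c := by simp
    have e2 : (L ∘L (c • (1 : ℂ →L[ℝ] ℂ))) I = L (c * I) := by simp
    rw [e1, e2, e c, e (c * I)]; simp; ring
  have hn : ‖L ∘L (c • (1 : ℂ →L[ℝ] ℂ))‖ ≤ ‖L‖ * ‖c‖ := by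
    refine (L.opNorm_comp_le _).trans ?_
    gcongr
    refine (norm_smul_le c (1 : ℂ →L[ℝ] ℂ)).trans ?_
    exact mul_le_of_le_one_right (norm_nonneg _) ContinuousLinearMap.norm_id_le
  calc _ ≤ (‖L‖ * ‖c‖) ^ 2 := by gcongr
    _ ≤ _ := by rw [mul_pow, hd]; nlinarith [sq_nonneg ‖c‖]

namespace IsCircleLift

variable {σ : ℝ → ℝ}

lemma exp_beurlingAhlfors_eq (h : IsCircleLift σ) {w w' : ℂ} (he : Complex.exp w = Complex.exp w') :
    Complex.exp (beurlingAhlfors σ w) = Complex.exp (beurlingAhlfors σ w') := by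
  have hp : Function.Periodic (fun w => Complex.exp (beurlingAhlfors σ w)) (2 * π * I) := fun w => by
    simp only [h.beurlingAhlfors_add_two_pi, exp_periodic _]
  obtain ⟨n, rfl⟩ := exp_eq_exp_iff_exists_int.1 he
  exact hp.int_mul n w'

lemma beurlingAhlfors_add_int (h : IsCircleLift σ) (w : ℂ) (n : ℤ) :
    beurlingAhlfors σ (w + n * (2 * π * I)) = beurlingAhlfors σ w + n * (2 * π * I) := by
  have hp : Function.Periodic (fun w => beurlingAhlfors σ w - w) (2 * π * I) := fun w => by
    simp only [h.beurlingAhlfors_add_two_pi]; ring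
  linear_combination hp.int_mul n w

lemma beurlingAhlfors_re_nonneg (h : IsCircleLift σ)
    {w : ℂ} (hw : 0 ≤ w.re) : 0 ≤ (beurlingAhlfors σ w).re := by
  rcases hw.eq_or_lt with h0 | h0
  · rw [beurlingAhlfors_re, ← h0]; simp
  · exact (h.beurlingAhlfors_re_pos h0).le

lemma exists_eq (h : IsCircleLift σ) (y : ℝ) : ∃ t, σ t = y := by
  have h1 := (h.sub_bounds 0 (y - σ 0 - 2 * π)).2
  have h2 := (h.sub_bounds 0 (y - σ 0 + 2 * π)).1
  obtain ⟨t, -, ht⟩ := intermediate_value_Icc (a := y - σ 0 - 2 * π) (b := y - σ 0 + 2 * π)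
    (by linarith [Real.pi_pos]) h.continuous.continuousOn
    (show y ∈ Icc _ _ from ⟨by linarith, by linarith⟩)
  exact ⟨t, ht⟩

lemma exp_eq_of_exp_beurlingAhlfors_eq (h : IsCircleLift σ)
    {w w' : ℂ} (hw : 0 ≤ w.re) (hw' : 0 ≤ w'.re)
    (he : Complex.exp (beurlingAhlfors σ w) = Complex.exp (beurlingAhlfors σ w')) :
    Complex.exp w = Complex.exp w' := by
  obtain ⟨n, hn⟩ := exp_eq_exp_iff_exists_int.1 he
  rw [← h.beurlingAhlfors_add_int] at hn
  have := h.injOn_beurlingAhlfors hw (show 0 ≤ (w' + n * (2 * π * I)).re by simpa using hw') hn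
  exact exp_eq_exp_iff_exists_int.2 ⟨n, this⟩

end IsCircleLift

/-- The conformal map onto the exterior domain, as a function on `1 ≤ ‖ω‖`. -/
def exteriorMap (p : ℂ) (G : ℂ → ℂ) (ω : ℂ) : ℂ := p + (G ω⁻¹)⁻¹

/-- The global map obtained by gluing `F` with a quasiconformal map of the exterior. -/
def gluedMap (p : ℂ) (F G : ℂ → ℂ) (σ : ℝ → ℝ) (z : ℂ) : ℂ :=
  open Classical in
  if ‖z‖ ≤ 1 then F z else exteriorMap p G (Complex.exp (beurlingAhlfors σ (Complex.log z)))

namespace IsWelding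

variable {Γ Ω Ω' : Set ℂ} {p : ℂ} {F G : ℂ → ℂ} {σ : ℝ → ℝ}

lemma isCircleLift (h : IsWelding Γ Ω Ω' p F G σ)
    : IsCircleLift σ := ⟨h.continuous, h.strictMono, h.add_two_pi⟩

lemma inv_mem_closedBall {ω : ℂ} (hω : 1 ≤ ‖ω‖) : ω⁻¹ ∈ closedBall (0 : ℂ) 1 := by
  rw [mem_closedBall_zero_iff, norm_inv]; exact inv_le_one_of_one_le₀ hω

lemma outer_inv_ne_zero (h : IsWelding Γ Ω Ω' p F G σ) {ω : ℂ} (hω : 1 ≤ ‖ω‖) : G ω⁻¹ ≠ 0 := by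
  rw [← h.outer_zero]
  intro he
  have := h.outer.injOn (inv_mem_closedBall hω) (by simp) he
  rw [inv_eq_zero] at this
  rw [this, norm_zero] at hω
  linarith

lemma continuousOn_exteriorMap (h : IsWelding Γ Ω Ω' p F G σ)
    : ContinuousOn (exteriorMap p G) {ω | 1 ≤ ‖ω‖} := by
  refine continuousOn_const.add (ContinuousOn.inv₀ ?_ fun ω hω => h.outer_inv_ne_zero hω)
  refine h.outer.continuousOn.comp (continuousOn_inv₀.mono fun ω (hω : 1 ≤ ‖ω‖) h0 => ?_)
    fun ω hω => inv_mem_closedBall hω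
  rw [mem_singleton_iff.1 h0, norm_zero] at hω
  linarith

lemma injOn_exteriorMap (h : IsWelding Γ Ω Ω' p F G σ) : InjOn (exteriorMap p G) {ω | 1 ≤ ‖ω‖} := by
  intro ω hω ω' hω' he
  exact inv_injective (h.outer.injOn (inv_mem_closedBall hω) (inv_mem_closedBall hω')
    (inv_injective (add_left_cancel he)))

lemma image_exteriorMap (h : IsWelding Γ Ω Ω' p F G σ) : exteriorMap p G '' {ω | 1 ≤ ‖ω‖} = Ωᶜ := by
  apply Subset.antisymm
  · rintro _ ⟨ω, hω, rfl⟩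
    have h0 := h.outer_inv_ne_zero hω
    refine (h.notMem_iff _ (by simpa [exteriorMap] using h0)).2 ?_
    rw [exteriorMap, add_sub_cancel_left, inv_inv, ← h.outer.image_closedBall]
    exact mem_image_of_mem _ (inv_mem_closedBall hω)
  · intro z hz
    have hzp : z ≠ p := fun he => hz (he ▸ h.mem)
    have := (h.notMem_iff z hzp).1 hz
    rw [← h.outer.image_closedBall] at this
    obtain ⟨η, hη, he⟩ := this
    have hη0 : η ≠ 0 := by
      rintro rfl
      rw [h.outer_zero, eq_comm, inv_eq_zero, sub_eq_zero] at he
      exact hzp he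
    refine ⟨η⁻¹, ?_, ?_⟩
    · rw [mem_ofPred_eq, norm_inv]
      exact (one_le_inv₀ (norm_pos_iff.2 hη0)).2 (mem_closedBall_zero_iff.1 hη)
    · rw [exteriorMap, inv_inv, he, inv_inv]; ring

lemma gluedMap_exp (h : IsWelding Γ Ω Ω' p F G σ) {w : ℂ} (hw : 0 ≤ w.re) :
    gluedMap p F G σ (Complex.exp w) = exteriorMap p G (Complex.exp (beurlingAhlfors σ w)) := by
  rcases hw.eq_or_lt with h0 | h0
  · have hw' : w = (w.im : ℝ) * I := by apply Complex.ext <;> simp [← h0]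
    rw [gluedMap, if_pos (by rw [norm_exp, ← h0]; simp), hw', beurlingAhlfors_mul_I, exteriorMap,
      ← Complex.exp_neg, ← neg_mul, inv_eq_of_mul_eq_one_left (h.mul_eq _)]
    ring
  · rw [gluedMap, if_neg (by rw [norm_exp]; simpa using h0)]
    congr 1
    exact h.isCircleLift.exp_beurlingAhlfors_eq (exp_log (Complex.exp_ne_zero w))

lemma gluedMap_of_norm_le {z : ℂ} (hz : ‖z‖ ≤ 1) : gluedMap p F G σ z = F z := if_pos hz

lemma gluedMap_of_one_le_norm (h : IsWelding Γ Ω Ω' p F G σ)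
    {z : ℂ} (hz : 1 ≤ ‖z‖) : gluedMap p F G σ z =
    exteriorMap p G (Complex.exp (beurlingAhlfors σ (Complex.log z))) := by
  have hz0 : z ≠ 0 := by rintro rfl; simp at hz; linarith
  rw [← h.gluedMap_exp (by rw [log_re]; exact Real.log_nonneg hz), exp_log hz0]

lemma gluedMap_eq (h : IsWelding Γ Ω Ω' p F G σ)
    {z₀ z : ℂ} (hz₀ : 1 ≤ ‖z₀‖) (hz : 1 ≤ ‖z‖) : gluedMap p F G σ z =
    exteriorMap p G (Complex.exp (beurlingAhlfors σ (log z₀ + log (z / z₀)))) ∧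
      0 ≤ (log z₀ + log (z / z₀)).re := by
  have hz0 : z₀ ≠ 0 := by rintro rfl; simp at hz₀; linarith
  have hz1 : z ≠ 0 := by rintro rfl; simp at hz; linarith
  have he : Complex.exp (log z₀ + log (z / z₀)) = z := by
    rw [Complex.exp_add, exp_log hz0, exp_log (div_ne_zero hz1 hz0)]; field_simp
  have hre : 0 ≤ (log z₀ + log (z / z₀)).re := by
    have := congrArg norm he
    rw [norm_exp] at this
    rw [← Real.exp_le_exp, this, Real.exp_zero]; exact hz
  refine ⟨?_, hre⟩
  rw [← h.gluedMap_exp hre, he]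

lemma one_le_norm_exp_beurlingAhlfors (h : IsWelding Γ Ω Ω' p F G σ) {w : ℂ} (hw : 0 ≤ w.re) :
    1 ≤ ‖Complex.exp (beurlingAhlfors σ w)‖ := by
  rw [norm_exp]; exact Real.one_le_exp (h.isCircleLift.beurlingAhlfors_re_nonneg hw)

lemma hasDerivAt_localLog {z₀ : ℂ} (hz₀ : z₀ ≠ 0) :
    HasDerivAt (fun z => log z₀ + log (z / z₀)) (1 / z₀) z₀ := by
  have h1 : HasDerivAt (fun z => z / z₀) (1 / z₀) z₀ := (hasDerivAt_id z₀).div_const z₀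
  have h2 := h1.clog (by rw [div_self hz₀]; exact one_mem_slitPlane)
  rw [div_self hz₀, div_one] at h2
  exact h2.const_add _

lemma continuous_gluedMap (h : IsWelding Γ Ω Ω' p F G σ) : Continuous (gluedMap p F G σ) := by
  have h1 : ContinuousOn (gluedMap p F G σ) (closedBall 0 1) :=
    h.inner.continuousOn.congr fun z hz => gluedMap_of_norm_le (mem_closedBall_zero_iff.1 hz)
  have h2 : ContinuousOn (gluedMap p F G σ) {z | 1 ≤ ‖z‖} := by
    intro z₀ hz₀
    have hz0 : z₀ ≠ 0 := by rintro rfl; simp at hz₀; linarith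
    have hl : ContinuousAt (fun z => Complex.exp (beurlingAhlfors σ (log z₀ + log (z / z₀)))) z₀ :=
      (continuous_exp.comp h.isCircleLift.continuous_beurlingAhlfors).continuousAt.comp
        (hasDerivAt_localLog hz0).continuousAt
    have hmaps : MapsTo (fun z => Complex.exp (beurlingAhlfors σ (log z₀ + log (z / z₀))))
        {z | 1 ≤ ‖z‖} {ω | 1 ≤ ‖ω‖} := fun z hz =>
      h.one_le_norm_exp_beurlingAhlfors (h.gluedMap_eq hz₀ hz).2
    have hc := ContinuousWithinAt.comp (g := exteriorMap p G)
      (f := fun z => Complex.exp (beurlingAhlfors σ (log z₀ + log (z / z₀))))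
      (h.continuousOn_exteriorMap _ (hmaps hz₀)) hl.continuousWithinAt hmaps
    exact hc.congr (fun z hz => (h.gluedMap_eq hz₀ hz).1) (h.gluedMap_eq hz₀ hz₀).1
  have := h1.union_of_isClosed h2 isClosed_closedBall (isClosed_le continuous_const continuous_norm)
  rw [← continuousOn_univ]
  refine this.mono fun z _ => ?_
  rcases le_total ‖z‖ 1 with hz | hz
  · exact Or.inl (mem_closedBall_zero_iff.2 hz)
  · exact Or.inr hz

lemma image_gluedMap_sphere (h : IsWelding Γ Ω Ω' p F G σ)
    : gluedMap p F G σ '' sphere 0 1 = Γ := by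
  rw [← h.inner.image_sphere]
  exact image_congr fun z hz => gluedMap_of_norm_le (mem_sphere_zero_iff_norm.1 hz).le

lemma tendsto_gluedMap (h : IsWelding Γ Ω Ω' p F G σ)
    : Tendsto (gluedMap p F G σ) (cobounded ℂ) (cobounded ℂ) := by
  have h1 : Tendsto (fun z : ℂ => Complex.exp (beurlingAhlfors σ (log z)))
      (cobounded ℂ) (cobounded ℂ) := by
    rw [← tendsto_norm_atTop_iff_cobounded]
    simp only [norm_exp]
    refine Real.tendsto_exp_atTop.comp ?_
    have : ∀ z : ℂ, (1 / 2) * Real.log ‖z‖ + -(2 * π) ≤ (beurlingAhlfors σ (log z)).re := fun z => by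
      have := (abs_le.1 (h.isCircleLift.abs_beurlingAhlfors_re_sub_le (log z))).1
      rw [log_re] at this
      linarith
    refine tendsto_atTop_mono this (tendsto_atTop_add_const_right _ _ ?_)
    exact (Real.tendsto_log_atTop.comp tendsto_norm_cobounded_atTop).const_mul_atTop (by norm_num)
  have h2 : Tendsto G (𝓝[≠] 0) (𝓝[≠] 0) := by
    refine tendsto_nhdsWithin_of_tendsto_nhds_of_eventually_within _ ?_ ?_
    · have := (h.outer.continuousOn.continuousAt (closedBall_mem_nhds 0 one_pos)).tendsto
      rw [h.outer_zero] at this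
      exact this.mono_left inf_le_left
    · filter_upwards [self_mem_nhdsWithin,
        mem_nhdsWithin_of_mem_nhds (closedBall_mem_nhds (0 : ℂ) one_pos)] with z hz hz1 he
      rw [mem_singleton_iff, ← h.outer_zero] at he
      exact hz (h.outer.injOn hz1 (by simp) he)
  have h3 := (tendsto_const_add_cobounded p).comp
    (tendsto_inv₀_nhdsNE_zero.comp (h2.comp (tendsto_inv₀_cobounded'.comp h1)))
  refine h3.congr' ?_
  have : ∀ᶠ z : ℂ in cobounded ℂ, 1 ≤ ‖z‖ :=
    tendsto_norm_cobounded_atTop.eventually (eventually_ge_atTop 1)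
  filter_upwards [this] with z hz
  exact (h.gluedMap_of_one_le_norm hz).symm

lemma bijective_gluedMap (h : IsWelding Γ Ω Ω' p F G σ) {M : ℝ} (hσ : IsQuasisymmetricLift σ M) :
    Function.Bijective (gluedMap p F G σ) := by
  have hb : BijOn (gluedMap p F G σ) (ball 0 1) Ω :=
    h.inner.bijOn.congr fun z hz => (gluedMap_of_norm_le (mem_ball_zero_iff.1 hz).le).symm
  have he : ∀ z : ℂ, z ∉ ball (0 : ℂ) 1 → ∃ w : ℂ, 0 ≤ w.re ∧ Complex.exp w = z := fun z hz => by
    rw [mem_ball_zero_iff, not_lt] at hz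
    refine ⟨log z, by rw [log_re]; exact Real.log_nonneg hz, exp_log ?_⟩
    rintro rfl; simp at hz; linarith
  have hc : BijOn (gluedMap p F G σ) (ball 0 1)ᶜ Ωᶜ := by
    refine ⟨fun z hz => ?_, fun z hz z' hz' hzz' => ?_, fun z hz => ?_⟩
    · obtain ⟨w, hw, rfl⟩ := he z hz
      rw [h.gluedMap_exp hw, ← h.image_exteriorMap]
      exact mem_image_of_mem _ (h.one_le_norm_exp_beurlingAhlfors hw)
    · obtain ⟨w, hw, rfl⟩ := he z hz
      obtain ⟨w', hw', rfl⟩ := he z' hz'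
      rw [h.gluedMap_exp hw, h.gluedMap_exp hw'] at hzz'
      exact h.isCircleLift.exp_eq_of_exp_beurlingAhlfors_eq hw hw'
        (h.injOn_exteriorMap (h.one_le_norm_exp_beurlingAhlfors hw)
          (h.one_le_norm_exp_beurlingAhlfors hw') hzz')
    · rw [← h.image_exteriorMap] at hz
      obtain ⟨ω, hω, rfl⟩ := hz
      have hω0 : ω ≠ 0 := by rintro rfl; simp at hω; linarith
      obtain ⟨w, hw, hwe⟩ : ∃ w : ℂ, 0 ≤ w.re ∧ beurlingAhlfors σ w = log ω := by
        have hre : 0 ≤ (log ω).re := by rw [log_re]; exact Real.log_nonneg hω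
        rcases hre.eq_or_lt with h0 | h0
        · obtain ⟨t, ht⟩ := hσ.exists_eq (log ω).im
          refine ⟨t * I, by simp, ?_⟩
          rw [beurlingAhlfors_mul_I, ht]
          apply Complex.ext <;> simp [← h0]
        · obtain ⟨w, hw, hwe⟩ := hσ.image_beurlingAhlfors.ge h0
          exact ⟨w, le_of_lt hw, hwe⟩
      refine ⟨Complex.exp w, ?_, by rw [h.gluedMap_exp hw, hwe, exp_log hω0]⟩
      rw [mem_compl_iff, mem_ball_zero_iff, not_lt, norm_exp]
      exact Real.one_le_exp hw
  constructor
  · rw [← injOn_univ, ← union_compl_self (ball (0 : ℂ) 1)]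
    refine (injOn_union disjoint_compl_right).2 ⟨hb.injOn, hc.injOn, fun z hz z' hz' hzz' => ?_⟩
    exact hc.mapsTo hz' (hzz' ▸ hb.mapsTo hz)
  · intro z
    by_cases hz : z ∈ Ω
    · exact (hb.surjOn hz).imp fun _ h => h.2
    · exact (hc.surjOn hz).imp fun _ h => h.2

lemma exists_hasFDerivAt_gluedMap (h : IsWelding Γ Ω Ω' p F G σ)
    {M : ℝ} (hσ : IsQuasisymmetricLift σ M) {z : ℂ}
    (hz : ‖z‖ ≠ 1) : ∃ L, HasFDerivAt (gluedMap p F G σ) L z ∧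
      ‖L‖ ^ 2 ≤ 4 * M * (M + 1) * L.det := by
  have hM := hσ.one_le
  rcases hz.lt_or_gt with hz | hz
  · have hn := (isOpen_ball (x := (0 : ℂ)) (ε := 1)).mem_nhds (mem_ball_zero_iff.2 hz)
    have hd := ((h.inner.differentiableOn.differentiableAt hn).hasDerivAt).complexToReal_fderiv
    refine ⟨_, hd.congr_of_eventuallyEq ?_, norm_sq_smul_le ?_ _⟩
    · filter_upwards [hn] with w hw
      exact gluedMap_of_norm_le (mem_ball_zero_iff.1 hw).le
    · have : (1 : ℂ →L[ℝ] ℂ).det = 1 := by rw [det_eq_re_im]; simp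
      rw [this, norm_one]; nlinarith
  · have hz0 : z ≠ 0 := by rintro rfl; simp at hz; linarith
    have e : log z + log (z / z) = log z := by rw [div_self hz0]; simp
    have hre : 0 < (log z).re := by rw [log_re]; exact Real.log_pos hz
    obtain ⟨L, hL⟩ := hσ.exists_hasQCDerivAt_beurlingAhlfors hre
    set b := beurlingAhlfors σ (log z) with hb
    have hbre : 0 < b.re := h.isCircleLift.beurlingAhlfors_re_pos hre
    have hb1 : 1 < ‖Complex.exp b‖ := by rw [norm_exp]; simpa using hbre
    have hinv : (Complex.exp b)⁻¹ ∈ ball (0 : ℂ) 1 := by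
      rw [mem_ball_zero_iff, norm_inv]; exact inv_lt_one_of_one_lt₀ hb1
    have hG := (h.outer.differentiableOn.differentiableAt (isOpen_ball.mem_nhds hinv)).hasDerivAt
    have hE : DifferentiableAt ℂ (fun ζ => exteriorMap p G (Complex.exp ζ)) b := by
      have hG' : DifferentiableAt ℂ (fun ζ => G (Complex.exp ζ)⁻¹) b :=
        DifferentiableAt.comp b (g := G) (f := fun ζ => (Complex.exp ζ)⁻¹) hG.differentiableAt
          (differentiableAt_exp.fun_inv (Complex.exp_ne_zero b))
      exact (hG'.fun_inv (h.outer_inv_ne_zero hb1.le)).const_add p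
    have hl := (hasDerivAt_localLog hz0).complexToReal_fderiv
    have h1 := HasFDerivAt.comp z (g := beurlingAhlfors σ) (g' := L)
      (by rw [e]; exact hL.hasStrictFDerivAt.hasFDerivAt) hl
    have h2 := HasDerivAt.comp_hasFDerivAt z (h₂ := fun ζ => exteriorMap p G (Complex.exp ζ))
      (by simp only [Function.comp_apply, e]; exact hE.hasDerivAt) h1
    refine ⟨_, h2.congr_of_eventuallyEq ?_, norm_sq_smul_le (norm_sq_comp_smul_le hL.norm_sq_le _) _⟩
    have : ∀ᶠ w : ℂ in 𝓝 z, 1 < ‖w‖ := continuous_norm.continuousAt.eventually_const_lt hz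
    filter_upwards [this] with w hw
    exact (h.gluedMap_eq hz.le hw.le).1

end IsWelding

/-- Integrating along the lines in the direction `u`: a function that vanishes off a compact set
has zero integral if it is a directional derivative off the unit circle. -/
lemma integral_eq_zero_of_hasDerivAt_line {g g' : ℂ → ℂ} (u : Circle) (hg : Continuous g)
    (hg' : Integrable g') {R : ℝ} (hR : ∀ z, R < ‖z‖ → g z = 0) (hR' : ∀ z, R < ‖z‖ → g' z = 0)
    (hd : ∀ z, ‖z‖ ≠ 1 → HasDerivAt (fun t : ℝ => g (z + t * u)) (g' z) 0) :
    ∫ z, g' z = 0 := by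
  have hrot := (rotation u).measurePreserving
  have hre : MeasurableEmbedding (rotation u) := (rotation u).toHomeomorph.measurableEmbedding
  have hprod := volume_preserving_equiv_real_prod.symm
  set Φ : ℝ × ℝ → ℂ := fun p => rotation u (measurableEquivRealProd.symm p) with hΦ
  have hmp : MeasurePreserving Φ := hrot.comp hprod
  have hme : MeasurableEmbedding Φ := hre.comp measurableEquivRealProd.symm.measurableEmbedding
  have hΦe : ∀ x y : ℝ, Φ (x, y) = u * (y * I) + x * u := fun x y => by
    rw [hΦ]; simp only [rotation_apply, measurableEquivRealProd_symm_apply]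
    rw [Complex.mk_eq_add_mul_I]; ring
  have hΦn : ∀ x y : ℝ, ‖Φ (x, y)‖ ^ 2 = x ^ 2 + y ^ 2 := fun x y => by
    rw [hΦ]
    simp only [rotation_apply, measurableEquivRealProd_symm_apply, norm_mul, Circle.norm_coe]
    rw [one_mul, ← normSq_eq_norm_sq, normSq_mk]; ring
  have hintg : Integrable (fun p : ℝ × ℝ => g' (Φ p)) (volume.prod volume) :=
    (hmp.integrable_comp_emb hme).2 hg'
  rw [← hmp.integral_comp hme, Measure.volume_eq_prod, integral_prod_symm _ hintg]
  refine (integral_congr_ae ?_).trans (integral_zero' _ _)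
  filter_upwards [hintg.prod_left_ae] with y hy
  set T := |R| + 1
  have hT : ∀ x : ℝ, T ≤ |x| → R < ‖Φ (x, y)‖ := fun x hx => by
    have h1 : |R| < |x| := by linarith [show T = |R| + 1 from rfl]
    have h2 : R ^ 2 < ‖Φ (x, y)‖ ^ 2 := by
      rw [hΦn]; nlinarith [sq_lt_sq.2 h1, sq_nonneg y]
    exact (le_abs_self R).trans_lt (abs_lt_of_sq_lt_sq h2 (norm_nonneg _))
  have hT0 : 0 < T := by positivity
  have hs : Function.support (fun x => g' (Φ (x, y))) ⊆ Ioc (-T) T := by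
    intro x hx
    by_contra hc
    refine hx (hR' _ (hT x ?_))
    rw [mem_Ioc, not_and_or, not_lt, not_le] at hc
    rcases hc with hc | hc
    · rw [abs_of_nonpos (by linarith)]; linarith
    · exact hc.le.trans (le_abs_self _)
  rw [← intervalIntegral.integral_eq_integral_of_support_subset hs,
    integral_eq_of_hasDerivAt_off_countable (fun x : ℝ => g (Φ (x, y))) _
      (s := {√(1 - y ^ 2), -√(1 - y ^ 2)}) (Set.toFinite _).countable ?_ ?_
      hy.intervalIntegrable]
  · rw [hR _ (hT _ (le_abs_self _)), hR _ (hT _ (by rw [abs_neg]; exact le_abs_self _)), sub_zero]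
    rfl
  · simp only [hΦe]; fun_prop
  · rintro x ⟨-, hx⟩
    have hx1 : ‖Φ (x, y)‖ ≠ 1 := fun h1 => by
      have := hΦn x y
      rw [h1] at this
      refine hx (sq_eq_sq_iff_eq_or_eq_neg.1 ?_)
      rw [Real.sq_sqrt (by nlinarith [sq_nonneg x])]
      linarith
    have h := hd _ hx1
    rw [← sub_self x] at h
    refine (h.comp_sub_const x x).congr_of_eventuallyEq (Eventually.of_forall fun t => ?_)
    simp only [hΦe]
    congr 1; push_cast; ring

lemma integrableOn_of_lintegral_sq_lt_top {g : ℂ → ℂ} {K : Set ℂ} (hK : volume K ≠ ⊤)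
    (hg : AEStronglyMeasurable g (volume.restrict K)) (h : ∫⁻ z in K, ‖g z‖ₑ ^ 2 < ⊤) :
    IntegrableOn g K := by
  refine ⟨hg, ?_⟩
  have : ∀ x : ℝ≥0∞, x ≤ 1 + x ^ 2 := fun x => by
    rcases le_total x 1 with hx | hx
    · exact hx.trans le_self_add
    · exact (le_self_pow₀ hx two_ne_zero).trans le_add_self
  calc ∫⁻ z in K, ‖g z‖ₑ ≤ ∫⁻ z in K, (1 + ‖g z‖ₑ ^ 2) := lintegral_mono fun z => this _
    _ = volume K + ∫⁻ z in K, ‖g z‖ₑ ^ 2 := by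
      rw [lintegral_add_left measurable_const]; simp
    _ < ⊤ := ENNReal.add_lt_top.2 ⟨hK.lt_top, h⟩

section Gluing

variable {f : ℂ → ℂ} {K : ℝ}

lemma hasFDerivAt_fderiv_of_norm_ne
    (hd : ∀ z, ‖z‖ ≠ 1 → ∃ L, HasFDerivAt f L z ∧ ‖L‖ ^ 2 ≤ K * L.det) {z : ℂ} (hz : ‖z‖ ≠ 1) :
    HasFDerivAt f (fderiv ℝ f z) z ∧ ‖fderiv ℝ f z‖ ^ 2 ≤ K * (fderiv ℝ f z).det := by
  obtain ⟨L, hL, hq⟩ := hd z hz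
  rw [hL.fderiv]; exact ⟨hL, hq⟩

lemma ae_norm_ne_one : ∀ᵐ z : ℂ, ‖z‖ ≠ 1 := by
  rw [ae_iff]
  convert Measure.addHaar_sphere (volume : Measure ℂ) 0 1 using 2
  ext z; simp

lemma lintegral_fderiv_sq_lt_top
    (hf : Continuous f) (hi : Function.Injective f)
    (hd : ∀ z, ‖z‖ ≠ 1 → ∃ L, HasFDerivAt f L z ∧ ‖L‖ ^ 2 ≤ K * L.det)
    (hK : 0 ≤ K) {k : Set ℂ} (hk : IsCompact k) :
    ∫⁻ z in k, ‖fderiv ℝ f z‖ₑ ^ 2 < ⊤ := by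
  set s := k \ sphere 0 1
  have hs : MeasurableSet s := hk.measurableSet.diff isClosed_sphere.measurableSet
  have hz : ∀ z ∈ s, ‖z‖ ≠ 1 := fun z hz h1 => hz.2 (mem_sphere_zero_iff_norm.2 h1)
  have e : ∫⁻ z in k, ‖fderiv ℝ f z‖ₑ ^ 2 = ∫⁻ z in s, ‖fderiv ℝ f z‖ₑ ^ 2 := by
    refine (setLIntegral_congr ?_).symm
    exact sdiff_null_ae_eq_self (Measure.addHaar_sphere volume _ _)
  have harea := lintegral_abs_det_fderiv_eq_addHaar_image volume hs (f := f)
    (fun z h => (hasFDerivAt_fderiv_of_norm_ne hd (hz z h)).1.hasFDerivWithinAt) hi.injOn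
  have hvol : volume (f '' s) < ⊤ :=
    (measure_mono (image_mono sdiff_subset)).trans_lt (hk.image hf).measure_lt_top
  calc ∫⁻ z in k, ‖fderiv ℝ f z‖ₑ ^ 2 = ∫⁻ z in s, ‖fderiv ℝ f z‖ₑ ^ 2 := e
    _ ≤ ∫⁻ z in s, ENNReal.ofReal K * ENNReal.ofReal |(fderiv ℝ f z).det| := by
      refine setLIntegral_mono' hs fun z h => ?_
      rw [← ENNReal.ofReal_mul hK, ← ofReal_norm, ← ENNReal.ofReal_pow (norm_nonneg _)]
      refine ENNReal.ofReal_le_ofReal ((hasFDerivAt_fderiv_of_norm_ne hd (hz z h)).2.trans ?_)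
      gcongr
      exact le_abs_self _
    _ = ENNReal.ofReal K * volume (f '' s) := by
      rw [lintegral_const_mul' _ _ ENNReal.ofReal_ne_top, harea]
    _ < ⊤ := ENNReal.mul_lt_top ENNReal.ofReal_lt_top hvol

lemma locallyIntegrable_fderiv_apply
    (hf : Continuous f) (hi : Function.Injective f)
    (hd : ∀ z, ‖z‖ ≠ 1 → ∃ L, HasFDerivAt f L z ∧ ‖L‖ ^ 2 ≤ K * L.det)
    (hK : 0 ≤ K) (v : ℂ) :
    LocallyIntegrable fun z => fderiv ℝ f z v := by
  rw [locallyIntegrable_iff]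
  intro k hk
  refine integrableOn_of_lintegral_sq_lt_top hk.measure_lt_top.ne
    (measurable_fderiv_apply_const ℝ f v).aestronglyMeasurable ?_
  calc ∫⁻ z in k, ‖fderiv ℝ f z v‖ₑ ^ 2 ≤ ∫⁻ z in k, ‖v‖ₑ ^ 2 * ‖fderiv ℝ f z‖ₑ ^ 2 := by
        refine lintegral_mono fun z => ?_
        rw [mul_comm, ← mul_pow]
        gcongr
        exact (fderiv ℝ f z).le_opENorm v
    _ = ‖v‖ₑ ^ 2 * ∫⁻ z in k, ‖fderiv ℝ f z‖ₑ ^ 2 :=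
      lintegral_const_mul' _ _ (by finiteness)
    _ < ⊤ := ENNReal.mul_lt_top (by finiteness) (lintegral_fderiv_sq_lt_top hf hi hd hK hk)

lemma hasWeakFDerivOn_of_hasFDerivAt
    (hf : Continuous f) (hi : Function.Injective f)
    (hd : ∀ z, ‖z‖ ≠ 1 → ∃ L, HasFDerivAt f L z ∧ ‖L‖ ^ 2 ≤ K * L.det) (hK : 0 ≤ K) :
    HasWeakFDerivOn f (fderiv ℝ f) univ := by
  have hli := locallyIntegrable_fderiv_apply hf hi hd hK
  refine ⟨(locallyIntegrableOn_univ.2 hf.locallyIntegrable),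
    fun v => locallyIntegrableOn_univ.2 (hli v), fun ψ hψ hψc _ v => ?_⟩
  simp only [Measure.restrict_univ]
  have hψd : Differentiable ℝ ψ := hψ.differentiable (by simp)
  have hDc : Continuous (fderiv ℝ ψ) := hψ.continuous_fderiv (by simp)
  have h1 : ∀ v, Integrable fun z => ψ z • fderiv ℝ f z v := fun v =>
    (hli v).integrable_smul_left_of_hasCompactSupport hψ.continuous hψc
  have h2 : ∀ v, Integrable fun z => fderiv ℝ ψ z v • f z := fun v =>
    Continuous.integrable_of_hasCompactSupport (by fun_prop)
      ((hψc.fderiv_apply (𝕜 := ℝ) v).smul_right)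
  have hunit : ∀ u : Circle, ∫ z, ψ z • fderiv ℝ f z u = -∫ z, fderiv ℝ ψ z u • f z := fun u => by
    rw [eq_neg_iff_add_eq_zero, ← integral_add (h1 _) (h2 _)]
    obtain ⟨R, hR⟩ := hψc.isBounded.exists_norm_le
    have hψ0 : ∀ z, R < ‖z‖ → ψ z = 0 := fun z hz =>
      image_eq_zero_of_notMem_tsupport fun h => absurd (hR z h) (not_le.2 hz)
    have hDψ0 : ∀ z, R < ‖z‖ → fderiv ℝ ψ z = 0 := fun z hz =>
      image_eq_zero_of_notMem_tsupport fun h =>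
        absurd (hR z (tsupport_fderiv_subset ℝ h)) (not_le.2 hz)
    refine integral_eq_zero_of_hasDerivAt_line (g := fun z => ψ z • f z) u
      (hψ.continuous.smul hf) ((h1 _).add (h2 _)) (R := R) (fun z hz => by simp [hψ0 z hz])
      (fun z hz => by simp [hψ0 z hz, hDψ0 z hz]) fun z hz => ?_
    have hp : HasFDerivAt (fun z => ψ z • f z) (ψ z • fderiv ℝ f z +
        (fderiv ℝ ψ z).smulRight (f z)) z :=
      (hψd z).hasFDerivAt.smul (hasFDerivAt_fderiv_of_norm_ne hd hz).1
    have hl : HasDerivAt (fun t : ℝ => z + t * (u : ℂ)) u 0 := by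
      simpa using (((hasDerivAt_id (0 : ℝ)).ofReal_comp).mul_const (u : ℂ)).const_add z
    have := HasFDerivAt.comp_hasDerivAt (0 : ℝ) (by simpa using hp) hl
    refine this.congr_deriv ?_
    simp
  obtain ⟨u, hu⟩ : ∃ u : Circle, v = ‖v‖ • (u : ℂ) := ⟨Circle.exp (arg v), by simp⟩
  rw [hu]
  simp only [map_smul, smul_comm _ ‖v‖, smul_assoc, integral_smul, hunit, smul_neg]

end Gluing

lemma norm_wirtingerD_le (L : ℂ →L[ℝ] ℂ) : ‖wirtingerD L‖ ≤ ‖L‖ := by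
  have h1 := L.le_opNorm 1
  have h2 := L.le_opNorm I
  rw [norm_one] at h1
  rw [norm_I] at h2
  have h3 := norm_sub_le (L 1) (I * L I)
  rw [norm_mul, norm_I] at h3
  rw [wirtingerD, norm_div, Complex.norm_ofNat]
  linarith

lemma norm_wirtingerDBar_le_of_norm_sq_le {L : ℂ →L[ℝ] ℂ} {K : ℝ} (hK : 1 ≤ K)
    (h : ‖L‖ ^ 2 ≤ K * L.det) :
    ‖wirtingerDBar L‖ ≤ (4 * K - 1) / (4 * K + 1) * ‖wirtingerD L‖ := by
  rw [det_eq_wirtinger] at h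
  have h1 : ‖wirtingerD L‖ ^ 2 ≤ ‖L‖ ^ 2 := by gcongr; exact norm_wirtingerD_le L
  have hq : 0 ≤ (4 * K - 1) / (4 * K + 1) := div_nonneg (by linarith) (by linarith)
  refine abs_le_of_sq_le_sq' ?_ (by positivity) |>.2
  have hq2 : (K - 1) ≤ K * ((4 * K - 1) / (4 * K + 1)) ^ 2 := by
    rw [div_pow, ← mul_div_assoc, le_div_iff₀ (by positivity)]
    nlinarith
  have h2 : K * ‖wirtingerDBar L‖ ^ 2 ≤ (K - 1) * ‖wirtingerD L‖ ^ 2 := by linarith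
  have h3 := h2.trans (mul_le_mul_of_nonneg_right hq2 (sq_nonneg ‖wirtingerD L‖))
  rw [mul_pow]
  rw [mul_assoc] at h3
  exact le_of_mul_le_mul_left h3 (by linarith)

theorem isQuasicircle_of_hasBoundedTurning {Γ : Set ℂ} (hΓ : IsJordanCurve Γ) {C : ℝ} (hC : 1 ≤ C)
    (hBT : HasBoundedTurning Γ C) : IsQuasicircle Γ := by
  obtain ⟨Ω, Ω', p, F, G, σ, h⟩ := exists_isWelding hΓ (by linarith) hBT
  obtain ⟨M, hσ⟩ := h.exists_isQuasisymmetricLift hC hBT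
  have hM := hσ.one_le
  set K := 4 * M * (M + 1)
  have hK : 1 ≤ K := by simp only [K]; nlinarith
  have hc := h.continuous_gluedMap
  have hb := h.bijective_gluedMap hσ
  have hd := fun z (hz : ‖z‖ ≠ 1) => h.exists_hasFDerivAt_gluedMap hσ hz
  have ht := h.tendsto_gluedMap
  rw [Metric.cobounded_eq_cocompact] at ht
  have hcl := (isProperMap_iff_tendsto_cocompact.2 ⟨hc, ht⟩).isClosedMap
  set e := (Equiv.ofBijective _ hb).toHomeomorphOfContinuousClosed hc hcl
  refine ⟨4 * K, gluedMap p F G σ, ⟨by linarith, hc.continuousOn, bijOn_univ.2 hb,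
    ⟨e.symm, e.symm.continuous.continuousOn, fun z _ => e.symm_apply_apply z,
      fun z _ => e.apply_symm_apply z⟩, fderiv ℝ (gluedMap p F G σ),
    hasWeakFDerivOn_of_hasFDerivAt hc hb.1 hd (by linarith), fun k _ hk =>
      lintegral_fderiv_sq_lt_top hc hb.1 hd (by linarith) hk, ?_⟩, h.image_gluedMap_sphere⟩
  rw [Measure.restrict_univ]
  filter_upwards [ae_norm_ne_one] with z hz
  exact norm_wirtingerDBar_le_of_norm_sq_le hK (hasFDerivAt_fderiv_of_norm_ne hd hz).2

section Mollification

variable {E : Type*} [NormedAddCommGroup E]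

lemma lintegral_enorm_sq (F : ℂ → E) : ∫⁻ z, ‖F z‖ₑ ^ 2 = eLpNorm F 2 volume ^ 2 := by
  have := eLpNorm_nnreal_pow_eq_lintegral (f := F) (μ := volume) (p := 2) two_ne_zero
  simpa using this.symm

lemma exists_lintegral_translate_sub_le {F : ℂ → E} (hF : MemLp F 2 volume) {δ : ℝ≥0∞}
    (hδ : 0 < δ) :
    ∃ ε > 0, ∀ y : ℂ, ‖y‖ < ε → ∫⁻ z, ‖F (z - y) - F z‖ₑ ^ 2 ≤ δ := by
  have : Fact ((2 : ℝ≥0∞) ≠ ⊤) := ⟨by simp⟩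
  have h1 : Continuous fun y : ℂ => DomAddAct.mk (-y) +ᵥ hF.toLp F :=
    (DomAddAct.continuous_mk.comp continuous_neg).vadd continuous_const
  have h2 : Tendsto (fun y : ℂ => edist (DomAddAct.mk (-y) +ᵥ hF.toLp F) (hF.toLp F) ^ 2) (𝓝 0)
      (𝓝 0) := by
    have h3 : Continuous fun y : ℂ => edist (DomAddAct.mk (-y) +ᵥ hF.toLp F) (hF.toLp F) ^ 2 :=
      (ENNReal.continuous_pow 2).comp (h1.edist continuous_const)
    have h4 := h3.tendsto 0
    simpa using h4
  obtain ⟨ε, hε, h⟩ := Metric.mem_nhds_iff.1 (h2.eventually (Iic_mem_nhds hδ))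
  refine ⟨ε, hε, fun y hy => ?_⟩
  have h5 := h (mem_ball_zero_iff.2 hy)
  rw [mem_ofPred_eq, DomAddAct.mk_vadd_toLp, Lp.edist_toLp_toLp, ← lintegral_enorm_sq] at h5
  simpa [sub_eq_neg_add] using h5

lemma lintegral_norm_integral_sq_le [NormedSpace ℝ E] {F : ℂ → E} (hF : MemLp F 2 volume)
    (φ : ContDiffBump (0 : ℂ)) {δ : ℝ≥0∞}
    (h : ∀ y : ℂ, ‖y‖ < φ.rOut → ∫⁻ z, ‖F (z - y) - F z‖ₑ ^ 2 ≤ δ) :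
    ∫⁻ z, ‖∫ t, φ.normed volume t • (F (z - t) - F z)‖ₑ ^ 2 ≤ δ := by
  set η := φ.normed volume
  have hηm : Measurable fun t => ‖η t‖ₑ := φ.continuous_normed.enorm.measurable
  have hη : ∫⁻ t, ‖η t‖ₑ = 1 := by
    simp only [fun t => Real.enorm_of_nonneg (φ.nonneg_normed (μ := volume) t), η]
    rw [← ofReal_integral_eq_lintegral_ofReal φ.integrable_normed
      (Eventually.of_forall φ.nonneg_normed), φ.integral_normed, ENNReal.ofReal_one]
  have hm : AEStronglyMeasurable (fun p : ℂ × ℂ => F (p.1 - p.2) - F p.1)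
      (volume.prod volume) :=
    (hF.1.comp_quasiMeasurePreserving
      (quasiMeasurePreserving_sub (μ := volume) (ν := volume))).sub hF.1.comp_fst
  have hm' : AEMeasurable (fun p : ℂ × ℂ => ‖η p.2‖ₑ * ‖F (p.1 - p.2) - F p.1‖ₑ ^ 2)
      (volume.prod volume) :=
    (hηm.comp measurable_snd).aemeasurable.mul (hm.enorm.pow_const 2)
  have hz : ∀ z, AEMeasurable (fun t => ‖F (z - t) - F z‖ₑ) volume := fun z =>
    ((hF.1.comp_measurePreserving (Measure.measurePreserving_sub_left volume z)).sub
      aestronglyMeasurable_const).enorm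
  have hpt : ∀ z, ‖∫ t, η t • (F (z - t) - F z)‖ₑ ^ 2 ≤
      ∫⁻ t, ‖η t‖ₑ * ‖F (z - t) - F z‖ₑ ^ 2 := fun z => by
    have h1 := sq_lintegral_le (volume.withDensity fun t => ‖η t‖ₑ)
      ((hz z).mono_ac (withDensity_absolutelyContinuous _ _))
    rw [withDensity_apply _ MeasurableSet.univ, Measure.restrict_univ, hη, one_mul,
      lintegral_withDensity_eq_lintegral_mul₀ hηm.aemeasurable (hz z),
      lintegral_withDensity_eq_lintegral_mul₀ hηm.aemeasurable ((hz z).pow_const 2)] at h1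
    refine le_trans ?_ h1
    gcongr
    refine (enorm_integral_le_lintegral_enorm _).trans (le_of_eq ?_)
    simp only [enorm_smul, Pi.mul_apply]
  calc _ ≤ ∫⁻ z, ∫⁻ t, ‖η t‖ₑ * ‖F (z - t) - F z‖ₑ ^ 2 := lintegral_mono hpt
    _ = ∫⁻ t, ∫⁻ z, ‖η t‖ₑ * ‖F (z - t) - F z‖ₑ ^ 2 := lintegral_lintegral_swap hm'
    _ ≤ ∫⁻ t, ‖η t‖ₑ * δ := by
      refine lintegral_mono fun t => ?_
      rw [lintegral_const_mul' _ _ (by finiteness)]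
      by_cases ht : ‖t‖ < φ.rOut
      · gcongr
        exact h t ht
      · have : η t = 0 := by
          rw [← Function.notMem_support, φ.support_normed_eq]
          simpa using ht
        simp [this]
    _ = δ := by rw [lintegral_mul_const _ hηm, hη, one_mul]

end Mollification

lemma eq_smulRight_add_smulRight (L : ℂ →L[ℝ] ℂ) :
    L = reCLM.smulRight (L 1) + imCLM.smulRight (L I) := by
  ext1 v
  conv_lhs => rw [← re_add_im v, ← mul_one (v.re : ℂ), ← real_smul, ← real_smul, map_add,
    map_smul, map_smul]
  simp

section WeakDerivative

variable {f : ℂ → ℂ} {f' : ℂ → ℂ →L[ℝ] ℂ}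

lemma HasWeakFDerivOn.locallyIntegrable (h : HasWeakFDerivOn f f' univ) (v : ℂ) :
    LocallyIntegrable fun z => f' z v :=
  locallyIntegrableOn_univ.1 (h.2.1 v)

lemma HasWeakFDerivOn.integral_eq (h : HasWeakFDerivOn f f' univ) {ψ : ℂ → ℝ}
    (hψ : ContDiff ℝ (⊤ : ℕ∞) ψ) (hc : HasCompactSupport ψ) (v : ℂ) :
    ∫ z, ψ z • f' z v = -∫ z, fderiv ℝ ψ z v • f z := by
  simpa using h.2.2 ψ hψ hc (subset_univ _) v

lemma HasWeakFDerivOn.aestronglyMeasurable (h : HasWeakFDerivOn f f' univ) :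
    AEStronglyMeasurable f' volume := by
  have e : f' = fun z => reCLM.smulRight (f' z 1) + imCLM.smulRight (f' z I) :=
    funext fun z => eq_smulRight_add_smulRight _
  have h1 := (h.locallyIntegrable 1).aestronglyMeasurable
  have h2 := (h.locallyIntegrable I).aestronglyMeasurable
  have hc : ∀ c : ℂ →L[ℝ] ℝ, Continuous fun w : ℂ => c.smulRight w := fun c =>
    (ContinuousLinearMap.smulRightL ℝ ℂ ℂ c).continuous
  rw [e]
  exact ((hc reCLM).comp_aestronglyMeasurable h1).add ((hc imCLM).comp_aestronglyMeasurable h2)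

lemma HasWeakFDerivOn.fderiv_convolution (h : HasWeakFDerivOn f f' univ) (hf : Continuous f)
    (φ : ContDiffBump (0 : ℂ)) (z v : ℂ) :
    fderiv ℝ (convolution (φ.normed volume) f (ContinuousLinearMap.lsmul ℝ ℝ) volume) z v =
      ∫ t, φ.normed volume t • f' (z - t) v := by
  set η := φ.normed volume
  have hη : ContDiff ℝ (⊤ : ℕ∞) η := φ.contDiff_normed
  have hηc : HasCompactSupport η := φ.hasCompactSupport_normed
  have hψ : ContDiff ℝ (⊤ : ℕ∞) fun t => η (z - t) := hη.comp (contDiff_const.sub contDiff_id)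
  have hψc : HasCompactSupport fun t => η (z - t) :=
    hηc.comp_homeomorph (Homeomorph.subLeft z)
  have hD := hηc.hasFDerivAt_convolution_left (ContinuousLinearMap.lsmul ℝ ℝ)
    (hη.of_le (by simp)) hf.locallyIntegrable z (μ := volume)
  have hi : Integrable (fun t => (ContinuousLinearMap.lsmul ℝ ℝ (E := ℂ)).precompL ℂ
      (fderiv ℝ η t) (f (z - t))) :=
    (hηc.fderiv ℝ).convolutionExists_left _ (hη.continuous_fderiv (by simp))
      hf.locallyIntegrable z
  rw [hD.fderiv, convolution_def, ContinuousLinearMap.integral_apply hi]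
  have e1 : ∫ t, η t • f' (z - t) v = ∫ t, η (z - t) • f' t v := by
    rw [← integral_sub_left_eq_self (fun t => η (z - t) • f' t v) volume z]
    simp
  have e2 : ∀ t, fderiv ℝ (fun t => η (z - t)) t v = -fderiv ℝ η (z - t) v := fun t => by
    have := ((hη.differentiable (by simp)) (z - t)).hasFDerivAt.comp t
      ((hasFDerivAt_id (𝕜 := ℝ) t).const_sub z)
    rw [show (fun t => η (z - t)) = η ∘ HSub.hSub z from rfl, this.fderiv]
    simp
  rw [e1, h.integral_eq hψ hψc, ← integral_neg,
    ← integral_sub_left_eq_self (fun t => -(fderiv ℝ (fun t => η (z - t)) t v • f t)) volume z]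
  simp [e2]

lemma memLp_indicator (h : HasWeakFDerivOn f f' univ) (hW : W12locOn f' univ) (R : ℝ) :
    MemLp ((closedBall (0 : ℂ) R).indicator f') 2 volume := by
  refine ⟨h.aestronglyMeasurable.indicator measurableSet_closedBall, ?_⟩
  have h1 := hW _ (subset_univ _) (isCompact_closedBall (0 : ℂ) R)
  have h2 : eLpNorm ((closedBall (0 : ℂ) R).indicator f') 2 volume ^ 2 < ⊤ := by
    rw [← lintegral_enorm_sq]
    refine lt_of_eq_of_lt ?_ h1
    rw [← lintegral_indicator measurableSet_closedBall]
    refine lintegral_congr fun z => ?_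
    by_cases hz : z ∈ closedBall (0 : ℂ) R
    · rw [indicator_of_mem hz, indicator_of_mem hz]; rfl
    · rw [indicator_of_notMem hz, indicator_of_notMem hz]; simp
  exact lt_of_not_ge fun h3 => by simp [top_le_iff.1 h3] at h2

lemma fderiv_convolution_sub (h : HasWeakFDerivOn f f' univ) (hW : W12locOn f' univ)
    (hf : Continuous f) {φ : ContDiffBump (0 : ℂ)} {R : ℝ} (hφ : φ.rOut ≤ 1) {z : ℂ}
    (hz : z ∈ closedBall (0 : ℂ) R) :
    fderiv ℝ (convolution (φ.normed volume) f (ContinuousLinearMap.lsmul ℝ ℝ) volume) z - f' z =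
      ∫ t, φ.normed volume t • ((closedBall (0 : ℂ) (R + 1)).indicator f' (z - t) -
        (closedBall (0 : ℂ) (R + 1)).indicator f' z) := by
  set F := (closedBall (0 : ℂ) (R + 1)).indicator f'
  have hF := memLp_indicator h hW (R + 1)
  set η := φ.normed volume
  have hη : ContDiff ℝ (⊤ : ℕ∞) η := φ.contDiff_normed
  have hηc : HasCompactSupport η := φ.hasCompactSupport_normed
  have hzn := mem_closedBall_zero_iff.1 hz
  have hFz : F z = f' z := indicator_of_mem (by rw [mem_closedBall_zero_iff]; linarith) _
  have hi1 : Integrable fun t => η t • F (z - t) :=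
    ((hF.comp_measurePreserving (Measure.measurePreserving_sub_left volume z)).locallyIntegrable
      one_le_two).integrable_smul_left_of_hasCompactSupport hη.continuous hηc
  have hi2 : Integrable fun t => η t • F z := φ.integrable_normed.smul_const _
  simp only [smul_sub]
  rw [integral_sub hi1 hi2, integral_smul_const, φ.integral_normed, one_smul, hFz]
  congr 1
  ext1 v
  rw [h.fderiv_convolution hf, ContinuousLinearMap.integral_apply hi1]
  refine integral_congr_ae (Eventually.of_forall fun t => ?_)
  by_cases ht : ‖t‖ < φ.rOut
  · have : F (z - t) = f' (z - t) := indicator_of_mem (by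
      rw [mem_closedBall_zero_iff]; linarith [norm_sub_le z t]) _
    simp [this, η]
  · have : η t = 0 := by
      rw [← Function.notMem_support, φ.support_normed_eq]
      simpa using ht
    simp [this, show φ.normed volume t = 0 from this]

/-- Smooth approximation of a continuous function in `W^{1,2}_loc`. -/
lemma exists_contDiff_approx (h : HasWeakFDerivOn f f' univ) (hW : W12locOn f' univ)
    (hf : Continuous f) (R : ℝ) {ε : ℝ} (hε : 0 < ε) {δ : ℝ≥0∞} (hδ : 0 < δ) :
    ∃ F : ℂ → ℂ, ContDiff ℝ (⊤ : ℕ∞) F ∧ (∀ z ∈ closedBall (0 : ℂ) R, dist (F z) (f z) ≤ ε) ∧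
      ∫⁻ z in closedBall (0 : ℂ) R, ‖fderiv ℝ F z - f' z‖ₑ ^ 2 ≤ δ := by
  obtain ⟨ε₁, hε₁, h₁⟩ := exists_lintegral_translate_sub_le (memLp_indicator h hW (R + 1)) hδ
  have huc := (isCompact_closedBall (0 : ℂ) (R + 1)).uniformContinuousOn_of_continuous
    hf.continuousOn
  obtain ⟨ε₂, hε₂, h₂⟩ := Metric.uniformContinuousOn_iff_le.1 huc ε hε
  have hρ : 0 < min (min ε₁ ε₂) 1 := by positivity
  set ρ := min (min ε₁ ε₂) 1
  have hρ1 : ρ ≤ ε₁ := (min_le_left _ _).trans (min_le_left _ _)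
  have hρ2 : ρ ≤ ε₂ := (min_le_left _ _).trans (min_le_right _ _)
  have hρ3 : ρ ≤ 1 := min_le_right _ _
  let φ : ContDiffBump (0 : ℂ) := ⟨ρ / 2, ρ, by positivity, by linarith⟩
  refine ⟨convolution (φ.normed volume) f (ContinuousLinearMap.lsmul ℝ ℝ) volume,
    φ.hasCompactSupport_normed.contDiff_convolution_left _ φ.contDiff_normed
      hf.locallyIntegrable, fun z hz => ?_, ?_⟩
  · refine φ.dist_normed_convolution_le hf.aestronglyMeasurable fun x hx => ?_
    have hx' : dist x z < ρ := hx
    rw [mem_closedBall] at hz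
    refine h₂ x (mem_closedBall.2 ?_) z (mem_closedBall.2 (by linarith)) (hx'.le.trans hρ2)
    linarith [dist_triangle x z 0]
  · refine le_trans ?_ (lintegral_norm_integral_sq_le (memLp_indicator h hW (R + 1)) φ
      fun y hy => h₁ y (lt_of_lt_of_le hy hρ1))
    refine le_trans (le_of_eq ?_) (setLIntegral_le_lintegral (closedBall (0 : ℂ) R) _)
    refine setLIntegral_congr_fun measurableSet_closedBall fun z hz => ?_
    rw [fderiv_convolution_sub h hW hf hρ3 hz]

end WeakDerivative

lemma apply_smul_sub_apply_smul (L : ℂ →L[ℝ] ℂ) (l : ℂ →L[ℝ] ℝ) :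
    l (L 1) • L I - l (L I) • L 1 = L.det • (I * l 1 - l I) := by
  have hl : ∀ w : ℂ, l w = w.re * l 1 + w.im * l I := fun w => by
    conv_lhs => rw [← re_add_im w, ← mul_one (w.re : ℂ), ← real_smul, ← real_smul, map_add,
      map_smul, map_smul, smul_eq_mul, smul_eq_mul]
  rw [det_eq_re_im, hl (L 1), hl (L I)]
  apply Complex.ext <;> simp <;> ring

section Degree

variable {f : ℂ → ℂ} {f' : ℂ → ℂ →L[ℝ] ℂ}

lemma HasWeakFDerivOn.integrable_smul (h : HasWeakFDerivOn f f' univ) {ψ : ℂ → ℝ}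
    (hψ : Continuous ψ) (hc : HasCompactSupport ψ) (v : ℂ) :
    Integrable fun z => ψ z • f' z v :=
  (h.locallyIntegrable v).integrable_smul_left_of_hasCompactSupport hψ hc

lemma HasWeakFDerivOn.integral_fderiv_smul_sub (h : HasWeakFDerivOn f f' univ) {ψ : ℂ → ℝ}
    (hψ : ContDiff ℝ (⊤ : ℕ∞) ψ) (hc : HasCompactSupport ψ) :
    ∫ z, (fderiv ℝ ψ z 1 • f' z I - fderiv ℝ ψ z I • f' z 1) = 0 := by
  have hs : ∀ v, ContDiff ℝ (⊤ : ℕ∞) fun z => fderiv ℝ ψ z v := fun v =>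
    (hψ.fderiv_right (by simp)).clm_apply contDiff_const
  have hcs : ∀ v, HasCompactSupport fun z => fderiv ℝ ψ z v := fun v =>
    hc.fderiv_apply (𝕜 := ℝ) v
  have hd : ∀ v w z, fderiv ℝ (fun z => fderiv ℝ ψ z v) z w = fderiv ℝ (fderiv ℝ ψ) z w v :=
    fun v w z => by
      have h2 : DifferentiableAt ℝ (fderiv ℝ ψ) z :=
        ((hψ.fderiv_right (m := 1) (by norm_cast)).differentiable one_ne_zero) z
      rw [fderiv_clm_apply h2 (differentiableAt_const v)]
      simp
  rw [integral_sub (h.integrable_smul (hs 1).continuous (hcs 1) I)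
    (h.integrable_smul (hs I).continuous (hcs I) 1), h.integral_eq (hs 1) (hcs 1),
    h.integral_eq (hs I) (hcs I), sub_eq_zero]
  congr 2
  ext z
  rw [hd, hd, (hψ.contDiffAt.isSymmSndFDerivAt (by rw [minSmoothness_of_isRCLikeNormedField]; norm_cast)) I 1]

lemma norm_apply_smul_sub_le {L M : ℂ →L[ℝ] ℂ} {l m : ℂ →L[ℝ] ℝ} {u v : ℂ} (hu : ‖u‖ = 1)
    (hv : ‖v‖ = 1) :
    ‖m (M u) • L v - l (L u) • L v‖ ≤ ‖m‖ * ‖M - L‖ * ‖L‖ + ‖m - l‖ * ‖L‖ * ‖L‖ := by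
  have e : m (M u) - l (L u) = m ((M - L) u) + (m - l) (L u) := by simp
  have h1 : ‖(M - L) u‖ ≤ ‖M - L‖ := by simpa [hu] using (M - L).le_opNorm u
  have h2 : ‖L u‖ ≤ ‖L‖ := by simpa [hu] using L.le_opNorm u
  have h3 : ‖L v‖ ≤ ‖L‖ := by simpa [hv] using L.le_opNorm v
  rw [← sub_smul, e, norm_smul, ← add_mul]
  gcongr
  refine (norm_add_le _ _).trans ?_
  gcongr
  · exact (m.le_opNorm _).trans (by gcongr)
  · exact ((m - l).le_opNorm _).trans (by gcongr)

lemma norm_apply_smul_sub_sub_le {L M : ℂ →L[ℝ] ℂ} {l m : ℂ →L[ℝ] ℝ} {B ε : ℝ} (hε : 0 < ε)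
    (hm : ‖m‖ ≤ B) (hml : ‖m - l‖ ≤ ε) :
    ‖(m (M 1) • L I - m (M I) • L 1) - (l (L 1) • L I - l (L I) • L 1)‖ ≤
      B / ε * ‖M - L‖ ^ 2 + ε * (B + 2) * ‖L‖ ^ 2 := by
  have hB := (norm_nonneg m).trans hm
  have h1 := norm_apply_smul_sub_le (L := L) (M := M) (l := l) (m := m) norm_one norm_I
  have h2 := norm_apply_smul_sub_le (L := L) (M := M) (l := l) (m := m) norm_I norm_one
  have h3 : ‖m‖ * ‖M - L‖ * ‖L‖ ≤ B * ‖M - L‖ * ‖L‖ := by gcongr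
  have h4 : ‖m - l‖ * ‖L‖ * ‖L‖ ≤ ε * ‖L‖ * ‖L‖ := by gcongr
  have h5 : 2 * (‖M - L‖ * ‖L‖) ≤ 1 / ε * ‖M - L‖ ^ 2 + ε * ‖L‖ ^ 2 := by
    have : 0 ≤ 1 / ε * (‖M - L‖ - ε * ‖L‖) ^ 2 := by positivity
    have e : 1 / ε * (‖M - L‖ - ε * ‖L‖) ^ 2 =
      1 / ε * ‖M - L‖ ^ 2 + ε * ‖L‖ ^ 2 - 2 * (‖M - L‖ * ‖L‖) := by field_simp; ring
    linarith
  have h6 := mul_le_mul_of_nonneg_left h5 hB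
  have e2 : B * (1 / ε * ‖M - L‖ ^ 2 + ε * ‖L‖ ^ 2) =
    B / ε * ‖M - L‖ ^ 2 + ε * B * ‖L‖ ^ 2 := by ring
  rw [sub_sub_sub_comm]
  refine (norm_sub_le _ _).trans ?_
  linarith

lemma exists_cutoff_smul_comp {f : ℂ → ℂ} (hf : Continuous f)
    {φ : ℂ → ℝ} (hφ : ContDiff ℝ (⊤ : ℕ∞) φ) (hc : IsCompact (f ⁻¹' tsupport φ)) :
    ∃ R : ℝ, ∃ ε > 0, f ⁻¹' tsupport φ ⊆ closedBall 0 R ∧ ∀ F : ℂ → ℂ, ContDiff ℝ (⊤ : ℕ∞) F →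
      (∀ z ∈ closedBall (0 : ℂ) R, dist (F z) (f z) ≤ ε) →
      ∃ ψ : ℂ → ℝ, ContDiff ℝ (⊤ : ℕ∞) ψ ∧ HasCompactSupport ψ ∧
        (∀ z ∉ closedBall (0 : ℂ) R, fderiv ℝ ψ z = 0) ∧
        ∀ z ∈ closedBall (0 : ℂ) R, fderiv ℝ ψ z = (fderiv ℝ φ (F z)).comp (fderiv ℝ F z) := by
  obtain ⟨R, hR0, hR⟩ := hc.isBounded.subset_closedBall_lt 0 0
  have hA : IsCompact (closedBall (0 : ℂ) (R + 2) \ ball 0 (R + 1)) :=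
    (isCompact_closedBall _ _).diff isOpen_ball
  obtain ⟨ε, hε, hd⟩ := (hA.image hf).exists_cthickening_subset_open
    (isClosed_tsupport φ).isOpen_compl (by
      rintro _ ⟨z, hz, rfl⟩ hzφ
      have h1 := mem_closedBall_zero_iff.1 (hR hzφ)
      have h2 : ¬ ‖z‖ < R + 1 := fun h => hz.2 (mem_ball_zero_iff.2 h)
      linarith)
  refine ⟨R + 2, ε, hε, hR.trans (closedBall_subset_closedBall (by linarith)), fun F hF hFf => ?_⟩
  let β : ContDiffBump (0 : ℂ) := ⟨R + 1, R + 2, by linarith, by linarith⟩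
  have hβt : tsupport β = closedBall 0 (R + 2) := β.tsupport_eq
  have hβ : ContDiff ℝ (⊤ : ℕ∞) β := β.contDiff
  have hsub : tsupport (fun z => β z * φ (F z)) ⊆ closedBall 0 (R + 2) :=
    hβt ▸ tsupport_mul_subset_left
  refine ⟨fun z => β z * φ (F z), hβ.mul (hφ.comp hF), β.hasCompactSupport.mul_right,
    fun z hz => ?_, fun z hz => ?_⟩
  · exact image_eq_zero_of_notMem_tsupport fun h => hz (hsub (tsupport_fderiv_subset ℝ h))
  have hD : HasFDerivAt (fun z => β z * φ (F z)) (β z • (fderiv ℝ φ (F z)).comp (fderiv ℝ F z) +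
      φ (F z) • fderiv ℝ β z) z :=
    ((hβ.differentiable (by simp)) z).hasFDerivAt.mul
      (((hφ.differentiable (by simp)) (F z)).hasFDerivAt.comp z
        ((hF.differentiable (by simp)) z).hasFDerivAt)
  rw [hD.fderiv]
  by_cases hz1 : z ∈ ball (0 : ℂ) (R + 1)
  · have e : (β : ℂ → ℝ) =ᶠ[𝓝 z] fun _ => 1 := β.eventuallyEq_one_of_mem_ball hz1
    rw [e.fderiv_eq, e.eq_of_nhds]
    simp
  · have hn : F z ∉ tsupport φ :=
      hd (mem_cthickening_of_dist_le _ (f z) _ _ ⟨z, ⟨hz, hz1⟩, rfl⟩ (hFf z hz))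
    have h0 : fderiv ℝ φ (F z) = 0 :=
      image_eq_zero_of_notMem_tsupport fun h => hn (tsupport_fderiv_subset ℝ h)
    rw [image_eq_zero_of_notMem_tsupport hn, h0]
    simp

lemma HasWeakFDerivOn.integrableOn_apply_smul (h : HasWeakFDerivOn f f' univ)
    (hW : W12locOn f' univ) {l : ℂ → ℂ →L[ℝ] ℝ} (hl : Continuous l) {K : Set ℂ}
    (hK : IsCompact K) (u v : ℂ) : IntegrableOn (fun z => l z (f' z u) • f' z v) K := by
  obtain ⟨B, hB⟩ := hK.exists_bound_of_continuousOn hl.continuousOn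
  have hm : ∀ w, AEStronglyMeasurable (fun z => f' z w) volume := fun w =>
    (h.locallyIntegrable w).aestronglyMeasurable
  have hm' : AEStronglyMeasurable (fun z => l z (f' z u) • f' z v) volume :=
    (isBoundedBilinearMap_apply.continuous.comp_aestronglyMeasurable
      (hl.aestronglyMeasurable.prodMk (hm u))).smul (hm v)
  refine ⟨hm'.restrict, ?_⟩
  have hpt : ∀ z ∈ K, ‖l z (f' z u) • f' z v‖ₑ ≤
      ENNReal.ofReal (B * ‖u‖ * ‖v‖) * ‖f' z‖ₑ ^ 2 := fun z hz => by
    rw [← ofReal_norm, ← ofReal_norm, ← ENNReal.ofReal_pow (norm_nonneg _),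
      ← ENNReal.ofReal_mul' (by positivity), norm_smul]
    refine ENNReal.ofReal_le_ofReal ?_
    have h1 := (l z).le_of_opNorm_le (hB z hz) (f' z u)
    have hB0 := (norm_nonneg _).trans (hB z hz)
    calc _ ≤ B * (‖f' z‖ * ‖u‖) * (‖f' z‖ * ‖v‖) := by
          gcongr
          · exact h1.trans (by gcongr; exact (f' z).le_opNorm u)
          · exact (f' z).le_opNorm v
      _ = _ := by ring
  refine (setLIntegral_mono' hK.measurableSet hpt).trans_lt ?_
  rw [lintegral_const_mul' _ _ ENNReal.ofReal_ne_top]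
  exact ENNReal.mul_lt_top ENNReal.ofReal_lt_top (hW K (subset_univ _) hK)

/-- The change of variables formula for a divergence, in a weak form. -/
lemma HasWeakFDerivOn.integral_det_smul (h : HasWeakFDerivOn f f' univ)
    (hW : W12locOn f' univ) (hf : Continuous f) {φ : ℂ → ℝ} (hφ : ContDiff ℝ (⊤ : ℕ∞) φ)
    (hφc : HasCompactSupport φ) (hc : IsCompact (f ⁻¹' tsupport φ)) :
    Integrable (fun z => (f' z).det • (I * fderiv ℝ φ (f z) 1 - fderiv ℝ φ (f z) I)) ∧
      ∫ z, (f' z).det • (I * fderiv ℝ φ (f z) 1 - fderiv ℝ φ (f z) I) = 0 := by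
  obtain ⟨R, ε₀, hε₀, hR, hψ⟩ := exists_cutoff_smul_comp hf hφ hc
  have hDc : Continuous (fderiv ℝ φ) := hφ.continuous_fderiv (by simp)
  obtain ⟨B, hB⟩ := (hφc.fderiv ℝ).exists_bound_of_continuous hDc
  have huc : UniformContinuous (fderiv ℝ φ) :=
    (hφc.fderiv ℝ).uniformContinuous_of_continuous hDc
  have hB0 : 0 ≤ B := (norm_nonneg _).trans (hB 0)
  set K := closedBall (0 : ℂ) R
  have hK : IsCompact K := isCompact_closedBall _ _
  set g : ℂ → ℂ := fun z => fderiv ℝ φ (f z) (f' z 1) • f' z I - fderiv ℝ φ (f z) (f' z I) • f' z 1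
    with hg
  have hgd : ∀ z, (f' z).det • (I * fderiv ℝ φ (f z) 1 - fderiv ℝ φ (f z) I) = g z := fun z =>
    (apply_smul_sub_apply_smul _ _).symm
  simp only [hgd]
  have hg0 : ∀ z ∉ K, g z = 0 := fun z hz => by
    have : fderiv ℝ φ (f z) = 0 :=
      image_eq_zero_of_notMem_tsupport fun h => hz (hR (tsupport_fderiv_subset ℝ h))
    simp [hg, this]
  have hgi : IntegrableOn g K :=
    (h.integrableOn_apply_smul hW (hDc.comp hf) hK 1 I).sub
      (h.integrableOn_apply_smul hW (hDc.comp hf) hK I 1)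
  refine ⟨(integrableOn_iff_integrable_of_support_subset
    (Function.support_subset_iff'.2 hg0)).1 hgi, ?_⟩
  rw [← setIntegral_eq_integral_of_forall_compl_eq_zero hg0]
  set Q := ∫⁻ z in K, ‖f' z‖ₑ ^ 2
  have hQ : Q < ⊤ := hW K (subset_univ _) hK
  set C := ENNReal.ofReal B + ENNReal.ofReal (B + 2) * Q
  have hC : C < ⊤ := ENNReal.add_lt_top.2
    ⟨ENNReal.ofReal_lt_top, ENNReal.mul_lt_top ENNReal.ofReal_lt_top hQ⟩
  have key : ∀ ε > 0, ‖∫ z in K, g z‖ₑ ≤ ENNReal.ofReal ε * C := fun ε hε => by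
    obtain ⟨ε₁, hε₁, hu⟩ := Metric.uniformContinuous_iff_le.1 huc ε hε
    obtain ⟨F, hF, hFf, hFD⟩ := exists_contDiff_approx h hW hf R (lt_min hε₀ hε₁)
      (δ := ENNReal.ofReal (ε ^ 2)) (ENNReal.ofReal_pos.2 (by positivity))
    obtain ⟨ψ, hψs, hψc, hψ0, hψD⟩ := hψ F hF fun z hz => (hFf z hz).trans (min_le_left _ _)
    have h0 := h.integral_fderiv_smul_sub hψs hψc
    rw [← setIntegral_eq_integral_of_forall_compl_eq_zero (s := K)
      fun z hz => by simp [hψ0 z hz]] at h0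
    have hψDc : ∀ v, Continuous fun z => fderiv ℝ ψ z v := fun v =>
      (hψs.continuous_fderiv (by simp)).clm_apply continuous_const
    have hi := (h.integrable_smul (hψDc 1) (hψc.fderiv_apply (𝕜 := ℝ) 1) I).sub
      (h.integrable_smul (hψDc I) (hψc.fderiv_apply (𝕜 := ℝ) I) 1)
    rw [← enorm_neg, ← zero_sub, ← h0]
    have h1 := integral_sub (hi.integrableOn (s := K)) hgi
    simp only [Pi.sub_apply] at h1
    rw [← h1]
    refine (enorm_integral_le_lintegral_enorm _).trans ?_
    have hpt : ∀ z ∈ K, ‖fderiv ℝ ψ z 1 • f' z I - fderiv ℝ ψ z I • f' z 1 - g z‖ₑ ≤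
        ENNReal.ofReal (B / ε) * ‖fderiv ℝ F z - f' z‖ₑ ^ 2 +
          ENNReal.ofReal (ε * (B + 2)) * ‖f' z‖ₑ ^ 2 := fun z hz => by
      rw [hψD z hz, ← ofReal_norm, ← ofReal_norm, ← ofReal_norm,
        ← ENNReal.ofReal_pow (norm_nonneg _), ← ENNReal.ofReal_pow (norm_nonneg _),
        ← ENNReal.ofReal_mul (by positivity), ← ENNReal.ofReal_mul (by positivity),
        ← ENNReal.ofReal_add (by positivity) (by positivity)]
      refine ENNReal.ofReal_le_ofReal (norm_apply_smul_sub_sub_le hε (hB _) ?_)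
      rw [← dist_eq_norm]
      exact hu ((hFf z hz).trans (min_le_right _ _))
    have hme : AEMeasurable (fun z => ENNReal.ofReal (B / ε) * ‖fderiv ℝ F z - f' z‖ₑ ^ 2)
        (volume.restrict K) :=
      ((((hF.continuous_fderiv (by simp)).aestronglyMeasurable.sub
        h.aestronglyMeasurable).enorm.pow_const 2).const_mul _).restrict
    refine (setLIntegral_mono' hK.measurableSet hpt).trans ?_
    rw [lintegral_add_left' hme, lintegral_const_mul' _ _ ENNReal.ofReal_ne_top,
      lintegral_const_mul' _ _ ENNReal.ofReal_ne_top]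
    calc _ ≤ ENNReal.ofReal (B / ε) * ENNReal.ofReal (ε ^ 2) +
          ENNReal.ofReal (ε * (B + 2)) * Q := by gcongr
      _ = ENNReal.ofReal ε * C := by
        rw [← ENNReal.ofReal_mul (by positivity), ENNReal.ofReal_mul hε.le, mul_add, ← mul_assoc,
          ← ENNReal.ofReal_mul hε.le]
        congr 2
        rw [← ENNReal.ofReal_mul hε.le]
        congr 1
        field_simp
  have hlim : Tendsto (fun ε : ℝ => ENNReal.ofReal ε * C) (𝓝[>] 0) (𝓝 0) := by
    have := ENNReal.Tendsto.mul_const (b := C)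
      ((ENNReal.continuous_ofReal.tendsto 0).mono_left nhdsWithin_le_nhds) (Or.inr hC.ne)
      (m := fun ε : ℝ => ENNReal.ofReal ε) (f := 𝓝[>] 0)
    simpa using this
  exact enorm_eq_zero.1 (le_antisymm (ge_of_tendsto hlim
    (eventually_mem_nhdsWithin.mono fun ε hε => key ε hε)) zero_le)

end Degree

section AreaBound

/-- A smooth vector field on the plane is `x ↦ χ x / (s² + |x|²) • x`; this is its profile. -/
def fieldProfile (χ : ContDiffBump (0 : ℂ)) (s : ℝ) (x : ℂ) : ℝ := χ x / (s ^ 2 + ‖x‖ ^ 2)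

variable {χ : ContDiffBump (0 : ℂ)} {s : ℝ}

lemma contDiff_fieldProfile (hs : 0 < s) : ContDiff ℝ (⊤ : ℕ∞) (fieldProfile χ s) :=
  χ.contDiff.div (contDiff_const.add (contDiff_norm_sq ℝ)) fun x => by positivity

lemma fderiv_fieldProfile_self (hs : 0 < s) (x : ℂ) :
    2 * fieldProfile χ s x + fderiv ℝ (fieldProfile χ s) x x =
      2 * χ x * (s ^ 2 / (s ^ 2 + ‖x‖ ^ 2) ^ 2) + fderiv ℝ χ x x / (s ^ 2 + ‖x‖ ^ 2) := by
  have hp : s ^ 2 + ‖x‖ ^ 2 ≠ 0 := by positivity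
  have hχ : DifferentiableAt ℝ χ x := (χ.contDiff (n := 1)).differentiable one_ne_zero x
  have hl : HasDerivAt (fun t : ℝ => t • x) x 1 := by
    simpa using (hasDerivAt_id (1 : ℝ)).smul_const x
  have hcomp : ∀ F : ℂ → ℝ, DifferentiableAt ℝ F x →
      HasDerivAt (fun t : ℝ => F (t • x)) (fderiv ℝ F x x) 1 := fun F hF => by
    have hF' : HasFDerivAt F (fderiv ℝ F x) ((1 : ℝ) • x) := by
      rw [one_smul]; exact hF.hasFDerivAt
    exact hF'.comp_hasDerivAt (1 : ℝ) hl
  have h1 := hcomp χ hχ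
  have h2 : HasDerivAt (fun t : ℝ => s ^ 2 + (t * ‖x‖) ^ 2) (2 * ‖x‖ ^ 2) 1 := by
    refine ((((hasDerivAt_id (1 : ℝ)).mul_const ‖x‖).pow 2).const_add (s ^ 2)).congr_deriv ?_
    simp; ring
  have h3 := hcomp (fieldProfile χ s) ((contDiff_fieldProfile hs).differentiable (by simp) x)
  have h4 := h1.div h2 (by simpa using hp)
  have e : (fun t : ℝ => fieldProfile χ s (t • x)) =
      (fun t : ℝ => χ (t • x)) / fun t : ℝ => s ^ 2 + (t * ‖x‖) ^ 2 := by
    ext t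
    simp [fieldProfile, mul_pow]
  rw [e] at h3
  rw [h3.unique h4, fieldProfile]
  simp only [one_smul, one_mul]
  field_simp
  ring

/-- The components of the vector field. -/
lemma exists_field (χ : ContDiffBump (0 : ℂ)) (hs : 0 < s) (w : ℂ) :
    ∃ φ₁ φ₂ : ℂ → ℝ, ContDiff ℝ (⊤ : ℕ∞) φ₁ ∧ ContDiff ℝ (⊤ : ℕ∞) φ₂ ∧
      tsupport φ₁ ⊆ closedBall w χ.rOut ∧ tsupport φ₂ ⊆ closedBall w χ.rOut ∧
      ∀ z, fderiv ℝ φ₁ z 1 + fderiv ℝ φ₂ z I =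
        2 * χ (z - w) * (s ^ 2 / (s ^ 2 + ‖z - w‖ ^ 2) ^ 2) +
          fderiv ℝ χ (z - w) (z - w) / (s ^ 2 + ‖z - w‖ ^ 2) := by
  have hq := contDiff_fieldProfile (χ := χ) hs
  have hsub : ContDiff ℝ (⊤ : ℕ∞) fun z : ℂ => z - w := contDiff_id.sub contDiff_const
  have hsupp : ∀ c : ℂ → ℝ,
      tsupport (fun z => c (z - w) * fieldProfile χ s (z - w)) ⊆ closedBall w χ.rOut := fun c => by
    refine closure_minimal (fun z hz => ?_) isClosed_closedBall
    by_contra hc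
    refine hz ?_
    have : χ (z - w) = 0 := χ.zero_of_le_dist (by
      rw [dist_zero_right, ← dist_eq_norm]; exact (not_le.1 hc).le)
    simp [fieldProfile, this]
  have hcomp : ∀ c : ℂ →L[ℝ] ℝ, ∀ z v, fderiv ℝ (fun z => c (z - w) * fieldProfile χ s (z - w)) z v =
      c (z - w) * fderiv ℝ (fieldProfile χ s) (z - w) v + fieldProfile χ s (z - w) * c v :=
    fun c z v => by
      have h1 : HasFDerivAt (fun z : ℂ => z - w) (ContinuousLinearMap.id ℝ ℂ) z :=
        (hasFDerivAt_id z).sub_const w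
      have h2 := (c.hasFDerivAt.comp z h1).mul
        ((hq.differentiable (by simp) (z - w)).hasFDerivAt.comp z h1)
      have h3 : fderiv ℝ (fun z => c (z - w) * fieldProfile χ s (z - w)) z = _ := h2.fderiv
      rw [h3]; simp
  refine ⟨_, _, (reCLM.contDiff.comp hsub).mul (hq.comp hsub),
    (imCLM.contDiff.comp hsub).mul (hq.comp hsub), hsupp _, hsupp _, fun z => ?_⟩
  rw [← fderiv_fieldProfile_self hs]
  refine (congrArg₂ (· + ·) (hcomp reCLM z 1) (hcomp imCLM z I)).trans ?_
  set x := z - w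
  set D := fderiv ℝ (fieldProfile χ s) x
  have hD : D x = x.re * D 1 + x.im * D I := by
    conv_lhs => rw [← re_add_im x, ← mul_one (x.re : ℂ), ← real_smul, ← real_smul, map_add,
      map_smul, map_smul, smul_eq_mul, smul_eq_mul]
  rw [hD]
  simp only [reCLM_apply, imCLM_apply, one_re, I_im]
  ring

variable {f : ℂ → ℂ} {f' : ℂ → ℂ →L[ℝ] ℂ}

lemma HasWeakFDerivOn.integrableOn_det (h : HasWeakFDerivOn f f' univ)
    (hW : W12locOn f' univ) (hJ : ∀ᵐ z, 0 ≤ (f' z).det) {K : Set ℂ} (hK : IsCompact K) :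
    IntegrableOn (fun z => (f' z).det) K := by
  refine ⟨(ContinuousLinearMap.continuous_det.comp_aestronglyMeasurable
    h.aestronglyMeasurable).restrict, (lintegral_mono_ae ?_).trans_lt (hW K (subset_univ _) hK)⟩
  filter_upwards [ae_restrict_of_ae hJ] with z hz
  change _ ≤ ‖f' z‖ₑ ^ 2
  rw [← ofReal_norm, ← ofReal_norm, ← ENNReal.ofReal_pow (norm_nonneg _), Real.norm_of_nonneg hz]
  refine ENNReal.ofReal_le_ofReal ?_
  have h1 := norm_wirtingerD_le (f' z)
  rw [det_eq_wirtinger]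
  nlinarith [norm_nonneg (wirtingerD (f' z)), sq_nonneg ‖wirtingerDBar (f' z)‖]

lemma HasWeakFDerivOn.exists_lintegral_det_le (h : HasWeakFDerivOn f f' univ)
    (hW : W12locOn f' univ) (hf : Continuous f) (hc : ∀ R, IsCompact (f ⁻¹' closedBall 0 R))
    (hJ : ∀ᵐ z, 0 ≤ (f' z).det) (T₀ : ℝ) {T : ℝ} (hT : 0 < T) :
    ∃ d : ℝ, 0 ≤ d ∧ ∀ w ∈ closedBall (0 : ℂ) T₀, ∀ s > 0, ∫⁻ z in f ⁻¹' closedBall w T,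
      ENNReal.ofReal (s ^ 2 / (s ^ 2 + ‖f z - w‖ ^ 2) ^ 2 * (f' z).det) ≤ ENNReal.ofReal d := by
  let χ : ContDiffBump (0 : ℂ) := ⟨T, 2 * T, hT, by linarith⟩
  obtain ⟨M, hM⟩ := (χ.hasCompactSupport.fderiv ℝ).exists_bound_of_continuous
    ((χ.contDiff (n := 1)).continuous_fderiv one_ne_zero)
  have hM0 : 0 ≤ M := (norm_nonneg _).trans (hM 0)
  set K := f ⁻¹' closedBall 0 (T₀ + 2 * T)
  have hK : IsCompact K := hc _
  have hdet := h.integrableOn_det hW hJ hK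
  have hdet0 : 0 ≤ ∫ z in K, (f' z).det :=
    setIntegral_nonneg_of_ae_restrict (ae_restrict_of_ae hJ)
  refine ⟨M / T * ∫ z in K, (f' z).det, by positivity, fun w hw s hs => ?_⟩
  have hwK : f ⁻¹' closedBall w (2 * T) ⊆ K := preimage_mono (closedBall_subset_closedBall' (by
    rw [mem_closedBall] at hw; linarith))
  have hcw : ∀ t ⊆ closedBall w (2 * T), IsClosed t → IsCompact (f ⁻¹' t) := fun t ht htc =>
    hK.of_isClosed_subset (htc.preimage hf) ((preimage_mono ht).trans hwK)
  obtain ⟨φ₁, φ₂, hφ₁, hφ₂, ht₁, ht₂, hφ⟩ := exists_field χ hs w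
  have hcs : ∀ φ : ℂ → ℝ, tsupport φ ⊆ closedBall w (2 * T) → HasCompactSupport φ := fun φ ht =>
    (isCompact_closedBall w (2 * T)).of_isClosed_subset (isClosed_tsupport _) ht
  obtain ⟨i₁, e₁⟩ := h.integral_det_smul hW hf hφ₁ (hcs _ ht₁) (hcw _ ht₁ (isClosed_tsupport _))
  obtain ⟨i₂, e₂⟩ := h.integral_det_smul hW hf hφ₂ (hcs _ ht₂) (hcw _ ht₂ (isClosed_tsupport _))
  set J := fun z => (f' z).det
  set G : ℂ → ℝ := fun z => fderiv ℝ φ₁ (f z) 1 + fderiv ℝ φ₂ (f z) I with hG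
  have hJG : Integrable (fun z => J z * G z) ∧ ∫ z, J z * G z = 0 := by
    have j₁ := imCLM.integrable_comp i₁
    have j₂ := reCLM.integrable_comp i₂
    have k₁ := imCLM.integral_comp_comm i₁
    have k₂ := reCLM.integral_comp_comm i₂
    rw [e₁, map_zero] at k₁
    rw [e₂, map_zero] at k₂
    have e : (fun z => J z * G z) = fun z => imCLM ((f' z).det • (I * fderiv ℝ φ₁ (f z) 1 -
        fderiv ℝ φ₁ (f z) I)) - reCLM ((f' z).det • (I * fderiv ℝ φ₂ (f z) 1 -
        fderiv ℝ φ₂ (f z) I)) := by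
      ext z
      simp [J, hG]
      ring
    rw [e]
    exact ⟨j₁.sub j₂, by rw [integral_sub j₁ j₂, k₁, k₂, sub_zero]⟩
  have hKm : MeasurableSet K := hK.measurableSet
  have hi : Integrable (K.indicator fun z => M / T * J z) :=
    (integrable_indicator_iff hKm).2 (hdet.const_mul _)
  have hpt : ∀ z, 0 ≤ J z → (f ⁻¹' closedBall w T).indicator
      (fun z => s ^ 2 / (s ^ 2 + ‖f z - w‖ ^ 2) ^ 2 * J z) z ≤
        J z * G z + K.indicator (fun z => M / T * J z) z := fun z hz => by
    have hG1 : G z = _ := hφ (f z)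
    set x := f z - w
    have hq : 0 ≤ s ^ 2 / (s ^ 2 + ‖x‖ ^ 2) ^ 2 := by positivity
    have hind : 0 ≤ fderiv ℝ χ x x / (s ^ 2 + ‖x‖ ^ 2) * J z +
        K.indicator (fun z => M / T * J z) z := by
      by_cases h0 : fderiv ℝ χ x = 0
      · simp only [h0, zero_apply, zero_div, zero_mul, zero_add]
        exact indicator_apply_nonneg fun _ => by positivity
      have hxT : T ≤ ‖x‖ := by
        by_contra hlt
        refine h0 ?_
        have e : (χ : ℂ → ℝ) =ᶠ[𝓝 x] fun _ => 1 :=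
          χ.eventuallyEq_one_of_mem_ball (mem_ball_zero_iff.2 (not_le.1 hlt))
        rw [e.fderiv_eq]; simp
      have hx2 : x ∈ closedBall (0 : ℂ) (2 * T) := by
        rw [← χ.tsupport_eq]
        by_contra hn
        exact h0 (image_eq_zero_of_notMem_tsupport fun h => hn (tsupport_fderiv_subset ℝ h))
      have hzK : z ∈ K := hwK (by
        rw [mem_preimage, mem_closedBall, dist_eq_norm]; exact mem_closedBall_zero_iff.1 hx2)
      rw [indicator_of_mem hzK, ← add_mul]
      refine mul_nonneg ?_ hz
      have h1 : -(M * ‖x‖) ≤ fderiv ℝ χ x x :=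
        (abs_le.1 ((fderiv ℝ χ x).le_of_opNorm_le (hM x) x)).1
      have h2 : -(M / T) ≤ -(M * ‖x‖) / (s ^ 2 + ‖x‖ ^ 2) := by
        rw [neg_div, neg_le_neg_iff, div_le_div_iff₀ (by positivity) hT]
        have : ‖x‖ * T ≤ s ^ 2 + ‖x‖ ^ 2 := by nlinarith [norm_nonneg x]
        nlinarith
      have h3 : -(M * ‖x‖) / (s ^ 2 + ‖x‖ ^ 2) ≤ fderiv ℝ χ x x / (s ^ 2 + ‖x‖ ^ 2) := by gcongr
      linarith
    have hfirst : (f ⁻¹' closedBall w T).indicator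
        (fun z => s ^ 2 / (s ^ 2 + ‖f z - w‖ ^ 2) ^ 2 * J z) z ≤
          2 * χ x * (s ^ 2 / (s ^ 2 + ‖x‖ ^ 2) ^ 2) * J z := by
      by_cases hzT : z ∈ f ⁻¹' closedBall w T
      · rw [indicator_of_mem hzT]
        have : χ x = 1 := χ.one_of_mem_closedBall (by
          rw [mem_closedBall_zero_iff, ← dist_eq_norm]; exact hzT)
        rw [this]
        nlinarith [mul_nonneg hq hz]
      · rw [indicator_of_notMem hzT]
        have := χ.nonneg (x := x)
        positivity
    rw [hG1]
    linarith
  have hT0 : MeasurableSet (f ⁻¹' closedBall w T) :=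
    (isClosed_closedBall.preimage hf).measurableSet
  calc _ = ∫⁻ z, ENNReal.ofReal ((f ⁻¹' closedBall w T).indicator
      (fun z => s ^ 2 / (s ^ 2 + ‖f z - w‖ ^ 2) ^ 2 * J z) z) := by
        rw [← lintegral_indicator hT0]
        refine lintegral_congr fun z => ?_
        by_cases hz : z ∈ f ⁻¹' closedBall w T
        · rw [indicator_of_mem hz, indicator_of_mem hz]
        · rw [indicator_of_notMem hz, indicator_of_notMem hz, ENNReal.ofReal_zero]
    _ ≤ ∫⁻ z, ENNReal.ofReal (J z * G z + K.indicator (fun z => M / T * J z) z) :=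
        lintegral_mono_ae (hJ.mono fun z hz => ENNReal.ofReal_le_ofReal (hpt z hz))
    _ = ENNReal.ofReal (∫ z, (J z * G z + K.indicator (fun z => M / T * J z) z)) := by
        refine (ofReal_integral_eq_lintegral_ofReal (hJG.1.add hi) ?_).symm
        filter_upwards [hJ] with z hz
        refine le_trans ?_ (hpt z hz)
        exact indicator_apply_nonneg fun _ => by positivity
    _ = _ := by
        rw [integral_add hJG.1 hi, hJG.2, zero_add, integral_indicator hKm, integral_const_mul]

lemma HasWeakFDerivOn.lintegral_sub_mul_det_le (h : HasWeakFDerivOn f f' univ)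
    (hf : Continuous f) (hJ : ∀ᵐ z, 0 ≤ (f' z).det) {S : Set ℂ} {d : ℝ} (hd : 0 ≤ d) {w : ℂ}
    (hS : ∀ s > 0, ∫⁻ z in S,
      ENNReal.ofReal (s ^ 2 / (s ^ 2 + ‖f z - w‖ ^ 2) ^ 2 * (f' z).det) ≤ ENNReal.ofReal d)
    {r : ℝ} (hr : 0 < r) (N : ℕ) :
    ∫⁻ z in S, ENNReal.ofReal ((1 / (r ^ 2 + ‖f z - w‖ ^ 2) -
      1 / ((2 ^ N * r) ^ 2 + ‖f z - w‖ ^ 2)) * (f' z).det) ≤ ENNReal.ofReal (3 * N * d) := by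
  induction N with
  | zero => simp
  | succ N ih =>
    set t := 2 ^ N * r
    have ht : 0 < t := by positivity
    have e : ∀ z, 0 ≤ (f' z).det → ENNReal.ofReal ((1 / (r ^ 2 + ‖f z - w‖ ^ 2) -
        1 / ((2 ^ (N + 1) * r) ^ 2 + ‖f z - w‖ ^ 2)) * (f' z).det) ≤
        ENNReal.ofReal ((1 / (r ^ 2 + ‖f z - w‖ ^ 2) - 1 / (t ^ 2 + ‖f z - w‖ ^ 2)) * (f' z).det) +
        ENNReal.ofReal 3 * ENNReal.ofReal (t ^ 2 / (t ^ 2 + ‖f z - w‖ ^ 2) ^ 2 * (f' z).det) :=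
      fun z hz => by
        rw [← ENNReal.ofReal_mul (by norm_num)]
        refine le_trans (ENNReal.ofReal_le_ofReal ?_) ENNReal.ofReal_add_le
        rw [← mul_assoc, ← add_mul]
        gcongr
        have h1 : 1 / (t ^ 2 + ‖f z - w‖ ^ 2) - 1 / ((2 ^ (N + 1) * r) ^ 2 + ‖f z - w‖ ^ 2) ≤
            3 * (t ^ 2 / (t ^ 2 + ‖f z - w‖ ^ 2) ^ 2) := by
          have e1 : 2 ^ (N + 1) * r = 2 * t := by rw [pow_succ]; ring
          rw [e1, div_sub_div _ _ (by positivity) (by positivity), mul_div_assoc', pow_two (_ + _),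
            div_le_div_iff₀ (by positivity) (by positivity)]
          have : 0 ≤ (t ^ 2 + ‖f z - w‖ ^ 2) * (t ^ 2 * (3 * (3 * t ^ 2))) := by positivity
          nlinarith
        linarith
    have hm : AEMeasurable (fun z => ENNReal.ofReal ((1 / (r ^ 2 + ‖f z - w‖ ^ 2) -
        1 / (t ^ 2 + ‖f z - w‖ ^ 2)) * (f' z).det)) (volume.restrict S) := by
      have h1 : Continuous fun z => 1 / (r ^ 2 + ‖f z - w‖ ^ 2) - 1 / (t ^ 2 + ‖f z - w‖ ^ 2) := by
        refine Continuous.sub ?_ ?_ <;>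
          refine Continuous.div continuous_const (by fun_prop) fun z => by positivity
      exact ((h1.aestronglyMeasurable.mul (ContinuousLinearMap.continuous_det.comp_aestronglyMeasurable
        h.aestronglyMeasurable)).aemeasurable.ennreal_ofReal).restrict
    calc _ ≤ _ := lintegral_mono_ae ((ae_restrict_of_ae hJ).mono e)
      _ ≤ ENNReal.ofReal (3 * N * d) + ENNReal.ofReal 3 * ENNReal.ofReal d := by
        rw [lintegral_add_left' hm, lintegral_const_mul' _ _ ENNReal.ofReal_ne_top]
        gcongr
        exact hS t ht
      _ = _ := by
        rw [← ENNReal.ofReal_mul (by norm_num), ← ENNReal.ofReal_add (by positivity) (by positivity)]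
        congr 1; push_cast; ring

end AreaBound

section LogEnergy

lemma norm_sq_le_mul_det {L : ℂ →L[ℝ] ℂ} {K : ℝ} (hK : 1 ≤ K)
    (h : ‖wirtingerDBar L‖ ≤ (K - 1) / (K + 1) * ‖wirtingerD L‖) : ‖L‖ ^ 2 ≤ K * L.det := by
  have hn : ‖L‖ ≤ ‖wirtingerD L‖ + ‖wirtingerDBar L‖ := by
    refine L.opNorm_le_bound (by positivity) fun v => ?_
    rw [apply_eq_wirtinger]
    refine (norm_add_le _ _).trans_eq ?_
    simp only [norm_mul, RCLike.norm_conj]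
    ring
  rw [det_eq_wirtinger]
  set x := ‖wirtingerD L‖
  set y := ‖wirtingerDBar L‖
  have hy : 0 ≤ y := norm_nonneg _
  have h' : (K + 1) * y ≤ (K - 1) * x := by
    rw [div_mul_eq_mul_div, le_div_iff₀ (by linarith)] at h
    linarith
  calc ‖L‖ ^ 2 ≤ (x + y) ^ 2 := by gcongr
    _ ≤ K * (x ^ 2 - y ^ 2) := by nlinarith [norm_nonneg (wirtingerD L)]

/-- The derivative density of the logarithmic test function below. -/
def logDensity (r R τ : ℝ) : ℝ := 1 / (r ^ 2 + τ) - 1 / (R ^ 2 + τ)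

/-- A smooth function which increases logarithmically on the annulus `r < |ω - w| < R`. -/
def logProfile (r R : ℝ) (w ω : ℂ) : ℝ :=
  (Real.log (r ^ 2 + ‖ω - w‖ ^ 2) - Real.log (R ^ 2 + ‖ω - w‖ ^ 2)) / 2

variable {r R : ℝ}

lemma logDensity_nonneg (hr : 0 < r) (hR : r ≤ R) {τ : ℝ} (hτ : 0 ≤ τ) :
    0 ≤ logDensity r R τ := by
  rw [logDensity, sub_nonneg]
  gcongr

lemma logDensity_le (hr : 0 < r) {τ : ℝ} (hτ : 0 ≤ τ) :
    logDensity r R τ ≤ 1 / r ^ 2 := by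
  have h1 : 1 / (r ^ 2 + τ) ≤ 1 / r ^ 2 := by gcongr; linarith
  have h2 : 0 ≤ 1 / (R ^ 2 + τ) := by positivity
  rw [logDensity]
  linarith

lemma mul_logDensity_le_one (hr : 0 < r) {τ : ℝ} (hτ : 0 ≤ τ) :
    τ * logDensity r R τ ≤ 1 := by
  have h1 : τ * (1 / (r ^ 2 + τ)) ≤ 1 := by
    rw [mul_one_div, div_le_one (by positivity)]
    nlinarith
  have h2 : 0 ≤ τ * (1 / (R ^ 2 + τ)) := by positivity
  rw [logDensity, mul_sub]
  linarith

lemma logDensity_le_nine_mul (hr : 0 < r) (hR : r ≤ R) {τ τ' : ℝ} (hτ : 0 ≤ τ) (hτ' : 0 ≤ τ')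
    (h : τ ≤ 2 * τ' + 2 * r ^ 2) : logDensity r R τ' ≤ 9 * logDensity r R τ := by
  have hR0 : 0 < R := hr.trans_le hR
  have hsq : r ^ 2 ≤ R ^ 2 := by gcongr
  have key : ∀ τ, 0 ≤ τ → logDensity r R τ = (R ^ 2 - r ^ 2) / ((r ^ 2 + τ) * (R ^ 2 + τ)) :=
    fun τ hτ => by
      rw [logDensity, div_sub_div _ _ (by positivity) (by positivity)]
      congr 1; ring
  rw [key _ hτ, key _ hτ', mul_div_assoc', div_le_div_iff₀ (by positivity) (by positivity)]
  have h1 : r ^ 2 + τ ≤ 3 * (r ^ 2 + τ') := by linarith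
  have h2 : R ^ 2 + τ ≤ 3 * (R ^ 2 + τ') := by linarith
  have h3 : (r ^ 2 + τ) * (R ^ 2 + τ) ≤ 3 * (r ^ 2 + τ') * (3 * (R ^ 2 + τ')) := by gcongr
  calc (R ^ 2 - r ^ 2) * ((r ^ 2 + τ) * (R ^ 2 + τ)) ≤
        (R ^ 2 - r ^ 2) * (3 * (r ^ 2 + τ') * (3 * (R ^ 2 + τ'))) :=
        mul_le_mul_of_nonneg_left h3 (sub_nonneg.2 hsq)
    _ = _ := by ring

lemma contDiff_logProfile (hr : 0 < r) (hR : r ≤ R) (w : ℂ) :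
    ContDiff ℝ (⊤ : ℕ∞) (logProfile r R w) := by
  have hR0 : 0 < R := hr.trans_le hR
  have h1 : ContDiff ℝ (⊤ : ℕ∞) fun ω : ℂ => ‖ω - w‖ ^ 2 :=
    (contDiff_id.sub contDiff_const).norm_sq ℝ
  exact (((contDiff_const.add h1).log fun x => by positivity).sub
    ((contDiff_const.add h1).log fun x => by positivity)).div_const 2

lemma norm_fderiv_logProfile_sq_le (hr : 0 < r) (hR : r ≤ R) (w ω : ℂ) :
    ‖fderiv ℝ (logProfile r R w) ω‖ ^ 2 ≤ logDensity r R (‖ω - w‖ ^ 2) := by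
  have hR0 : 0 < R := hr.trans_le hR
  have hV := logDensity_nonneg hr hR (sq_nonneg ‖ω - w‖)
  have h1 : HasFDerivAt (fun ω : ℂ => ‖ω - w‖ ^ 2)
      ((2 • (innerSL ℝ (ω - w)).comp (ContinuousLinearMap.id ℝ ℂ))) ω := by
    simpa using ((hasFDerivAt_id ω).sub_const w).norm_sq
  have h2 := (((h1.const_add (r ^ 2)).log (by positivity)).sub
    ((h1.const_add (R ^ 2)).log (by positivity))).mul_const (2⁻¹ : ℝ)
  have h3 : ‖fderiv ℝ (logProfile r R w) ω‖ ≤ ‖ω - w‖ * logDensity r R (‖ω - w‖ ^ 2) := by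
    rw [show fderiv ℝ (logProfile r R w) ω = _ from h2.fderiv]
    refine ContinuousLinearMap.opNorm_le_bound _ (by positivity) fun v => ?_
    have e2 : ∀ q : ℝ, q = inner ℝ (ω - w) v * logDensity r R (‖ω - w‖ ^ 2) →
        ‖q‖ ≤ ‖ω - w‖ * logDensity r R (‖ω - w‖ ^ 2) * ‖v‖ := fun q hq => by
      rw [hq, norm_mul, Real.norm_of_nonneg hV]
      have := norm_inner_le_norm (𝕜 := ℝ) (ω - w) v
      nlinarith
    refine e2 _ ?_
    simp [logDensity]
    ring
  calc _ ≤ (‖ω - w‖ * logDensity r R (‖ω - w‖ ^ 2)) ^ 2 := by gcongr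
    _ = ‖ω - w‖ ^ 2 * logDensity r R (‖ω - w‖ ^ 2) * logDensity r R (‖ω - w‖ ^ 2) := by ring
    _ ≤ 1 * logDensity r R (‖ω - w‖ ^ 2) := by
      gcongr; exact mul_logDensity_le_one hr (sq_nonneg _)
    _ = _ := one_mul _

/-- The logarithmic test function separates the ball of radius `2r` from the complement of the
ball of radius `R - r`. -/
lemma le_logProfile_sub (hr : 0 < r) {N : ℕ} (hN : 1 ≤ N) {w x y : ℂ} (hx : ‖x - w‖ ≤ 2 * r)
    (hy : 2 ^ N * r - r ≤ ‖y - w‖) :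
    N * Real.log 2 - Real.log 5 ≤
      logProfile r (2 ^ N * r) w y - logProfile r (2 ^ N * r) w x := by
  have h2 : (2 : ℝ) ≤ 2 ^ N := by simpa using pow_le_pow_right₀ (one_le_two (α := ℝ)) hN
  set R := 2 ^ N * r with hRdef
  have hR : 2 * r ≤ R := by rw [hRdef]; gcongr
  have hR0 : 0 < R := by linarith
  have hlR : Real.log (R ^ 2) = 2 * (N * Real.log 2) + 2 * Real.log r := by
    rw [Real.log_pow, hRdef, Real.log_mul (by positivity) hr.ne', Real.log_pow]; push_cast; ring
  have a1 : Real.log (r ^ 2 + ‖x - w‖ ^ 2) ≤ Real.log 5 + 2 * Real.log r := by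
    have e : Real.log (5 * r ^ 2) = Real.log 5 + 2 * Real.log r := by
      rw [Real.log_mul (by norm_num) (by positivity), Real.log_pow]; push_cast; ring
    rw [← e]
    refine Real.log_le_log (by positivity) ?_
    nlinarith [norm_nonneg (x - w)]
  have a2 : Real.log (R ^ 2) ≤ Real.log (R ^ 2 + ‖x - w‖ ^ 2) :=
    Real.log_le_log (by positivity) (by nlinarith [norm_nonneg (x - w)])
  have a3 : Real.log (R ^ 2 + ‖y - w‖ ^ 2) ≤ Real.log 5 + Real.log (r ^ 2 + ‖y - w‖ ^ 2) := by
    rw [← Real.log_mul (by norm_num) (by positivity)]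
    refine Real.log_le_log (by positivity) ?_
    nlinarith [norm_nonneg (y - w)]
  simp only [logProfile]
  linarith

lemma enorm_sub_le_lintegral_circle {h : ℂ → ℝ} (hh : ContDiff ℝ 1 h) {a x y : ℂ} {ρ : ℝ}
    (hx : dist x a = ρ) (hy : dist y a = ρ) :
    ‖h y - h x‖ₑ ≤ ∫⁻ θ in Ioo (-π) π,
      ENNReal.ofReal ρ * ‖fderiv ℝ h (polarPt a 1 ρ θ)‖ₑ := by
  have hρ : 0 ≤ ρ := hx ▸ dist_nonneg
  obtain ⟨s, hs, rfl⟩ := exists_polarPt_eq norm_one hx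
  obtain ⟨t, ht, rfl⟩ := exists_polarPt_eq norm_one hy
  wlog hst : s < t generalizing s t
  · rcases (not_lt.1 hst).eq_or_lt with rfl | hts
    · simp
    · have := this t ht hy s hs hx hts
      rwa [← enorm_neg, neg_sub] at this
  refine (enorm_sub_le_lintegral_polarPt isOpen_univ hh.contDiffOn norm_one hρ hst
    (fun _ _ => mem_univ _) (γ := fun θ => h (polarPt a 1 ρ θ))
    (hh.continuous.comp (continuous_polarPt a 1 ρ)).continuousOn fun _ _ => rfl).trans ?_
  exact lintegral_mono_set (Ioo_subset_Ioo hs.1.le ht.2)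

end LogEnergy

section WeakQuasisymmetry

variable {f : ℂ → ℂ} {f' : ℂ → ℂ →L[ℝ] ℂ}

/-- The energy of the logarithmic test function composed with a smooth approximation of `f`. -/
lemma HasWeakFDerivOn.lintegral_fderiv_logProfile_le (h : HasWeakFDerivOn f f' univ)
    (hf : Continuous f) {K : ℝ} (hK : 0 ≤ K) (hJ : ∀ᵐ z, ‖f' z‖ ^ 2 ≤ K * (f' z).det)
    {F : ℂ → ℂ} (hF : ContDiff ℝ (⊤ : ℕ∞) F) {r R : ℝ} (hr : 0 < r) (hR : r ≤ R) {S : Set ℂ}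
    (hS : MeasurableSet S) (hFf : ∀ z ∈ S, dist (F z) (f z) ≤ r) {δ : ℝ} (hδ : 0 ≤ δ) {w : ℂ}
    (hD : ∫⁻ z in S, ‖fderiv ℝ F z - f' z‖ₑ ^ 2 ≤ ENNReal.ofReal (r ^ 2))
    (hE : ∫⁻ z in S, ENNReal.ofReal (logDensity r R (‖f z - w‖ ^ 2) * (f' z).det) ≤
      ENNReal.ofReal δ) :
    ∫⁻ z in S, ‖fderiv ℝ (fun z => logProfile r R w (F z)) z‖ₑ ^ 2 ≤
      ENNReal.ofReal (18 * K * δ + 2) := by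
  have hpt : ∀ z ∈ S, ‖f' z‖ ^ 2 ≤ K * (f' z).det →
      ‖fderiv ℝ (fun z => logProfile r R w (F z)) z‖ₑ ^ 2 ≤
        ENNReal.ofReal (18 * K) * ENNReal.ofReal (logDensity r R (‖f z - w‖ ^ 2) * (f' z).det) +
          ENNReal.ofReal (2 / r ^ 2) * ‖fderiv ℝ F z - f' z‖ₑ ^ 2 := fun z hz hJz => by
    have e : fderiv ℝ (fun z => logProfile r R w (F z)) z =
        (fderiv ℝ (logProfile r R w) (F z)).comp (fderiv ℝ F z) :=
      fderiv_comp z ((contDiff_logProfile hr hR w).differentiable (by simp) _)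
        (hF.differentiable (by simp) z)
    have hd := hFf z hz
    rw [dist_eq_norm] at hd
    have hfF : ‖f z - w‖ ≤ ‖F z - w‖ + r := by
      have : f z - w = (F z - w) - (F z - f z) := by ring
      rw [this]
      exact (norm_sub_le _ _).trans (by linarith)
    have hV : logDensity r R (‖F z - w‖ ^ 2) ≤ 9 * logDensity r R (‖f z - w‖ ^ 2) := by
      refine logDensity_le_nine_mul hr hR (sq_nonneg _) (sq_nonneg _) ?_
      nlinarith [norm_nonneg (f z - w), sq_nonneg (‖F z - w‖ - r)]
    have hV0 := logDensity_nonneg hr hR (sq_nonneg ‖F z - w‖)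
    have hV0' := logDensity_nonneg hr hR (sq_nonneg ‖f z - w‖)
    have hV1 := logDensity_le (R := R) hr (sq_nonneg ‖F z - w‖)
    have hDF : ‖fderiv ℝ F z‖ ^ 2 ≤ 2 * ‖f' z‖ ^ 2 + 2 * ‖fderiv ℝ F z - f' z‖ ^ 2 := by
      have h1 : ‖fderiv ℝ F z‖ ≤ ‖f' z‖ + ‖fderiv ℝ F z - f' z‖ := by
        have := norm_add_le (f' z) (fderiv ℝ F z - f' z)
        rwa [add_sub_cancel] at this
      nlinarith [norm_nonneg (fderiv ℝ F z), sq_nonneg (‖f' z‖ - ‖fderiv ℝ F z - f' z‖)]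
    have hreal : ‖fderiv ℝ (fun z => logProfile r R w (F z)) z‖ ^ 2 ≤
        18 * K * (logDensity r R (‖f z - w‖ ^ 2) * (f' z).det) +
          2 / r ^ 2 * ‖fderiv ℝ F z - f' z‖ ^ 2 := by
      calc _ ≤ (‖fderiv ℝ (logProfile r R w) (F z)‖ * ‖fderiv ℝ F z‖) ^ 2 := by
            rw [e]; gcongr; exact ContinuousLinearMap.opNorm_comp_le _ _
        _ ≤ logDensity r R (‖F z - w‖ ^ 2) *
            (2 * ‖f' z‖ ^ 2 + 2 * ‖fderiv ℝ F z - f' z‖ ^ 2) := by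
            rw [mul_pow]; gcongr; exact norm_fderiv_logProfile_sq_le hr hR w _
        _ = 2 * (logDensity r R (‖F z - w‖ ^ 2) * ‖f' z‖ ^ 2) +
            logDensity r R (‖F z - w‖ ^ 2) * (2 * ‖fderiv ℝ F z - f' z‖ ^ 2) := by ring
        _ ≤ 2 * (9 * logDensity r R (‖f z - w‖ ^ 2) * (K * (f' z).det)) +
            1 / r ^ 2 * (2 * ‖fderiv ℝ F z - f' z‖ ^ 2) := by gcongr
        _ = _ := by ring
    have hdet : 0 ≤ K * (f' z).det := (sq_nonneg _).trans hJz
    rw [← ofReal_norm, ← ofReal_norm, ← ENNReal.ofReal_pow (norm_nonneg _),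
      ← ENNReal.ofReal_pow (norm_nonneg _), ← ENNReal.ofReal_mul (by positivity),
      ← ENNReal.ofReal_mul (by positivity)]
    exact (ENNReal.ofReal_le_ofReal hreal).trans ENNReal.ofReal_add_le
  have hm : AEMeasurable (fun z => ENNReal.ofReal (18 * K) *
      ENNReal.ofReal (logDensity r R (‖f z - w‖ ^ 2) * (f' z).det)) (volume.restrict S) := by
    have h1 : Continuous fun z => logDensity r R (‖f z - w‖ ^ 2) := by
      have hR0 : 0 < R := hr.trans_le hR
      unfold logDensity
      refine Continuous.sub ?_ ?_ <;>
        refine Continuous.div continuous_const (by fun_prop) fun z => by positivity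
    exact ((h1.aestronglyMeasurable.mul (ContinuousLinearMap.continuous_det.comp_aestronglyMeasurable
      h.aestronglyMeasurable)).aemeasurable.ennreal_ofReal.const_mul _).restrict
  calc _ ≤ _ := lintegral_mono_ae (((ae_restrict_iff' hS).2
        (hJ.mono fun z hz hzS => hpt z hzS hz)))
    _ ≤ ENNReal.ofReal (18 * K) * ENNReal.ofReal δ +
        ENNReal.ofReal (2 / r ^ 2) * ENNReal.ofReal (r ^ 2) := by
      rw [lintegral_add_left' hm, lintegral_const_mul' _ _ ENNReal.ofReal_ne_top,
        lintegral_const_mul' _ _ ENNReal.ofReal_ne_top]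
      gcongr
    _ = _ := by
      rw [← ENNReal.ofReal_mul (by positivity), ← ENNReal.ofReal_mul (by positivity),
        ← ENNReal.ofReal_add (by positivity) (by positivity), div_mul_cancel₀ _ (by positivity)]

lemma exists_dist_eq_of_isPreconnected {X : Set ℂ} (hX : IsPreconnected X) {a x y : ℂ} {ρ : ℝ}
    (hx : x ∈ X) (hxρ : dist x a ≤ ρ) (hy : y ∈ X) (hyρ : ρ ≤ dist y a) :
    ∃ z ∈ X, dist z a = ρ :=
  hX.intermediate_value hx hy (continuous_id.dist continuous_const).continuousOn ⟨hxρ, hyρ⟩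

lemma exists_nat_quadratic_gt (A : ℝ) {B : ℝ} (hB : 0 ≤ B) :
    ∃ N : ℕ, 1 ≤ N ∧ 0 ≤ N * Real.log 2 - Real.log 5 ∧
      A * N + B < (N * Real.log 2 - Real.log 5) ^ 2 * (Real.log 2 / 2) := by
  have h2 : 0 < Real.log 2 := Real.log_pos one_lt_two
  have h5 : Real.log 5 ≤ 3 * Real.log 2 := by
    rw [← Real.log_rpow two_pos]
    exact Real.log_le_log (by norm_num) (by norm_num)
  set c := Real.log 2 ^ 3 / 2
  have hc : 0 < c := by positivity
  obtain ⟨n, hn⟩ := exists_nat_gt (4 * (A + B) / c)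
  refine ⟨n + 6, by omega, ?_, ?_⟩
  · push_cast
    nlinarith [(Nat.cast_nonneg n : (0 : ℝ) ≤ n)]
  · push_cast
    have hn0 : (0 : ℝ) ≤ n := Nat.cast_nonneg n
    rw [div_lt_iff₀ hc] at hn
    have h1 : ((n : ℝ) + 6) / 2 * Real.log 2 ≤ (n + 6) * Real.log 2 - Real.log 5 := by nlinarith
    have h3 : A * (n + 6) + B ≤ (A + B) * (n + 6) := by nlinarith
    calc A * (n + 6) + B ≤ (A + B) * (n + 6) := h3
      _ < (((n : ℝ) + 6) * c / 4) * (n + 6) := by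
        gcongr
        nlinarith
      _ = (((n : ℝ) + 6) / 2 * Real.log 2) ^ 2 * (Real.log 2 / 2) := by simp only [c]; ring
      _ ≤ _ := by gcongr

/-- Planar quasiconformal maps are weakly quasisymmetric on the unit disk. -/
lemma IsQCOn.exists_norm_sub_le {K : ℝ} (hqc : IsQCOn f univ univ K) :
    ∃ M : ℝ, 0 ≤ M ∧ ∀ a ∈ closedBall (0 : ℂ) 1, ∀ b ∈ closedBall (0 : ℂ) 1,
      ∀ p ∈ closedBall (0 : ℂ) 1, 2 * ‖a - p‖ ^ 2 ≤ ‖a - b‖ ^ 2 →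
        ‖f p - f a‖ ≤ M * ‖f b - f a‖ := by
  obtain ⟨hK, hfc, hbij, ⟨g, hgc, hgf, hfg⟩, f', h, hW, hdil⟩ := hqc
  have hf : Continuous f := continuousOn_univ.1 hfc
  have hg : Continuous g := continuousOn_univ.1 hgc
  have hpre : ∀ X : Set ℂ, f ⁻¹' X = g '' X := fun X =>
    (congrFun (image_eq_preimage_of_inverse (fun x => hfg (mem_univ x))
      fun x => hgf (mem_univ x)) X).symm
  have hK0 : 0 ≤ K := by linarith
  have hJK : ∀ᵐ z, ‖f' z‖ ^ 2 ≤ K * (f' z).det := by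
    rw [Measure.restrict_univ] at hdil
    exact hdil.mono fun z hz => norm_sq_le_mul_det hK hz
  have hJ : ∀ᵐ z, 0 ≤ (f' z).det := hJK.mono fun z hz =>
    nonneg_of_mul_nonneg_right ((sq_nonneg _).trans hz) (by linarith)
  have hc : ∀ R, IsCompact (f ⁻¹' closedBall 0 R) := fun R => by
    rw [hpre]; exact (isCompact_closedBall _ _).image hg
  obtain ⟨T, hT⟩ := ((isCompact_closedBall (0 : ℂ) 3).image hf).isBounded.subset_closedBall_lt 0 0
  obtain ⟨hT0, hT⟩ := hT
  have hTf : ∀ z ∈ closedBall (0 : ℂ) 3, ‖f z‖ ≤ T := fun z hz =>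
    mem_closedBall_zero_iff.1 (hT (mem_image_of_mem f hz))
  obtain ⟨d, hd, hdE⟩ := h.exists_lintegral_det_le hW hf hc hJ T (T := 2 * T) (by positivity)
  obtain ⟨N, hN, hN0, hNc⟩ := exists_nat_quadratic_gt (2 * π * (54 * K * d)) (B := 4 * π)
    (by positivity)
  refine ⟨2 ^ N, by positivity, fun a ha b hb p hp hapb => ?_⟩
  rw [mem_closedBall_zero_iff] at ha hb hp
  by_contra! hcon
  have hpa : 0 < ‖a - p‖ := norm_sub_pos_iff.2 fun e => by
    rw [e, sub_self, norm_zero] at hcon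
    exact absurd hcon (not_lt.2 (by positivity))
  have hab : ‖a - b‖ ≤ 2 := (norm_sub_le _ _).trans (by linarith)
  have hr₁₂ : ‖a - p‖ < ‖a - b‖ := by
    refine lt_of_pow_lt_pow_left₀ 2 (norm_nonneg _) ?_
    nlinarith
  have hne : b ≠ a := fun e => by
    rw [e, sub_self, norm_zero] at hr₁₂; linarith
  set w := f a with hw
  set r := ‖f b - w‖ with hrdef
  have hr : 0 < r := norm_sub_pos_iff.2 fun e => hne (hbij.injOn (mem_univ _) (mem_univ _) e)
  have hrR : r ≤ 2 ^ N * r := le_mul_of_one_le_left hr.le (one_le_pow₀ one_le_two)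
  have ha3 : ∀ ρ ≤ ‖a - b‖, ∀ z, dist z a = ρ → z ∈ closedBall (0 : ℂ) 3 := fun ρ hρ z hz => by
    rw [mem_closedBall_zero_iff]
    have : z = (z - a) + a := by ring
    rw [this]
    rw [dist_eq_norm] at hz
    exact (norm_add_le _ _).trans (by linarith)
  obtain ⟨F, hF, hFf, hFD⟩ := exists_contDiff_approx h hW hf 3 hr
    (δ := ENNReal.ofReal (r ^ 2)) (by positivity)
  have hwT : w ∈ closedBall (0 : ℂ) T := mem_closedBall_zero_iff.2 (hTf a (by
    rw [mem_closedBall_zero_iff]; linarith))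
  have hsub : closedBall (0 : ℂ) 3 ⊆ f ⁻¹' closedBall w (2 * T) := fun z hz => by
    rw [mem_preimage, mem_closedBall, dist_eq_norm]
    have := mem_closedBall_zero_iff.1 hwT
    exact (norm_sub_le _ _).trans (by linarith [hTf z hz])
  have hE := h.lintegral_fderiv_logProfile_le hf hK0 hJK hF hr hrR measurableSet_closedBall hFf
    (δ := 3 * N * d) (by positivity) hFD (w := w) ((lintegral_mono_set hsub).trans
      (h.lintegral_sub_mul_det_le hf hJ hd (hdE w hwT) hr N))
  set H : ℂ → ℝ := fun z => logProfile r (2 ^ N * r) w (F z)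
  have hH : ContDiff ℝ (⊤ : ℕ∞) H := (contDiff_logProfile hr hrR w).comp hF
  have hHm : Measurable fun z => ‖fderiv ℝ H z‖ₑ :=
    (hH.continuous_fderiv (by simp)).enorm.measurable
  have hmain := length_area (W := (closedBall (0 : ℂ) 3).indicator fun z => ‖fderiv ℝ H z‖ₑ)
    (hHm.indicator measurableSet_closedBall) (a := a) norm_one hpa hr₁₂ hN0 fun ρ hρ => by
      have hρ0 : 0 < ρ := hpa.trans hρ.1
      obtain ⟨x, hx, hxρ⟩ := exists_dist_eq_of_isPreconnected (a := a) (ρ := ρ)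
        (X := f ⁻¹' closedBall w r) (by
          rw [hpre]; exact (convex_closedBall w r).isPreconnected.image g hg.continuousOn)
        (x := a) (by simp [hw, hr.le]) (by simpa using hρ0.le) (y := b)
        (by simp [dist_eq_norm, hrdef]) (by rw [dist_comm, dist_eq_norm]; exact hρ.2.le)
      obtain ⟨q, hq3, hqR⟩ : ∃ q, ρ ≤ dist q a ∧ 2 ^ N * r ≤ dist (f q) w := by
        have hq : f (g (w + (2 * T + 2 ^ N * r + 1 : ℝ))) = w + (2 * T + 2 ^ N * r + 1 : ℝ) :=
          hfg (mem_univ _)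
        have hd : dist (w + (2 * T + 2 ^ N * r + 1 : ℝ)) w = 2 * T + 2 ^ N * r + 1 := by
          rw [dist_eq_norm, add_sub_cancel_left, norm_real, Real.norm_of_nonneg (by positivity)]
        refine ⟨g (w + (2 * T + 2 ^ N * r + 1 : ℝ)), ?_, ?_⟩
        · by_contra! hlt
          have h1 := mem_closedBall.1 (hsub (ha3 _ (hlt.le.trans hρ.2.le) _ rfl))
          rw [hq, hd] at h1
          linarith
        · rw [hq, hd]; linarith
      obtain ⟨y, hy, hyρ⟩ := exists_dist_eq_of_isPreconnected (a := a) (ρ := ρ)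
        (X := f ⁻¹' (ball w (2 ^ N * r))ᶜ) (by
          rw [hpre]
          exact (isPreconnected_compl_ball w (by positivity)).image g hg.continuousOn)
        (x := p) (by simpa [dist_eq_norm] using hcon.le)
        (by rw [dist_comm, dist_eq_norm]; exact hρ.1.le) (y := q) (by simpa using hqR) hq3
      have hx3 := hFf x (ha3 ρ hρ.2.le x hxρ)
      have hy3 := hFf y (ha3 ρ hρ.2.le y hyρ)
      rw [mem_preimage, mem_closedBall] at hx
      rw [mem_preimage, mem_compl_iff, mem_ball, not_lt] at hy
      have hFx : ‖F x - w‖ ≤ 2 * r := by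
        rw [← dist_eq_norm]
        linarith [dist_triangle (F x) (f x) w]
      have hFy : 2 ^ N * r - r ≤ ‖F y - w‖ := by
        rw [← dist_eq_norm]
        linarith [dist_triangle (f y) (F y) w, dist_comm (f y) (F y)]
      calc ENNReal.ofReal (N * Real.log 2 - Real.log 5) ≤ ‖H y - H x‖ₑ := by
            rw [← ofReal_norm]
            exact ENNReal.ofReal_le_ofReal
              ((le_logProfile_sub hr hN hFx hFy).trans (Real.le_norm_self _))
        _ ≤ _ := enorm_sub_le_lintegral_circle (hH.of_le (by simp)) hxρ hyρ
        _ = _ := by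
          refine lintegral_congr fun θ => ?_
          rw [indicator_of_mem (ha3 ρ hρ.2.le _ (dist_polarPt norm_one hρ0.le θ))]
  have hintg : ∫⁻ z, (closedBall (0 : ℂ) 3).indicator (fun z => ‖fderiv ℝ H z‖ₑ) z ^ 2 =
      ∫⁻ z in closedBall (0 : ℂ) 3, ‖fderiv ℝ H z‖ₑ ^ 2 := by
    rw [← lintegral_indicator measurableSet_closedBall]
    refine lintegral_congr fun z => ?_
    by_cases hz : z ∈ closedBall (0 : ℂ) 3 <;> simp [hz]
  have hlog : Real.log 2 / 2 ≤ Real.log (‖a - b‖ / ‖a - p‖) := by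
    have h1 : Real.log 2 ≤ Real.log ((‖a - b‖ / ‖a - p‖) ^ 2) := by
      refine Real.log_le_log two_pos ?_
      rw [div_pow, le_div_iff₀ (by positivity)]
      exact hapb
    rw [Real.log_pow] at h1
    push_cast at h1
    linarith
  have hfin : (N * Real.log 2 - Real.log 5) ^ 2 * Real.log (‖a - b‖ / ‖a - p‖) ≤
      2 * π * (18 * K * (3 * N * d) + 2) := by
    rw [hintg] at hmain
    rw [← ENNReal.ofReal_le_ofReal_iff (by positivity), ENNReal.ofReal_mul (p := 2 * π)
      (by positivity)]
    refine hmain.trans ?_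
    gcongr
  have := mul_le_mul_of_nonneg_left hlog (sq_nonneg (N * Real.log 2 - Real.log 5))
  linarith

end WeakQuasisymmetry

section ArcTopology

open scoped RealInnerProductSpace

lemma isPreconnected_circle_inter_lt (m : ℂ) (c : ℝ) :
    IsPreconnected {p : ℂ | ‖p‖ = 1 ∧ ⟪m, p⟫ < c} := by
  set α := Complex.arg (-m)
  have hin : ∀ t : ℝ, ⟪m, circlePt t⟫ = -(‖m‖ * Real.cos (t - α)) := fun t => by
    have h1 : m = -(‖m‖ * Complex.exp (α * I)) := by
      have := Complex.norm_mul_exp_arg_mul_I (-m)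
      rw [norm_neg] at this
      rw [this, neg_neg]
    have h2 : conj (Complex.exp (α * I)) * circlePt t = Complex.exp ((t - α : ℝ) * I) := by
      rw [circlePt, ← Complex.exp_conj, ← Complex.exp_add]
      congr 1
      simp
      ring
    rw [Complex.inner]
    conv_lhs => rw [h1]
    rw [mul_comm, map_neg, map_mul, conj_ofReal, neg_mul, mul_assoc, h2, neg_re, re_ofReal_mul,
      exp_ofReal_mul_I_re]
  have him : {p : ℂ | ‖p‖ = 1 ∧ ⟪m, p⟫ < c} =
      circlePt '' {t ∈ Icc (α - π) (α + π) | -(‖m‖ * Real.cos (t - α)) < c} := by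
    ext p
    constructor
    · rintro ⟨hp, hpc⟩
      obtain ⟨t, ht, rfl⟩ := exists_circlePt_eq hp (α - π)
      exact ⟨t, ⟨⟨ht.1, by linarith [ht.2]⟩, by rwa [← hin]⟩, rfl⟩
    · rintro ⟨t, ⟨-, ht⟩, rfl⟩
      exact ⟨norm_circlePt t, by rwa [hin]⟩
  rw [him]
  refine (OrdConnected.isPreconnected ⟨?_⟩).image _ continuous_circlePt.continuousOn
  rintro x ⟨hx, hxc⟩ y ⟨hy, hyc⟩ t ht
  refine ⟨⟨hx.1.trans ht.1, ht.2.trans hy.2⟩, ?_⟩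
  have hcos : min (Real.cos (x - α)) (Real.cos (y - α)) ≤ Real.cos (t - α) :=
    cos_min_le (by linarith [hx.1]) (by linarith [hy.2])
      ⟨sub_le_sub_right ht.1 α, sub_le_sub_right ht.2 α⟩
  rcases min_le_iff.1 hcos with h | h
  · nlinarith [mul_le_mul_of_nonneg_left h (norm_nonneg m)]
  · nlinarith [mul_le_mul_of_nonneg_left h (norm_nonneg m)]

lemma norm_sq_sub_le_of_le_inner {a b p : ℂ} (ha : ‖a‖ = 1) (hb : ‖b‖ = 1) (hp : ‖p‖ = 1)
    (h : 1 + ⟪a, b⟫ ≤ ⟪a + b, p⟫) :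
    2 * ‖a - p‖ ^ 2 ≤ ‖a - b‖ ^ 2 ∨ 2 * ‖b - p‖ ^ 2 ≤ ‖a - b‖ ^ 2 := by
  rw [inner_add_left] at h
  by_contra! hcon
  have h1 := hcon.1
  have h2 := hcon.2
  rw [norm_sub_sq_real, norm_sub_sq_real, ha, hp, hb] at h1
  rw [norm_sub_sq_real, norm_sub_sq_real, ha, hp, hb] at h2
  linarith

/-- One of the two arcs of the unit circle between `a` and `b` lies on the same side as the
chord. -/
lemma IsArcPair.forall_le_inner {a b : ℂ} {A B : Set ℂ} (h : IsArcPair unitCircleSet a b A B) :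
    (∀ p ∈ A, 1 + ⟪a, b⟫ ≤ ⟪a + b, p⟫) ∨ ∀ p ∈ B, 1 + ⟪a, b⟫ ≤ ⟪a + b, p⟫ := by
  obtain ⟨hU, hI, hA, hB, -, -⟩ := h
  have hS : ∀ p, p ∈ A ∪ B ↔ ‖p‖ = 1 := fun p => by
    rw [hU, unitCircleSet, mem_sphere_zero_iff_norm]
  have hAB : ∀ p, p ∈ A ∩ B ↔ p = a ∨ p = b := fun p => by rw [hI]; simp
  have ha : ‖a‖ = 1 := (hS a).1 (Or.inl ((hAB a).2 (Or.inl rfl)).1)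
  have hb : ‖b‖ = 1 := (hS b).1 (Or.inl ((hAB b).2 (Or.inr rfl)).1)
  by_contra! hcon
  obtain ⟨⟨p, hp, hpc⟩, q, hq, hqc⟩ := hcon
  obtain ⟨x, ⟨-, hx⟩, hxAB⟩ := isPreconnected_closed_iff.1
    (isPreconnected_circle_inter_lt (a + b) (1 + ⟪a, b⟫)) A B hA hB (fun x hx => (hS x).2 hx.1)
    ⟨p, ⟨(hS p).1 (Or.inl hp), hpc⟩, hp⟩ ⟨q, ⟨(hS q).1 (Or.inr hq), hqc⟩, hq⟩
  rw [inner_add_left] at hx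
  rcases (hAB x).1 hxAB with rfl | rfl
  · rw [real_inner_self_eq_norm_sq, ha, real_inner_comm] at hx
    linarith
  · rw [real_inner_self_eq_norm_sq, hb] at hx
    linarith

lemma IsArcPair.preimage {f : ℂ → ℂ} {g : ℂ → ℂ} (hf : Continuous f) (hg : Continuous g)
    (hfg : Function.RightInverse g f) (hgf : Function.LeftInverse g f) {S : Set ℂ}
    {z₁ z₂ : ℂ} {A B : Set ℂ} (h : IsArcPair (f '' S) z₁ z₂ A B) :
    IsArcPair S (g z₁) (g z₂) (g '' A) (g '' B) := by
  have hpre : ∀ X, g '' X = f ⁻¹' X := fun X => congrFun (image_eq_preimage_of_inverse hfg hgf) X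
  obtain ⟨hU, hI, hA, hB, hcA, hcB⟩ := h
  refine ⟨?_, ?_, ?_, ?_, hcA.image g hg.continuousOn, hcB.image g hg.continuousOn⟩
  · rw [← image_union, hU, ← image_comp, hgf.comp_eq_id, image_id]
  · rw [← image_inter hfg.injective, hI, image_pair]
  · rw [hpre]; exact hA.preimage hf
  · rw [hpre]; exact hB.preimage hf

lemma IsQuasicircle.exists_min_diam_le {Γ : Set ℂ} (h : IsQuasicircle Γ) :
    ∃ C : ℝ, 1 ≤ C ∧ ∀ z₁ ∈ Γ, ∀ z₂ ∈ Γ, ∀ A B : Set ℂ, IsArcPair Γ z₁ z₂ A B →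
      min (diam A) (diam B) ≤ C * ‖z₁ - z₂‖ := by
  obtain ⟨K, f, hqc, rfl⟩ := h
  obtain ⟨M, hM, hMf⟩ := hqc.exists_norm_sub_le
  obtain ⟨-, hf, -, ⟨g, hg, hgf, hfg⟩, -⟩ := hqc
  rw [continuousOn_univ] at hf hg
  have hgf' : Function.LeftInverse g f := fun x => hgf (mem_univ x)
  have hfg' : Function.RightInverse g f := fun x => hfg (mem_univ x)
  refine ⟨max 1 (2 * (M + 1)), le_max_left _ _, ?_⟩
  rintro _ ⟨a, ha, rfl⟩ _ ⟨b, hb, rfl⟩ A B hAB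
  have hAB' := hAB.preimage hf hg hfg' hgf'
  rw [hgf' a, hgf' b] at hAB'
  have hS : ∀ p, p ∈ unitCircleSet ↔ ‖p‖ = 1 := fun p => mem_sphere_zero_iff_norm
  have hS' : ∀ p ∈ unitCircleSet, p ∈ closedBall (0 : ℂ) 1 := fun p hp =>
    mem_closedBall_zero_iff.2 ((hS p).1 hp).le
  have key : ∀ X, g '' X ⊆ unitCircleSet → (∀ p ∈ g '' X, 1 + ⟪a, b⟫ ≤ ⟪a + b, p⟫) →
      diam X ≤ max 1 (2 * (M + 1)) * ‖f a - f b‖ := fun X hXS hX => by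
    have hsub : X ⊆ closedBall (f a) ((M + 1) * ‖f a - f b‖) := fun z hz => by
      have hgz : g z ∈ g '' X := mem_image_of_mem g hz
      have hc := norm_sq_sub_le_of_le_inner ((hS a).1 ha) ((hS b).1 hb) ((hS _).1 (hXS hgz))
        (hX _ hgz)
      rw [mem_closedBall, dist_eq_norm]
      rcases hc with hc | hc
      · have := hMf a (hS' a ha) b (hS' b hb) (g z) (hS' _ (hXS hgz)) hc
        rw [hfg' z, norm_sub_rev (f b)] at this
        nlinarith [norm_nonneg (f a - f b)]
      · have := hMf b (hS' b hb) a (hS' a ha) (g z) (hS' _ (hXS hgz)) (by rwa [norm_sub_rev b a])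
        rw [hfg' z] at this
        have h2 := norm_sub_le_norm_sub_add_norm_sub z (f b) (f a)
        rw [norm_sub_rev (f b)] at h2
        linarith
    refine (diam_le_of_subset_closedBall (by positivity) hsub).trans ?_
    rw [← mul_assoc]
    gcongr
    exact le_max_right _ _
  rcases hAB'.forall_le_inner with h | h
  · exact (min_le_left _ _).trans (key A (hAB'.1 ▸ subset_union_left) h)
  · exact (min_le_right _ _).trans (key B (hAB'.1 ▸ subset_union_right) h)

end ArcTopology

/-- A closed Jordan curve `Γ ⊂ ℂ` is a quasicircle iff there is a
constant `C ≥ 1` such that for all `z₁, z₂ ∈ Γ`, the smaller of the two subarcs of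
`Γ` between `z₁` and `z₂` has diameter at most `C|z₁ - z₂|`. -/
theorem statement1 (Γ : Set ℂ) (hΓ : IsJordanCurve Γ) :
    IsQuasicircle Γ ↔
    ∃ C : ℝ, 1 ≤ C ∧ ∀ z₁ ∈ Γ, ∀ z₂ ∈ Γ, ∀ A B : Set ℂ, IsArcPair Γ z₁ z₂ A B →
      min (Metric.diam A) (Metric.diam B) ≤ C * ‖z₁ - z₂‖ := by
  constructor
  · exact IsQuasicircle.exists_min_diam_le
  · rintro ⟨C, hC, h⟩
    exact isQuasicircle_of_hasBoundedTurning hΓ hC (hasBoundedTurning_of_isArcPair hΓ h)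

end WPPaper
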